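/- Let K = Q(√-3) and p a prime with p ≥ 5. There exist Hermitian cusp forms F_{10}, F_{12}, χ_{18} of respective weights 10, 12, 18 such that: (1) the Hermitian Eisenstein series E_4, E_6 and F_{10}, F_{12}, χ_{18} are algebraically independent and the graded ring ⊕_{0 ≤ k ∈ 2Z} M_k^{(s)}(U_2(O_K), ν_k)_{Z_(p)} of symmetric even-weight Hermitian modular forms with p-integral coefficients equals Z_(p)[E_4, E_6, F_{10}, F_{12}, χ_{18}]; in particular every f ∈ M_k^{(s)}(U_2(O_K), ν_k)_{Z_(p)} (k even) equals P(E_4, E_6, F_{10}, F_{12}, χ_{18}) for a unique polynomial P over Z_(p); (2) the restrictions to the Siegel half-space satisfy E_4|_{S_2} = G_4, E_6|_{S_2} = G_6, F_{10}|_{S_2} = 2X_{10}, F_{12}|_{S_2} = 2X_{12}, χ_{18}|_{S_2} ≡ 0; (3) a_{χ_{18}}([[2, 2i/√3],[−2i/√3, 2]]) = 1, so the diagonal of ord_p(χ_{18}) is (2, 2). -/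

import Mathlib

open Complex Matrix
open scoped ComplexOrder

noncomputable section

/-- `√d_K` for an imaginary quadratic discriminant `d < 0`,
taken as `√|d| · i` in the upper half plane. -/
def sqrtD (d : ℤ) : ℂ := Real.sqrt (-d) * Complex.I

/-- The ring of integers `O_K = ℤ[(d + √d)/2]` of the imaginary quadratic field of
discriminant `d`, viewed as a subset of `ℂ`. -/
def ringInt (d : ℤ) : Set ℂ :=
  {z | ∃ a b : ℤ, z = (a : ℂ) + (b : ℂ) * (((d : ℂ) + sqrtD d) / 2)}

/-- The inverse different `D_K⁻¹ = O_K / √d_K`. -/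
def invDiff (d : ℤ) : Set ℂ := {z | sqrtD d * z ∈ ringInt d}

/-- The Hermitian upper half-space of degree 2:
`Z` with `(Z - ᵗZ̄)/(2i)` positive definite. -/
def HermitianUpperHalfSpace : Set (Matrix (Fin 2) (Fin 2) ℂ) :=
  {Z | ((Z - Zᴴ).map (fun w => w / (2 * Complex.I))).PosDef}

/-- The lattice `Λ₂(K)`: Hermitian matrices with integral diagonal and
`√d_K ·`(off-diagonal entries) in `O_K`. -/
def LambdaH (d : ℤ) : Set (Matrix (Fin 2) (Fin 2) ℂ) :=
  {H | H.IsHermitian ∧ (∀ i, ∃ n : ℤ, H i i = (n : ℂ)) ∧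
    ∀ i j, sqrtD d * H i j ∈ ringInt d}

/-- Semi-positive elements of `Λ₂(K)`, the index set of Fourier expansions. -/
def HermLattice (d : ℤ) : Set (Matrix (Fin 2) (Fin 2) ℂ) :=
  {H | H ∈ LambdaH d ∧ H.PosSemidef}

/-- The symplectic-form matrix `J₂ = [[0, -1], [1, 0]]` (2×2 blocks). -/
def J2 : Matrix (Fin 2 ⊕ Fin 2) (Fin 2 ⊕ Fin 2) ℂ :=
  Matrix.fromBlocks 0 (-1) 1 0

/-- The Hermitian modular group `U₂(O_K)`:
matrices with entries in `O_K` satisfying `ᵗM̄ J₂ M = J₂`. -/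
def HermitianModularGroup (d : ℤ) : Set (Matrix (Fin 2 ⊕ Fin 2) (Fin 2 ⊕ Fin 2) ℂ) :=
  {M | (∀ i j, M i j ∈ ringInt d) ∧ Mᴴ * J2 * M = J2}

/-- The fractional-linear action `Z ↦ (AZ + B)(CZ + D)⁻¹`. -/
def matAct (M : Matrix (Fin 2 ⊕ Fin 2) (Fin 2 ⊕ Fin 2) ℂ)
    (Z : Matrix (Fin 2) (Fin 2) ℂ) : Matrix (Fin 2) (Fin 2) ℂ :=
  (M.toBlocks₁₁ * Z + M.toBlocks₁₂) * (M.toBlocks₂₁ * Z + M.toBlocks₂₂)⁻¹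

/-- The character `ν_k`: `det^{k/2}` for `K = ℚ(√-1)` (i.e. `d = -4`, `k` even),
and `det^k` for `K = ℚ(√-3)` (i.e. `d = -3`). -/
def nuChar (d k : ℤ) (M : Matrix (Fin 2 ⊕ Fin 2) (Fin 2 ⊕ Fin 2) ℂ) : ℂ :=
  if d = -4 then M.det ^ (k / 2) else M.det ^ k

/-- A Hermitian modular form of degree 2, weight `k` and character `ν_k` for `U₂(O_K)`,
bundled with its Fourier expansion over the semi-positive part of `Λ₂(K)`. -/
structure HermitianModularForm (d k : ℤ) where
  toFun : Matrix (Fin 2) (Fin 2) ℂ → ℂ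
  coeff : Matrix (Fin 2) (Fin 2) ℂ → ℂ
  holo : DifferentiableOn ℂ (fun Z : Fin 2 → Fin 2 → ℂ => toFun (Matrix.of Z))
    {Z | Matrix.of Z ∈ HermitianUpperHalfSpace}
  transform : ∀ M ∈ HermitianModularGroup d, ∀ Z ∈ HermitianUpperHalfSpace,
    toFun (matAct M Z) =
      nuChar d k M * (M.toBlocks₂₁ * Z + M.toBlocks₂₂).det ^ k * toFun Z
  coeff_supported : ∀ H, coeff H ≠ 0 → H ∈ HermLattice d
  expansion : ∀ Z ∈ HermitianUpperHalfSpace,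
    HasSum (fun H : HermLattice d =>
      coeff H * Complex.exp (2 * Real.pi * Complex.I * ((H : Matrix (Fin 2) (Fin 2) ℂ) * Z).trace))
      (toFun Z)

/-- A Hermitian modular form is symmetric if `f(ᵗZ) = f(Z)`. -/
def IsSymmetricHMF {d k : ℤ} (f : HermitianModularForm d k) : Prop :=
  ∀ Z ∈ HermitianUpperHalfSpace, f.toFun Zᵀ = f.toFun Z

/-- `z` is a `p`-integral rational number: `z = a/b` with `p ∤ b`. -/
def IsPIntegral (p : ℕ) (z : ℂ) : Prop :=
  ∃ a b : ℤ, ¬ (p : ℤ) ∣ b ∧ (b : ℂ) * z = (a : ℂ)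

/-- `z ≡ w (mod p^l)` in the local ring `ℤ_(p)`, i.e. `(z - w)/p^l` is `p`-integral. -/
def ModCongr (p l : ℕ) (z w : ℂ) : Prop :=
  IsPIntegral p ((z - w) / (p : ℂ) ^ l)


/-- The lexicographic order on `Λ₂(K)` used to define `ord_p`:
compare first `tr H`, then the `(1,1)`-entry `m`, then (for off-diagonal entry
`(a + b i)/2`) first `a`, then `b`. -/
def lexLt (H H' : Matrix (Fin 2) (Fin 2) ℂ) : Prop :=
  H.trace.re < H'.trace.re ∨
    (H.trace = H'.trace ∧
      ((H 0 0).re < (H' 0 0).re ∨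
        (H 0 0 = H' 0 0 ∧
          ((H 0 1).re < (H' 0 1).re ∨
            ((H 0 1).re = (H' 0 1).re ∧ (H 0 1).im < (H' 0 1).im)))))

/-- The Siegel upper half-space of degree `n`: symmetric complex matrices with
positive definite imaginary part. -/
def SiegelUpperHalfSpace (n : ℕ) : Set (Matrix (Fin n) (Fin n) ℂ) :=
  {Z | Z.IsSymm ∧ ((Z - Zᴴ).map (fun w => w / (2 * Complex.I))).PosDef}

/-- The symplectic-form matrix over `ℤ` in degree `n`. -/
def Jn (n : ℕ) : Matrix (Fin n ⊕ Fin n) (Fin n ⊕ Fin n) ℤ :=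
  Matrix.fromBlocks 0 (-1) 1 0

/-- The Siegel modular group `Γ_n = Sp_n(ℤ)` (as a set of `2n × 2n` integer matrices). -/
def SiegelModularGroup (n : ℕ) : Set (Matrix (Fin n ⊕ Fin n) (Fin n ⊕ Fin n) ℤ) :=
  {M | Mᵀ * Jn n * M = Jn n}

/-- The fractional-linear action of an integral symplectic matrix on the Siegel
upper half-space. -/
def matActS {n : ℕ} (M : Matrix (Fin n ⊕ Fin n) (Fin n ⊕ Fin n) ℤ)
    (Z : Matrix (Fin n) (Fin n) ℂ) : Matrix (Fin n) (Fin n) ℂ :=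
  ((M.map (fun a => (a : ℂ))).toBlocks₁₁ * Z + (M.map (fun a => (a : ℂ))).toBlocks₁₂) *
    ((M.map (fun a => (a : ℂ))).toBlocks₂₁ * Z + (M.map (fun a => (a : ℂ))).toBlocks₂₂)⁻¹

/-- The index lattice of Fourier expansions of Siegel modular forms of level `N`:
semi-positive symmetric rational matrices `T` with `N·T` half-integral,
i.e. `T ∈ (1/N)Λ_n`. -/
def SiegelLattice (n : ℕ) (N : ℕ) : Set (Matrix (Fin n) (Fin n) ℚ) :=
  {T | T.IsSymm ∧ (∀ i, ∃ a : ℤ, (N : ℚ) * T i i = (a : ℚ)) ∧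
    (∀ i j, ∃ a : ℤ, 2 * (N : ℚ) * T i j = (a : ℚ)) ∧
    (T.map (fun q => (q : ℝ))).PosSemidef}

/-- A Siegel modular form of degree `n` and weight `k` for a subgroup
`Γ ⊆ Γ_n = Sp_n(ℤ)` of level `N`, bundled with its Fourier expansion. For the
full modular group take `Γ = SiegelModularGroup n` and `N = 1`. -/
structure SiegelModularForm (n : ℕ) (k : ℤ)
    (Γ : Set (Matrix (Fin n ⊕ Fin n) (Fin n ⊕ Fin n) ℤ)) (N : ℕ) where
  toFun : Matrix (Fin n) (Fin n) ℂ → ℂ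
  coeff : Matrix (Fin n) (Fin n) ℚ → ℂ
  holo : DifferentiableOn ℂ (fun Z : Fin n → Fin n → ℂ => toFun (Matrix.of Z))
    {Z | Matrix.of Z ∈ SiegelUpperHalfSpace n}
  transform : ∀ M ∈ Γ, ∀ Z ∈ SiegelUpperHalfSpace n,
    toFun (matActS M Z) =
      ((M.map (fun a => (a : ℂ))).toBlocks₂₁ * Z +
        (M.map (fun a => (a : ℂ))).toBlocks₂₂).det ^ k * toFun Z
  coeff_supported : ∀ T, coeff T ≠ 0 → T ∈ SiegelLattice n N
  expansion : ∀ Z ∈ SiegelUpperHalfSpace n,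
    HasSum (fun T : SiegelLattice n N =>
      coeff T * Complex.exp (2 * Real.pi * Complex.I *
        (((T : Matrix (Fin n) (Fin n) ℚ).map (fun q => (q : ℂ))) * Z).trace))
      (toFun Z)


/-- A Hermitian cusp form (degree 2, class number one field): the Fourier
coefficients vanish off the positive definite part of the lattice. -/
def IsCuspHMF {d k : ℤ} (f : HermitianModularForm d k) : Prop :=
  ∀ H, ¬ H.PosDef → f.coeff H = 0

/-- `H0 = ord_p f`: `H0` is the minimal element of `Λ₂(K)`, in the lexicographic
order `lexLt`, whose Fourier coefficient is not divisible by `p`. -/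
def IsOrdP (p : ℕ) {d k : ℤ} (f : HermitianModularForm d k)
    (H0 : Matrix (Fin 2) (Fin 2) ℂ) : Prop :=
  H0 ∈ HermLattice d ∧ ¬ ModCongr p 1 (f.coeff H0) 0 ∧
    ∀ H ∈ HermLattice d, lexLt H H0 → ModCongr p 1 (f.coeff H) 0

namespace KN

/-- Complex `2 × 2` matrices. -/
abbrev M2 := Matrix (Fin 2) (Fin 2) ℂ

open scoped Real
open Finset Filter Topology Function

variable {k : ℤ} {τ e : ℂ} {Z : M2}

section LevelOneForms
open UpperHalfPlane ModularForm ModularFormClass MatrixGroups EisensteinSeries SlashInvariantForm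
open PowerSeries hiding X exp

/-- The `q`-expansion of the level one Eisenstein series of weight 4. -/
def e4 : PowerSeries ℂ := qExpansion 1 E₄
/-- The `q`-expansion of the level one Eisenstein series of weight 6. -/
def e6 : PowerSeries ℂ := qExpansion 1 E₆
/-- The `q`-expansion of the modular discriminant. -/
def dl : PowerSeries ℂ := qExpansion 1 ModularForm.discriminant

lemma e4_coeff_zero : e4.coeff 0 = 1 := E_qExpansion_coeff_zero _ ⟨2, rfl⟩
lemma e6_coeff_zero : e6.coeff 0 = 1 := E_qExpansion_coeff_zero _ ⟨3, rfl⟩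
lemma e4_coeff_one : e4.coeff 1 = 240 := E₄_qExpansion_coeff_one
lemma e6_coeff_one : e6.coeff 1 = -504 := E₆_qExpansion_coeff_one

lemma dl_coeff_zero : dl.coeff 0 = 0 := by
  have h : (dl).order = 1 := discriminant_qExpansion_order
  exact coeff_of_lt_order 0 (by rw [h]; norm_num)

lemma dl_coeff_one : dl.coeff 1 = 1 := discriminant_qExpansion_coeff_one

/-- The space of level one `q`-expansions of weight `w`. -/
def Mspan (w : ℤ) : Submodule ℂ (PowerSeries ℂ) :=
  Submodule.span ℂ {g | ∃ i j : ℕ, 4 * (i : ℤ) + 6 * j = w ∧ g = e4 ^ i * e6 ^ j}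

lemma mem_Mspan (i j : ℕ) (w : ℤ) (h : 4 * (i : ℤ) + 6 * j = w) : e4 ^ i * e6 ^ j ∈ Mspan w :=
  Submodule.subset_span ⟨i, j, h, rfl⟩

lemma mul_mem_Mspan {w v : ℤ} {f g : PowerSeries ℂ} (hf : f ∈ Mspan w) (hg : g ∈ Mspan v) :
    f * g ∈ Mspan (w + v) := by
  refine Submodule.span_induction₂ (p := fun f g _ _ => f * g ∈ Mspan (w + v)) ?_ ?_ ?_ ?_ ?_ ?_ ?_
    hf hg
  · rintro _ _ ⟨i, j, h, rfl⟩ ⟨i', j', h', rfl⟩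
    have := mem_Mspan (i + i') (j + j') (w + v) (by push_cast; linarith)
    convert this using 1
    ring
  · intro y _; simp
  · intro y _; simp
  · intro x y z _ _ _ h1 h2; rw [add_mul]; exact add_mem h1 h2
  · intro x y z _ _ _ h1 h2; rw [mul_add]; exact add_mem h1 h2
  · intro r x y _ _ h; rw [smul_mul_assoc]; exact Submodule.smul_mem _ _ h
  · intro r x y _ _ h; rw [mul_smul_comm]; exact Submodule.smul_mem _ _ h

lemma dl_eq : dl = (1 / 1728 : ℂ) • (e4 ^ 3 - e6 ^ 2) := by
  have h : (ModularForm.discriminant : ℍ → ℂ) = ((1 / 1728 : ℂ) •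
      (ModularForm.mcast (by decide) (E₄.pow 3) - ModularForm.mcast (by decide) (E₆.pow 2) :
        ModularForm 𝒮ℒ 12) : ModularForm 𝒮ℒ 12) := by
    funext z
    rw [discriminant_eq_E₄_cube_sub_E₆_sq]
    simp only [FunLike.coe_smul, FunLike.coe_sub, coe_mcast, ModularForm.coe_pow, Pi.smul_apply,
      Pi.sub_apply, Pi.pow_apply, smul_eq_mul]
    ring
  rw [dl, h, FunLike.coe_smul, ModularForm.qExpansion_smul one_pos one_mem_strictPeriods_SL]
  simp only [FunLike.coe_sub, coe_mcast,
    ModularForm.qExpansion_sub one_pos one_mem_strictPeriods_SL,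
    ModularForm.qExpansion_pow one_pos one_mem_strictPeriods_SL]
  rfl

lemma dl_mem : dl ∈ Mspan 12 := by
  rw [dl_eq]
  refine Submodule.smul_mem _ _ (sub_mem ?_ ?_)
  · simpa using mem_Mspan 3 0 12 (by norm_num)
  · simpa using mem_Mspan 0 2 12 (by norm_num)

lemma exists_weights (hk : Even k) (h0 : 0 ≤ k) (h2 : k ≠ 2) :
    ∃ i j : ℕ, 4 * (i : ℤ) + 6 * j = k := by
  obtain ⟨l, rfl⟩ := hk
  rcases Int.even_or_odd' l with ⟨c, rfl | rfl⟩
  · exact ⟨c.toNat, 0, by omega⟩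
  · exact ⟨(c - 1).toNat, 1, by omega⟩

lemma qExpansion_mem_Mspan : ∀ (N : ℕ) (k : ℤ) (_ : k.toNat ≤ N) (f : ModularForm 𝒮ℒ k),
    qExpansion 1 f ∈ Mspan k := by
  intro N
  induction N using Nat.strong_induction_on with
  | _ N ih =>
  intro k hkN f
  rcases lt_or_ge k 0 with hneg | hpos
  · have h0 : (f : ℍ → ℂ) = 0 := ModularFormClass.levelOne_neg_weight_eq_zero hneg f
    have : f = 0 := by ext z; simp [h0]
    subst this
    have := (ModularForm.qExpansion_eq_zero_iff (k := k) one_pos one_mem_strictPeriods_SL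
      (0 : ModularForm 𝒮ℒ k)).2 rfl
    rw [this]; exact zero_mem _
  by_cases hodd : Odd k
  · have : f = 0 := ModularForm.levelOne_odd_weight_eq_zero hodd f
    subst this
    have := (ModularForm.qExpansion_eq_zero_iff (k := k) one_pos one_mem_strictPeriods_SL
      (0 : ModularForm 𝒮ℒ k)).2 rfl
    rw [this]; exact zero_mem _
  have hev : Even k := Int.not_odd_iff_even.1 hodd
  by_cases hk2 : k = 2
  · subst hk2
    have : f = 0 := rank_zero_iff_forall_zero.1 levelOne_weight_two_rank_zero f
    subst this
    have := (ModularForm.qExpansion_eq_zero_iff (k := 2) one_pos one_mem_strictPeriods_SL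
      (0 : ModularForm 𝒮ℒ 2)).2 rfl
    rw [this]; exact zero_mem _
  obtain ⟨i, j, hij⟩ := exists_weights hev hpos hk2
  -- cusp forms
  have cusp : ∀ g : ModularForm 𝒮ℒ k, (qExpansion 1 g).coeff 0 = 0 → qExpansion 1 g ∈ Mspan k := by
    intro g hg
    rw [ModularForm.qExpansion_eq_qExpansion_discriminant_mul g hg]
    rcases lt_or_ge (k - 12) 0 with h12 | h12
    · have h0 : (CuspForm.discriminantEquiv (toCuspForm g hg)) = 0 := by
        have h0 := ModularFormClass.levelOne_neg_weight_eq_zero h12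
          (CuspForm.discriminantEquiv (toCuspForm g hg))
        ext z; simp only [h0]; rfl
      rw [h0]
      have := (ModularForm.qExpansion_eq_zero_iff (k := k - 12) one_pos one_mem_strictPeriods_SL
        (0 : ModularForm 𝒮ℒ (k - 12))).2 rfl
      rw [this]; simp
    · have := ih (k - 12).toNat (by omega) (k - 12) le_rfl
        (CuspForm.discriminantEquiv (toCuspForm g hg))
      have h := mul_mem_Mspan dl_mem this
      rw [show (12 : ℤ) + (k - 12) = k by ring] at h
      exact h
  set b : ModularForm 𝒮ℒ k := ModularForm.mcast (by linarith) ((E₄.pow i).mul (E₆.pow j))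
    with hb
  have hbq : qExpansion 1 b = e4 ^ i * e6 ^ j := by
    rw [hb, coe_mcast,
      ModularForm.qExpansion_mul one_pos one_mem_strictPeriods_SL,
      ModularForm.qExpansion_pow one_pos one_mem_strictPeriods_SL,
      ModularForm.qExpansion_pow one_pos one_mem_strictPeriods_SL]
    rfl
  set c := (qExpansion 1 f).coeff 0
  have hq : qExpansion 1 (f - c • b : ModularForm 𝒮ℒ k) = qExpansion 1 f - c • (e4 ^ i * e6 ^ j) := by
    rw [FunLike.coe_sub, ModularForm.qExpansion_sub one_pos one_mem_strictPeriods_SL,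
      FunLike.coe_smul, ModularForm.qExpansion_smul one_pos one_mem_strictPeriods_SL, hbq]
  have h1 := cusp (f - c • b) (by
    rw [hq]
    have h1 := e4_coeff_zero
    have h2 := e6_coeff_zero
    simp only [coeff_zero_eq_constantCoeff] at h1 h2
    simp [h1, h2, c])
  rw [hq] at h1
  have := add_mem h1 (Submodule.smul_mem _ c (mem_Mspan i j k hij))
  simpa using this

lemma qExpansion_mem_dl_pow (m : ℕ) : ∀ (k : ℤ) (f : ModularForm 𝒮ℒ k),
    (∀ n < m, (qExpansion 1 f).coeff n = 0) →
    ∃ g ∈ Mspan (k - 12 * m), qExpansion 1 f = dl ^ m * g := by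
  induction m with
  | zero => intro k f _; exact ⟨_, by simpa using qExpansion_mem_Mspan _ k le_rfl f, by simp⟩
  | succ m ih =>
    intro k f hf
    have h := ModularForm.qExpansion_eq_qExpansion_discriminant_mul f (hf 0 (by omega))
    obtain ⟨g, hg, hg'⟩ := ih (k - 12) (CuspForm.discriminantEquiv (toCuspForm f (hf 0 (by omega))))
      (by
        set φ := qExpansion 1 (CuspForm.discriminantEquiv (toCuspForm f (hf 0 (by omega))))
        have h1 : ((m + 1 : ℕ) : ℕ∞) ≤ (qExpansion 1 f).order :=
          nat_le_order _ _ hf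
        rw [h, order_mul, discriminant_qExpansion_order] at h1
        intro n hn
        refine coeff_of_lt_order n ?_
        push_cast at h1
        rw [add_comm] at h1
        have h2 : (m : ℕ∞) ≤ φ.order := by
          rwa [ENat.add_le_add_iff_left (by simp)] at h1
        exact lt_of_lt_of_le (by exact_mod_cast hn) h2)
    refine ⟨g, ?_, ?_⟩
    · convert hg using 2; push_cast; ring
    · rw [h, hg', pow_succ]
      change dl * _ = _
      ring

/-- `e(τ) = exp (2π i τ)`. -/
def ex (z : ℂ) : ℂ := exp (2 * π * Complex.I * z)

lemma norm_ex (z : ℂ) : ‖ex z‖ = Real.exp (-2 * π * z.im) := by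
  rw [ex, norm_exp]
  congr 1
  simp [mul_assoc]

lemma ex_add (z w : ℂ) : ex (z + w) = ex z * ex w := by
  rw [ex, mul_add, exp_add]; rfl

lemma ex_int (n : ℤ) : ex n = 1 := by
  rw [ex, exp_eq_one_iff]; exact ⟨n, by ring⟩

lemma ex_zero : ex 0 = 1 := by simp [ex]

lemma ex_neg (z : ℂ) : ex (-z) = (ex z)⁻¹ := by
  rw [ex, mul_neg, exp_neg]; rfl

lemma ex_nat_mul (n : ℕ) (z : ℂ) : ex (n * z) = ex z ^ n := by
  rw [ex, ex, ← exp_nat_mul]; congr 1; ring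

lemma ex_ne_zero (z : ℂ) : ex z ≠ 0 := exp_ne_zero _

lemma differentiable_ex : Differentiable ℂ ex := by unfold ex; fun_prop

lemma continuous_ex : Continuous ex := differentiable_ex.continuous

/-- A convergent `q`-series with the transformation law of a level one form of weight `k`
and vanishing order at least `m` is `Δ ^ m` times a level one form of weight `k - 12 m`. -/
theorem levelOne_structure (k : ℤ) (c : ℕ → ℂ) (m : ℕ)
    (hs : ∀ τ : ℂ, 0 < τ.im → Summable fun n : ℕ => c n * ex (n * τ))
    (hlaw : ∀ τ : ℂ, 0 < τ.im →
      ∑' n : ℕ, c n * ex (n * (-1 / τ)) = τ ^ k * ∑' n : ℕ, c n * ex (n * τ))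
    (hm : ∀ n < m, c n = 0) :
    ∃ g ∈ Mspan (k - 12 * m), mk c = dl ^ m * g := by
  set h : ℍ → ℂ := fun τ => ∑' n : ℕ, c n * ex (n * τ) with hh
  have hS : h ∣[k] ModularGroup.S = h := by
    funext τ
    rw [SL_slash_apply, modular_S_smul, ModularGroup.denom_S]
    have h1 := hlaw τ τ.2
    simp only [hh]
    rw [show (-(τ : ℂ))⁻¹ = -1 / (τ : ℂ) by
      simp [neg_div, inv_neg], h1, mul_comm, ← mul_assoc, ← zpow_add₀ τ.ne_zero]
    simp
  have hT : h ∣[k] ModularGroup.T = h := by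
    funext τ
    have hden : denom (ModularGroup.T : GL (Fin 2) ℝ) τ = 1 := by
      have h10 : ((ModularGroup.T : GL (Fin 2) ℝ) : Matrix (Fin 2) (Fin 2) ℝ) 1 0 = 0 := by
        change ((ModularGroup.T 1 0 : ℤ) : ℝ) = 0
        simp [ModularGroup.T]
      have h11 : ((ModularGroup.T : GL (Fin 2) ℝ) : Matrix (Fin 2) (Fin 2) ℝ) 1 1 = 1 := by
        change ((ModularGroup.T 1 1 : ℤ) : ℝ) = 1
        simp [ModularGroup.T]
      rw [denom, h10, h11]; simp
    rw [SL_slash_apply, hden, modular_T_smul]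
    simp only [hh]
    simp [mul_add, ex_add, show ∀ n : ℕ, ex n = 1 from fun n => by simpa using ex_int n]
  have hinv := slash_action_generators_SL2Z hS hT
  have hHS : ∀ τ : ℍ, HasSum (fun m ↦ c m • Function.Periodic.qParam 1 τ ^ m) (h τ) := by
    intro τ
    have := (hs τ τ.2).hasSum
    convert this using 2 with n
    rw [ex_nat_mul]
    simp [Function.Periodic.qParam, ex]
  let f : ModularForm 𝒮ℒ k :=
    { toFun := h
      slash_action_eq' := by
        intro A hA
        obtain ⟨A, rfl⟩ := hA
        exact hinv A
      holo' := by
        rw [UpperHalfPlane.mdifferentiable_iff]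
        have : DifferentiableOn ℂ (fun τ : ℂ => ∑' n : ℕ, c n * ex (n * τ)) {τ | 0 < τ.im} := by
          intro τ hτ
          have hτ : 0 < τ.im := hτ
          have hd : DifferentiableOn ℂ (fun τ : ℂ => ∑' n : ℕ, c n * ex (n * τ))
              {z | τ.im / 2 < z.im} := by
            refine differentiableOn_tsum_of_summable_norm
              (u := fun n => ‖c n * ex (n * (((τ.im / 2 : ℝ) : ℂ) * Complex.I))‖) ?_ ?_ ?_ ?_
            · exact (hs _ (by simpa using hτ)).norm
            · intro n
              exact ((differentiable_const _).mul
                (differentiable_ex.comp (by fun_prop))).differentiableOn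
            · exact isOpen_lt continuous_const Complex.continuous_im
            · intro n z hz
              rw [norm_mul, norm_mul]
              gcongr
              rw [norm_ex, norm_ex]
              apply Real.exp_le_exp.2
              have hz : τ.im / 2 < z.im := hz
              have h1 : ((n : ℂ) * z).im = n * z.im := by simp
              have h2 : ((n : ℂ) * (((τ.im / 2 : ℝ) : ℂ) * Complex.I)).im = n * (τ.im / 2) := by
                simp
              rw [h1, h2]
              have : (n : ℝ) * (τ.im / 2) ≤ n * z.im := by gcongr
              nlinarith [Real.pi_pos]
          exact ((hd.differentiableAt ((isOpen_lt continuous_const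
            Complex.continuous_im).mem_nhds (show τ.im / 2 < τ.im by linarith)))).differentiableWithinAt
        refine this.congr ?_
        intro z hz
        simp [hh, ofComplex_apply_of_im_pos hz]
      bdd_at_cusps' := by
        intro x hc
        rw [Subgroup.IsArithmetic.isCusp_iff_isCusp_SL2Z] at hc
        rw [OnePoint.isBoundedAt_iff_forall_SL2Z hc]
        intro γ _
        rw [hinv]
        exact isBoundedAtImInfty_of_hasSum_qExpansion one_pos hHS }
  have hc : ∀ n, c n = (qExpansion 1 f).coeff n := fun n =>
    ModularFormClass.qExpansion_coeff_unique one_pos one_mem_strictPeriods_SL hHS n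
  obtain ⟨g, hg, hg'⟩ := qExpansion_mem_dl_pow m k f (fun n hn => by rw [← hc, hm n hn])
  refine ⟨g, hg, ?_⟩
  rw [← hg']
  ext n
  simp [hc n]

end LevelOneForms

/-- Fourier indices `(n, r, s, m)`. -/
abbrev X := ℤ × ℤ × ℤ × ℤ
/-- Coordinates `(τ₁, t, σ, τ₂)` on the Hermitian half-space. -/
abbrev Q := ℂ × ℂ × ℂ × ℂ

variable {κ : ℕ} {a b : X → ℂ} {A : Fin 5 → X → ℂ} {g : ℤ → ℤ → ℂ} {z : Q}

/-- The pairing between indices and points. -/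
def lin (x : X) (z : Q) : ℂ :=
  x.1 * z.1 + x.2.1 * z.2.1 + (x.2.1 + 2 * x.2.2.1) * z.2.2.1 + x.2.2.2 * z.2.2.2

/-- The Hermitian half-space in coordinates. -/
def Dom (z : Q) : Prop :=
  0 < z.1.im ∧ z.2.1.im ^ 2 + 3 * z.2.2.1.im ^ 2 < z.1.im * z.2.2.2.im

/-- The cone of semi-positive indices. -/
def Cone (x : X) : Prop :=
  0 ≤ x.1 ∧ 0 ≤ x.2.2.2 ∧ x.2.1 ^ 2 + x.2.1 * x.2.2.1 + x.2.2.1 ^ 2 ≤ 3 * x.1 * x.2.2.2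

/-- The `ℓ¹`-size of an index. -/
def sz (x : X) : ℝ := |(x.1 : ℝ)| + |(x.2.1 : ℝ)| + |(x.2.2.1 : ℝ)| + |(x.2.2.2 : ℝ)|

/-- Subexponential growth. -/
def Grow (a : X → ℂ) : Prop := ∀ δ > 0, ∃ C : ℝ, ∀ x, ‖a x‖ ≤ C * Real.exp (δ * sz x)

/-- Support in the cone. -/
def CS (a : X → ℂ) : Prop := ∀ x, ¬ Cone x → a x = 0

/-- The function attached to a family of Fourier coefficients. -/
def FF (a : X → ℂ) (z : Q) : ℂ := ∑' x, a x * ex (lin x z)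

/-- The rate of decay of exponentials at a point. -/
def rate (z : Q) : ℝ :=
  (z.1.im * z.2.2.2.im - (z.2.1.im ^ 2 + 3 * z.2.2.1.im ^ 2)) / (3 * (z.1.im + z.2.2.2.im))

lemma Dom.im2_pos (h : Dom z) : 0 < z.2.2.2.im := by
  obtain ⟨h1, h2⟩ := h
  by_contra hc
  push Not at hc
  nlinarith [sq_nonneg z.2.1.im, sq_nonneg z.2.2.1.im]

lemma Dom.rate_pos (h : Dom z) : 0 < rate z := by
  have h2 := h.im2_pos
  obtain ⟨h1, h3⟩ := h
  unfold rate
  apply div_pos <;> linarith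

lemma lin_im (x : X) (z : Q) : (lin x z).im = x.1 * z.1.im + x.2.1 * z.2.1.im +
    (x.2.1 + 2 * x.2.2.1) * z.2.2.1.im + x.2.2.2 * z.2.2.2.im := by
  simp [lin]

lemma Cone.real {x : X} (h : Cone x) : 0 ≤ (x.1 : ℝ) ∧ 0 ≤ (x.2.2.2 : ℝ) ∧
    (x.2.1 : ℝ) ^ 2 + x.2.1 * x.2.2.1 + (x.2.2.1 : ℝ) ^ 2 ≤ 3 * x.1 * x.2.2.2 :=
  ⟨by exact_mod_cast h.1, by exact_mod_cast h.2.1, by exact_mod_cast h.2.2⟩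

lemma Cone.sz_le {x : X} (h : Cone x) : sz x ≤ 3 * ((x.1 : ℝ) + x.2.2.2) := by
  obtain ⟨h1, h2, h3⟩ := h.real
  unfold sz
  rw [abs_of_nonneg h1, abs_of_nonneg h2]
  have hr : |(x.2.1 : ℝ)| ≤ x.1 + x.2.2.2 := by
    apply abs_le_of_sq_le_sq _ (by linarith)
    nlinarith [sq_nonneg ((x.2.1 : ℝ) + 2 * x.2.2.1), sq_nonneg ((x.1 : ℝ) - x.2.2.2)]
  have hs : |(x.2.2.1 : ℝ)| ≤ x.1 + x.2.2.2 := by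
    apply abs_le_of_sq_le_sq _ (by linarith)
    nlinarith [sq_nonneg ((x.2.2.1 : ℝ) + 2 * x.2.1), sq_nonneg ((x.1 : ℝ) - x.2.2.2)]
  linarith

lemma rate_mul_sz_le {x : X} (hx : Cone x) (hz : Dom z) :
    rate z * sz x ≤ (lin x z).im := by
  have h0 := hz.rate_pos
  have hv2 := hz.im2_pos
  obtain ⟨hv1, hD⟩ := hz
  obtain ⟨h1, h2, h3⟩ := hx.real
  rw [lin_im]
  set v1 := z.1.im
  set v2 := z.2.2.2.im
  set b := z.2.1.im
  set d := z.2.2.1.im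
  set n := (x.1 : ℝ)
  set m := (x.2.2.2 : ℝ)
  set r := (x.2.1 : ℝ)
  set s := (x.2.2.1 : ℝ)
  set δ := 3 * rate z with hδ
  have hδ1 : δ * (v1 + v2) = v1 * v2 - (b ^ 2 + 3 * d ^ 2) := by
    have hne : v1 + v2 ≠ 0 := by linarith
    rw [hδ, rate]
    change 3 * ((v1 * v2 - (b ^ 2 + 3 * d ^ 2)) / (3 * (v1 + v2))) * (v1 + v2) = _
    field_simp
  have hδ0 : 0 < δ := by linarith
  have hA : 0 ≤ v1 - δ := by
    by_contra hc; push Not at hc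
    nlinarith [sq_nonneg b, sq_nonneg d]
  have hB : 0 ≤ v2 - δ := by
    by_contra hc; push Not at hc
    nlinarith [sq_nonneg b, sq_nonneg d]
  have hAB : b ^ 2 + 3 * d ^ 2 ≤ (v1 - δ) * (v2 - δ) := by nlinarith
  have key : |r * b + (r + 2 * s) * d| ≤ n * (v1 - δ) + m * (v2 - δ) := by
    apply abs_le_of_sq_le_sq _ (by positivity)
    have e1 : (r * b + (r + 2 * s) * d) ^ 2 ≤ (r ^ 2 + (r + 2 * s) ^ 2 / 3) * (b ^ 2 + 3 * d ^ 2) := by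
      nlinarith [sq_nonneg (3 * r * d - (r + 2 * s) * b)]
    have e2 : (r ^ 2 + (r + 2 * s) ^ 2 / 3) ≤ 4 * (n * m) := by nlinarith
    have e3 : (r ^ 2 + (r + 2 * s) ^ 2 / 3) * (b ^ 2 + 3 * d ^ 2) ≤
        4 * (n * m) * ((v1 - δ) * (v2 - δ)) := by
      apply mul_le_mul e2 hAB (by positivity) (by positivity)
    nlinarith [sq_nonneg (n * (v1 - δ) - m * (v2 - δ))]
  have h4 : rate z * sz x ≤ δ * (n + m) := by
    have := hx.sz_le
    rw [hδ]
    nlinarith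
  have := (abs_le.1 key).1
  linarith

lemma summable_exp_abs {c : ℝ} (hc : 0 < c) : Summable fun n : ℤ => Real.exp (-c * |(n : ℝ)|) := by
  have h : Summable fun n : ℕ => Real.exp (-c * n) := by
    have := Real.summable_exp_nat_mul_iff.2 (show -c < 0 by linarith)
    simpa [mul_comm] using this
  refine Summable.of_nat_of_neg ?_ ?_
  · simpa using h
  · simpa using h

lemma summable_exp_sz {c : ℝ} (hc : 0 < c) : Summable fun x : X => Real.exp (-c * sz x) := by
  have h := summable_exp_abs hc
  have h4 := h.mul_of_nonneg (h.mul_of_nonneg (h.mul_of_nonneg h (fun _ => (Real.exp_pos _).le)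
    (fun _ => (Real.exp_pos _).le)) (fun _ => (Real.exp_pos _).le)
    (fun _ => mul_nonneg (Real.exp_pos _).le (Real.exp_pos _).le)) (fun _ => (Real.exp_pos _).le)
    (fun _ => mul_nonneg (Real.exp_pos _).le (mul_nonneg (Real.exp_pos _).le (Real.exp_pos _).le))
  refine h4.congr ?_
  intro x
  simp only [← Real.exp_add, sz]
  congr 1
  ring

lemma norm_ex_lin_le {x : X} (hx : Cone x) (hz : Dom z) :
    ‖ex (lin x z)‖ ≤ Real.exp (-(2 * π * rate z) * sz x) := by
  rw [norm_ex]
  apply Real.exp_le_exp.2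
  have := rate_mul_sz_le hx hz
  nlinarith [Real.pi_pos]

/-- A uniform exponential bound for the terms of the Fourier series. -/
lemma exists_term_bound (hc : CS a) (hg : Grow a) {ρ : ℝ} (hρ : 0 < ρ) :
    ∃ C : ℝ, ∀ z, Dom z → ρ ≤ rate z → ∀ x,
      ‖a x * ex (lin x z)‖ ≤ C * Real.exp (-ρ * sz x) := by
  obtain ⟨C, hC⟩ := hg ρ hρ
  refine ⟨C, fun z hz hr x => ?_⟩
  have hC0 : 0 ≤ C := by
    have := (norm_nonneg _).trans (hC x)
    exact nonneg_of_mul_nonneg_left this (Real.exp_pos _)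
  by_cases hx : Cone x
  · rw [norm_mul]
    calc ‖a x‖ * ‖ex (lin x z)‖ ≤ (C * Real.exp (ρ * sz x)) *
          Real.exp (-(2 * π * rate z) * sz x) :=
        mul_le_mul (hC x) (norm_ex_lin_le hx hz) (norm_nonneg _) (by positivity)
      _ = C * Real.exp (ρ * sz x + -(2 * π * rate z) * sz x) := by
        rw [mul_assoc, Real.exp_add]
      _ ≤ _ := by
        gcongr
        have h0 : 0 ≤ sz x := by unfold sz; positivity
        have : ρ ≤ π * rate z := by nlinarith [Real.pi_gt_three]
        nlinarith
  · rw [hc x hx]; simp; positivity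

lemma summable_FF (hc : CS a) (hg : Grow a) (hz : Dom z) :
    Summable fun x => a x * ex (lin x z) := by
  obtain ⟨C, hC⟩ := exists_term_bound hc hg hz.rate_pos
  exact Summable.of_norm_bounded ((summable_exp_sz hz.rate_pos).mul_left C) (hC z hz le_rfl)

lemma integral_ex_int (n : ℤ) : ∫ u in (0:ℝ)..1, ex (n * u) = if n = 0 then 1 else 0 := by
  split_ifs with h
  · subst h; simp [ex_zero]
  · have hne : (2 * π * I * n : ℂ) ≠ 0 := by
      simp [Real.pi_ne_zero, h]
    have := integral_exp_mul_complex (a := 0) (b := 1) hne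
    have h1 : ∀ u : ℝ, ex (n * u) = exp (2 * π * I * n * u) := by
      intro u; rw [ex]; congr 1; ring
    simp only [h1]
    rw [this]
    have h2 : exp (2 * π * I * n * (1 : ℝ)) = 1 := by
      rw [exp_eq_one_iff]; exact ⟨n, by push_cast; ring⟩
    rw [h2]; simp

/-- Uniqueness of Fourier coefficients for absolutely convergent series indexed by frequencies. -/
lemma fourier_unique {ι : Type*} [Countable ι] {a : ι → ℂ} (ha : Summable a) (ν : ι → ℤ)
    (h : ∀ u : ℝ, ∑' i, a i * ex (ν i * u) = 0) (n : ℤ) :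
    ∑' i, (if ν i = n then a i else 0) = 0 := by
  have hn : ∀ (j : ℤ) (u : ℝ), ‖ex (j * u)‖ = 1 := by
    intro j u; rw [norm_ex]; simp
  have hcont : ∀ i, Continuous fun u : ℝ => a i * ex ((ν i - n : ℤ) * u) := fun i =>
    continuous_const.mul (continuous_ex.comp (by fun_prop))
  have key := intervalIntegral.hasSum_integral_of_dominated_convergence
    (μ := MeasureTheory.volume) (a := (0 : ℝ)) (b := 1)
    (F := fun i (u : ℝ) => a i * ex ((ν i - n : ℤ) * u)) (f := fun _ => 0)
    (bound := fun i _ => ‖a i‖)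
    (fun i => (hcont i).aestronglyMeasurable)
    (fun i => by
      filter_upwards with u _
      rw [norm_mul, hn, mul_one])
    (by filter_upwards with u _; exact ha.norm)
    (by simp)
    (by
      filter_upwards with u _
      have h1 : (fun i => a i * ex ((ν i - n : ℤ) * u)) = fun i => ex (-(n * u)) * (a i * ex (ν i * u)) := by
        funext i
        rw [show (((ν i - n : ℤ) : ℂ) * u) = -(n * u) + ν i * u by push_cast; ring, ex_add]
        ring
      rw [h1]
      have h2 : Summable fun i => a i * ex (ν i * u) := by
        refine Summable.of_norm ?_
        refine ha.norm.congr fun i => ?_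
        rw [norm_mul, hn, mul_one]
      have := h2.hasSum.mul_left (ex (-(n * u)))
      rwa [h u, mul_zero] at this)
  have h3 := key.tsum_eq
  rw [intervalIntegral.integral_zero] at h3
  refine Eq.trans (tsum_congr fun i => ?_) h3
  rw [intervalIntegral.integral_const_mul, integral_ex_int]
  simp [sub_eq_zero]

/-- Real translates stay in the domain. -/
lemma Dom.add_real (hz : Dom z) (u1 u2 u3 u4 : ℝ) :
    Dom (z.1 + u1, z.2.1 + u2, z.2.2.1 + u3, z.2.2.2 + u4) := by
  simpa [Dom] using hz

lemma coeff_eq_zero_of_sum (ha : Summable a)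
    (h : ∀ u1 u2 u3 u4 : ℝ, ∑' x, a x * ex (lin x (u1, u2, u3, u4)) = 0) (x0 : X) : a x0 = 0 := by
  classical
  have hn : ∀ (j : ℤ) (u : ℝ), ‖ex (j * u)‖ = 1 := by
    intro j u; rw [norm_ex]; simp
  have hsum : ∀ (b : X → ℂ) (_ : Summable b) (ν : X → ℤ) (u : ℝ),
      Summable fun x => b x * ex (ν x * u) := by
    intro b hb ν u
    refine Summable.of_norm ?_
    refine hb.norm.congr fun i => ?_
    rw [norm_mul, hn, mul_one]
  have hind : ∀ (b : X → ℂ) (_ : Summable b) (p : X → Prop) [DecidablePred p],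
      Summable fun x => if p x then b x else 0 := by
    intro b hb p _
    exact hb.indicator {x | p x} |>.congr (fun x => by simp [Set.indicator])
  have s1 : ∀ u2 u3 u4 : ℝ, ∑' x : X, (if x.1 = x0.1 then a x else 0) *
      ex (x.2.1 * u2) * ex ((x.2.1 + 2 * x.2.2.1 : ℤ) * u3) * ex (x.2.2.2 * u4) = 0 := by
    intro u2 u3 u4
    have := fourier_unique (a := fun x => a x * ex (x.2.1 * u2) *
      ex ((x.2.1 + 2 * x.2.2.1 : ℤ) * u3) * ex (x.2.2.2 * u4))
      (hsum _ (hsum _ (hsum _ ha (fun x => x.2.1) u2) (fun x => x.2.1 + 2 * x.2.2.1) u3)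
        (fun x => x.2.2.2) u4) (fun x => x.1) (fun u1 => by
          refine Eq.trans (tsum_congr fun x => ?_) (h u1 u2 u3 u4)
          simp only [lin, ex_add]
          push_cast
          ring) x0.1
    refine Eq.trans (tsum_congr fun x => ?_) this
    split_ifs <;> simp
  have s2 : ∀ u3 u4 : ℝ, ∑' x : X, (if x.2.1 = x0.2.1 then (if x.1 = x0.1 then a x else 0) else 0) *
      ex ((x.2.1 + 2 * x.2.2.1 : ℤ) * u3) * ex (x.2.2.2 * u4) = 0 := by
    intro u3 u4
    have := fourier_unique (a := fun x : X => (if x.1 = x0.1 then a x else 0) *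
      ex ((x.2.1 + 2 * x.2.2.1 : ℤ) * u3) * ex (x.2.2.2 * u4))
      (hsum _ (hsum _ (hind a ha (fun x => x.1 = x0.1)) (fun x => x.2.1 + 2 * x.2.2.1) u3)
        (fun x => x.2.2.2) u4) (fun x => x.2.1) (fun u2 => by
          refine Eq.trans (tsum_congr fun x => ?_) (s1 u2 u3 u4)
          ring) x0.2.1
    refine Eq.trans (tsum_congr fun x => ?_) this
    split_ifs <;> simp
  have s3 : ∀ u4 : ℝ, ∑' x : X, (if x.2.1 + 2 * x.2.2.1 = x0.2.1 + 2 * x0.2.2.1 then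
      (if x.2.1 = x0.2.1 then (if x.1 = x0.1 then a x else 0) else 0) else 0) *
      ex (x.2.2.2 * u4) = 0 := by
    intro u4
    have := fourier_unique (a := fun x : X =>
      (if x.2.1 = x0.2.1 then (if x.1 = x0.1 then a x else 0) else 0) * ex (x.2.2.2 * u4))
      (hsum _ (hind _ (hind a ha (fun x => x.1 = x0.1)) (fun x => x.2.1 = x0.2.1))
        (fun x => x.2.2.2) u4) (fun x => x.2.1 + 2 * x.2.2.1) (fun u3 => by
          refine Eq.trans (tsum_congr fun x => ?_) (s2 u3 u4)
          ring) (x0.2.1 + 2 * x0.2.2.1)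
    refine Eq.trans (tsum_congr fun x => ?_) this
    split_ifs <;> simp
  have s4 := fourier_unique (a := fun x : X =>
      (if x.2.1 + 2 * x.2.2.1 = x0.2.1 + 2 * x0.2.2.1 then
      (if x.2.1 = x0.2.1 then (if x.1 = x0.1 then a x else 0) else 0) else 0))
      (hind _ (hind _ (hind a ha (fun x => x.1 = x0.1)) (fun x => x.2.1 = x0.2.1))
        (fun x => x.2.1 + 2 * x.2.2.1 = x0.2.1 + 2 * x0.2.2.1))
        (fun x => x.2.2.2) s3 x0.2.2.2
  rw [tsum_eq_single x0] at s4
  · simpa using s4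
  · intro x hx
    by_contra hne
    apply hx
    have h1 : x.2.2.2 = x0.2.2.2 := by by_contra hc; simp [hc] at hne
    have h2 : x.2.1 + 2 * x.2.2.1 = x0.2.1 + 2 * x0.2.2.1 := by by_contra hc; simp [hc] at hne
    have h3 : x.2.1 = x0.2.1 := by by_contra hc; simp [hc] at hne
    have h4 : x.1 = x0.1 := by by_contra hc; simp [hc] at hne
    exact Prod.ext h4 (Prod.ext h3 (Prod.ext (by omega) h1))

/-- Fourier coefficients are determined by the function on a horizontal slice. -/
lemma FF_injective (ha : ∀ z, Dom z → Summable fun x => a x * ex (lin x z))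
    (hb : ∀ z, Dom z → Summable fun x => b x * ex (lin x z))
    (h : ∀ z, Dom z → FF a z = FF b z) : a = b := by
  funext x0
  have hz0 : Dom (I, 0, 0, I) := by simp [Dom]
  have key := coeff_eq_zero_of_sum (a := fun x => (a x - b x) * ex (lin x (I, 0, 0, I)))
    (((ha _ hz0).sub (hb _ hz0)).congr fun x => by ring) (fun u1 u2 u3 u4 => by
      have hz := hz0.add_real u1 u2 u3 u4
      have h1 := h _ hz
      have h2 := (ha _ hz).hasSum.sub (hb _ hz).hasSum
      have h3 : (∑' x, a x * ex (lin x _)) - ∑' x, b x * ex (lin x _) = 0 := sub_eq_zero.2 h1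
      rw [h3] at h2
      refine Eq.trans (tsum_congr fun x => ?_) h2.tsum_eq
      rw [mul_assoc, ← ex_add, sub_mul]
      congr 3 <;> (simp [lin]; ring)) x0
  have := (mul_eq_zero.1 key).resolve_right (ex_ne_zero _)
  exact sub_eq_zero.1 this

section MomentLimit
variable {ι : Type*} {c : ι → ℂ} {y : ι → ℤ}

lemma summable_norm_mul_exp_abs (hs : ∀ t : ℂ, Summable fun x => c x * ex (y x * t)) (R : ℝ) :
    Summable fun x => ‖c x‖ * Real.exp (R * |(y x : ℝ)|) := by
  have hpi := Real.pi_pos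
  have h1 := (hs ((-R / (2 * π) : ℝ) * I)).norm
  have h2 := (hs ((R / (2 * π) : ℝ) * I)).norm
  refine Summable.of_nonneg_of_le (fun x => by positivity) (fun x => ?_) (h1.add h2)
  have e1 : ∀ u : ℝ, ‖ex (y x * ((u / (2 * π) : ℝ) * I))‖ = Real.exp (-(u * y x)) := by
    intro u
    rw [norm_ex]
    congr 1
    have : ((y x : ℂ) * ((u / (2 * π) : ℝ) * I)).im = y x * (u / (2 * π)) := by
      rw [mul_im, re_ofReal_mul, im_ofReal_mul]
      simp
    rw [this]
    field_simp
  rw [norm_mul, norm_mul, e1, e1, ← mul_add]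
  gcongr
  rcases abs_cases (y x : ℝ) with h | h <;> rw [h.1]
  · have : -(-R * (y x : ℝ)) = R * y x := by ring
    rw [this]
    linarith [Real.exp_pos (-(R * (y x : ℝ)))]
  · have : R * -(y x : ℝ) = -(R * y x) := by ring
    rw [this]
    linarith [Real.exp_pos (-(-R * (y x : ℝ)))]

lemma summable_norm_mul_pow_mul_exp (hs : ∀ t : ℂ, Summable fun x => c x * ex (y x * t))
    (R : ℝ) (i : ℕ) :
    Summable fun x => ‖c x‖ * |(y x : ℝ)| ^ i * Real.exp (R * |(y x : ℝ)|) := by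
  refine Summable.of_nonneg_of_le (fun x => by positivity) (fun x => ?_)
    ((summable_norm_mul_exp_abs hs (R + 1)).mul_left (i.factorial : ℝ))
  have h := Real.pow_div_factorial_le_exp |(y x : ℝ)| (abs_nonneg _) i
  rw [div_le_iff₀ (by positivity)] at h
  rw [add_mul, one_mul, Real.exp_add]
  calc ‖c x‖ * |(y x : ℝ)| ^ i * Real.exp (R * |(y x : ℝ)|)
      ≤ ‖c x‖ * (Real.exp |(y x : ℝ)| * i.factorial) * Real.exp (R * |(y x : ℝ)|) := by gcongr
    _ = _ := by ring

lemma summable_mul_pow (hs : ∀ t : ℂ, Summable fun x => c x * ex (y x * t)) (i : ℕ) :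
    Summable fun x => c x * (y x : ℂ) ^ i := by
  refine Summable.of_norm_bounded (summable_norm_mul_pow_mul_exp hs 0 i) (fun x => ?_)
  simp

lemma norm_sub_moment_le (hs : ∀ t : ℂ, Summable fun x => c x * ex (y x * t)) (i : ℕ)
    (h0 : ∀ i' < i, ∑' x, c x * (y x : ℂ) ^ i' = 0) :
    ∃ K : ℝ, ∀ t : ℂ, ‖t‖ ≤ 1 → ‖∑' x, c x * ex (y x * t) -
      (2 * π * I * t) ^ i / i.factorial * ∑' x, c x * (y x : ℂ) ^ i‖ ≤
        K * ‖t‖ ^ (i + 1) := by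
  have hK := (summable_norm_mul_pow_mul_exp hs (2 * π) (i + 1)).mul_left
    ((2 * π) ^ (i + 1))
  refine ⟨∑' x, (2 * π) ^ (i + 1) *
    (‖c x‖ * |(y x : ℝ)| ^ (i + 1) * Real.exp (2 * π * |(y x : ℝ)|)), fun t ht => ?_⟩
  have hsum : ∀ j, Summable fun x => c x * ((2 * π * I * (y x * t)) ^ j / j.factorial) := by
    intro j
    refine ((summable_mul_pow hs j).mul_left ((2 * π * I * t) ^ j / j.factorial)).congr
      fun x => ?_
    ring
  have hts : ∀ j, ∑' x, c x * ((2 * π * I * (y x * t)) ^ j / j.factorial) =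
      (2 * π * I * t) ^ j / j.factorial * ∑' x, c x * (y x : ℂ) ^ j := by
    intro j
    rw [← tsum_mul_left]
    refine tsum_congr fun x => ?_
    ring
  have hfin : ∑' x, c x * ∑ j ∈ range (i + 1),
      (2 * π * I * (y x * t)) ^ j / j.factorial =
      (2 * π * I * t) ^ i / i.factorial * ∑' x, c x * (y x : ℂ) ^ i := by
    simp_rw [mul_sum]
    rw [Summable.tsum_finsetSum (fun j _ => hsum j), sum_range_succ, hts,
      sum_eq_zero, zero_add]
    intro j hj
    rw [hts, h0 j (mem_range.1 hj), mul_zero]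
  have hfs : Summable fun x => c x * ∑ j ∈ range (i + 1),
      (2 * π * I * (y x * t)) ^ j / j.factorial := by
    simp_rw [mul_sum]
    exact summable_sum fun j _ => hsum j
  rw [← hfin, ← (hs t).tsum_sub hfs, ← tsum_mul_right]
  refine tsum_of_norm_bounded ((hK.mul_right (‖t‖ ^ (i + 1))).hasSum) (fun x => ?_)
  rw [← mul_sub, norm_mul, ex]
  have h1 := norm_exp_sub_sum_le_norm_mul_exp (2 * π * I * (y x * t)) (i + 1)
  have h2 : ‖2 * π * I * (y x * t)‖ = 2 * π * |(y x : ℝ)| * ‖t‖ := by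
    simp [abs_of_pos Real.pi_pos]; ring
  rw [h2] at h1
  calc ‖c x‖ * _ ≤ ‖c x‖ * ((2 * π * |(y x : ℝ)| * ‖t‖) ^ (i + 1) *
        Real.exp (2 * π * |(y x : ℝ)| * ‖t‖)) := by gcongr
    _ ≤ ‖c x‖ * ((2 * π * |(y x : ℝ)| * ‖t‖) ^ (i + 1) *
        Real.exp (2 * π * |(y x : ℝ)|)) := by
        have : 2 * π * |(y x : ℝ)| * ‖t‖ ≤ 2 * π * |(y x : ℝ)| :=
          mul_le_of_le_one_right (by positivity) ht
        have := Real.exp_le_exp.2 this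
        gcongr
    _ = _ := by rw [mul_pow, mul_pow]; ring

/-- The lowest moment of a Fourier series is its leading Taylor coefficient. -/
lemma moment_limit (hs : ∀ t : ℂ, Summable fun x => c x * ex (y x * t)) (i : ℕ)
    (h0 : ∀ i' < i, ∑' x, c x * (y x : ℂ) ^ i' = 0) :
    Tendsto (fun t : ℂ => (∑' x, c x * ex (y x * t)) / t ^ i) (𝓝[≠] 0)
      (𝓝 ((2 * π * I) ^ i / i.factorial * ∑' x, c x * (y x : ℂ) ^ i)) := by
  obtain ⟨K, hK⟩ := norm_sub_moment_le hs i h0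
  rw [tendsto_iff_norm_sub_tendsto_zero]
  have hlim : Tendsto (fun t : ℂ => K * ‖t‖) (𝓝[≠] 0) (𝓝 0) := by
    have : Tendsto (fun t : ℂ => K * ‖t‖) (𝓝 0) (𝓝 (K * ‖(0 : ℂ)‖)) :=
      (continuous_const.mul continuous_norm).tendsto _
    simp only [norm_zero, mul_zero] at this
    exact this.mono_left nhdsWithin_le_nhds
  refine squeeze_zero' (Eventually.of_forall fun _ => norm_nonneg _) ?_ hlim
  have hball : ∀ᶠ t : ℂ in 𝓝[≠] 0, ‖t‖ ≤ 1 := by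
    apply nhdsWithin_le_nhds
    filter_upwards [Metric.closedBall_mem_nhds (0 : ℂ) one_pos] with t ht
    simpa using ht
  filter_upwards [hball, self_mem_nhdsWithin] with t ht hne
  have hne' : t ≠ 0 := hne
  have e : (∑' x, c x * ex (y x * t)) / t ^ i -
      (2 * π * I) ^ i / i.factorial * ∑' x, c x * (y x : ℂ) ^ i =
      (∑' x, c x * ex (y x * t) - (2 * π * I * t) ^ i / i.factorial *
        ∑' x, c x * (y x : ℂ) ^ i) / t ^ i := by
    rw [mul_pow _ t, sub_div]
    congr 1
    field_simp
  rw [e, norm_div, norm_pow, div_le_iff₀ (by positivity)]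
  refine (hK t ht).trans (le_of_eq ?_)
  ring

end MomentLimit

/-- Jacobi-type forms of weight `κ` and index `m`, given by their coefficients. -/
structure JF (κ : ℤ) (m : ℕ) (γ : ℤ × ℤ → ℂ) : Prop where
  cone : ∀ n r, γ (n, r) ≠ 0 → 0 ≤ n ∧ r ^ 2 ≤ 4 * n * m
  summ : ∀ τ t : ℂ, 0 < τ.im → Summable fun x : ℤ × ℤ => γ x * ex (x.1 * τ + x.2 * t)
  law : ∀ τ t : ℂ, 0 < τ.im → ∑' x : ℤ × ℤ, γ x * ex (x.1 * (-1 / τ) + x.2 * (t / τ)) =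
    τ ^ κ * ex (m * t ^ 2 / τ) * ∑' x : ℤ × ℤ, γ x * ex (x.1 * τ + x.2 * t)
  shift : ∀ n r, γ (n + r + m, r + 2 * m) = γ (n, r)

/-- The moments of a family of coefficients. -/
def mom (γ : ℤ × ℤ → ℂ) (j : ℕ) (n : ℤ) : ℂ := ∑' r : ℤ, γ (n, r) * (r : ℂ) ^ j

namespace JF
variable {κ : ℤ} {m : ℕ} {γ : ℤ × ℤ → ℂ}

lemma summ_t (h : JF κ m γ) (hτ : 0 < τ.im) (t : ℂ) :
    Summable fun x : ℤ × ℤ => γ x * ex (x.1 * τ) * ex (x.2 * t) :=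
  (h.summ τ t hτ).congr fun x => by rw [ex_add, mul_assoc]

lemma summ_mom (h : JF κ m γ) (hτ : 0 < τ.im) (j : ℕ) :
    Summable fun x : ℤ × ℤ => γ x * ex (x.1 * τ) * (x.2 : ℂ) ^ j :=
  summable_mul_pow (h.summ_t hτ) j

lemma tsum_mom (h : JF κ m γ) (hτ : 0 < τ.im) (j : ℕ) :
    ∑' x : ℤ × ℤ, γ x * ex (x.1 * τ) * (x.2 : ℂ) ^ j = ∑' n : ℤ, mom γ j n * ex (n * τ) := by
  rw [(h.summ_mom hτ j).tsum_prod]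
  refine tsum_congr fun n => ?_
  rw [mom, ← tsum_mul_right]
  exact tsum_congr fun r => by ring

lemma mom_neg (h : JF κ m γ) (j : ℕ) {n : ℤ} (hn : n < 0) : mom γ j n = 0 := by
  rw [mom, ← tsum_zero (β := ℤ)]
  refine tsum_congr fun r => ?_
  by_cases hc : γ (n, r) = 0
  · rw [hc, zero_mul]
  · have := (h.cone n r hc).1; omega

lemma tsum_mom_nat (h : JF κ m γ) (j : ℕ) (τ : ℂ) :
    ∑' n : ℤ, mom γ j n * ex (n * τ) = ∑' n : ℕ, mom γ j n * ex (n * τ) := by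
  have := (Nat.cast_injective (R := ℤ)).tsum_eq (f := fun n : ℤ => mom γ j n * ex (n * τ)) (by
    intro n hn
    by_contra hc
    apply hn
    have : n < 0 := by
      by_contra h0
      exact hc ⟨n.toNat, by omega⟩
    simp [h.mom_neg j this])
  rw [← this]
  simp

lemma summable_mom_nat (h : JF κ m γ) (j : ℕ) (hτ : 0 < τ.im) :
    Summable fun n : ℕ => mom γ j n * ex (n * τ) := by
  have h1 := (h.summ_mom hτ j).prod
  have h2 : Summable fun n : ℤ => mom γ j n * ex (n * τ) := by
    refine h1.congr fun n => ?_
    rw [mom, ← tsum_mul_right]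
    exact tsum_congr fun r => by ring
  have := h2.comp_injective (Nat.cast_injective (R := ℤ))
  exact this.congr fun n => by simp

/-- The lowest Taylor coefficient is a modular form. -/
lemma mom_structure (h : JF κ m γ) (j : ℕ) (h0 : ∀ j' < j, ∀ n, mom γ j' n = 0) (N : ℕ)
    (hN : ∀ n : ℕ, n < N → mom γ j n = 0) :
    ∃ g ∈ Mspan (κ + j - 12 * N), PowerSeries.mk (fun n : ℕ => mom γ j n) = dl ^ N * g := by
  refine levelOne_structure (κ + j) _ N (fun τ hτ => h.summable_mom_nat j hτ) (fun τ hτ => ?_) hN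
  have hτ0 : τ ≠ 0 := by rintro rfl; simp at hτ
  have hτ' : 0 < (-1 / τ).im := by
    have := UpperHalfPlane.im_inv_neg_coe_pos ⟨τ, hτ⟩
    rwa [show (-1 / τ) = (-τ)⁻¹ by rw [neg_div, one_div, inv_neg]]
  rw [← h.tsum_mom_nat, ← h.tsum_mom_nat, ← h.tsum_mom hτ, ← h.tsum_mom hτ']
  have hz : ∀ {τ : ℂ}, 0 < τ.im → ∀ j' < j,
      ∑' x : ℤ × ℤ, γ x * ex (x.1 * τ) * (x.2 : ℂ) ^ j' = 0 := by
    intro τ hτ j' hj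
    rw [h.tsum_mom hτ]
    simp [h0 j' hj]
  have l1 := moment_limit (h.summ_t hτ) j (hz hτ)
  have l2 := moment_limit (h.summ_t hτ') j (hz hτ')
  have hdiv : Tendsto (fun t : ℂ => t / τ) (𝓝[≠] 0) (𝓝[≠] 0) := by
    refine tendsto_nhdsWithin_of_tendsto_nhds_of_eventually_within _ ?_ ?_
    · have : Tendsto (fun t : ℂ => t / τ) (𝓝 0) (𝓝 (0 / τ)) :=
        (continuous_id.div_const τ).tendsto _
      rw [zero_div] at this
      exact this.mono_left nhdsWithin_le_nhds
    · filter_upwards [self_mem_nhdsWithin] with t ht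
      exact div_ne_zero ht hτ0
  have l3 := l2.comp hdiv
  have lex : Tendsto (fun t : ℂ => τ ^ (κ + j) * ex (m * t ^ 2 / τ)) (𝓝[≠] 0) (𝓝 (τ ^ (κ + j))) := by
    have : Tendsto (fun t : ℂ => τ ^ (κ + j) * ex (m * t ^ 2 / τ)) (𝓝 0)
        (𝓝 (τ ^ (κ + j) * ex (m * 0 ^ 2 / τ))) :=
      (continuous_const.mul (continuous_ex.comp (by fun_prop))).tendsto _
    simp only [ne_eq, OfNat.ofNat_ne_zero, not_false_eq_true, zero_pow, mul_zero, zero_div,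
      ex_zero, mul_one] at this
    exact this.mono_left nhdsWithin_le_nhds
  have l4 := lex.mul l1
  have heq : (fun t : ℂ => τ ^ (κ + j) * ex (m * t ^ 2 / τ) *
      ((∑' x : ℤ × ℤ, γ x * ex (x.1 * τ) * ex (x.2 * t)) / t ^ j)) =ᶠ[𝓝[≠] 0]
      ((fun t : ℂ => (∑' x : ℤ × ℤ, γ x * ex (x.1 * (-1 / τ)) * ex (x.2 * t)) / t ^ j) ∘
        fun t => t / τ) := by
    filter_upwards [self_mem_nhdsWithin] with t ht
    have ht0 : t ≠ 0 := ht
    have hl := h.law τ t hτ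
    simp only [ex_add, ← mul_assoc] at hl
    simp only [Function.comp]
    rw [hl, zpow_add₀ hτ0, zpow_natCast, div_pow]
    field_simp
  have hu := tendsto_nhds_unique (l4.congr' heq) l3
  have hc : (2 * (π : ℂ) * I) ^ j / j.factorial ≠ 0 := by
    apply div_ne_zero
    · simp [Real.pi_ne_zero]
    · exact_mod_cast j.factorial_ne_zero
  have := mul_left_cancel₀ hc (b := ∑' x : ℤ × ℤ, γ x * ex (x.1 * (-1 / τ)) * (x.2 : ℂ) ^ j)
    (c := τ ^ (κ + j) * ∑' x : ℤ × ℤ, γ x * ex (x.1 * τ) * (x.2 : ℂ) ^ j) (by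
      rw [← hu]; ring)
  exact this

lemma eq_zero_of_mom (h : JF κ m γ) (h0 : ∀ j ≤ 2 * m, ∀ n, mom γ j n = 0) : γ = 0 := by
  have key : ∀ N : ℕ, ∀ n : ℤ, n < N → ∀ r, γ (n, r) = 0 := by
    intro N
    induction N with
    | zero =>
      intro n hn r
      by_contra hc
      have := (h.cone n r hc).1
      omega
    | succ N ih =>
      intro n hn r
      rcases lt_or_eq_of_le (show n ≤ N by push_cast at hn; omega) with hlt | heq
      · exact ih n hlt r
      have supp : ∀ r : ℤ, γ (n, r) ≠ 0 → -(m : ℤ) ≤ r ∧ r ≤ m := by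
        intro r hr
        constructor
        · by_contra hc
          rw [← h.shift] at hr
          exact hr (ih _ (by omega) _)
        · by_contra hc
          have hs := h.shift (n - r + m) (r - 2 * m)
          rw [show n - r + m + (r - 2 * m) + m = n by ring, show r - 2 * m + 2 * m = r by ring] at hs
          rw [hs] at hr
          exact hr (ih _ (by omega) _)
      have hv : ∀ i : Fin (2 * m + 1), γ (n, (i : ℤ) - m) = 0 := by
        have hinj : Injective fun i : Fin (2 * m + 1) => (((i : ℤ) - m : ℤ) : ℂ) := by
          intro i j hij
          have : ((i : ℤ) - m : ℤ) = (j : ℤ) - m := Int.cast_injective hij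
          exact Fin.ext (by omega)
        have := eq_zero_of_forall_pow_sum_mul_pow_eq_zero
          (v := fun i : Fin (2 * m + 1) => γ (n, (i : ℤ) - m)) hinj (fun j => by
            have hj := h0 j (by omega) n
            rw [mom] at hj
            refine Eq.trans ?_ hj
            have hinj' : Injective fun i : Fin (2 * m + 1) => ((i : ℤ) - m : ℤ) :=
              fun i j hij => hinj (by simpa using hij)
            rw [← hinj'.tsum_eq (f := fun r : ℤ => γ (n, r) * (r : ℂ) ^ (j : ℕ)), tsum_fintype]
            intro r hr
            obtain ⟨h1, h2⟩ := supp r (left_ne_zero_of_mul hr)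
            exact ⟨⟨(r + m).toNat, by omega⟩, by
              change (((r + m).toNat : ℕ) : ℤ) - m = r
              omega⟩)
        intro i
        exact congrFun this i
      by_contra hc
      obtain ⟨h1, h2⟩ := supp r hc
      have := hv ⟨(r + m).toNat, by omega⟩
      rw [show (((⟨(r + m).toNat, by omega⟩ : Fin (2 * m + 1)) : ℕ) : ℤ) - m = r by
        change (((r + m).toNat : ℕ) : ℤ) - m = r
        omega] at this
      exact hc this
  funext ⟨n, r⟩
  exact key (n.toNat + 1) n (by omega) r

end JF

lemma mom_odd {γ : ℤ × ℤ → ℂ} (h : ∀ n r, γ (n, -r) = γ (n, r)) {j : ℕ} (hj : Odd j) (n : ℤ) :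
    mom γ j n = 0 := by
  have h1 : mom γ j n = -mom γ j n := by
    conv_lhs => rw [mom, ← (Equiv.neg ℤ).tsum_eq]
    rw [mom, ← tsum_neg]
    refine tsum_congr fun r => ?_
    simp [h, hj.neg_pow]
  exact self_eq_neg.1 h1

/-- The partial inversion. -/
def Sz (z : Q) : Q :=
  (-1 / z.1, z.2.1 / z.1, z.2.2.1 / z.1, z.2.2.2 - (z.2.1 ^ 2 + 3 * z.2.2.1 ^ 2) / z.1)

/-- Coefficient families of Hermitian modular forms of weight `k` and sign `e`. -/
structure HF (k : ℤ) (e : ℂ) (a : X → ℂ) : Prop where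
  cone : CS a
  grow : Grow a
  S1 : ∀ z, Dom z → FF a (Sz z) = z.1 ^ k * FF a z
  swap : ∀ n r s m, a (m, r, s, n) = a (n, r, s, m)
  flip : ∀ n r s m, a (n, r, -r - s, m) = e * a (n, r, s, m)
  rot : ∀ n r s m, a (n, -s, r + s, m) = e * a (n, r, s, m)
  shift : ∀ n r s m, a (n + r + m, r + 2 * m, s - m, m) = a (n, r, s, m)

lemma im_neg_inv_pos (hτ : 0 < τ.im) : 0 < (-1 / τ).im := by
  have := UpperHalfPlane.im_inv_neg_coe_pos ⟨τ, hτ⟩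
  rwa [show (-1 / τ) = (-τ)⁻¹ by rw [neg_div, one_div, inv_neg]]

lemma Dom_Sz (hz : Dom z) : Dom (Sz z) := by
  obtain ⟨⟨x1, y1⟩, ⟨x2, y2⟩, ⟨x3, y3⟩, ⟨x4, y4⟩⟩ := z
  obtain ⟨h1, h2⟩ := hz
  simp only at h1 h2
  have hN : 0 < x1 ^ 2 + y1 ^ 2 := by positivity
  have hN' : x1 * x1 + y1 * y1 ≠ 0 := by nlinarith
  constructor
  · exact im_neg_inv_pos h1
  · simp only [Sz, div_im, normSq_apply, sub_im, add_im, add_re,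
      mul_re, mul_im, pow_two, re_ofNat, im_ofNat, neg_re,
      neg_im, one_re, one_im]
    rw [← sub_pos] at h2 ⊢
    have : 0 < (y1 * y4 - (y2 ^ 2 + 3 * y3 ^ 2)) / (x1 * x1 + y1 * y1) := by
      apply div_pos h2; nlinarith
    convert this using 1
    field_simp
    ring

lemma exists_Dom (hτ : 0 < τ.im) (t σ : ℂ) : ∃ τ2, Dom (τ, t, σ, τ2) := by
  refine ⟨((t.im ^ 2 + 3 * σ.im ^ 2 + 1) / τ.im : ℝ) * I, hτ, ?_⟩
  simp only [mul_im, ofReal_re, I_im, ofReal_im, I_re]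
  field_simp
  linarith

/-- The index type of Fourier–Jacobi coefficients: `((n, r), s)`. -/
abbrev W := (ℤ × ℤ) × ℤ

/-- The exponent of a Fourier–Jacobi term. -/
def linW (w : W) (τ t σ : ℂ) : ℂ := w.1.1 * τ + w.1.2 * t + (w.1.2 + 2 * w.2) * σ

/-- The Fourier–Jacobi coefficients. -/
def fj (a : X → ℂ) (m : ℤ) (w : W) : ℂ := a (w.1.1, w.1.2, w.2, m)

lemma injW (m : ℤ) : Injective fun w : W => ((w.1.1, w.1.2, w.2, m) : X) := by
  rintro ⟨⟨a, b⟩, c⟩ ⟨⟨a', b'⟩, c'⟩ h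
  simp only [Prod.mk.injEq] at h
  obtain ⟨rfl, rfl, rfl, -⟩ := h
  rfl

lemma lin_eq_linW (w : W) (m : ℤ) (τ t σ τ2 : ℂ) :
    lin (w.1.1, w.1.2, w.2, m) (τ, t, σ, τ2) = linW w τ t σ + m * τ2 := rfl

lemma summable_fj (hc : CS a) (hg : Grow a) (m : ℤ) (hτ : 0 < τ.im) (t σ : ℂ) :
    Summable fun w => fj a m w * ex (linW w τ t σ) := by
  obtain ⟨τ2, h⟩ := exists_Dom hτ t σ
  have h1 := ((summable_FF hc hg h).comp_injective (injW m)).mul_right (ex (-(m * τ2)))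
  refine h1.congr fun w => ?_
  simp only [Function.comp, lin_eq_linW, ex_add, fj]
  rw [ex_neg]
  field_simp [ex_ne_zero]

lemma tsum_ite_m (f : X → ℂ) (m : ℤ) :
    ∑' x : X, (if x.2.2.2 = m then f x else 0) = ∑' w : W, f (w.1.1, w.1.2, w.2, m) := by
  rw [← (injW m).tsum_eq]
  · simp
  · intro x hx
    have : x.2.2.2 = m := by by_contra hc; simp [hc] at hx
    exact ⟨((x.1, x.2.1), x.2.2.1), by simp [← this]⟩

/-- The transformation law of Fourier–Jacobi coefficients. -/
lemma fj_law (hc : CS a) (hg : Grow a)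
    (hS : ∀ z, Dom z → FF a (Sz z) = z.1 ^ k * FF a z) (m : ℤ) (hτ : 0 < τ.im) (t σ : ℂ) :
    ∑' w, fj a m w * ex (linW w (-1 / τ) (t / τ) (σ / τ)) =
      τ ^ k * ex (m * (t ^ 2 + 3 * σ ^ 2) / τ) * ∑' w, fj a m w * ex (linW w τ t σ) := by
  obtain ⟨τ2, hz⟩ := exists_Dom hτ t σ
  have s1 := summable_FF hc hg hz
  have s2 := summable_FF hc hg (Dom_Sz hz)
  have key := fourier_unique (s2.sub (s1.mul_left (τ ^ k))) (fun x => x.2.2.2) (fun u => by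
    have hz' := hz.add_real 0 0 0 u
    have hu := hS _ hz'
    have s1' := summable_FF hc hg hz'
    have s2' := summable_FF hc hg (Dom_Sz hz')
    have h0 := (s2'.hasSum.sub (s1'.hasSum.mul_left (τ ^ k))).tsum_eq
    refine Eq.trans (tsum_congr fun x => ?_) (h0.trans (sub_eq_zero.2 ?_))
    · have e1 : lin x (τ + (0 : ℝ), t + (0 : ℝ), σ + (0 : ℝ), τ2 + u) =
          lin x (τ, t, σ, τ2) + x.2.2.2 * u := by simp [lin]; ring
      have e2 : lin x (Sz (τ + (0 : ℝ), t + (0 : ℝ), σ + (0 : ℝ), τ2 + u)) =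
          lin x (Sz (τ, t, σ, τ2)) + x.2.2.2 * u := by simp [lin, Sz]; ring
      rw [e1, e2, ex_add, ex_add]
      ring
    · refine Eq.trans hu ?_
      simp [FF]) m
  rw [tsum_ite_m] at key
  have f1 := summable_fj hc hg m hτ t σ
  have f2 := summable_fj hc hg m (im_neg_inv_pos hτ) (t / τ) (σ / τ)
  have e3 : ex (m * (τ2 - (t ^ 2 + 3 * σ ^ 2) / τ)) * ex (m * (t ^ 2 + 3 * σ ^ 2) / τ) = ex (m * τ2) := by
    rw [← ex_add]; congr 1; ring
  have h5 := ((f2.hasSum.mul_right (ex (m * (τ2 - (t ^ 2 + 3 * σ ^ 2) / τ)))).sub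
    ((f1.hasSum.mul_right (ex (m * τ2))).mul_left (τ ^ k))).tsum_eq
  have h6 : ∑' w, fj a m w * ex (linW w (-1 / τ) (t / τ) (σ / τ)) *
      ex (m * (τ2 - (t ^ 2 + 3 * σ ^ 2) / τ)) =
      τ ^ k * ((∑' w, fj a m w * ex (linW w τ t σ)) * ex (m * τ2)) := by
    rw [tsum_mul_right]
    refine sub_eq_zero.1 (h5.symm.trans (Eq.trans (tsum_congr fun w => ?_) key))
    simp only [Sz, lin_eq_linW, ex_add, fj]
    ring
  rw [tsum_mul_right, ← e3] at h6
  apply mul_right_cancel₀ (ex_ne_zero (m * (τ2 - (t ^ 2 + 3 * σ ^ 2) / τ)))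
  rw [h6]; ring

/-- The `y`-moments of the Fourier–Jacobi coefficients. -/
def gam (a : X → ℂ) (m : ℤ) (i : ℕ) (x : ℤ × ℤ) : ℂ :=
  ∑' s : ℤ, a (x.1, x.2, s, m) * ((x.2 + 2 * s : ℤ) : ℂ) ^ i

lemma fj_term (a : X → ℂ) (m : ℤ) (w : W) (τ t σ : ℂ) : fj a m w * ex (linW w τ t σ) =
    fj a m w * ex (w.1.1 * τ + w.1.2 * t) * ex (((w.1.2 + 2 * w.2 : ℤ) : ℂ) * σ) := by
  rw [mul_assoc, ← ex_add, linW]; push_cast; rfl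

lemma summable_fj_mom (hc : CS a) (hg : Grow a) (m : ℤ) (hτ : 0 < τ.im)
    (t : ℂ) (i : ℕ) :
    Summable fun w : W => fj a m w * ex (w.1.1 * τ + w.1.2 * t) * ((w.1.2 + 2 * w.2 : ℤ) : ℂ) ^ i :=
  summable_mul_pow (fun σ => (summable_fj hc hg m hτ t σ).congr fun w => fj_term ..) i

lemma tsum_fj_mom (hc : CS a) (hg : Grow a) (m : ℤ) (hτ : 0 < τ.im)
    (t : ℂ) (i : ℕ) :
    ∑' w : W, fj a m w * ex (w.1.1 * τ + w.1.2 * t) * ((w.1.2 + 2 * w.2 : ℤ) : ℂ) ^ i =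
      ∑' x : ℤ × ℤ, gam a m i x * ex (x.1 * τ + x.2 * t) := by
  rw [(summable_fj_mom hc hg m hτ t i).tsum_prod]
  refine tsum_congr fun x => ?_
  rw [gam, ← tsum_mul_right]
  exact tsum_congr fun s => by rw [fj]; ring

lemma fj_limit (hc : CS a) (hg : Grow a) (m : ℤ) (i : ℕ)
    (h0 : ∀ i' < i, gam a m i' = 0) (hτ : 0 < τ.im) (t : ℂ) :
    Tendsto (fun σ : ℂ => (∑' w, fj a m w * ex (linW w τ t σ)) / σ ^ i) (𝓝[≠] 0)
      (𝓝 ((2 * π * I) ^ i / i.factorial *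
        ∑' x : ℤ × ℤ, gam a m i x * ex (x.1 * τ + x.2 * t))) := by
  have := moment_limit (c := fun w : W => fj a m w * ex (w.1.1 * τ + w.1.2 * t))
    (y := fun w => w.1.2 + 2 * w.2) (fun σ => (summable_fj hc hg m hτ t σ).congr fun w => fj_term ..) i (fun i' hi => by
        rw [tsum_fj_mom hc hg m hτ, h0 i' hi]; simp)
  rw [tsum_fj_mom hc hg m hτ] at this
  refine this.congr fun σ => ?_
  congr 1
  exact tsum_congr fun w => (fj_term ..).symm

lemma tendsto_div_punctured (hτ0 : τ ≠ 0) :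
    Tendsto (fun t : ℂ => t / τ) (𝓝[≠] 0) (𝓝[≠] 0) := by
  refine tendsto_nhdsWithin_of_tendsto_nhds_of_eventually_within _ ?_ ?_
  · have : Tendsto (fun t : ℂ => t / τ) (𝓝 0) (𝓝 (0 / τ)) :=
      (continuous_id.div_const τ).tendsto _
    rw [zero_div] at this
    exact this.mono_left nhdsWithin_le_nhds
  · filter_upwards [self_mem_nhdsWithin] with t ht
    exact div_ne_zero ht hτ0

/-- The lowest `y`-moment of a Fourier–Jacobi coefficient is a Jacobi form. -/
lemma HF.jf (h : HF k e a) (m i : ℕ)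
    (h0 : ∀ i' < i, gam a m i' = 0) : JF (k + i) m (gam a m i) where
  cone n r hne := by
    have : ∃ s, a (n, r, s, m) ≠ 0 := by
      by_contra hc
      push Not at hc
      apply hne
      simp [gam, hc]
    obtain ⟨s, hs⟩ := this
    have hx : Cone (n, r, s, m) := by
      by_contra hc
      exact hs (h.cone _ hc)
    obtain ⟨h1, h2, h3⟩ := hx
    simp only at h1 h2 h3
    exact ⟨h1, by nlinarith [sq_nonneg (r + 2 * s)]⟩
  summ τ t hτ := by
    refine (summable_fj_mom h.cone h.grow m hτ t i).prod.congr fun x => ?_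
    rw [gam, ← tsum_mul_right]
    exact tsum_congr fun s => by rw [fj]; ring
  law τ t hτ := by
    have hτ0 : τ ≠ 0 := by rintro rfl; simp at hτ
    have l1 := fj_limit h.cone h.grow m i h0 hτ t
    have l2 := (fj_limit h.cone h.grow m i h0 (im_neg_inv_pos hτ) (t / τ)).comp
      (tendsto_div_punctured hτ0)
    have lex : Tendsto (fun σ : ℂ => τ ^ (k + i) * ex (m * (t ^ 2 + 3 * σ ^ 2) / τ)) (𝓝[≠] 0)
        (𝓝 (τ ^ (k + i) * ex (m * t ^ 2 / τ))) := by
      have : Tendsto (fun σ : ℂ => τ ^ (k + i) * ex (m * (t ^ 2 + 3 * σ ^ 2) / τ)) (𝓝 0)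
          (𝓝 (τ ^ (k + i) * ex (m * (t ^ 2 + 3 * 0 ^ 2) / τ))) :=
        (continuous_const.mul (continuous_ex.comp (by fun_prop))).tendsto _
      simp only [ne_eq, OfNat.ofNat_ne_zero, not_false_eq_true, zero_pow, mul_zero, add_zero] at this
      exact this.mono_left nhdsWithin_le_nhds
    have heq : (fun σ : ℂ => τ ^ (k + i) * ex (m * (t ^ 2 + 3 * σ ^ 2) / τ) *
        ((∑' w, fj a m w * ex (linW w τ t σ)) / σ ^ i)) =ᶠ[𝓝[≠] 0]
        ((fun σ : ℂ => (∑' w, fj a m w * ex (linW w (-1 / τ) (t / τ) σ)) / σ ^ i) ∘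
          fun σ => σ / τ) := by
      filter_upwards [self_mem_nhdsWithin] with σ hσ
      have hσ0 : σ ≠ 0 := hσ
      have hl := fj_law h.cone h.grow h.S1 m hτ t σ
      simp only [Function.comp]
      rw [hl, zpow_add₀ hτ0, zpow_natCast, div_pow]
      push_cast
      field_simp
    have hu := tendsto_nhds_unique ((lex.mul l1).congr' heq) l2
    have hc : (2 * (π : ℂ) * I) ^ i / i.factorial ≠ 0 := by
      apply div_ne_zero
      · simp [Real.pi_ne_zero]
      · exact_mod_cast i.factorial_ne_zero
    apply mul_left_cancel₀ hc
    rw [← hu]; ring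
  shift n r := by
    simp only [gam]
    rw [← (Equiv.subRight (m : ℤ)).tsum_eq]
    refine tsum_congr fun s => ?_
    simp only [Equiv.subRight_apply]
    rw [h.shift]
    congr 3
    ring

/-- Convolution of coefficient families. -/
def conv (a b : X → ℂ) (x : X) : ℂ := ∑' y, a y * b (x - y)

lemma lin_add (x y : X) (z : Q) : lin (x + y) z = lin x z + lin y z := by
  simp [lin]; ring

lemma Cone.add {x y : X} (hx : Cone x) (hy : Cone y) : Cone (x + y) := by
  obtain ⟨n, r, s, m⟩ := x
  obtain ⟨n', r', s', m'⟩ := y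
  obtain ⟨h1, h2, h3⟩ := hx
  obtain ⟨h1', h2', h3'⟩ := hy
  simp only at h1 h2 h3 h1' h2' h3'
  refine ⟨by simp; omega, by simp; omega, ?_⟩
  simp only [Prod.mk_add_mk]
  have hB : (2 * r * r' + r * s' + r' * s + 2 * s * s') ^ 2 ≤ (3 * (n * m' + n' * m)) ^ 2 := by
    have e1 : (2 * r * r' + r * s' + r' * s + 2 * s * s') ^ 2 ≤
        4 * ((r ^ 2 + r * s + s ^ 2) * (r' ^ 2 + r' * s' + s' ^ 2)) := by
      nlinarith [sq_nonneg (r * s' - r' * s)]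
    have e2 : (r ^ 2 + r * s + s ^ 2) * (r' ^ 2 + r' * s' + s' ^ 2) ≤ (3 * n * m) * (3 * n' * m') :=
      mul_le_mul h3 h3' (by nlinarith [sq_nonneg (r' + s'), sq_nonneg r', sq_nonneg s'])
        (by positivity)
    nlinarith [sq_nonneg (n * m' - n' * m)]
  have := abs_le_of_sq_le_sq hB (by positivity)
  have := (abs_le.1 this).2
  nlinarith

lemma Dom_diag {v : ℝ} (hv : 0 < v) : Dom (v * I, 0, 0, v * I) := by
  simp [Dom, hv]

lemma grow_of_summable
    (h : ∀ v : ℝ, 0 < v → Summable fun x => a x * ex (lin x (v * I, 0, 0, v * I))) :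
    Grow a := by
  intro δ hδ
  have hpi := Real.pi_pos
  have hs := (h (δ / (2 * π)) (by positivity)).norm
  refine ⟨∑' x, ‖a x * ex (lin x ((δ / (2 * π) : ℝ) * I, 0, 0,
    (δ / (2 * π) : ℝ) * I))‖, fun x => ?_⟩
  have h1 := hs.le_tsum x (fun _ _ => norm_nonneg _)
  rw [norm_mul, norm_ex] at h1
  have h2 : -2 * π * (lin x ((δ / (2 * π) : ℝ) * I, 0, 0,
      (δ / (2 * π) : ℝ) * I)).im = -(δ * (x.1 + x.2.2.2)) := by
    rw [lin_im]
    simp only [im_ofReal_mul, I_im, zero_im]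
    field_simp
    ring
  rw [h2] at h1
  have h3 : δ * ((x.1 : ℝ) + x.2.2.2) ≤ δ * sz x := by
    gcongr
    unfold sz
    linarith [le_abs_self (x.1 : ℝ), le_abs_self (x.2.2.2 : ℝ), abs_nonneg (x.2.1 : ℝ),
      abs_nonneg (x.2.2.1 : ℝ)]
  calc ‖a x‖ = ‖a x‖ * Real.exp (-(δ * (x.1 + x.2.2.2))) * Real.exp (δ * (x.1 + x.2.2.2)) := by
        rw [mul_assoc, ← Real.exp_add]; simp
    _ ≤ _ := by
        refine mul_le_mul h1 (Real.exp_le_exp.2 h3) (Real.exp_pos _).le ?_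
        exact tsum_nonneg fun _ => norm_nonneg _

/-- The shear of pairs underlying convolution. -/
def shear : X × X ≃ X × X where
  toFun p := (p.2, p.1 - p.2)
  invFun p := (p.1 + p.2, p.1)
  left_inv p := by simp
  right_inv p := by simp

lemma summable_shear (hsa : Summable fun x => a x * ex (lin x z))
    (hsb : Summable fun x => b x * ex (lin x z)) :
    Summable fun p : X × X => a p.2 * b (p.1 - p.2) * ex (lin p.1 z) := by
  have h := (summable_mul_of_summable_norm hsa.norm hsb.norm)
  refine (shear.summable_iff.2 h).congr fun p => ?_
  simp only [Function.comp, shear, Equiv.coe_fn_mk]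
  have : lin p.1 z = lin p.2 z + lin (p.1 - p.2) z := by rw [← lin_add]; congr 1; abel
  rw [this, ex_add]; ring

lemma summable_conv_term (hsa : Summable fun x => a x * ex (lin x z))
    (hsb : Summable fun x => b x * ex (lin x z)) :
    Summable fun x => conv a b x * ex (lin x z) := by
  refine (summable_shear hsa hsb).prod.congr fun x => ?_
  rw [conv, ← tsum_mul_right]

lemma FF_conv (hsa : Summable fun x => a x * ex (lin x z))
    (hsb : Summable fun x => b x * ex (lin x z)) : FF (conv a b) z = FF a z * FF b z := by
  simp only [FF]
  rw [tsum_mul_tsum_of_summable_norm hsa.norm hsb.norm, ← shear.tsum_eq]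
  refine Eq.trans ?_ ((summable_shear hsa hsb).tsum_prod.symm.trans (tsum_congr fun p => ?_))
  · exact tsum_congr fun x => by rw [conv, ← tsum_mul_right]
  · simp only [shear, Equiv.coe_fn_mk]
    have : lin p.1 z = lin p.2 z + lin (p.1 - p.2) z := by rw [← lin_add]; congr 1; abel
    rw [this, ex_add]; ring

lemma CS.conv (ha : CS a) (hb : CS b) : CS (conv a b) := by
  intro x hx
  rw [KN.conv, ← tsum_zero (β := X)]
  refine tsum_congr fun y => ?_
  by_cases h1 : Cone y
  · by_cases h2 : Cone (x - y)
    · exact absurd (by simpa using h1.add h2) hx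
    · rw [hb _ h2, mul_zero]
  · rw [ha _ h1, zero_mul]

lemma conv_equiv (g : X ≃+ X) {e e' : ℂ} (ha : ∀ x, a (g x) = e * a x)
    (hb : ∀ x, b (g x) = e' * b x) (x : X) : conv a b (g x) = e * e' * conv a b x := by
  rw [conv, conv, ← g.toEquiv.tsum_eq, ← tsum_mul_left]
  refine tsum_congr fun y => ?_
  change a (g y) * b (g x - g y) = _
  rw [← map_sub, ha, hb]
  ring

/-- Exchange of the diagonal entries. -/
def gswap : X ≃+ X where
  toFun x := (x.2.2.2, x.2.1, x.2.2.1, x.1)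
  invFun x := (x.2.2.2, x.2.1, x.2.2.1, x.1)
  left_inv _ := rfl
  right_inv _ := rfl
  map_add' _ _ := rfl

/-- Complex conjugation. -/
def gflip : X ≃+ X where
  toFun x := (x.1, x.2.1, -x.2.1 - x.2.2.1, x.2.2.2)
  invFun x := (x.1, x.2.1, -x.2.1 - x.2.2.1, x.2.2.2)
  left_inv x := by simp
  right_inv x := by simp
  map_add' x y := by ext <;> simp; ring

/-- Multiplication of the off-diagonal entry by a unit of order six. -/
def grot : X ≃+ X where
  toFun x := (x.1, -x.2.2.1, x.2.1 + x.2.2.1, x.2.2.2)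
  invFun x := (x.1, x.2.1 + x.2.2.1, -x.2.1, x.2.2.2)
  left_inv x := by simp
  right_inv x := by simp
  map_add' x y := by ext <;> simp <;> ring

/-- The unipotent substitution. -/
def gshift : X ≃+ X where
  toFun x := (x.1 + x.2.1 + x.2.2.2, x.2.1 + 2 * x.2.2.2, x.2.2.1 - x.2.2.2, x.2.2.2)
  invFun x := (x.1 - x.2.1 + x.2.2.2, x.2.1 - 2 * x.2.2.2, x.2.2.1 + x.2.2.2, x.2.2.2)
  left_inv x := by ext <;> simp; ring
  right_inv x := by ext <;> simp; ring
  map_add' x y := by ext <;> simp <;> ring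

lemma HF.summ (h : HF k e a) (hz : Dom z) :
    Summable fun x => a x * ex (lin x z) := summable_FF h.cone h.grow hz

lemma HF.conv {k k' : ℤ} {e e' : ℂ} (ha : HF k e a) (hb : HF k' e' b) :
    HF (k + k') (e * e') (conv a b) where
  cone := ha.cone.conv hb.cone
  grow := grow_of_summable fun v hv =>
    summable_conv_term (ha.summ (Dom_diag hv)) (hb.summ (Dom_diag hv))
  S1 z hz := by
    have h0 : z.1 ≠ 0 := by
      intro h; have := hz.1; rw [h] at this; simp at this
    rw [FF_conv (ha.summ (Dom_Sz hz)) (hb.summ (Dom_Sz hz)), FF_conv (ha.summ hz) (hb.summ hz),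
      ha.S1 z hz, hb.S1 z hz, zpow_add₀ h0]
    ring
  swap n r s m := by
    have := conv_equiv gswap (e := 1) (e' := 1) (a := a) (b := b)
      (fun x => (ha.swap x.1 x.2.1 x.2.2.1 x.2.2.2).trans (one_mul _).symm)
      (fun x => (hb.swap x.1 x.2.1 x.2.2.1 x.2.2.2).trans (one_mul _).symm) (n, r, s, m)
    rwa [one_mul, one_mul] at this
  flip n r s m := conv_equiv gflip (fun x => ha.flip x.1 x.2.1 x.2.2.1 x.2.2.2)
      (fun x => hb.flip x.1 x.2.1 x.2.2.1 x.2.2.2) (n, r, s, m)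
  rot n r s m := conv_equiv grot (fun x => ha.rot x.1 x.2.1 x.2.2.1 x.2.2.2)
      (fun x => hb.rot x.1 x.2.1 x.2.2.1 x.2.2.2) (n, r, s, m)
  shift n r s m := by
    have := conv_equiv gshift (e := 1) (e' := 1) (a := a) (b := b)
      (fun x => (ha.shift x.1 x.2.1 x.2.2.1 x.2.2.2).trans (one_mul _).symm)
      (fun x => (hb.shift x.1 x.2.1 x.2.2.1 x.2.2.2).trans (one_mul _).symm) (n, r, s, m)
    rwa [one_mul, one_mul] at this

/-- The coefficients of the constant function. -/
def cone1 (x : X) : ℂ := if x = 0 then 1 else 0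

lemma FF_cone1 (z : Q) : FF cone1 z = 1 := by
  rw [FF, tsum_eq_single 0]
  · simp [cone1, lin, ex_zero]
  · intro x hx; simp [cone1, hx]

lemma HF.one : HF 0 1 cone1 where
  cone x hx := by
    have : x ≠ 0 := by rintro rfl; exact hx ⟨le_rfl, le_rfl, le_rfl⟩
    simp [cone1, this]
  grow := grow_of_summable fun v hv => by
    refine summable_of_ne_finset_zero (s := {0}) fun x hx => ?_
    have : x ≠ 0 := by simpa using hx
    simp [cone1, this]
  S1 z hz := by simp [FF_cone1]
  swap n r s m := by simp only [cone1, Prod.ext_iff]; congr 1; simp; tauto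
  flip n r s m := by simp only [cone1, Prod.ext_iff]; rw [one_mul]; congr 1; simp; omega
  rot n r s m := by simp only [cone1, Prod.ext_iff]; rw [one_mul]; congr 1; simp; omega
  shift n r s m := by simp only [cone1, Prod.ext_iff]; congr 1; simp; omega

lemma FF_add (hsa : Summable fun x => a x * ex (lin x z))
    (hsb : Summable fun x => b x * ex (lin x z)) : FF (a + b) z = FF a z + FF b z := by
  simp only [FF, Pi.add_apply, add_mul]
  exact hsa.tsum_add hsb

lemma FF_smul (c : ℂ) (a : X → ℂ) (z : Q) : FF (c • a) z = c * FF a z := by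
  simp only [FF, Pi.smul_apply, smul_eq_mul, mul_assoc, tsum_mul_left]

lemma HF.add (ha : HF k e a) (hb : HF k e b) : HF k e (a + b) where
  cone x hx := by simp [ha.cone x hx, hb.cone x hx]
  grow := grow_of_summable fun v hv =>
    ((ha.summ (Dom_diag hv)).add (hb.summ (Dom_diag hv))).congr fun x => by simp [add_mul]
  S1 z hz := by
    rw [FF_add (ha.summ (Dom_Sz hz)) (hb.summ (Dom_Sz hz)), FF_add (ha.summ hz) (hb.summ hz),
      ha.S1 z hz, hb.S1 z hz, mul_add]
  swap n r s m := by simp [ha.swap n r s m, hb.swap n r s m]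
  flip n r s m := by simp [ha.flip n r s m, hb.flip n r s m, mul_add]
  rot n r s m := by simp [ha.rot n r s m, hb.rot n r s m, mul_add]
  shift n r s m := by simp [ha.shift n r s m, hb.shift n r s m]

lemma HF.smul (c : ℂ) (ha : HF k e a) : HF k e (c • a) where
  cone x hx := by simp [ha.cone x hx]
  grow := grow_of_summable fun v hv =>
    ((ha.summ (Dom_diag hv)).mul_left c).congr fun x => by simp [mul_assoc]
  S1 z hz := by rw [FF_smul, FF_smul, ha.S1 z hz]; ring
  swap n r s m := by simp [ha.swap n r s m]
  flip n r s m := by simp [ha.flip n r s m]; ring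
  rot n r s m := by simp [ha.rot n r s m]; ring
  shift n r s m := by simp [ha.shift n r s m]

/-- The space of coefficient families of weight `k` and sign `e`. -/
def HFsub (k : ℤ) (e : ℂ) : Submodule ℂ (X → ℂ) where
  carrier := {a | HF k e a}
  add_mem' ha hb := HF.add ha hb
  zero_mem' := by
    have h : HF k e 0 :=
      { cone := fun x _ => rfl
        grow := fun δ _ => ⟨0, fun x => by simp⟩
        S1 := fun z _ => by simp [FF]
        swap := by simp
        flip := by simp
        rot := by simp
        shift := by simp }
    exact h
  smul_mem' c _ ha := HF.smul c ha

/-- Convolution powers. -/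
def cpow (a : X → ℂ) : ℕ → X → ℂ
  | 0 => cone1
  | n + 1 => conv a (cpow a n)

lemma HF.cpow (h : HF k 1 a) (n : ℕ) : HF (n * k) 1 (cpow a n) := by
  induction n with
  | zero => simpa [KN.cpow] using HF.one
  | succ n ih =>
    have := h.conv ih
    rw [one_mul] at this
    rwa [show k + n * k = ((n + 1 : ℕ) : ℤ) * k by push_cast; ring] at this

lemma HF.FF_cpow (h : HF k 1 a) (n : ℕ) (hz : Dom z) :
    FF (KN.cpow a n) z = FF a z ^ n := by
  induction n with
  | zero => simp [KN.cpow, FF_cone1]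
  | succ n ih => rw [KN.cpow, FF_conv (h.summ hz) ((h.cpow n).summ hz), ih, pow_succ']

lemma fourier_unique_pair {γ : ℤ × ℤ → ℂ}
    (hs : ∀ τ t : ℂ, 0 < τ.im → Summable fun x : ℤ × ℤ => γ x * ex (x.1 * τ + x.2 * t))
    (h : ∀ τ t : ℂ, 0 < τ.im → ∑' x : ℤ × ℤ, γ x * ex (x.1 * τ + x.2 * t) = 0) : γ = 0 := by
  funext ⟨n, r⟩
  have hI : 0 < I.im := by simp
  have s1 : ∀ v : ℝ, ∑' x : ℤ × ℤ, (if x.1 = n then γ x * ex (x.1 * I) else 0) * ex (x.2 * v) = 0 := by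
    intro v
    have := fourier_unique (hs I v hI) (fun x => x.1) (fun u => by
      refine Eq.trans (tsum_congr fun x => ?_) (h (I + u) v (by simp))
      rw [mul_assoc, ← ex_add]; congr 2; ring) n
    refine Eq.trans (tsum_congr fun x => ?_) this
    split_ifs
    · rw [mul_assoc, ← ex_add]
    · simp
  have hsum : Summable fun x : ℤ × ℤ => if x.1 = n then γ x * ex (x.1 * I) else 0 := by
    have h0 : Summable fun x : ℤ × ℤ => γ x * ex (x.1 * I) :=
      (hs I 0 hI).congr fun x => by simp
    exact (h0.indicator {x | x.1 = n}).congr fun x => by simp [Set.indicator]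
  have s2 := fourier_unique hsum (fun x => x.2) s1 r
  rw [tsum_eq_single (n, r)] at s2
  · have := mul_eq_zero.1 (by simpa using s2 : γ (n, r) * ex (n * I) = 0)
    exact this.resolve_right (ex_ne_zero _)
  · rintro ⟨n', r'⟩ hne
    split_ifs with h1 h2
    · simp only at h1 h2; subst h1 h2; exact absurd rfl hne
    · rfl
    · rfl

lemma fourier_unique_nat {c : ℕ → ℂ} (hs : ∀ τ : ℂ, 0 < τ.im → Summable fun n : ℕ => c n * ex (n * τ))
    (h : ∀ τ : ℂ, 0 < τ.im → ∑' n : ℕ, c n * ex (n * τ) = 0) : c = 0 := by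
  funext n
  have := fourier_unique (hs I (by simp)) (fun x => (x : ℤ)) (fun u => by
    refine Eq.trans (tsum_congr fun x => ?_) (h (I + u) (by simp))
    rw [mul_assoc, ← ex_add]; congr 2; push_cast; ring) n
  rw [tsum_eq_single n] at this
  · exact (mul_eq_zero.1 (by simpa using this : c n * ex (n * I) = 0)).resolve_right
      (ex_ne_zero _)
  · intro n' hne
    rw [if_neg (by exact_mod_cast hne)]

/-- Convergence of a power series on the disc, in the variable `τ`. -/
def Cv (P : PowerSeries ℂ) : Prop :=
  ∀ τ : ℂ, 0 < τ.im → Summable fun n : ℕ => PowerSeries.coeff n P * ex (n * τ)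

/-- Evaluation of a power series at `q = e(τ)`. -/
def ev (P : PowerSeries ℂ) (τ : ℂ) : ℂ := ∑' n : ℕ, PowerSeries.coeff n P * ex (n * τ)

lemma Cv.mul_aux {P R : PowerSeries ℂ} (n : ℕ) (τ : ℂ) : PowerSeries.coeff n (P * R) * ex (n * τ) =
    ∑ kl ∈ Finset.HasAntidiagonal.antidiagonal n, (PowerSeries.coeff kl.1 P * ex (kl.1 * τ)) *
      (PowerSeries.coeff kl.2 R * ex (kl.2 * τ)) := by
  rw [PowerSeries.coeff_mul, sum_mul]
  refine sum_congr rfl fun kl hkl => ?_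
  rw [← Finset.HasAntidiagonal.mem_antidiagonal.1 hkl]
  push_cast
  rw [add_mul, ex_add]; ring

lemma Cv.mul {P R : PowerSeries ℂ} (hP : Cv P) (hR : Cv R) : Cv (P * R) := by
  intro τ hτ
  simp_rw [Cv.mul_aux]
  exact (summable_norm_sum_mul_antidiagonal_of_summable_norm (hP τ hτ).norm (hR τ hτ).norm).of_norm

lemma ev_mul {P R : PowerSeries ℂ} (hP : Cv P) (hR : Cv R) (hτ : 0 < τ.im) :
    ev (P * R) τ = ev P τ * ev R τ := by
  rw [ev, ev, ev, tsum_mul_tsum_eq_tsum_sum_antidiagonal_of_summable_norm (hP τ hτ).norm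
    (hR τ hτ).norm]
  exact tsum_congr fun n => Cv.mul_aux n τ

lemma Cv.add {P R : PowerSeries ℂ} (hP : Cv P) (hR : Cv R) : Cv (P + R) := fun τ hτ =>
  ((hP τ hτ).add (hR τ hτ)).congr fun n => by simp [add_mul]

lemma ev_add {P R : PowerSeries ℂ} (hP : Cv P) (hR : Cv R) (hτ : 0 < τ.im) :
    ev (P + R) τ = ev P τ + ev R τ := by
  rw [ev, ev, ev, ← (hP τ hτ).tsum_add (hR τ hτ)]
  exact tsum_congr fun n => by simp [add_mul]

lemma Cv.smul {P : PowerSeries ℂ} (c : ℂ) (hP : Cv P) : Cv (c • P) := fun τ hτ =>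
  ((hP τ hτ).mul_left c).congr fun n => by simp [mul_assoc]

lemma ev_smul (c : ℂ) (P : PowerSeries ℂ) (τ : ℂ) : ev (c • P) τ = c * ev P τ := by
  rw [ev, ev, ← tsum_mul_left]
  exact tsum_congr fun n => by simp [mul_assoc]

lemma Cv.one : Cv 1 := fun τ _ => by
  refine summable_of_ne_finset_zero (s := {0}) fun n hn => ?_
  rw [PowerSeries.coeff_one, if_neg (by simpa using hn), zero_mul]

lemma ev_one (τ : ℂ) : ev 1 τ = 1 := by
  rw [ev, tsum_eq_single 0]
  · simp [ex_zero]
  · intro n hn; rw [PowerSeries.coeff_one, if_neg hn, zero_mul]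

lemma ev_injective {P : PowerSeries ℂ} (hP : Cv P) (h : ∀ τ : ℂ, 0 < τ.im → ev P τ = 0) : P = 0 := by
  have := fourier_unique_nat (c := fun n => PowerSeries.coeff n P) hP h
  ext n
  simpa using congrFun this n

/-- Iterated leading coefficients: order `m` in `e(τ₂)`, then `i` in `σ`, then `j` in `t`. -/
def LeadP (F : Q → ℂ) (m i j : ℕ) (P : PowerSeries ℂ) : Prop :=
  Cv P ∧ ∃ (φ : ℂ → ℂ → ℂ → ℂ) (ψ : ℂ → ℂ → ℂ),
    (∀ τ t σ : ℂ, 0 < τ.im → Tendsto (fun V : ℝ => F (τ, t, σ, V * I) *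
      ex (-(m * (V * I)))) atTop (𝓝 (φ τ t σ))) ∧
    (∀ τ t : ℂ, 0 < τ.im → Tendsto (fun σ => φ τ t σ / σ ^ i) (𝓝[≠] 0) (𝓝 (ψ τ t))) ∧
    (∀ τ : ℂ, 0 < τ.im → Tendsto (fun t => ψ τ t / t ^ j) (𝓝[≠] 0) (𝓝 (ev P τ)))

lemma eventually_Dom (hτ : 0 < τ.im) (t σ : ℂ) :
    ∀ᶠ V : ℝ in atTop, Dom (τ, t, σ, V * I) := by
  filter_upwards [eventually_gt_atTop ((t.im ^ 2 + 3 * σ.im ^ 2) / τ.im)] with V hV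
  refine ⟨hτ, ?_⟩
  rw [div_lt_iff₀ hτ] at hV
  simp
  linarith

lemma LeadP.congr {F G : Q → ℂ} {m i j : ℕ} {P : PowerSeries ℂ} (h : LeadP F m i j P)
    (hFG : ∀ z, Dom z → F z = G z) : LeadP G m i j P := by
  obtain ⟨hP, φ, ψ, h1, h2, h3⟩ := h
  refine ⟨hP, φ, ψ, fun τ t σ hτ => (h1 τ t σ hτ).congr' ?_, h2, h3⟩
  filter_upwards [eventually_Dom hτ t σ] with V hV
  rw [hFG _ hV]

lemma LeadP.mul {F G : Q → ℂ} {m i j m' i' j' : ℕ} {P R : PowerSeries ℂ} (h : LeadP F m i j P)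
    (h' : LeadP G m' i' j' R) : LeadP (fun z => F z * G z) (m + m') (i + i') (j + j') (P * R) := by
  obtain ⟨hP, φ, ψ, h1, h2, h3⟩ := h
  obtain ⟨hP', φ', ψ', h1', h2', h3'⟩ := h'
  refine ⟨hP.mul hP', fun τ t σ => φ τ t σ * φ' τ t σ, fun τ t => ψ τ t * ψ' τ t,
    fun τ t σ hτ => ((h1 τ t σ hτ).mul (h1' τ t σ hτ)).congr fun V => ?_,
    fun τ t hτ => ((h2 τ t hτ).mul (h2' τ t hτ)).congr fun σ => ?_, fun τ hτ => ?_⟩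
  · have : (-(((m + m' : ℕ) : ℂ) * (V * I))) = -(m * (V * I)) + -(m' * (V * I)) := by
      push_cast; ring
    rw [this, ex_add]; ring
  · rw [pow_add, div_mul_div_comm]
  · rw [ev_mul hP hP' hτ]
    refine ((h3 τ hτ).mul (h3' τ hτ)).congr fun t => ?_
    rw [pow_add, div_mul_div_comm]

lemma LeadP.add {F G : Q → ℂ} {m i j : ℕ} {P R : PowerSeries ℂ} (h : LeadP F m i j P)
    (h' : LeadP G m i j R) : LeadP (fun z => F z + G z) m i j (P + R) := by
  obtain ⟨hP, φ, ψ, h1, h2, h3⟩ := h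
  obtain ⟨hP', φ', ψ', h1', h2', h3'⟩ := h'
  refine ⟨hP.add hP', fun τ t σ => φ τ t σ + φ' τ t σ, fun τ t => ψ τ t + ψ' τ t,
    fun τ t σ hτ => ((h1 τ t σ hτ).add (h1' τ t σ hτ)).congr fun V => ?_,
    fun τ t hτ => ((h2 τ t hτ).add (h2' τ t hτ)).congr fun σ => ?_, fun τ hτ => ?_⟩
  · rw [add_mul]
  · rw [add_div]
  · rw [ev_add hP hP' hτ]
    refine ((h3 τ hτ).add (h3' τ hτ)).congr fun t => ?_
    rw [add_div]

lemma LeadP.smul {F : Q → ℂ} {m i j : ℕ} {P : PowerSeries ℂ} (c : ℂ) (h : LeadP F m i j P) :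
    LeadP (fun z => c * F z) m i j (c • P) := by
  obtain ⟨hP, φ, ψ, h1, h2, h3⟩ := h
  refine ⟨hP.smul c, fun τ t σ => c * φ τ t σ, fun τ t => c * ψ τ t,
    fun τ t σ hτ => ((h1 τ t σ hτ).const_mul c).congr fun V => ?_,
    fun τ t hτ => ((h2 τ t hτ).const_mul c).congr fun σ => ?_, fun τ hτ => ?_⟩
  · rw [mul_assoc]
  · rw [mul_div_assoc]
  · rw [ev_smul]
    refine ((h3 τ hτ).const_mul c).congr fun t => ?_
    rw [mul_div_assoc]

lemma LeadP.one : LeadP (fun _ => 1) 0 0 0 1 := by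
  refine ⟨Cv.one, fun _ _ _ => 1, fun _ _ => 1, fun τ t σ _ => ?_, fun τ t _ => ?_, fun τ _ => ?_⟩
  · simp [ex_zero]
  · simp
  · simp [ev_one]

lemma LeadP.pow {F : Q → ℂ} {m i j : ℕ} {P : PowerSeries ℂ} (h : LeadP F m i j P) (n : ℕ) :
    LeadP (fun z => F z ^ n) (n * m) (n * i) (n * j) (P ^ n) := by
  induction n with
  | zero => simpa using LeadP.one
  | succ n ih =>
    have := ih.mul h
    rw [← Nat.succ_mul, ← Nat.succ_mul, ← Nat.succ_mul, ← _root_.pow_succ] at this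
    exact this.congr fun z _ => (_root_.pow_succ _ _).symm

lemma LeadP.unique {F : Q → ℂ} {m i j : ℕ} {P R : PowerSeries ℂ} (h : LeadP F m i j P)
    (h' : LeadP F m i j R) : P = R := by
  obtain ⟨hP, φ, ψ, h1, h2, h3⟩ := h
  obtain ⟨hR, φ', ψ', h1', h2', h3'⟩ := h'
  have hφ : ∀ τ t σ, 0 < τ.im → φ τ t σ = φ' τ t σ := fun τ t σ hτ =>
    tendsto_nhds_unique (h1 τ t σ hτ) (h1' τ t σ hτ)
  have hψ : ∀ τ t, 0 < τ.im → ψ τ t = ψ' τ t := fun τ t hτ =>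
    tendsto_nhds_unique (h2 τ t hτ) ((h2' τ t hτ).congr fun σ => by rw [hφ τ t σ hτ])
  have hE : ∀ τ, 0 < τ.im → ev P τ = ev R τ := fun τ hτ =>
    tendsto_nhds_unique (h3 τ hτ) ((h3' τ hτ).congr fun t => by rw [hψ τ t hτ])
  have hm : Cv (P + (-1 : ℂ) • R) := hP.add (hR.smul _)
  have := ev_injective hm (fun τ hτ => by
    rw [ev_add hP (hR.smul _) hτ, ev_smul, hE τ hτ]; ring)
  rw [neg_one_smul] at this
  exact add_neg_eq_zero.1 this

/-- Vanishing below a given order. -/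
structure Low (a : X → ℂ) (m i j : ℕ) : Prop where
  q : ∀ m' : ℤ, m' < m → ∀ n r s, a (n, r, s, m') = 0
  σ : ∀ i' < i, gam a m i' = 0
  t : ∀ l < j, ∀ n, mom (gam a m i) l n = 0

/-- The factorial normalisation of Taylor coefficients. -/
def tc (i : ℕ) : ℂ := (2 * π * I) ^ i / i.factorial

lemma tc_ne_zero (i : ℕ) : tc i ≠ 0 := by
  apply div_ne_zero
  · simp [Real.pi_ne_zero]
  · exact_mod_cast i.factorial_ne_zero

lemma tendsto_fj (hc : CS a) (hg : Grow a) (m : ℕ)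
    (hq : ∀ m' : ℤ, m' < m → ∀ n r s, a (n, r, s, m') = 0) (hτ : 0 < τ.im) (t σ : ℂ) :
    Tendsto (fun V : ℝ => FF a (τ, t, σ, V * I) * ex (-(m * (V * I)))) atTop
      (𝓝 (∑' w, fj a m w * ex (linW w τ t σ))) := by
  obtain ⟨V0, hV0⟩ := (eventually_Dom hτ t σ).exists
  have hterm : ∀ (V : ℝ) (x : X), a x * ex (lin x (τ, t, σ, V * I)) *
      ex (-(m * (V * I))) = a x * ex (lin x (τ, t, σ, V0 * I)) *
        ex (-(m * (V0 * I))) * ex ((x.2.2.2 - m) * ((V - V0) * I)) := by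
    intro V x
    rw [mul_assoc, ← ex_add, mul_assoc, mul_assoc, ← ex_add, ← ex_add]
    congr 2
    simp only [lin]; ring
  have hn : ∀ (V : ℝ) (x : X), ‖ex ((x.2.2.2 - m) * ((V - V0) * I))‖ =
      Real.exp (-(2 * π * (x.2.2.2 - m) * (V - V0))) := by
    intro V x
    rw [norm_ex]
    congr 1
    have : (((x.2.2.2 : ℂ) - m) * ((V - V0) * I)) =
      (((x.2.2.2 : ℝ) - m) * (V - V0) : ℝ) * I := by push_cast; ring
    rw [this, im_ofReal_mul, I_im]; ring
  have hlim : (∑' w, fj a m w * ex (linW w τ t σ)) =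
      ∑' x : X, if x.2.2.2 = (m : ℤ) then a x * ex (lin x (τ, t, σ, V0 * I)) *
        ex (-(m * (V0 * I))) else 0 := by
    rw [tsum_ite_m]
    refine tsum_congr fun w => ?_
    rw [lin_eq_linW, ex_add, fj, ex_neg]
    push_cast
    field_simp [ex_ne_zero]
  rw [hlim]
  have hFF : ∀ V : ℝ, FF a (τ, t, σ, V * I) * ex (-(m * (V * I))) =
      ∑' x, a x * ex (lin x (τ, t, σ, V0 * I)) *
        ex (-(m * (V0 * I))) * ex ((x.2.2.2 - m) * ((V - V0) * I)) := by
    intro V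
    rw [FF, ← tsum_mul_right]
    exact tsum_congr fun x => hterm V x
  simp_rw [hFF]
  refine tendsto_tsum_of_dominated_convergence
    (((summable_FF hc hg hV0).mul_right (ex (-(m * (V0 * I))))).norm) (fun x => ?_) ?_
  · split_ifs with hx
    · simp [hx, ex_zero]
    · rcases lt_or_gt_of_ne hx with hlt | hgt
      · have : a x = 0 := hq _ hlt x.1 x.2.1 x.2.2.1
        simp [this]
      · rw [tendsto_zero_iff_norm_tendsto_zero]
        simp_rw [norm_mul _ (ex _), hn]
        have hpos : 0 < 2 * π * ((x.2.2.2 : ℝ) - m) := by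
          have : (m : ℝ) < x.2.2.2 := by exact_mod_cast hgt
          have := Real.pi_pos
          have : 0 < (x.2.2.2 : ℝ) - m := by linarith
          positivity
        have h1 : Tendsto (fun V : ℝ => Real.exp (-(2 * π * (x.2.2.2 - m) * (V - V0)))) atTop
            (𝓝 0) := by
          apply Real.tendsto_exp_atBot.comp
          apply tendsto_neg_atTop_atBot.comp
          exact (tendsto_id.atTop_add (tendsto_const_nhds (x := -V0))).const_mul_atTop hpos
        simpa using h1.const_mul (‖a x * ex (lin x (τ, t, σ, V0 * I))‖ *
          ‖ex (-(m * (V0 * I)))‖)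
  · filter_upwards [eventually_ge_atTop V0] with V hV x
    rw [norm_mul _ (ex ((x.2.2.2 - m) * ((V - V0) * I))), hn]
    by_cases hx : (m : ℤ) ≤ x.2.2.2
    · refine mul_le_of_le_one_right (norm_nonneg _) (Real.exp_le_one_iff.2 ?_)
      have h1 : (m : ℝ) ≤ x.2.2.2 := by exact_mod_cast hx
      have h2 : 0 ≤ (x.2.2.2 : ℝ) - m := by linarith
      have h3 : 0 ≤ V - V0 := by linarith
      have := Real.pi_pos
      have : 0 ≤ 2 * π * (x.2.2.2 - m) * (V - V0) := by positivity
      linarith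
    · have : a x = 0 := hq _ (not_le.1 hx) x.1 x.2.1 x.2.2.1
      simp [this]

lemma HF.lead (h : HF k e a) {m i j : ℕ} (hl : Low a m i j) :
    LeadP (FF a) m i j ((tc i * tc j) • PowerSeries.mk fun n : ℕ => mom (gam a m i) j n) := by
  have hj := h.jf m i hl.σ
  refine ⟨Cv.smul _ fun τ hτ => by simpa using hj.summable_mom_nat j hτ,
    fun τ t σ => ∑' w, fj a m w * ex (linW w τ t σ),
    fun τ t => tc i * ∑' x : ℤ × ℤ, gam a m i x * ex (x.1 * τ + x.2 * t),
    fun τ t σ hτ => tendsto_fj h.cone h.grow m hl.q hτ t σ,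
    fun τ t hτ => fj_limit h.cone h.grow m i hl.σ hτ t, fun τ hτ => ?_⟩
  have l1 := (moment_limit (hj.summ_t hτ) j (fun j' hj' => by
    rw [hj.tsum_mom hτ]; simp [hl.t j' hj'])).const_mul (tc i)
  rw [hj.tsum_mom hτ, hj.tsum_mom_nat, ← mul_assoc] at l1
  rw [ev_smul]
  simp only [ev, PowerSeries.coeff_mk]
  refine l1.congr fun t => ?_
  rw [mul_div_assoc]
  congr 2
  exact tsum_congr fun x => by rw [mul_assoc, ← ex_add]

lemma fj_eq_zero (hc : CS a) (hg : Grow a) (m : ℤ)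
    (h : ∀ τ t σ : ℂ, 0 < τ.im → ∑' w, fj a m w * ex (linW w τ t σ) = 0) (n r s : ℤ) :
    a (n, r, s, m) = 0 := by
  have hs : ∀ z, Dom z → Summable fun x : X => (if x.2.2.2 = m then a x else 0) * ex (lin x z) := by
    intro z hz
    refine ((summable_FF hc hg hz).indicator {x | x.2.2.2 = m}).congr fun x => ?_
    simp only [Set.indicator, Set.mem_ofPred_eq]; split_ifs <;> simp
  have := FF_injective (b := 0) hs (fun z _ => by simp [summable_zero]) (fun z hz => by
    have e1 : FF (fun x : X => if x.2.2.2 = m then a x else 0) z =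
        ∑' x : X, if x.2.2.2 = m then a x * ex (lin x z) else 0 :=
      tsum_congr fun x => ite_zero_mul _ _ _
    rw [e1, tsum_ite_m]
    have e2 : FF 0 z = 0 := by simp [FF]
    rw [e2]
    have e3 := h z.1 z.2.1 z.2.2.1 hz.1
    have e4 := tsum_mul_right (f := fun w => fj a m w * ex (linW w z.1 z.2.1 z.2.2.1))
      (a := ex (m * z.2.2.2)) (L := SummationFilter.unconditional _)
    rw [e3, zero_mul] at e4
    refine Eq.trans (tsum_congr fun w => ?_) e4
    rw [show z = (z.1, z.2.1, z.2.2.1, z.2.2.2) from rfl, lin_eq_linW, ex_add, fj, mul_assoc])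
  simpa using congrFun this (n, r, s, m)

lemma tendsto_zero_of_div_pow {f : ℂ → ℂ} {l : ℂ} {i i' : ℕ} (hi : i' < i)
    (h : Tendsto (fun t => f t / t ^ i) (𝓝[≠] 0) (𝓝 l)) :
    Tendsto (fun t => f t / t ^ i') (𝓝[≠] 0) (𝓝 0) := by
  have h0 : Tendsto (fun t : ℂ => t ^ (i - i')) (𝓝[≠] 0) (𝓝 0) := by
    have : Tendsto (fun t : ℂ => t ^ (i - i')) (𝓝 0) (𝓝 (0 ^ (i - i'))) :=
      (continuous_pow _).tendsto _
    rw [zero_pow (by omega)] at this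
    exact this.mono_left nhdsWithin_le_nhds
  have := h.mul h0
  rw [mul_zero] at this
  refine this.congr' ?_
  filter_upwards [self_mem_nhdsWithin] with t ht
  have ht0 : t ≠ 0 := ht
  rw [show i = i' + (i - i') by omega, pow_add, show i' + (i - i') - i' = i - i' by omega]
  field_simp

lemma HF.low_of_lead (h : HF k e a) {m i j : ℕ} {P : PowerSeries ℂ}
    (hl : LeadP (FF a) m i j P) : Low a m i j := by
  obtain ⟨hP, φ, ψ, h1, h2, h3⟩ := hl
  have hneg : ∀ m' : ℤ, m' < 0 → ∀ n r s, a (n, r, s, m') = 0 := fun m' hm n r s =>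
    h.cone _ fun hx => by have := hx.2.1; simp only at this; omega
  have hq : ∀ M : ℕ, M ≤ m → ∀ m' : ℤ, m' < M → ∀ n r s, a (n, r, s, m') = 0 := by
    intro M
    induction M with
    | zero => intro _ m' hm; exact hneg m' (by simpa using hm)
    | succ M ih =>
      intro hM m' hm
      rcases lt_or_eq_of_le (show m' ≤ M by push_cast at hm; omega) with hlt | rfl
      · exact ih (by omega) m' hlt
      refine fj_eq_zero h.cone h.grow _ fun τ t σ hτ => ?_
      refine tendsto_nhds_unique (tendsto_fj h.cone h.grow M (ih (by omega)) hτ t σ) ?_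
      have hz : Tendsto (fun V : ℝ => ex (((m : ℂ) - M) * (V * I))) atTop (𝓝 0) := by
        rw [tendsto_zero_iff_norm_tendsto_zero]
        have hn : ∀ V : ℝ, ‖ex (((m : ℂ) - M) * (V * I))‖ =
            Real.exp (-(2 * π * (m - M) * V)) := by
          intro V
          rw [norm_ex]
          congr 1
          have : (((m : ℂ) - M) * (V * I)) = (((m : ℝ) - M) * V : ℝ) * I := by
            push_cast; ring
          rw [this, im_ofReal_mul, I_im]; ring
        simp_rw [hn]
        have hpos : 0 < 2 * π * ((m : ℝ) - M) := by
          have : (M : ℝ) < m := by exact_mod_cast hM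
          have := Real.pi_pos
          have : 0 < (m : ℝ) - M := by linarith
          positivity
        apply Real.tendsto_exp_atBot.comp
        apply tendsto_neg_atTop_atBot.comp
        exact tendsto_id.const_mul_atTop hpos
      have := (h1 τ t σ hτ).mul hz
      rw [mul_zero] at this
      refine this.congr fun V => ?_
      rw [mul_assoc, ← ex_add]
      congr 2
      ring
  have hφ : ∀ τ t σ, 0 < τ.im → φ τ t σ = ∑' w, fj a m w * ex (linW w τ t σ) := fun τ t σ hτ =>
    tendsto_nhds_unique (h1 τ t σ hτ) (tendsto_fj h.cone h.grow m (hq m le_rfl) hτ t σ)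
  have hσ : ∀ I : ℕ, I ≤ i → ∀ i' < I, gam a m i' = 0 := by
    intro I
    induction I with
    | zero => intro _ i' hi; omega
    | succ I ih =>
      intro hI i' hi
      rcases lt_or_eq_of_le (Nat.lt_succ_iff.1 hi) with hlt | rfl
      · exact ih (by omega) i' hlt
      have hjf := h.jf m i' (ih (by omega))
      refine fourier_unique_pair hjf.summ fun τ t hτ => ?_
      have l1 := fj_limit h.cone h.grow m i' (ih (by omega)) hτ t
      have l2 := tendsto_zero_of_div_pow (show i' < i by omega) ((h2 τ t hτ).congr fun σ => by
        rw [hφ τ t σ hτ])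
      exact (mul_eq_zero.1 (tendsto_nhds_unique l1 l2)).resolve_left (tc_ne_zero i')
  have hψ : ∀ τ t, 0 < τ.im → ψ τ t = tc i * ∑' x : ℤ × ℤ, gam a m i x * ex (x.1 * τ + x.2 * t) :=
    fun τ t hτ => tendsto_nhds_unique (h2 τ t hτ) ((fj_limit h.cone h.grow m i (hσ i le_rfl) hτ t).congr
      fun σ => by rw [hφ τ t σ hτ])
  have hjf := h.jf m i (hσ i le_rfl)
  refine ⟨hq m le_rfl, hσ i le_rfl, ?_⟩
  have ht : ∀ J : ℕ, J ≤ j → ∀ j' < J, ∀ n, mom (gam a m i) j' n = 0 := by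
    intro J
    induction J with
    | zero => intro _ j' hj; omega
    | succ J ih =>
      intro hJ j' hj
      rcases lt_or_eq_of_le (Nat.lt_succ_iff.1 hj) with hlt | rfl
      · exact ih (by omega) j' hlt
      have hz := fourier_unique_nat (c := fun n : ℕ => mom (gam a m i) j' n)
        (fun τ hτ => hjf.summable_mom_nat j' hτ) (fun τ hτ => by
          have l1 := (moment_limit (hjf.summ_t hτ) j' (fun j'' hj'' => by
            rw [hjf.tsum_mom hτ]; simp [ih (by omega) j'' hj''])).const_mul (tc i)
          rw [hjf.tsum_mom hτ, hjf.tsum_mom_nat, ← mul_assoc] at l1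
          have l2 := tendsto_zero_of_div_pow (show j' < j by omega) ((h3 τ hτ).congr fun t => by
            rw [hψ τ t hτ])
          have := tendsto_nhds_unique l1 (l2.congr fun t => by
            rw [mul_div_assoc]
            congr 2
            exact tsum_congr fun x => by rw [mul_assoc, ← ex_add])
          exact (mul_eq_zero.1 this).resolve_left (mul_ne_zero (tc_ne_zero i) (tc_ne_zero j')))
      intro n
      rcases lt_or_ge n 0 with hn | hn
      · exact hjf.mom_neg j' hn
      · have := congrFun hz n.toNat
        simpa [Int.toNat_of_nonneg hn] using this
  exact ht j le_rfl

/-- The indices `(r, s)` carrying a nonzero coefficient, inside a box. -/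
def fs (a : X → ℂ) (n m : ℤ) : Finset (ℤ × ℤ) :=
  open Classical in (Finset.Icc (-(n + m)) (n + m) ×ˢ Finset.Icc (-(n + m)) (n + m)).filter
    fun p => a (n, p.1, p.2, m) ≠ 0

lemma Cone.box {n r s m : ℤ} (h : Cone (n, r, s, m)) :
    (-(n + m) ≤ r ∧ r ≤ n + m) ∧ (-(n + m) ≤ s ∧ s ≤ n + m) := by
  obtain ⟨h1, h2, h3⟩ := h
  simp only at h1 h2 h3
  have hr : r ^ 2 ≤ (n + m) ^ 2 := by nlinarith [sq_nonneg (r + 2 * s), sq_nonneg (n - m)]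
  have hs : s ^ 2 ≤ (n + m) ^ 2 := by nlinarith [sq_nonneg (2 * r + s), sq_nonneg (n - m)]
  exact ⟨abs_le.1 (abs_le_of_sq_le_sq hr (by omega)), abs_le.1 (abs_le_of_sq_le_sq hs (by omega))⟩

lemma CS.cone (hc : CS a) {x : X} (h : a x ≠ 0) : Cone x := by
  by_contra hx; exact h (hc x hx)

lemma mem_fs (hc : CS a) {n m : ℤ} {p : ℤ × ℤ} :
    p ∈ fs a n m ↔ a (n, p.1, p.2, m) ≠ 0 := by
  simp only [fs, mem_filter, mem_product, mem_Icc, and_iff_right_iff_imp]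
  exact fun h => (hc.cone h).box

lemma fs_eq_zero (hc : CS a) {n m : ℤ} {p : ℤ × ℤ} (h : p ∉ fs a n m) :
    a (n, p.1, p.2, m) = 0 := by
  by_contra hn; exact h ((mem_fs hc).2 hn)

/-- The double moments. -/
def dm (a : X → ℂ) (n m : ℤ) (i j : ℕ) : ℂ :=
  ∑ p ∈ fs a n m, a (n, p.1, p.2, m) * ((p.1 + 2 * p.2 : ℤ) : ℂ) ^ i * (p.1 : ℂ) ^ j

lemma mom_gam (hc : CS a) (n m : ℤ) (i j : ℕ) : mom (gam a m i) j n = dm a n m i j := by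
  have hz : ∀ p ∉ fs a n m,
      a (n, p.1, p.2, m) * ((p.1 + 2 * p.2 : ℤ) : ℂ) ^ i * (p.1 : ℂ) ^ j = 0 := fun p hp => by
    rw [fs_eq_zero hc hp]; simp
  rw [dm, ← tsum_eq_sum (L := SummationFilter.unconditional _) hz,
    (summable_of_ne_finset_zero hz).tsum_prod]
  refine tsum_congr fun r => ?_
  rw [gam]; exact tsum_mul_right.symm

lemma gam_eq_sum (hc : CS a) (n r m : ℤ) (i : ℕ) :
    gam a m i (n, r) = ∑ s ∈ Finset.Icc (-(n + m)) (n + m), a (n, r, s, m) * ((r + 2 * s : ℤ) : ℂ) ^ i := by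
  rw [gam]
  refine tsum_eq_sum fun s hs => ?_
  by_cases h : a (n, r, s, m) = 0
  · simp [h]
  · exact absurd (mem_Icc.2 (hc.cone h).box.2) hs

lemma sum_fs_rot {M : Type*} [AddCommMonoid M] (h : HF k 1 a) (n m : ℤ)
    (g : ℂ → ℤ × ℤ → M) : ∑ p ∈ fs a n m, g (a (n, p.1, p.2, m)) p =
      ∑ p ∈ fs a n m, g (a (n, p.1, p.2, m)) (-p.2, p.1 + p.2) := by
  have hr : ∀ p : ℤ × ℤ, a (n, -p.2, p.1 + p.2, m) = a (n, p.1, p.2, m) := fun p => by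
    rw [h.rot, one_mul]
  refine (sum_bij (fun p _ => ((-p.2, p.1 + p.2) : ℤ × ℤ)) ?_ ?_ ?_ ?_).symm
  · intro p hp
    rw [mem_fs h.cone] at hp ⊢
    rwa [hr]
  · rintro ⟨p1, p2⟩ _ ⟨q1, q2⟩ _ hpq
    simp only [Prod.mk.injEq] at hpq ⊢
    omega
  · rintro ⟨p1, p2⟩ hp
    refine ⟨(p1 + p2, -p1), ?_, by simp⟩
    rw [mem_fs h.cone] at hp ⊢
    rw [← hr]; simpa using hp
  · intro p _
    rw [hr]

open Polynomial in
lemma expand_dm (a : X → ℂ) (n m : ℤ) (d : ℕ) (U V : ℂ[X]) :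
    ∑ p ∈ fs a n m, C (a (n, p.1, p.2, m)) *
      (C (p.1 : ℂ) * U + C ((p.1 + 2 * p.2 : ℤ) : ℂ) * V) ^ d =
    ∑ l ∈ range (d + 1), U ^ l * V ^ (d - l) * (d.choose l : ℂ[X]) * C (dm a n m (d - l) l) := by
  simp_rw [add_pow, mul_sum, dm, map_sum, mul_sum]
  rw [sum_comm]
  refine sum_congr rfl fun l _ => sum_congr rfl fun p _ => ?_
  rw [mul_pow, mul_pow, C_mul, C_mul, C_pow, C_pow]
  ring

open Polynomial in
/-- The hexagonal symmetry forces additional vanishing of moments. -/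
lemma HF.dm_eq_zero (h : HF k 1 a) (n m : ℤ) {i : ℕ}
    (h0 : ∀ i' < i, ∀ j, dm a n m i' j = 0) {j : ℕ} (hj : j < 2 * i) : dm a n m i j = 0 := by
  set P : ℂ[X] := ∑ p ∈ fs a n m, C (a (n, p.1, p.2, m)) *
      (C (p.1 : ℂ) * Polynomial.X + C ((p.1 + 2 * p.2 : ℤ) : ℂ) * 1) ^ (i + j) with hP
  have e1 := expand_dm a n m (i + j) Polynomial.X 1
  have hdvd : ∀ U V : ℂ[X], V ^ i ∣ ∑ p ∈ fs a n m, C (a (n, p.1, p.2, m)) *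
      (C (p.1 : ℂ) * U + C ((p.1 + 2 * p.2 : ℤ) : ℂ) * V) ^ (i + j) := by
    intro U V
    rw [expand_dm]
    refine dvd_sum fun l _ => ?_
    by_cases hl : i ≤ i + j - l
    · exact Dvd.dvd.mul_right (Dvd.dvd.mul_right (Dvd.dvd.mul_left (pow_dvd_pow V hl) _) _) _
    · rw [h0 _ (not_le.1 hl)]; simp
  have r1 : P = ∑ p ∈ fs a n m, C (a (n, p.1, p.2, m)) *
      (C (p.1 : ℂ) * (C (1 / 2 : ℂ) * (Polynomial.X + 3)) +
        C ((p.1 + 2 * p.2 : ℤ) : ℂ) * (C (1 / 2 : ℂ) * (1 - Polynomial.X))) ^ (i + j) := by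
    rw [hP, sum_fs_rot h n m (fun c p => C c *
      (C (p.1 : ℂ) * Polynomial.X + C ((p.1 + 2 * p.2 : ℤ) : ℂ) * 1) ^ (i + j))]
    refine sum_congr rfl fun p _ => ?_
    congr 2
    have : (2 : ℂ[X]) * C (1 / 2) = 1 := by
      rw [← C_ofNat, ← C_mul]; norm_num
    push_cast
    simp only [map_add, map_mul, map_neg, map_intCast, C_ofNat]
    linear_combination (-(p.2 : ℂ[X]) * Polynomial.X + (2 * p.1 + p.2)) * this - (-(p.2 : ℂ[X]) * Polynomial.X + (2 * p.1 + p.2)) * this - ((p.1 : ℂ[X]) * 2 + p.2 - p.2 * Polynomial.X) * this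
  have r2 : P = ∑ p ∈ fs a n m, C (a (n, p.1, p.2, m)) *
      (C (p.1 : ℂ) * (C (1 / 2 : ℂ) * (3 - Polynomial.X)) +
        C ((p.1 + 2 * p.2 : ℤ) : ℂ) * (C (-1 / 2 : ℂ) * (1 + Polynomial.X))) ^ (i + j) := by
    rw [hP, sum_fs_rot h n m (fun c p => C c *
      (C (p.1 : ℂ) * Polynomial.X + C ((p.1 + 2 * p.2 : ℤ) : ℂ) * 1) ^ (i + j)),
      sum_fs_rot h n m (fun c p => C c *
      (C ((((-p.2, p.1 + p.2) : ℤ × ℤ).1 : ℤ) : ℂ) * Polynomial.X + C ((((-p.2, p.1 + p.2) : ℤ × ℤ).1 + 2 * ((-p.2, p.1 + p.2) : ℤ × ℤ).2 : ℤ) : ℂ) * 1) ^ (i + j))]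
    refine sum_congr rfl fun p _ => ?_
    congr 2
    have : (2 : ℂ[X]) * C (1 / 2) = 1 := by
      rw [← C_ofNat, ← C_mul]; norm_num
    have h2 : C (-1 / 2 : ℂ) = - C (1 / 2) := by rw [← C_neg]; congr 1; norm_num
    rw [h2]
    push_cast
    simp only [map_add, map_mul, map_neg, map_intCast, C_ofNat]
    linear_combination ((p.1 : ℂ[X]) * Polynomial.X + p.2 * Polynomial.X - p.1 + p.2) * this
  have d1 : (Polynomial.X - C 1 : ℂ[X]) ^ i ∣ P := by
    have h1 := hdvd (C (1 / 2 : ℂ) * (Polynomial.X + 3)) (C (1 / 2 : ℂ) * (1 - Polynomial.X))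
    rw [← r1, mul_pow] at h1
    refine (dvd_trans ?_ (dvd_of_mul_left_dvd h1))
    rw [show (1 - Polynomial.X : ℂ[X]) = (-1) * (Polynomial.X - C 1) by simp, mul_pow]
    exact Dvd.intro_left _ rfl
  have d2 : (Polynomial.X - C (-1) : ℂ[X]) ^ i ∣ P := by
    have h1 := hdvd (C (1 / 2 : ℂ) * (3 - Polynomial.X)) (C (-1 / 2 : ℂ) * (1 + Polynomial.X))
    rw [← r2, mul_pow] at h1
    refine (dvd_trans ?_ (dvd_of_mul_left_dvd h1))
    rw [show (1 + Polynomial.X : ℂ[X]) = (Polynomial.X - C (-1)) by simp [add_comm]]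
  have hcop : IsCoprime ((Polynomial.X - C 1 : ℂ[X]) ^ i) ((Polynomial.X - C (-1)) ^ i) :=
    (isCoprime_X_sub_C_of_isUnit_sub (by norm_num)).pow
  have hdd := hcop.mul_dvd d1 d2
  have hdeg : P.natDegree ≤ j := by
    rw [hP, e1]
    refine natDegree_sum_le_of_forall_le _ _ fun l _ => ?_
    by_cases hl : l ≤ j
    · refine (natDegree_mul_le.trans ?_)
      rw [natDegree_C, add_zero]
      refine (natDegree_mul_le.trans ?_)
      rw [natDegree_natCast, one_pow, mul_one, natDegree_X_pow]
      simpa using hl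
    · rw [h0 _ (by omega)]; simp
  have hP0 : P = 0 := by
    by_contra hne
    have := natDegree_le_of_dvd hdd hne
    rw [natDegree_mul (pow_ne_zero _ (X_sub_C_ne_zero _)) (pow_ne_zero _ (X_sub_C_ne_zero _)),
      natDegree_pow, natDegree_pow, natDegree_X_sub_C, natDegree_X_sub_C] at this
    omega
  have := congrArg (fun R => coeff R j) (e1.symm.trans (hP.symm.trans hP0))
  simp only [finsetSum_coeff, coeff_zero, one_pow, mul_one, coeff_mul_C] at this
  rw [sum_eq_single j] at this
  · rw [← C_eq_natCast, coeff_mul_C, coeff_X_pow, if_pos rfl, one_mul, Nat.add_sub_cancel] at this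
    refine (mul_eq_zero.1 this).resolve_left ?_
    exact_mod_cast (Nat.choose_pos (by omega)).ne'
  · intro l _ hl
    rw [← C_eq_natCast, coeff_mul_C, coeff_X_pow, if_neg (Ne.symm hl)]; simp
  · intro hj'; exact absurd (mem_range.2 (by omega)) hj'

section

lemma HF.low_rot (h : HF k 1 a) {m i : ℕ} (hl : Low a m i 0) : Low a m i (2 * i) :=
  ⟨hl.q, hl.σ, fun j hj n => by
    rw [mom_gam h.cone]
    refine h.dm_eq_zero n m (fun i' hi' j => ?_) hj
    rw [← mom_gam h.cone, hl.σ i' hi']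
    simp [mom]⟩

lemma HF.gam_odd (h : HF k 1 a) (m : ℤ) {i : ℕ} (hi : Odd i) : gam a m i = 0 := by
  funext ⟨n, r⟩
  have h1 : gam a m i (n, r) = -gam a m i (n, r) := by
    conv_lhs => rw [gam, ← ((Equiv.neg ℤ).trans (Equiv.subRight r)).tsum_eq]
    rw [gam, ← tsum_neg]
    refine tsum_congr fun s => ?_
    have := h.flip n r s m
    rw [one_mul] at this
    simp only [Equiv.trans_apply, Equiv.neg_apply, Equiv.subRight_apply]
    rw [show -s - r = -r - s by ring, this, show r + 2 * (-r - s) = -(r + 2 * s) by ring]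
    push_cast
    rw [hi.neg_pow]; ring
  simpa [self_eq_neg] using h1

lemma HF.gam_neg (h : HF k 1 a) (m : ℤ) {i : ℕ} (hi : Even i) (n r : ℤ) :
    gam a m i (n, -r) = gam a m i (n, r) := by
  have hr : ∀ s, a (n, -r, -s, m) = a (n, r, s, m) := fun s => by
    have h1 := h.rot n r s m
    have h2 := h.rot n (-s) (r + s) m
    have h3 := h.rot n (-(r + s)) (-s + (r + s)) m
    rw [one_mul] at h1 h2 h3
    rw [← h1, ← h2, ← h3]
    congr 2; ring_nf
  rw [gam, gam, ← (Equiv.neg ℤ).tsum_eq]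
  refine tsum_congr fun s => ?_
  simp only [Equiv.neg_apply, hr]
  rw [show (-r + 2 * -s) = -(r + 2 * s) by ring]
  push_cast
  rw [hi.neg_pow]

lemma Low.succ_i {m i j : ℕ} (hl : Low a m i j) (h0 : gam a m i = 0) : Low a m (i + 1) 0 :=
  ⟨hl.q, fun i' hi' => by
    rcases Nat.lt_succ_iff_lt_or_eq.1 hi' with h | rfl
    exacts [hl.σ _ h, h0], fun j' hj' => absurd hj' (Nat.not_lt_zero _)⟩

lemma Low.succ_j {m i j : ℕ} (hl : Low a m i j) (h0 : ∀ n, mom (gam a m i) j n = 0) :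
    Low a m i (j + 1) :=
  ⟨hl.q, hl.σ, fun j' hj' => by
    rcases Nat.lt_succ_iff_lt_or_eq.1 hj' with h | rfl
    exacts [hl.t _ h, h0]⟩

lemma HF.low_of_large (h : HF k 1 a) {m i j : ℕ} (hl : Low a m i j) (hj : 2 * m < j) :
    Low a m (i + 1) 0 :=
  hl.succ_i ((h.jf m i hl.σ).eq_zero_of_mom fun j' hj' => hl.t j' (by omega))

lemma eq_zero_of_gam (hc : CS a) {n r m : ℤ} (h : ∀ i, gam a m i (n, r) = 0) (s : ℤ) :
    a (n, r, s, m) = 0 := by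
  set S := Finset.Icc (-(n + m)) (n + m)
  by_cases hs : s ∈ S
  · have key : ∀ P : Polynomial ℂ, ∑ s ∈ S, a (n, r, s, m) * P.eval ((r + 2 * s : ℤ) : ℂ) = 0 := by
      intro P
      induction P using Polynomial.induction_on' with
      | add p q hp hq => simp only [Polynomial.eval_add, mul_add, sum_add_distrib, hp, hq, add_zero]
      | monomial i c =>
        have := h i
        rw [gam_eq_sum hc] at this
        simp only [Polynomial.eval_monomial]
        calc _ = c * ∑ s ∈ S, a (n, r, s, m) * ((r + 2 * s : ℤ) : ℂ) ^ i := by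
              rw [mul_sum]; exact sum_congr rfl fun s _ => by ring
          _ = 0 := by rw [this, mul_zero]
    have := key (∏ s' ∈ S.erase s, (Polynomial.X - Polynomial.C ((r + 2 * s' : ℤ) : ℂ)))
    rw [sum_eq_single s] at this
    · refine (mul_eq_zero.1 this).resolve_right ?_
      rw [Polynomial.eval_prod, ← ne_eq, prod_ne_zero_iff]
      intro s' hs'
      rw [Polynomial.eval_sub, Polynomial.eval_X, Polynomial.eval_C, sub_ne_zero]
      have := ne_of_mem_erase hs'
      intro hh
      have : r + 2 * s = r + 2 * s' := by exact_mod_cast hh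
      omega
    · intro s' hs' hne
      rw [Polynomial.eval_prod, prod_eq_zero (mem_erase.2 ⟨hne, hs'⟩), mul_zero]
      simp
    · exact fun h => absurd hs h
  · by_contra h0
    exact hs (mem_Icc.2 (hc.cone h0).box.2)

lemma HF.low_succ_m (h : HF k 1 a) {m i : ℕ} (hl : Low a m i 0) (hi : m < i) : Low a (m + 1) 0 0 := by
  have hg : ∀ d, Low a m (i + d) 0 := by
    intro d
    induction d with
    | zero => exact hl
    | succ d ih =>
      have hr := h.low_rot ih
      exact h.low_of_large hr (by omega)
  refine ⟨fun m' hm' n r s => ?_, fun i' hi' => absurd hi' (Nat.not_lt_zero _),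
    fun j' hj' => absurd hj' (Nat.not_lt_zero _)⟩
  rcases lt_or_eq_of_le (Int.le_of_lt_add_one (by simpa using hm')) with h' | rfl
  · exact hl.q m' h' n r s
  · exact eq_zero_of_gam h.cone (fun i' => by rw [(hg (i' + 1)).σ i' (by omega)]; rfl) s

end

/-- The weight of a monomial in the five generators. -/
def wt (d : Fin 5 →₀ ℕ) : ℤ := 4 * d 0 + 6 * d 1 + 10 * d 2 + 12 * d 3 + 18 * d 4

/-- The coefficients of a monomial in the five generators. -/
def mon (A : Fin 5 → X → ℂ) (d : Fin 5 →₀ ℕ) : X → ℂ :=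
  conv (conv (conv (conv (cpow (A 0) (d 0)) (cpow (A 1) (d 1))) (cpow (A 2) (d 2)))
    (cpow (A 3) (d 3))) (cpow (A 4) (d 4))

/-- Five forms with the leading terms of the generators. -/
structure Gens (A : Fin 5 → X → ℂ) : Prop where
  h0 : HF 4 1 (A 0)
  h1 : HF 6 1 (A 1)
  h2 : HF 10 1 (A 2)
  h3 : HF 12 1 (A 3)
  h4 : HF 18 1 (A 4)
  l0 : LeadP (FF (A 0)) 0 0 0 e4
  l1 : LeadP (FF (A 1)) 0 0 0 e6
  l2 : ∃ c : ℂ, c ≠ 0 ∧ LeadP (FF (A 2)) 1 0 2 (c • dl)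
  l3 : ∃ c : ℂ, c ≠ 0 ∧ LeadP (FF (A 3)) 1 0 0 (c • dl)
  l4 : ∃ c : ℂ, c ≠ 0 ∧ LeadP (FF (A 4)) 2 2 4 (c • dl ^ 2)

namespace Gens
variable {A : Fin 5 → X → ℂ}

lemma hf (G : Gens A) (d : Fin 5 →₀ ℕ) : HF (wt d) 1 (mon A d) := by
  have := ((((G.h0.cpow (d 0)).conv (G.h1.cpow (d 1))).conv (G.h2.cpow (d 2))).conv
    (G.h3.cpow (d 3))).conv (G.h4.cpow (d 4))
  simp only [mul_one] at this
  rw [mon, wt]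
  convert this using 1
  ring

lemma FF_mon (G : Gens A) (d : Fin 5 →₀ ℕ) (hz : Dom z) :
    FF (mon A d) z = FF (A 0) z ^ d 0 * FF (A 1) z ^ d 1 * FF (A 2) z ^ d 2 * FF (A 3) z ^ d 3 *
      FF (A 4) z ^ d 4 := by
  have c0 := G.h0.cpow (d 0)
  have c1 := G.h1.cpow (d 1)
  have c2 := G.h2.cpow (d 2)
  have c3 := G.h3.cpow (d 3)
  have c4 := G.h4.cpow (d 4)
  have s1 := c0.conv c1
  have s2 := s1.conv c2
  have s3 := s2.conv c3
  rw [mon, FF_conv (s3.summ hz) (c4.summ hz), FF_conv (s2.summ hz) (c3.summ hz),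
    FF_conv (s1.summ hz) (c2.summ hz), FF_conv (c0.summ hz) (c1.summ hz), G.h0.FF_cpow _ hz,
    G.h1.FF_cpow _ hz, G.h2.FF_cpow _ hz, G.h3.FF_cpow _ hz, G.h4.FF_cpow _ hz]

lemma lead_mon (G : Gens A) : ∃ c10 c12 c18 : ℂ, c10 ≠ 0 ∧ c12 ≠ 0 ∧ c18 ≠ 0 ∧
    ∀ d : Fin 5 →₀ ℕ, LeadP (FF (mon A d)) (d 2 + d 3 + 2 * d 4) (2 * d 4) (4 * d 4 + 2 * d 2)
      ((c10 ^ d 2 * c12 ^ d 3 * c18 ^ d 4) • (dl ^ (d 2 + d 3 + 2 * d 4) * (e4 ^ d 0 * e6 ^ d 1))) := by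
  obtain ⟨c10, hc10, l2⟩ := G.l2
  obtain ⟨c12, hc12, l3⟩ := G.l3
  obtain ⟨c18, hc18, l4⟩ := G.l4
  refine ⟨c10, c12, c18, hc10, hc12, hc18, fun d => ?_⟩
  have := (((((G.l0.pow (d 0)).mul (G.l1.pow (d 1))).mul (l2.pow (d 2))).mul (l3.pow (d 3))).mul
    (l4.pow (d 4))).congr (G := FF (mon A d)) fun z hz => (G.FF_mon d hz).symm
  convert this using 1
  · ring
  · ring
  · ring
  · rw [smul_pow, smul_pow, smul_pow]
    simp only [Algebra.smul_mul_assoc, Algebra.mul_smul_comm, smul_smul]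
    congr 1
    · ring
    · ring

lemma exists_lead (G : Gens A) {m a c : ℕ} (hm : 2 * c + a ≤ m) (V : Submodule ℂ (X → ℂ))
    (hV : V ≤ HFsub k 1)
    (hmon : ∀ d, wt d = k → d 2 + d 3 + 2 * d 4 = m → mon A d ∈ V) {g : PowerSeries ℂ}
    (hg : g ∈ Mspan (k + (2 * c : ℕ) + (4 * c + 2 * a : ℕ) - 12 * m)) :
    ∃ h ∈ V, LeadP (FF h) m (2 * c) (4 * c + 2 * a) (dl ^ m * g) := by
  obtain ⟨c10, c12, c18, h10, h12, h18, hl⟩ := G.lead_mon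
  induction hg using Submodule.span_induction with
  | mem g hg =>
    obtain ⟨i, j, hij, rfl⟩ := hg
    set d : Fin 5 →₀ ℕ := Finsupp.equivFunOnFinite.symm ![i, j, a, m - a - 2 * c, c] with hd
    have d0 : d 0 = i := rfl
    have d1 : d 1 = j := rfl
    have d2 : d 2 = a := rfl
    have d3 : d 3 = m - a - 2 * c := rfl
    have d4 : d 4 = c := rfl
    have hs : d 2 + d 3 + 2 * d 4 = m := by rw [d2, d3, d4]; omega
    have hw : wt d = k := by rw [wt, d0, d1, d2, d3, d4]; push_cast at hij; omega
    set K := c10 ^ d 2 * c12 ^ d 3 * c18 ^ d 4 with hK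
    have hK0 : K ≠ 0 := by positivity
    refine ⟨K⁻¹ • mon A d, V.smul_mem _ (hmon d hw hs), ?_⟩
    have := ((hl d).smul K⁻¹).congr (G := FF (K⁻¹ • mon A d)) fun z _ => (FF_smul _ _ _).symm
    rw [smul_smul, inv_mul_cancel₀ hK0, one_smul, hs, d0, d1, d2, d4] at this
    exact this
  | zero =>
    refine ⟨0, V.zero_mem, ?_⟩
    have := ((hl 0).smul 0).congr (G := FF 0) fun z _ => by simp [FF]
    refine ⟨by rw [mul_zero]; exact fun τ _ => by simp [summable_zero], 0, 0, ?_, ?_, ?_⟩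
    · intro τ t σ _; simp [FF]
    · intro τ t _; simp
    · intro τ _; simp [ev]
  | add g g' _ _ ih ih' =>
    obtain ⟨h, hh, l⟩ := ih
    obtain ⟨h', hh', l'⟩ := ih'
    refine ⟨h + h', V.add_mem hh hh', ?_⟩
    rw [mul_add]
    exact (l.add l').congr fun z hz => (FF_add ((hV hh).summ hz) ((hV hh').summ hz)).symm
  | smul t g _ ih =>
    obtain ⟨h, hh, l⟩ := ih
    refine ⟨t • h, V.smul_mem _ hh, ?_⟩
    rw [mul_smul_comm]
    exact (l.smul t).congr fun z hz => (FF_smul _ _ _).symm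

lemma step (G : Gens A) {m a c : ℕ} (hm : 2 * c + a ≤ m) (V : Submodule ℂ (X → ℂ))
    (hV : V ≤ HFsub k 1) (hmon : ∀ d, wt d = k → d 2 + d 3 + 2 * d 4 = m → mon A d ∈ V)
    {f : X → ℂ} (hf : HF k 1 f) (hl : Low f m (2 * c) (4 * c + 2 * a)) :
    ∃ g ∈ V, Low (f - g) m (2 * c) (4 * c + 2 * (a + 1)) := by
  have hj := hf.jf m (2 * c) hl.σ
  obtain ⟨g, hg, he⟩ := hj.mom_structure (4 * c + 2 * a) hl.t m (fun n hn => by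
    have : ∀ r, gam f m (2 * c) (n, r) = 0 := fun r => by
      rw [gam]
      refine (tsum_congr fun s => ?_).trans tsum_zero
      rw [← hf.swap, hl.q n (by exact_mod_cast hn), zero_mul]
    simp [mom, this])
  obtain ⟨h, hh, lh⟩ := G.exists_lead hm V hV hmon hg
  have lf := hf.lead hl
  rw [he] at lf
  set t := tc (2 * c) * tc (4 * c + 2 * a)
  have hfh : HF k 1 (f - t • h) := by
    have := hf.add ((hV hh).smul (-t))
    rwa [neg_smul, ← sub_eq_add_neg] at this
  have hlead : LeadP (FF (f - t • h)) m (2 * c) (4 * c + 2 * a) 0 := by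
    have := (lf.add (lh.smul (-t))).congr (G := FF (f - t • h)) fun z hz => by
      rw [← FF_smul, ← FF_add (hf.summ hz) (((hV hh).smul (-t)).summ hz), neg_smul,
        ← sub_eq_add_neg]
    rwa [neg_smul, add_neg_cancel] at this
  have hlow := hfh.low_of_lead hlead
  have hz := (hfh.lead hlow).unique hlead
  have hm0 : ∀ n, mom (gam (f - t • h) m (2 * c)) (4 * c + 2 * a) n = 0 := by
    intro n
    rcases lt_or_ge n 0 with hn | hn
    · refine (tsum_congr fun r => ?_).trans tsum_zero
      by_contra hne
      have := (hfh.jf m (2 * c) hlow.σ).cone n r (left_ne_zero_of_mul hne)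
      omega
    · lift n to ℕ using hn
      have := congrArg (PowerSeries.coeff n) hz
      simpa [tc_ne_zero] using this
  refine ⟨t • h, V.smul_mem _ hh, ?_⟩
  exact (hlow.succ_j hm0).succ_j (mom_odd (hfh.gam_neg m ⟨c, by ring⟩) ⟨2 * c + a, by ring⟩)

lemma step_a (G : Gens A) {m c : ℕ} (V : Submodule ℂ (X → ℂ))
    (hV : V ≤ HFsub k 1) (hmon : ∀ d, wt d = k → d 2 + d 3 + 2 * d 4 = m → mon A d ∈ V)
    (N : ℕ) : ∀ a : ℕ, m + 1 ≤ N + 2 * c + a → ∀ f : X → ℂ, HF k 1 f →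
      Low f m (2 * c) (4 * c + 2 * a) → ∃ g ∈ V, Low (f - g) m (2 * (c + 1)) 0 := by
  induction N with
  | zero =>
    intro a ha f hf hl
    have h1 := hf.low_of_large hl (by omega)
    exact ⟨0, V.zero_mem, by rw [sub_zero]; exact h1.succ_i (hf.gam_odd m ⟨c, rfl⟩)⟩
  | succ N ih =>
    intro a ha f hf hl
    by_cases hm : 2 * c + a ≤ m
    · obtain ⟨g, hg, h1⟩ := G.step hm V hV hmon hf hl
      obtain ⟨g', hg', h2⟩ := ih (a + 1) (by omega) (f - g) ((HFsub k 1).sub_mem hf (hV hg)) h1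
      exact ⟨g + g', V.add_mem hg hg', by rwa [← sub_sub]⟩
    · have h1 := hf.low_of_large hl (by omega)
      exact ⟨0, V.zero_mem, by rw [sub_zero]; exact h1.succ_i (hf.gam_odd m ⟨c, rfl⟩)⟩

lemma step_c (G : Gens A) {m : ℕ} (V : Submodule ℂ (X → ℂ))
    (hV : V ≤ HFsub k 1) (hmon : ∀ d, wt d = k → d 2 + d 3 + 2 * d 4 = m → mon A d ∈ V)
    (N : ℕ) : ∀ c : ℕ, m + 1 ≤ N + 2 * c → ∀ f : X → ℂ, HF k 1 f →
      Low f m (2 * c) 0 → ∃ g ∈ V, Low (f - g) (m + 1) 0 0 := by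
  induction N with
  | zero =>
    intro c hc f hf hl
    exact ⟨0, V.zero_mem, by rw [sub_zero]; exact hf.low_succ_m hl (by omega)⟩
  | succ N ih =>
    intro c hc f hf hl
    have h0 := hf.low_rot hl
    obtain ⟨g, hg, h1⟩ := G.step_a V hV hmon (m + 1) 0 (by omega) f hf (c := c) (by
      rwa [show 4 * c + 2 * 0 = 2 * (2 * c) by ring])
    obtain ⟨g', hg', h2⟩ := ih (c + 1) (by omega) (f - g) ((HFsub k 1).sub_mem hf (hV hg)) h1
    exact ⟨g + g', V.add_mem hg hg', by rwa [← sub_sub]⟩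

lemma steps (G : Gens A) {m0 : ℕ} (V : Submodule ℂ (X → ℂ))
    (hV : V ≤ HFsub k 1) (hmon : ∀ d, wt d = k → m0 ≤ d 2 + d 3 + 2 * d 4 → mon A d ∈ V)
    {f : X → ℂ} (hf : HF k 1 f) (hl : Low f m0 0 0) (t : ℕ) :
    ∃ g ∈ V, Low (f - g) (m0 + t) 0 0 := by
  induction t with
  | zero => exact ⟨0, V.zero_mem, by rwa [sub_zero]⟩
  | succ t ih =>
    obtain ⟨g, hg, h1⟩ := ih
    obtain ⟨g', hg', h2⟩ := G.step_c V hV (fun d hd hm => hmon d hd (by omega)) (m0 + t + 1) 0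
      (by omega) (f - g) ((HFsub k 1).sub_mem hf (hV hg)) h1
    exact ⟨g + g', V.add_mem hg hg', by rwa [← sub_sub]⟩

/-- Every form of weight `k` is a linear combination of monomials of weight `k`. -/
theorem mem_span (G : Gens A) {f : X → ℂ} (hf : HF k 1 f) :
    f ∈ Submodule.span ℂ (mon A '' {d | wt d = k}) := by
  have hV : Submodule.span ℂ (mon A '' {d | wt d = k}) ≤ HFsub k 1 := by
    rw [Submodule.span_le]
    rintro _ ⟨d, rfl, rfl⟩
    exact G.hf d
  have hneg : ∀ {f : X → ℂ}, HF k 1 f → Low f 0 0 0 := fun {f} hf =>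
    ⟨fun m' hm n r s => hf.cone _ fun hx => by
      have := hx.2.1; simp only [Nat.cast_zero] at this hm; omega,
      fun i' hi' => absurd hi' (Nat.not_lt_zero _), fun j' hj' => absurd hj' (Nat.not_lt_zero _)⟩
  obtain ⟨g, hg, hl⟩ := G.steps _ hV (fun d hd _ => Submodule.subset_span ⟨d, hd, rfl⟩) hf (hneg hf)
    (k.toNat + 1)
  have hfg : HF k 1 (f - g) := (HFsub k 1).sub_mem hf (hV hg)
  have hz : f - g = 0 := by
    funext ⟨n, r, s, m⟩
    obtain ⟨g', hg', hl'⟩ := G.steps (⊥ : Submodule ℂ (X → ℂ)) bot_le (fun d hd hm => by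
      exfalso; rw [wt] at hd; omega) hfg hl (m.toNat + 1)
    rw [Submodule.mem_bot] at hg'
    subst hg'
    rw [sub_zero] at hl'
    exact hl'.q m (by push_cast; omega) n r s
  rw [sub_eq_zero.1 hz]
  exact hg

end Gens

open PowerSeries hiding X exp

section
variable {K : Type*} [Field K]

/-- The order in the last variable of a monomial in the generators. -/
def mu (d : Fin 5 →₀ ℕ) : ℕ := d 2 + d 3 + 2 * d 4

/-- The exponents of the cuspidal generators. -/
def cusp (d : Fin 5 →₀ ℕ) : ℕ × ℕ × ℕ := (d 2, d 3, d 4)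

lemma eq_zero_of_forall_eval [Infinite K] (h24 : (24 : K) ≠ 0) (m : ℕ) (I : Finset (ℕ × ℕ × ℕ))
    (hI : ∀ i ∈ I, i.1 + i.2.1 + 2 * i.2.2 = m) (c : ℕ × ℕ × ℕ → K)
    (h : ∀ u w : K, ∑ i ∈ I, c i * ((u - 6) ^ i.1 * (u + 18) ^ i.2.1 * (w ^ 2) ^ i.2.2) = 0) :
    ∀ i ∈ I, c i = 0 := by
  set ex3 : ℕ × ℕ × ℕ → Fin 3 →₀ ℕ := fun i => Finsupp.equivFunOnFinite.symm ![i.1, i.2.1, 2 * i.2.2]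
    with hex
  have hinj : Injective ex3 := by
    rintro ⟨a, b, c⟩ ⟨a', b', c'⟩ hh
    have h0 : a = a' := DFunLike.congr_fun hh 0
    have h1 : b = b' := DFunLike.congr_fun hh 1
    have h2 : 2 * c = 2 * c' := DFunLike.congr_fun hh 2
    simp only [Prod.mk.injEq]; omega
  set P : MvPolynomial (Fin 3) K := ∑ i ∈ I, MvPolynomial.monomial (ex3 i) (c i) with hP
  have hev : ∀ f : Fin 3 → K, MvPolynomial.eval f P =
      ∑ i ∈ I, c i * (f 0 ^ i.1 * f 1 ^ i.2.1 * (f 2 ^ 2) ^ i.2.2) := by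
    intro f
    rw [hP, map_sum]
    refine sum_congr rfl fun i _ => ?_
    rw [MvPolynomial.eval_monomial, Finsupp.prod_fintype _ _ (fun _ => pow_zero _), Fin.prod_univ_three]
    simp [hex, pow_mul]
  have hmul : P * (MvPolynomial.X 1 - MvPolynomial.X 0) = 0 := by
    refine MvPolynomial.funext fun f => ?_
    rw [map_mul, map_sub, MvPolynomial.eval_X, MvPolynomial.eval_X, map_zero, hev]
    by_cases hf : f 1 - f 0 = 0
    · rw [hf, mul_zero]
    · set θ := 24 / (f 1 - f 0) with hθ
      have hθ0 : θ ≠ 0 := div_ne_zero h24 hf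
      have h1 := h (θ * f 0 + 6) (θ * f 2)
      have e2 : θ * f 0 + 6 + 18 = θ * f 1 := by
        rw [hθ]; field_simp; ring
      rw [add_sub_cancel_right, e2] at h1
      have : θ ^ m * ∑ i ∈ I, c i * (f 0 ^ i.1 * f 1 ^ i.2.1 * (f 2 ^ 2) ^ i.2.2) = 0 := by
        rw [← h1, mul_sum]
        refine sum_congr rfl fun i hi => ?_
        rw [← hI i hi]; ring
      rw [(mul_eq_zero.1 this).resolve_left (pow_ne_zero _ hθ0), zero_mul]
  have hX : (MvPolynomial.X 1 - MvPolynomial.X 0 : MvPolynomial (Fin 3) K) ≠ 0 := by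
    intro h0
    have := congrArg (MvPolynomial.eval ![(0 : K), 1, 0]) h0
    simp at this
  have hP0 := (mul_eq_zero.1 hmul).resolve_right hX
  intro i hi
  have := congrArg (MvPolynomial.coeff (ex3 i)) hP0
  rw [hP, MvPolynomial.coeff_sum, sum_eq_single i] at this
  · simpa using this
  · intro j _ hj
    rw [MvPolynomial.coeff_monomial, if_neg fun h => hj (hinj h)]
  · exact fun h => absurd hi h

/-- Leading-term data of the generators in one power series variable. -/
structure Slices (E : Fin 5 → PowerSeries K) (u w : K) : Prop where
  c0 : (E 0).constantCoeff = 1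
  c1 : (E 1).constantCoeff = 1
  c2 : (E 2).constantCoeff = u - 6
  c3 : (E 3).constantCoeff = u + 18
  c4 : (E 4).constantCoeff = w ^ 2
  d0 : coeff 1 (E 0) = 240
  d1 : coeff 1 (E 1) = -504

lemma pow_three_ne {E : Fin 5 → PowerSeries K} {u w : K} (h : Slices E u w) (h6 : (6 : K) ≠ 0) :
    E 0 ^ 3 ≠ E 1 ^ 2 := by
  intro he
  have := congrArg (coeff 1) he
  have hm : ∀ P R : PowerSeries K, coeff 1 (P * R) =
      P.constantCoeff * coeff 1 R + coeff 1 P * R.constantCoeff := by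
    intro P R
    rw [coeff_mul, Finset.Nat.sum_antidiagonal_succ]
    simp
  rw [pow_succ, pow_two, pow_two, hm, hm, hm] at this
  simp only [map_mul, h.c0, h.c1, h.d0, h.d1] at this
  have h2 : (6 : K) ^ 3 * 8 = 0 := by linear_combination this
  have h8 : (8 : K) ≠ 0 := by
    intro h8; apply h6
    have : (6 : K) ^ 3 = 0 := by linear_combination 27 * h8
    exact pow_eq_zero_iff (by norm_num) |>.1 this
  exact (mul_ne_zero (pow_ne_zero 3 h6) h8) h2

lemma indep_core [Infinite K] (h6 : (6 : K) ≠ 0) (k : ℤ) (m : ℕ) (D : Finset (Fin 5 →₀ ℕ))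
    (hk : ∀ d ∈ D, wt d = k) (hm : ∀ d ∈ D, mu d = m) (c : (Fin 5 →₀ ℕ) → K)
    (h : ∀ u w : K, ∃ E : Fin 5 → PowerSeries K, Slices E u w ∧
      ∑ d ∈ D, C (c d) *
        (E 0 ^ d 0 * E 1 ^ d 1 * (E 2 ^ d 2 * E 3 ^ d 3 * E 4 ^ d 4)) = 0) :
    ∀ d ∈ D, c d = 0 := by
  classical
  have h24 : (24 : K) ≠ 0 := by
    intro h24; apply h6
    have : (6 : K) ^ 2 * 2 = 0 := by linear_combination 3 * h24
    rcases mul_eq_zero.1 this with h | h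
    · exact pow_eq_zero_iff (by norm_num) |>.1 h
    · linear_combination 3 * h
  set I := D.image cusp with hI
  set H : ℕ × ℕ × ℕ → Polynomial K := fun i =>
    ∑ d ∈ D with cusp d = i, Polynomial.C (c d) * Polynomial.X ^ (d 0 + d 1) with hH
  have key : ∀ t : ℕ, ∀ i ∈ I, (Polynomial.X - Polynomial.C 1) ^ t ∣ H i := by
    intro t
    induction t with
    | zero => intro i _; simp
    | succ t ih =>
      have : ∀ i, ∃ P, i ∈ I → H i = (Polynomial.X - Polynomial.C 1) ^ t * P := by
        intro i
        by_cases hi : i ∈ I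
        · obtain ⟨P, hP⟩ := ih i hi
          exact ⟨P, fun _ => hP⟩
        · exact ⟨0, fun h => absurd h hi⟩
      choose P hP using this
      have hz : ∀ i ∈ I, (P i).eval 1 = 0 := by
        refine eq_zero_of_forall_eval h24 m I ?_ (fun i => (P i).eval 1) ?_
        · intro i hi
          obtain ⟨d, hd, rfl⟩ := mem_image.1 hi
          exact hm d hd
        · intro u w
          obtain ⟨E, hE, hsum⟩ := h u w
          have hu0 : E 0 * (E 0)⁻¹ = 1 := PowerSeries.mul_inv_cancel _ (by rw [hE.c0]; simp)
          have hu1 : E 1 * (E 1)⁻¹ = 1 := PowerSeries.mul_inv_cancel _ (by rw [hE.c1]; simp)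
          set v := E 1 * (E 0)⁻¹ with hv
          set ρ := E 0 ^ 3 * (E 1)⁻¹ ^ 2 with hρ
          have e0 : E 0 = v ^ 2 * ρ := by
            calc E 0 = E 0 * (E 1 * (E 1)⁻¹) ^ 2 * (E 0 * (E 0)⁻¹) ^ 2 := by rw [hu0, hu1]; ring
              _ = _ := by rw [hv, hρ]; ring
          have e1 : E 1 = v ^ 3 * ρ := by
            calc E 1 = E 1 * (E 1 * (E 1)⁻¹) ^ 2 * (E 0 * (E 0)⁻¹) ^ 3 := by rw [hu0, hu1]; ring
              _ = _ := by rw [hv, hρ]; ring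
          have hρ1 : ρ - 1 ≠ 0 := by
            intro h0
            apply pow_three_ne hE h6
            calc E 0 ^ 3 = ρ * E 1 ^ 2 := by
                  calc E 0 ^ 3 = E 0 ^ 3 * (E 1 * (E 1)⁻¹) ^ 2 := by rw [hu1]; ring
                    _ = _ := by rw [hρ]; ring
              _ = _ := by rw [sub_eq_zero.1 h0, one_mul]
          have cρ : ρ.constantCoeff = 1 := by
            rw [hρ]; simp [hE.c0, hE.c1]
          have cv : v.constantCoeff = 1 := by
            rw [hv]; simp [hE.c0, hE.c1]
          set ω : ℕ × ℕ × ℕ → ℕ := fun i => ((k - 10 * i.1 - 12 * i.2.1 - 18 * i.2.2) / 2).toNat with hω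
          set g : ℕ × ℕ × ℕ → PowerSeries K := fun i => E 2 ^ i.1 * E 3 ^ i.2.1 * E 4 ^ i.2.2 with hg
          have s1 : ∑ i ∈ I, v ^ ω i * Polynomial.aeval ρ (H i) * g i = 0 := by
            rw [← hsum, ← sum_fiberwise_of_maps_to (s := D) (t := I) (g := cusp)
              (fun d hd => mem_image_of_mem _ hd)]
            refine sum_congr rfl fun i _ => ?_
            rw [hH, map_sum, mul_sum, sum_mul]
            refine sum_congr rfl fun d hd => ?_
            obtain ⟨hd1, rfl⟩ := mem_filter.1 hd
            have hw : ω (cusp d) = 2 * d 0 + 3 * d 1 := by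
              have := hk d hd1
              rw [wt] at this
              simp only [hω, cusp]
              omega
            rw [map_mul, map_pow, Polynomial.aeval_X, Polynomial.aeval_C, hw, e0, e1, hg]
            simp only [cusp]
            rw [show algebraMap K (PowerSeries K) (c d) = C (c d) from rfl]
            ring
          have s2 : (ρ - 1) ^ t * ∑ i ∈ I, v ^ ω i * Polynomial.aeval ρ (P i) * g i = 0 := by
            rw [← s1, mul_sum]
            refine sum_congr rfl fun i hi => ?_
            rw [hP i hi, map_mul, map_pow, map_sub, Polynomial.aeval_X, Polynomial.aeval_C, map_one]
            ring
          have s3 := (mul_eq_zero.1 s2).resolve_left (pow_ne_zero _ hρ1)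
          have s4 := congrArg constantCoeff s3
          rw [map_sum, map_zero] at s4
          rw [← s4]
          refine sum_congr rfl fun i _ => ?_
          have hae : (Polynomial.aeval ρ (P i)).constantCoeff = (P i).eval 1 := by
            rw [Polynomial.aeval_def, Polynomial.hom_eval₂, cρ, Polynomial.eval,
              show (constantCoeff (R := K)).comp (algebraMap K (PowerSeries K)) = RingHom.id K by
                ext; simp]
          rw [map_mul, map_mul, map_pow, cv, one_pow, one_mul, hae, hg]
          simp only [map_mul, map_pow, hE.c2, hE.c3, hE.c4]
      intro i hi
      rw [hP i hi, pow_succ]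
      exact mul_dvd_mul_left _ (Polynomial.dvd_iff_isRoot.2 (hz i hi))
  intro d hd
  have hi : cusp d ∈ I := mem_image_of_mem _ hd
  have hH0 : H (cusp d) = 0 := by
    by_contra hne
    have := Polynomial.natDegree_le_of_dvd (key ((H (cusp d)).natDegree + 1) _ hi) hne
    rw [Polynomial.natDegree_pow, Polynomial.natDegree_X_sub_C] at this
    omega
  have := congrArg (fun R => Polynomial.coeff R (d 0 + d 1)) hH0
  simp only [hH, Polynomial.finsetSum_coeff, Polynomial.coeff_zero, Polynomial.coeff_C_mul,
    Polynomial.coeff_X_pow] at this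
  rw [sum_eq_single d] at this
  · simpa using this
  · intro d' hd' hne
    obtain ⟨hd1, hd2⟩ := mem_filter.1 hd'
    rw [if_neg, mul_zero]
    intro hs
    apply hne
    have w1 := hk d hd
    have w2 := hk d' hd1
    simp only [cusp, Prod.mk.injEq] at hd2
    obtain ⟨a1, a2, a3⟩ := hd2
    rw [wt] at w1 w2
    ext i
    fin_cases i <;> simp <;> omega
  · intro hh; exact (hh (mem_filter.2 ⟨hd, by rfl⟩)).elim

end

section
variable {S : Type*} [CommRing S]

/-- Support in the cone, over any ring. -/
def CSR (a : X → S) : Prop := ∀ x, ¬ Cone x → a x = 0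

/-- A square box. -/
def bx (N : ℤ) : Finset (ℤ × ℤ) := Finset.Icc (-N) N ×ˢ Finset.Icc (-N) N

/-- The indices of the convolution sum. -/
def cidx (x : X) : Finset ((ℕ × ℕ) × ℤ × ℤ) :=
  (range (x.2.2.2.toNat + 1) ×ˢ range (x.1.toNat + 1)) ×ˢ bx (x.1 + x.2.2.2)

/-- The embedding of the indices of the convolution sum. -/
def cemb : (ℕ × ℕ) × ℤ × ℤ ↪ X where
  toFun q := (q.1.2, q.2.1, q.2.2, q.1.1)
  inj' := by
    rintro ⟨⟨a, b⟩, c, d⟩ ⟨⟨a', b'⟩, c', d'⟩ h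
    simp only [Prod.mk.injEq, Nat.cast_inj] at h
    obtain ⟨rfl, rfl, rfl, rfl⟩ := h
    rfl

/-- Finite convolution, over any ring. -/
def convR (a b : X → S) (x : X) : S := ∑ q ∈ cidx x, a (cemb q) * b (x - cemb q)

lemma mem_cidx {x y : X} (hy : Cone y) (hxy : Cone (x - y)) : y ∈ (cidx x).map cemb := by
  obtain ⟨n, r, s, m⟩ := x
  obtain ⟨n', r', s', m'⟩ := y
  have b1 := hy.box
  obtain ⟨h1, h2, -⟩ := hy
  obtain ⟨h1', h2', -⟩ := hxy
  simp only [Prod.mk_sub_mk] at h1 h2 h1' h2'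
  lift n' to ℕ using h1
  lift m' to ℕ using h2
  rw [Finset.mem_map]
  refine ⟨((m', n'), r', s'), ?_, rfl⟩
  simp only [cidx, bx, mem_product, mem_range, mem_Icc]
  omega

lemma conv_eq_convR (ha : CS a) (hb : CS b) : conv a b = convR a b := by
  funext x
  rw [conv, convR, tsum_eq_sum (s := (cidx x).map cemb), sum_map]
  intro y hy
  by_contra h
  exact hy (mem_cidx (ha.cone (left_ne_zero_of_mul h)) (hb.cone (right_ne_zero_of_mul h)))

lemma CSR.cone {a : X → S} (hc : CSR a) {x : X} (h : a x ≠ 0) : Cone x := by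
  by_contra hx; exact h (hc x hx)

lemma CSR.convR {a b : X → S} (ha : CSR a) (hb : CSR b) : CSR (convR a b) := by
  intro x hx
  refine sum_eq_zero fun q _ => ?_
  by_contra h
  have h1 := ha.cone (left_ne_zero_of_mul h)
  have h2 := hb.cone (right_ne_zero_of_mul h)
  apply hx
  have := h1.add h2
  rwa [add_sub_cancel] at this

/-- The unit for convolution, over any ring. -/
def oneR (x : X) : S := if x = 0 then 1 else 0

lemma CSR.oneR : CSR (oneR (S := S)) := by
  intro x hx
  rw [KN.oneR, if_neg]
  rintro rfl
  exact hx ⟨le_rfl, le_rfl, by simp⟩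

/-- Convolution powers, over any ring. -/
def cpowR (a : X → S) : ℕ → X → S
  | 0 => oneR
  | n + 1 => convR a (cpowR a n)

lemma CSR.cpowR {a : X → S} (ha : CSR a) (n : ℕ) : CSR (cpowR a n) := by
  induction n with
  | zero => exact CSR.oneR
  | succ n ih => exact ha.convR ih

/-- Monomials, over any ring. -/
def monR (A : Fin 5 → X → S) (d : Fin 5 →₀ ℕ) : X → S :=
  convR (convR (convR (convR (cpowR (A 0) (d 0)) (cpowR (A 1) (d 1))) (cpowR (A 2) (d 2)))
    (cpowR (A 3) (d 3))) (cpowR (A 4) (d 4))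

lemma cpow_eq_cpowR (ha : CS a) (n : ℕ) : cpow a n = cpowR a n := by
  induction n with
  | zero => rfl
  | succ n ih => rw [cpow, cpowR, ih, conv_eq_convR ha (CSR.cpowR ha n)]

lemma mon_eq_monR (hA : ∀ i, CS (A i)) (d : Fin 5 →₀ ℕ) : mon A d = monR A d := by
  have c := fun i => CSR.cpowR (hA i) (d i)
  rw [mon, cpow_eq_cpowR (hA 0), cpow_eq_cpowR (hA 1), cpow_eq_cpowR (hA 2), cpow_eq_cpowR (hA 3),
    cpow_eq_cpowR (hA 4), conv_eq_convR (c 0) (c 1), conv_eq_convR (CSR.convR (c 0) (c 1)) (c 2),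
    conv_eq_convR ((CSR.convR (c 0) (c 1)).convR (c 2)) (c 3),
    conv_eq_convR (((CSR.convR (c 0) (c 1)).convR (c 2)).convR (c 3)) (c 4), monR]

variable {T : Type*} [CommRing T]

lemma map_convR (φ : S →+* T) (a b : X → S) :
    (fun x => φ (convR a b x)) = convR (fun x => φ (a x)) fun x => φ (b x) := by
  funext x; simp [convR]

lemma map_cpowR (φ : S →+* T) (a : X → S) (n : ℕ) :
    (fun x => φ (cpowR a n x)) = cpowR (fun x => φ (a x)) n := by
  induction n with
  | zero => funext x; simp [cpowR, oneR, apply_ite φ]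
  | succ n ih => simp only [cpowR]; rw [map_convR, ih]

lemma map_monR (φ : S →+* T) (A : Fin 5 → X → S) (d : Fin 5 →₀ ℕ) :
    (fun x => φ (monR A d x)) = monR (fun i x => φ (A i x)) d := by
  simp only [monR, map_convR, map_cpowR]

end

section
variable {K : Type*} [Field K]

/-- The sum of the coefficients with given diagonal. -/
def sl (f : X → K) (n m : ℤ) : K := ∑ p ∈ bx (n + m), f (n, p.1, p.2, m)

/-- The generating series of the slices. -/
def Ev (f : X → K) : PowerSeries (PowerSeries K) :=
  mk fun m => mk fun n => sl f n m

lemma CSR.mem_bx {f : X → K} (hf : CSR f) {n r s m N : ℤ} (h : f (n, r, s, m) ≠ 0) (hN : n + m ≤ N) :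
    (r, s) ∈ bx N := by
  have := (hf.cone h).box
  simp only [bx, mem_product, mem_Icc]
  omega

lemma sl_eq_finsum {f : X → K} (hf : CSR f) (n m : ℤ) {N : ℤ} (hN : n + m ≤ N) :
    ∑ p ∈ bx N, f (n, p.1, p.2, m) = ∑ᶠ p : ℤ × ℤ, f (n, p.1, p.2, m) := by
  rw [finsum_eq_sum_of_support_subset]
  intro p hp
  exact hf.mem_bx hp hN

lemma sum_shift_bx {g : X → K} (hg : CSR g) (n m N : ℤ) (p1 : ℤ × ℤ)
    (h : ∀ p2 : ℤ × ℤ, g (n, p2.1, p2.2, m) ≠ 0 → p1 + p2 ∈ bx N) :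
    ∑ p ∈ bx N, g (n, p.1 - p1.1, p.2 - p1.2, m) = sl g n m := by
  rw [sl, sl_eq_finsum hg n m le_rfl, ← finsum_comp_equiv (Equiv.subRight p1)]
  rw [finsum_eq_sum_of_support_subset (s := bx N)]
  · rfl
  · intro p hp
    have := h (p - p1) hp
    rwa [add_sub_cancel] at this

lemma Ev_convR {f g : X → K} (hf : CSR f) (hg : CSR g) : Ev (convR f g) = Ev f * Ev g := by
  ext m n
  rw [coeff_mul, map_sum]
  simp only [Ev, coeff_mk, coeff_mul]
  rw [Finset.Nat.sum_antidiagonal_eq_sum_range_succ_mk]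
  simp_rw [Finset.Nat.sum_antidiagonal_eq_sum_range_succ_mk]
  have h1 : sl (convR f g) n m = ∑ m1 ∈ range (m + 1), ∑ n1 ∈ range (n + 1),
      ∑ p1 ∈ bx (n + m), ∑ p ∈ bx (n + m), f (n1, p1.1, p1.2, m1) *
        g ((n : ℤ) - n1, p.1 - p1.1, p.2 - p1.2, (m : ℤ) - m1) := by
    simp only [sl, convR, cidx, Int.toNat_natCast]
    rw [sum_comm, sum_product, sum_product]
    rfl
  rw [h1]
  refine sum_congr rfl fun m1 hm1 => sum_congr rfl fun n1 hn1 => ?_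
  have hm1' := mem_range.1 hm1
  have hn1' := mem_range.1 hn1
  have e1 : sl f n1 m1 = ∑ p ∈ bx (n + m), f (n1, p.1, p.2, m1) := by
    rw [sl, sl_eq_finsum hf n1 m1 le_rfl, sl_eq_finsum hf n1 m1 (by omega)]
  rw [e1, sum_mul, Nat.cast_sub (by omega), Nat.cast_sub (by omega)]
  refine sum_congr rfl fun p1 _ => ?_
  rw [← mul_sum]
  by_cases h0 : f (n1, p1.1, p1.2, m1) = 0
  · simp [h0]
  rw [sum_shift_bx hg]
  intro p2 hp2
  have b1 := hf.mem_bx h0 le_rfl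
  have b2 := hg.mem_bx hp2 le_rfl
  simp only [bx, mem_product, mem_Icc, Prod.fst_add, Prod.snd_add] at b1 b2 ⊢
  omega

lemma Ev_oneR : Ev (oneR (S := K)) = 1 := by
  ext m n
  simp only [Ev, coeff_mk, coeff_one, sl, oneR]
  by_cases hm : m = 0
  · subst hm
    by_cases hn : n = 0
    · subst hn
      rw [sum_eq_single (0, 0)]
      · simp
      · rintro ⟨a, b⟩ _ h
        rw [if_neg]
        rintro h'
        simp only [Prod.ext_iff, Prod.fst_zero, Prod.snd_zero] at h'
        exact h (by simp [h'.2.1, h'.2.2.1])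
      · simp [bx]
    · rw [sum_eq_zero]
      · simp [coeff_one, hn]
      · intro p _
        rw [if_neg]
        intro h'
        simp [Prod.ext_iff, hn] at h'
  · rw [sum_eq_zero]
    · simp [hm]
    · intro p _
      rw [if_neg]
      intro h'
      simp [Prod.ext_iff, hm] at h'

lemma Ev_cpowR {f : X → K} (hf : CSR f) (n : ℕ) : Ev (cpowR f n) = Ev f ^ n := by
  induction n with
  | zero => simp [cpowR, Ev_oneR]
  | succ n ih => rw [cpowR, Ev_convR hf (hf.cpowR n), ih, pow_succ']

lemma Ev_monR {A : Fin 5 → X → K} (hA : ∀ i, CSR (A i)) (d : Fin 5 →₀ ℕ) : Ev (monR A d) =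
    Ev (A 0) ^ d 0 * Ev (A 1) ^ d 1 * Ev (A 2) ^ d 2 * Ev (A 3) ^ d 3 * Ev (A 4) ^ d 4 := by
  have c := fun i => CSR.cpowR (hA i) (d i)
  rw [monR, Ev_convR (((c 0).convR (c 1)).convR (c 2) |>.convR (c 3)) (c 4),
    Ev_convR (((c 0).convR (c 1)).convR (c 2)) (c 3), Ev_convR ((c 0).convR (c 1)) (c 2),
    Ev_convR (c 0) (c 1)]
  simp only [Ev_cpowR (hA _)]

/-- Twisting by a pair of nonzero scalars. -/
def tw (x0 y0 : K) (f : X → K) (x : X) : K := f x * (x0 ^ x.2.1 * y0 ^ x.2.2.1)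

lemma CSR.tw {f : X → K} (hf : CSR f) (x0 y0 : K) : CSR (tw x0 y0 f) := by
  intro x hx; rw [KN.tw, hf x hx, zero_mul]

lemma tw_convR {x0 y0 : K} (hx : x0 ≠ 0) (hy : y0 ≠ 0) (f g : X → K) :
    tw x0 y0 (convR f g) = convR (tw x0 y0 f) (tw x0 y0 g) := by
  funext x
  simp only [tw, convR, sum_mul]
  refine sum_congr rfl fun q _ => ?_
  have e1 : x0 ^ x.2.1 = x0 ^ (cemb q).2.1 * x0 ^ (x - cemb q).2.1 := by
    rw [← zpow_add₀ hx]; congr 1; simp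
  have e2 : y0 ^ x.2.2.1 = y0 ^ (cemb q).2.2.1 * y0 ^ (x - cemb q).2.2.1 := by
    rw [← zpow_add₀ hy]; congr 1; simp
  rw [e1, e2]; ring

lemma tw_cpowR {x0 y0 : K} (hx : x0 ≠ 0) (hy : y0 ≠ 0) (f : X → K) (n : ℕ) :
    tw x0 y0 (cpowR f n) = cpowR (tw x0 y0 f) n := by
  induction n with
  | zero =>
    funext x
    simp only [cpowR, tw, oneR]
    split_ifs with h
    · simp [h]
    · simp
  | succ n ih => rw [cpowR, tw_convR hx hy, ih, cpowR]

lemma tw_monR {x0 y0 : K} (hx : x0 ≠ 0) (hy : y0 ≠ 0) (A : Fin 5 → X → K) (d : Fin 5 →₀ ℕ) :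
    tw x0 y0 (monR A d) = monR (fun i => tw x0 y0 (A i)) d := by
  simp only [monR, tw_convR hx hy, tw_cpowR hx hy]

end

section
variable {K : Type*} [Field K]

/-- The leading coefficients of the five generators, over a field. -/
structure LeadCoeffs (F : Fin 5 → X → K) (f9 : X → K) : Prop where
  csr : ∀ i, CSR (F i)
  csr9 : CSR f9
  a0 : F 0 0 = 1
  b0 : F 0 (1, 0, 0, 0) = 240
  a1 : F 1 0 = 1
  b1 : F 1 (1, 0, 0, 0) = -504
  z2 : ∀ n r s m, n ≤ 0 ∨ m ≤ 0 → F 2 (n, r, s, m) = 0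
  z3 : ∀ n r s m, n ≤ 0 ∨ m ≤ 0 → F 3 (n, r, s, m) = 0
  z9 : ∀ n r s m, n ≤ 0 ∨ m ≤ 0 → f9 (n, r, s, m) = 0
  l2 : ∀ r s : ℤ, F 2 (1, r, s, 1) =
    if r ^ 2 + r * s + s ^ 2 = 0 then -6 else if r ^ 2 + r * s + s ^ 2 = 1 then 1 else 0
  l3 : ∀ r s : ℤ, F 3 (1, r, s, 1) =
    if r ^ 2 + r * s + s ^ 2 = 0 then 18 else if r ^ 2 + r * s + s ^ 2 = 1 then 1 else 0
  l9 : ∀ r s : ℤ, f9 (1, r, s, 1) =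
    if r ^ 2 + r * s + s ^ 2 = 1 then (if (r - s) % 3 = 1 then 1 else -1) else 0
  sq : F 4 = convR f9 f9

lemma exists_torus_point [IsAlgClosed K] (h6 : (6 : K) ≠ 0) (u w : K) : ∃ x y : K, x ≠ 0 ∧ y ≠ 0 ∧
    (x + x⁻¹ * y + y⁻¹) + (y + x⁻¹ + x * y⁻¹) = u ∧
    (x + x⁻¹ * y + y⁻¹) - (y + x⁻¹ + x * y⁻¹) = w := by
  have h2 : (2 : K) ≠ 0 := by
    intro h; apply h6; linear_combination 3 * h
  set s : K := (u + w) / 2 with hs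
  set s' : K := (u - w) / 2 with hs'
  obtain ⟨x1, hx1⟩ : ∃ x1 : K, x1 ^ 3 - s * x1 ^ 2 + s' * x1 - 1 = 0 := by
    obtain ⟨x, hx⟩ := IsAlgClosed.exists_root
      (Polynomial.X ^ 3 + (Polynomial.C (-s) * Polynomial.X ^ 2 + Polynomial.C s' * Polynomial.X
        + Polynomial.C (-1)) : Polynomial K) (by
        rw [Polynomial.degree_add_eq_left_of_degree_lt] <;> rw [Polynomial.degree_X_pow]
        · norm_num
        · exact lt_of_le_of_lt Polynomial.degree_quadratic_le (by norm_num))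
    refine ⟨x, ?_⟩
    simp only [Polynomial.IsRoot, Polynomial.eval_add, Polynomial.eval_mul, Polynomial.eval_pow,
      Polynomial.eval_X, Polynomial.eval_C] at hx
    linear_combination hx
  have h1 : x1 ≠ 0 := by rintro rfl; simp at hx1
  obtain ⟨x2, hx2⟩ : ∃ x2 : K, x2 ^ 2 - (s - x1) * x2 + x1⁻¹ = 0 := by
    obtain ⟨x, hx⟩ := IsAlgClosed.exists_root
      (Polynomial.X ^ 2 + (Polynomial.C (-(s - x1)) * Polynomial.X
        + Polynomial.C (x1⁻¹)) : Polynomial K) (by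
        rw [Polynomial.degree_add_eq_left_of_degree_lt] <;> rw [Polynomial.degree_X_pow]
        · norm_num
        · exact lt_of_le_of_lt Polynomial.degree_linear_le (by norm_num))
    refine ⟨x, ?_⟩
    simp only [Polynomial.IsRoot, Polynomial.eval_add, Polynomial.eval_mul, Polynomial.eval_pow,
      Polynomial.eval_X, Polynomial.eval_C] at hx
    linear_combination hx
  have hx2' : x1 * (x2 * (s - x1 - x2)) = 1 := by
    have := congrArg (x1 * ·) hx2
    simp only [mul_add, mul_sub, mul_inv_cancel₀ h1, mul_zero] at this
    linear_combination -this
  set x3 := s - x1 - x2 with hx3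
  have h22 : x2 ≠ 0 := by rintro h; simp [h] at hx2'
  have h33 : x3 ≠ 0 := by rintro h; simp [h] at hx2'
  have e2 : x1⁻¹ * x3⁻¹ = x2 := by
    field_simp; linear_combination -hx2'
  have e3 : x1⁻¹ = x2 * x3 := by
    field_simp; linear_combination -hx2'
  have e4 : x3⁻¹ = x1 * x2 := by
    field_simp; linear_combination -hx2'
  have s1 : x1 + x2 + x3 = s := by rw [hx3]; ring
  have s2 : x1 * x2 + x2 * x3 + x1 * x3 = s' := by
    have : x1 * (x1 * x2 + x2 * x3 + x1 * x3 - s') = 0 := by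
      rw [← s1] at hx1
      linear_combination hx2' - hx1
    rcases mul_eq_zero.1 this with h | h
    · exact absurd h h1
    · linear_combination h
  refine ⟨x1, x3⁻¹, h1, inv_ne_zero h33, ?_, ?_⟩
  · rw [e2, inv_inv, e3, e4]
    have : s + s' = u := by rw [hs, hs']; field_simp; ring
    linear_combination s1 + s2 + this
  · rw [e2, inv_inv, e3, e4]
    have : s - s' = w := by rw [hs, hs']; field_simp; ring
    linear_combination s1 - s2 + this

lemma extract_min {S : Type*} [CommRing S] [IsDomain S] {ι : Type*} (D : Finset ι) (a : ι → S)
    (H : ι → PowerSeries S) (μ : ι → ℕ) (m : ℕ) (hm : ∀ d ∈ D, m ≤ μ d)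
    (h : ∑ d ∈ D, C (a d) * (H d * PowerSeries.X ^ μ d) = 0) :
    ∑ d ∈ D with μ d = m, a d * (H d).constantCoeff = 0 := by
  have h1 : PowerSeries.X ^ m *
      ∑ d ∈ D, C (a d) * (H d * PowerSeries.X ^ (μ d - m)) = 0 := by
    rw [← h, mul_sum]
    refine sum_congr rfl fun d hd => ?_
    conv_rhs => rw [← Nat.sub_add_cancel (hm d hd), pow_add]
    ring
  have h2 := (mul_eq_zero.1 h1).resolve_left (pow_ne_zero _ X_ne_zero)
  have h3 := congrArg constantCoeff h2
  rw [map_sum, map_zero] at h3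
  rw [← h3, sum_filter]
  refine sum_congr rfl fun d hd => ?_
  have := hm d hd
  split_ifs with hmu
  · simp [hmu]
  · have : μ d - m ≠ 0 := by omega
    simp [this]

lemma sl_zero_zero (f : X → K) : sl f 0 0 = f 0 := by
  simp [sl, bx]; rfl

lemma sl_one_zero {f : X → K} (hf : CSR f) : sl f 1 0 = f (1, 0, 0, 0) := by
  rw [sl, sum_eq_single (0, 0)]
  · rintro ⟨r, s⟩ _ h
    refine hf _ fun ⟨_, _, h3⟩ => h ?_
    simp only at h3
    have : r = 0 := by nlinarith [sq_nonneg (r + 2 * s)]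
    have : s = 0 := by nlinarith [sq_nonneg (2 * r + s)]
    simp [*]
  · simp [bx]

lemma sum_bx_two (f : ℤ × ℤ → K) (h : ∀ r s : ℤ, 1 < r ^ 2 + r * s + s ^ 2 → f (r, s) = 0) :
    ∑ p ∈ bx 2, f p = f (0, 0) + (f (1, 0) + f (-1, 1) + f (0, -1))
      + (f (0, 1) + f (-1, 0) + f (1, -1)) := by
  have : ({(0, 0), (1, 0), (-1, 1), (0, -1), (0, 1), (-1, 0), (1, -1)} : Finset (ℤ × ℤ)) ⊆ bx 2 := by
    decide
  rw [← sum_subset this]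
  · simp [sum_insert]
    ring
  · rintro ⟨r, s⟩ h1 h2
    apply h
    simp only [bx, mem_product, mem_Icc] at h1
    obtain ⟨⟨a1, a2⟩, a3, a4⟩ := h1
    revert h2
    interval_cases r <;> interval_cases s <;> decide

/-- Shifting out one factor of the outer variable. -/
def Ev1 (f : X → K) : PowerSeries (PowerSeries K) :=
  mk fun m => mk fun n => sl f n (m + 1)

lemma Ev_eq_X_mul {f : X → K} (h : ∀ n r s m, n ≤ 0 ∨ m ≤ 0 → f (n, r, s, m) = 0) :
    Ev f = Ev1 f * PowerSeries.X := by
  ext m n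
  cases m with
  | zero =>
    simp [Ev, sl, h _ _ _ 0 (Or.inr le_rfl)]
  | succ m => simp [Ev, Ev1, coeff_succ_mul_X]

lemma constantCoeff_Ev1 {f : X → K} (h : ∀ n r s m, n ≤ 0 ∨ m ≤ 0 → f (n, r, s, m) = 0) :
    (Ev1 f).constantCoeff = (mk fun n => sl f (n + 1) 1) * PowerSeries.X := by
  ext n
  cases n with
  | zero =>
    rw [coeff_zero_mul_X, ← coeff_zero_eq_constantCoeff_apply]
    simp [Ev1, sl, h 0 _ _ _ (Or.inl le_rfl), -coeff_zero_eq_constantCoeff]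
  | succ n =>
    rw [coeff_succ_mul_X, ← coeff_zero_eq_constantCoeff_apply]
    simp [Ev1]

theorem indep [IsAlgClosed K] (h6 : (6 : K) ≠ 0) {F : Fin 5 → X → K} {f9 : X → K}
    (L : LeadCoeffs F f9) (k : ℤ) (D : Finset (Fin 5 →₀ ℕ)) (hk : ∀ d ∈ D, wt d = k)
    (c : (Fin 5 →₀ ℕ) → K) (h : ∀ x, ∑ d ∈ D, c d * monR F d x = 0) : ∀ d ∈ D, c d = 0 := by
  classical
  by_contra hcon
  push Not at hcon
  obtain ⟨d0, hd0, hc0⟩ := hcon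
  set D1 := D.filter (fun d => c d ≠ 0) with hD1
  have hne : D1.Nonempty := ⟨d0, mem_filter.2 ⟨hd0, hc0⟩⟩
  obtain ⟨d1, hd1, hmin⟩ := D1.exists_min_image mu hne
  refine (mem_filter.1 hd1).2 ?_
  refine indep_core h6 k (mu d1) (D1.filter fun d => mu d = mu d1)
    (fun d hd => hk d (mem_filter.1 (mem_filter.1 hd).1).1)
    (fun d hd => (mem_filter.1 hd).2) c ?_ d1 (mem_filter.2 ⟨hd1, rfl⟩)
  intro u w
  obtain ⟨x, y, hx, hy, hu, hw⟩ := exists_torus_point h6 u w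
  have hcs : ∀ i, CSR (tw x y (F i)) := fun i => (L.csr i).tw x y
  have z2 : ∀ n r s m, n ≤ 0 ∨ m ≤ 0 → tw x y (F 2) (n, r, s, m) = 0 := fun n r s m h => by
    rw [tw, L.z2 n r s m h, zero_mul]
  have z3 : ∀ n r s m, n ≤ 0 ∨ m ≤ 0 → tw x y (F 3) (n, r, s, m) = 0 := fun n r s m h => by
    rw [tw, L.z3 n r s m h, zero_mul]
  have z9 : ∀ n r s m, n ≤ 0 ∨ m ≤ 0 → tw x y f9 (n, r, s, m) = 0 := fun n r s m h => by
    rw [tw, L.z9 n r s m h, zero_mul]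
  have e4 : Ev (tw x y (F 4)) = Ev (tw x y f9) ^ 2 := by
    rw [L.sq, tw_convR hx hy, Ev_convR (L.csr9.tw x y) (L.csr9.tw x y), sq]
  have key : ∀ d, Ev (tw x y (monR F d)) = (Ev (tw x y (F 0)) ^ d 0 * Ev (tw x y (F 1)) ^ d 1 *
      (Ev1 (tw x y (F 2)) ^ d 2 * Ev1 (tw x y (F 3)) ^ d 3 * (Ev1 (tw x y f9) ^ 2) ^ d 4))
      * PowerSeries.X ^ mu d := by
    intro d
    rw [tw_monR hx hy, Ev_monR hcs, e4, Ev_eq_X_mul z2, Ev_eq_X_mul z3, Ev_eq_X_mul z9, mu]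
    ring
  have hsum : ∑ d ∈ D1, C (C (c d)) * Ev (tw x y (monR F d)) = 0 := by
    ext m n
    simp only [map_sum, coeff_C_mul, map_zero, Ev, coeff_mk, sl,
      mul_sum]
    rw [sum_comm]
    refine sum_eq_zero fun q _ => ?_
    simp only [tw, ← mul_assoc, ← sum_mul]
    have := h (n, q.1, q.2, m)
    rw [← sum_filter_of_ne (p := fun d => c d ≠ 0)
      (fun d _ hd => left_ne_zero_of_mul hd)] at this
    rw [hD1, this, zero_mul, zero_mul]
  simp only [key] at hsum
  have h2 := extract_min D1 (fun d => C (c d)) _ mu (mu d1) hmin hsum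
  let E : Fin 5 → PowerSeries K := ![(Ev (tw x y (F 0))).constantCoeff,
    (Ev (tw x y (F 1))).constantCoeff, mk fun n => sl (tw x y (F 2)) (n + 1) 1,
    mk fun n => sl (tw x y (F 3)) (n + 1) 1,
    (mk fun n => sl (tw x y f9) (n + 1) 1) ^ 2]
  refine ⟨E, ?_, ?_⟩
  · have c0 : ∀ f : X → K, ((Ev f).constantCoeff).constantCoeff = f 0 := fun f => by
      rw [← coeff_zero_eq_constantCoeff_apply,
        ← coeff_zero_eq_constantCoeff_apply]
      simp [Ev, sl_zero_zero]
    have c1 : ∀ f : X → K, CSR f → coeff 1 ((Ev f).constantCoeff) = f (1, 0, 0, 0) :=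
      fun f hf => by
      rw [← coeff_zero_eq_constantCoeff_apply]
      simp [Ev, sl_one_zero hf]
    have c2 : ∀ f : X → K, (mk fun n : ℕ => sl f (n + 1) 1).constantCoeff
        = ∑ p ∈ bx 2, f (1, p.1, p.2, 1) := fun f => by
      rw [← coeff_zero_eq_constantCoeff_apply]
      simp [sl]
    have hz : ∀ r s : ℤ, 1 < r ^ 2 + r * s + s ^ 2 → ¬ (r ^ 2 + r * s + s ^ 2 = 0) ∧
      ¬ (r ^ 2 + r * s + s ^ 2 = 1) := fun r s h => by omega
    constructor
    · simp [E, c0, tw, L.a0]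
    · simp [E, c0, tw, L.a1]
    · simp only [E, Fin.isValue, Matrix.cons_val, c2]
      rw [sum_bx_two _ fun r s h => by
        simp only [tw, L.l2, if_neg (hz r s h).1, if_neg (hz r s h).2, zero_mul]]
      simp only [tw, L.l2]
      norm_num
      linear_combination hu
    · simp only [E, Fin.isValue, Matrix.cons_val, c2]
      rw [sum_bx_two _ fun r s h => by
        simp only [tw, L.l3, if_neg (hz r s h).1, if_neg (hz r s h).2, zero_mul]]
      simp only [tw, L.l3]
      norm_num
      linear_combination hu
    · simp only [E, Fin.isValue, Matrix.cons_val, map_pow, c2]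
      rw [sum_bx_two _ fun r s h => by
        simp only [tw, L.l9, if_neg (hz r s h).2, zero_mul]]
      simp only [tw, L.l9]
      norm_num
      rw [← hw]
      ring
    · simp [E, c1 _ (hcs 0), tw, L.b0]
    · simp [E, c1 _ (hcs 1), tw, L.b1]
  · have h3 : PowerSeries.X ^ (mu d1) * ∑ d ∈ D1 with mu d = mu d1, C (c d) *
        (E 0 ^ d 0 * E 1 ^ d 1 * (E 2 ^ d 2 * E 3 ^ d 3 * E 4 ^ d 4)) = 0 := by
      rw [← h2, mul_sum]
      refine sum_congr rfl fun d hd => ?_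
      rw [← (mem_filter.1 hd).2, mu]
      simp only [map_mul, map_pow, constantCoeff_Ev1 z2, constantCoeff_Ev1 z3, constantCoeff_Ev1 z9,
        E, Fin.isValue, Matrix.cons_val]
      ring
    exact (mul_eq_zero.1 h3).resolve_left (pow_ne_zero _ X_ne_zero)

end

/-- The norm form `r² + rs + s²`. -/
def nrm (p : ℤ × ℤ) : ℤ := p.1 ^ 2 + p.1 * p.2 + p.2 ^ 2

lemma nrm_nonneg (p : ℤ × ℤ) : 0 ≤ nrm p := by
  unfold nrm; nlinarith [sq_nonneg (p.1 + p.2), sq_nonneg p.1, sq_nonneg p.2]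

/-- The terms of the theta series. -/
def tt (τ t σ : ℂ) (p : ℤ × ℤ) : ℂ := ex (nrm p * τ / 3 + p.1 * t + (p.1 + 2 * p.2) * σ)

/-- The theta series of the cosets of the norm form. -/
def vth (j : ℤ) (τ t σ : ℂ) : ℂ := ∑' p : ℤ × ℤ, if (3 : ℤ) ∣ p.1 - p.2 - j then tt τ t σ p else 0

lemma jterm_eq (n : ℤ) (z τ : ℂ) : jacobiTheta₂_term n z τ = ex (n * z + n ^ 2 * τ / 2) := by
  rw [jacobiTheta₂_term, ex]; congr 1; ring

lemma summable_jterm (z : ℂ) (hτ : 0 < τ.im) : Summable (jacobiTheta₂_term · z τ) :=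
  (summable_jacobiTheta₂_term_iff z τ).2 hτ

lemma div_im_pos (hτ : 0 < τ.im) {c : ℝ} (hc : 0 < c) : 0 < (τ / c).im := by
  rw [div_ofReal_im]; positivity

lemma tt_eq (τ t σ : ℂ) (p : ℤ × ℤ) : tt τ t σ p =
    jacobiTheta₂_term p.1 t (τ / 2) * jacobiTheta₂_term (p.1 + 2 * p.2) σ (τ / 6) := by
  rw [jterm_eq, jterm_eq, ← ex_add, tt, nrm]; congr 1; push_cast; ring

lemma inj_parity : Injective fun p : ℤ × ℤ => (p.1, p.1 + 2 * p.2) := by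
  rintro ⟨a, b⟩ ⟨c, d⟩ h
  simp only [Prod.mk.injEq] at h ⊢
  omega

lemma summable_tt (hτ : 0 < τ.im) (t σ : ℂ) : Summable (tt τ t σ) := by
  have h1 := summable_jterm t (τ := τ / 2) (by simpa using div_im_pos hτ (c := 2) two_pos)
  have h2 := summable_jterm σ (τ := τ / 6) (by simpa using div_im_pos hτ (c := 6) (by norm_num))
  have := (summable_mul_of_summable_norm h1.norm h2.norm).comp_injective inj_parity
  refine this.congr fun p => ?_
  rw [tt_eq]; rfl

lemma summable_vth (hτ : 0 < τ.im) (t σ : ℂ) (j : ℤ) :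
    Summable fun p : ℤ × ℤ => if (3 : ℤ) ∣ p.1 - p.2 - j then tt τ t σ p else 0 := by
  refine Summable.of_norm_bounded (summable_tt hτ t σ).norm fun p => ?_
  split_ifs <;> simp

lemma sgn_mul_jterm (n : ℤ) (z τ : ℂ) :
    (-1) ^ n * jacobiTheta₂_term n z τ = jacobiTheta₂_term n (z + 1 / 2) τ := by
  have : (-1 : ℂ) ^ n = ex (n / 2) := by
    rw [ex, show 2 * (π : ℂ) * I * (n / 2) = n * (π * I) by ring, exp_int_mul,
      exp_pi_mul_I]
  rw [this, jterm_eq, jterm_eq, ← ex_add]; congr 1; ring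

lemma tsum_parity {f g : ℤ → ℂ} (hf : Summable f) (hg : Summable g) :
    ∑' p : ℤ × ℤ, f p.1 * g (p.1 + 2 * p.2) = ((∑' n, f n) * (∑' n, g n)
      + (∑' n : ℤ, (-1) ^ n * f n) * (∑' n : ℤ, (-1) ^ n * g n)) / 2 := by
  have sg : ∀ {f : ℤ → ℂ}, Summable f → Summable fun n : ℤ => (-1) ^ n * f n := by
    intro f hf
    refine Summable.of_norm_bounded hf.norm fun n => ?_
    simp
  rw [tsum_mul_tsum_of_summable_norm hf.norm hg.norm,
    tsum_mul_tsum_of_summable_norm (sg hf).norm (sg hg).norm,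
    ← Summable.tsum_add (summable_mul_of_summable_norm hf.norm hg.norm)
      (summable_mul_of_summable_norm (sg hf).norm (sg hg).norm), ← tsum_div_const]
  refine Eq.trans ?_ (inj_parity.tsum_eq (f := fun x : ℤ × ℤ => (f x.1 * g x.2 +
    (-1) ^ x.1 * f x.1 * ((-1) ^ x.2 * g x.2)) / 2) ?_)
  · refine tsum_congr fun p => ?_
    have : (-1 : ℂ) ^ (p.1 + 2 * p.2) = (-1) ^ p.1 := by
      rw [zpow_add₀ (by norm_num), _root_.zpow_mul]; norm_num
    have h2 : (-1 : ℂ) ^ p.1 * (-1) ^ p.1 = 1 := by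
      rw [← zpow_add₀ (by norm_num), ← two_mul, _root_.zpow_mul]; norm_num
    rw [this]
    linear_combination (-1 / 2 * f p.1 * g (p.1 + 2 * p.2)) * h2
  · rintro ⟨r, y⟩ h
    rcases Int.even_or_odd (y - r) with ⟨s, hs⟩ | ⟨s, hs⟩
    · exact ⟨(r, s), Prod.ext rfl (by dsimp only; omega)⟩
    · exfalso
      apply h
      have h1 : (-1 : ℂ) ^ y = - (-1) ^ r := by
        rw [show y = r + 2 * s + 1 by omega, zpow_add₀ (by norm_num), zpow_add₀ (by norm_num),
          _root_.zpow_mul]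
        norm_num
      have h2 : (-1 : ℂ) ^ r * (-1) ^ r = 1 := by
        rw [← zpow_add₀ (by norm_num), ← two_mul, _root_.zpow_mul]; norm_num
      simp only [h1]
      linear_combination (-1 / 2 * f r * g y) * h2

lemma tsum_class {F : ℤ × ℤ → ℂ} (hF : Summable F) (j : ℤ) :
    ∑' p : ℤ × ℤ, (if (3 : ℤ) ∣ p.1 - p.2 + j then F p else 0) =
      (∑' q : ℤ × ℤ, F (2 * q.1 + 0, 3 * q.2 + 0 + j - q.1))
        + ∑' q : ℤ × ℤ, F (2 * q.1 + 1, 3 * q.2 + 1 + j - q.1) := by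
  have key : ∀ e : ℤ, (e = 0 ∨ e = 1) → ∑' q : ℤ × ℤ, F (2 * q.1 + e, 3 * q.2 + e + j - q.1)
      = ∑' p : ℤ × ℤ, if (3 : ℤ) ∣ p.1 - p.2 + j ∧ p.1 % 2 = e then F p else 0 := by
    intro e he
    have inj : Injective fun q : ℤ × ℤ => ((2 * q.1 + e, 3 * q.2 + e + j - q.1) : ℤ × ℤ) := by
      rintro ⟨a, b⟩ ⟨c, d⟩ h
      simp only [Prod.mk.injEq] at h ⊢
      omega
    refine Eq.trans ?_ (inj.tsum_eq (f := fun p : ℤ × ℤ =>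
      if (3 : ℤ) ∣ p.1 - p.2 + j ∧ p.1 % 2 = e then F p else 0) ?_)
    · refine tsum_congr fun q => ?_
      rw [if_pos]
      constructor
      · exact ⟨q.1 - q.2, by ring⟩
      · omega
    · rintro ⟨r, s⟩ h
      have h' : (3 : ℤ) ∣ r - s + j ∧ r % 2 = e := by
        by_contra hc
        exact h (if_neg hc)
      obtain ⟨⟨w, hw⟩, h2⟩ := h'
      exact ⟨(r / 2, r / 2 - w), by simp only [Prod.mk.injEq]; omega⟩
  have hs : ∀ e : ℤ, Summable fun p : ℤ × ℤ =>
      if (3 : ℤ) ∣ p.1 - p.2 + j ∧ p.1 % 2 = e then F p else 0 := fun e => by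
    refine Summable.of_norm_bounded hF.norm fun p => ?_
    split_ifs <;> simp
  rw [key 0 (Or.inl rfl), key 1 (Or.inr rfl), ← Summable.tsum_add (hs 0) (hs 1)]
  refine tsum_congr fun p => ?_
  rcases Int.emod_two_eq p.1 with h | h <;> simp [h]

lemma cpow_half_real_mul {r : ℝ} (hr : 0 < r) {w : ℂ} (hw : w ≠ 0) :
    ((r : ℂ) * w) ^ (1 / 2 : ℂ) = (Real.sqrt r : ℂ) * w ^ (1 / 2 : ℂ) := by
  rw [cpow_def_of_ne_zero (mul_ne_zero (by exact_mod_cast hr.ne') hw),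
    cpow_def_of_ne_zero hw, log_ofReal_mul hr hw, add_mul, exp_add,
    Real.sqrt_eq_rpow, Real.rpow_def_of_pos hr]
  push_cast
  rfl

lemma jtheta_inv (z : ℂ) (hτ : 0 < τ.im) : jacobiTheta₂ (z / τ) (-1 / τ) =
    (-I * τ) ^ (1 / 2 : ℂ) * ex (z ^ 2 / (2 * τ)) * jacobiTheta₂ z τ := by
  have h0 : τ ≠ 0 := by rintro rfl; simp at hτ
  have h1 : (-I * τ) ^ (1 / 2 : ℂ) ≠ 0 := by
    rw [cpow_ne_zero_iff]; simp [h0]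
  have h2 : ex (z ^ 2 / (2 * τ)) * exp (-π * I * z ^ 2 / τ) = 1 := by
    rw [ex, ← exp_add, ← exp_zero]; congr 1; field_simp; ring
  rw [jacobiTheta₂_functional_equation z τ]
  have h3 := mul_one_div_cancel h1
  linear_combination (-jacobiTheta₂ (z / τ) (-1 / τ)) * ((-I * τ) ^ (1 / 2 : ℂ) *
    (1 / (-I * τ) ^ (1 / 2 : ℂ))) * h2 - jacobiTheta₂ (z / τ) (-1 / τ) * h3

/-- The dual form of the theta transformation formula. -/
lemma theta_dual (hτ : 0 < τ.im) (t σ : ℂ) (j : ℤ) :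
    ∑' p : ℤ × ℤ, ex (j * (p.1 + 2 * p.2) / 3) * tt (-1 / τ) (t / τ) (σ / τ) p =
      -I * √3 * τ * ex ((t ^ 2 + 3 * σ ^ 2) / τ) * vth (-j) τ t σ := by
  have h0 : τ ≠ 0 := by rintro rfl; simp at hτ
  have hn : 0 < (-1 / τ).im := im_neg_inv_pos hτ
  have i2 : 0 < (2 * τ).im := by simpa using hτ
  have i6 : 0 < (6 * τ).im := by simpa using hτ
  have n2 : -1 / (2 * τ) = (-1 / τ) / 2 := by field_simp
  have n6 : -1 / (6 * τ) = (-1 / τ) / 6 := by field_simp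
  have s2 := fun z => summable_jterm z (τ := -1 / (2 * τ)) (im_neg_inv_pos i2)
  have s6 := fun z => summable_jterm z (τ := -1 / (6 * τ)) (im_neg_inv_pos i6)
  have hL : ∀ p : ℤ × ℤ, ex (j * (p.1 + 2 * p.2) / 3) * tt (-1 / τ) (t / τ) (σ / τ) p =
      jacobiTheta₂_term p.1 (t / τ) (-1 / (2 * τ)) *
        jacobiTheta₂_term (p.1 + 2 * p.2) (σ / τ + j / 3) (-1 / (6 * τ)) := by
    intro p
    rw [tt_eq, n2, n6, mul_left_comm, jterm_eq _ (σ / τ), jterm_eq _ (σ / τ + j / 3), ← ex_add]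
    congr 2; push_cast; ring
  simp_rw [hL]
  rw [tsum_parity (s2 _) (s6 _)]
  simp_rw [sgn_mul_jterm]
  have hv : vth (-j) τ t σ = ∑' p : ℤ × ℤ, if (3 : ℤ) ∣ p.1 - p.2 + j then tt τ t σ p else 0 := by
    simp [vth]
  rw [hv, tsum_class (summable_tt hτ t σ)]
  have hA : ∀ e : ℤ, ∑' q : ℤ × ℤ, tt τ t σ (2 * q.1 + e, 3 * q.2 + e + j - q.1) =
      ex (e ^ 2 * τ / 4 + e * t) * jacobiTheta₂ (2 * t + e * τ) (2 * τ) *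
        (ex ((3 * e + 2 * j) ^ 2 * τ / 12 + (3 * e + 2 * j) * σ) *
          jacobiTheta₂ (6 * σ + (3 * e + 2 * j) * τ) (6 * τ)) := by
    intro e
    rw [mul_mul_mul_comm, ← ex_add, jacobiTheta₂, jacobiTheta₂, tsum_mul_tsum_of_summable_norm
      (summable_jterm _ i2).norm (summable_jterm _ i6).norm, ← tsum_mul_left]
    refine tsum_congr fun q => ?_
    rw [jterm_eq, jterm_eq, ← ex_add, ← ex_add, tt, nrm]
    congr 1; push_cast; ring
  have hB : ∀ e : ℤ, jacobiTheta₂ (t / τ + e / 2) (-1 / (2 * τ)) *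
      jacobiTheta₂ (σ / τ + j / 3 + e / 2) (-1 / (6 * τ)) / 2 = -I * √3 * τ *
        ex ((t ^ 2 + 3 * σ ^ 2) / τ) * ∑' q : ℤ × ℤ, tt τ t σ (2 * q.1 + e, 3 * q.2 + e + j - q.1) := by
    intro e
    have e1 := jtheta_inv (2 * t + e * τ) i2
    have e2 := jtheta_inv (6 * σ + (3 * e + 2 * j) * τ) i6
    rw [show (2 * t + e * τ) / (2 * τ) = t / τ + e / 2 by field_simp] at e1
    rw [show (6 * σ + (3 * e + 2 * j) * τ) / (6 * τ) = σ / τ + j / 3 + e / 2 by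
      field_simp; ring] at e2
    rw [hA, e1, e2]
    have w0 : -I * τ ≠ 0 := by simp [h0]
    have c2 := cpow_half_real_mul (r := 2) (by norm_num) w0
    have c6 := cpow_half_real_mul (r := 6) (by norm_num) w0
    rw [show ((2 : ℝ) : ℂ) * (-I * τ) = -I * (2 * τ) by push_cast; ring] at c2
    rw [show ((6 : ℝ) : ℂ) * (-I * τ) = -I * (6 * τ) by push_cast; ring] at c6
    have cc : (-I * τ) ^ (1 / 2 : ℂ) * (-I * τ) ^ (1 / 2 : ℂ) = -I * τ := by
      rw [← cpow_add _ _ w0]; norm_num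
    have c3 : (Real.sqrt 2 : ℂ) * Real.sqrt 6 = 2 * √3 := by
      rw [show (6 : ℝ) = 2 * 3 by norm_num, Real.sqrt_mul (by norm_num)]
      have : (Real.sqrt 2 : ℂ) * Real.sqrt 2 = 2 := by
        rw [← ofReal_mul, Real.mul_self_sqrt (by norm_num)]; norm_num
      push_cast
      linear_combination (√3 : ℂ) * this
    have x1 : ex ((2 * t + e * τ) ^ 2 / (2 * (2 * τ))) * ex ((6 * σ + (3 * e + 2 * j) * τ) ^ 2 /
        (2 * (6 * τ))) = ex ((t ^ 2 + 3 * σ ^ 2) / τ) * (ex (e ^ 2 * τ / 4 + e * t) *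
          ex ((3 * e + 2 * j) ^ 2 * τ / 12 + (3 * e + 2 * j) * σ)) := by
      rw [← ex_add, ← ex_add, ← ex_add]; congr 1; field_simp; ring
    rw [c2, c6]
    set J1 := jacobiTheta₂ (2 * t + e * τ) (2 * τ)
    set J2 := jacobiTheta₂ (6 * σ + (3 * e + 2 * j) * τ) (6 * τ)
    set u := (-I * τ) ^ (1 / 2 : ℂ)
    calc _ = ((Real.sqrt 2 : ℂ) * Real.sqrt 6) * (u * u) * (ex ((2 * t + e * τ) ^ 2 / (2 * (2 * τ))) *
        ex ((6 * σ + (3 * e + 2 * j) * τ) ^ 2 / (2 * (6 * τ)))) * J1 * J2 / 2 := by ring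
      _ = _ := by rw [c3, cc, x1]; ring
  have h1 := hB 0
  have h2 := hB 1
  simp only [Int.cast_zero, Int.cast_one, zero_div, add_zero] at h1 h2
  rw [mul_add, add_div]
  simp only [add_zero]
  exact congrArg₂ (· + ·) h1 h2

/-- Polynomial growth of the coefficients of a power series. -/
def PG (P : PowerSeries ℤ) : Prop :=
  ∃ (C : ℝ) (A : ℕ), 0 ≤ C ∧ ∀ n : ℕ, |((coeff n P : ℤ) : ℝ)| ≤ C * ((n : ℝ) + 1) ^ A

/-- The value of a power series in `q^{1/3}`. -/
def pe (P : PowerSeries ℤ) (τ : ℂ) : ℂ := ∑' n : ℕ, ((coeff n P : ℤ) : ℂ) * ex (n * τ / 3)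

lemma summable_poly_exp (hτ : 0 < τ.im) (A : ℕ) :
    Summable fun n : ℕ => ((n : ℝ) + 1) ^ A * ‖ex (n * τ / 3)‖ := by
  have hr : ‖ex (τ / 3)‖ < 1 := by
    rw [norm_ex, Real.exp_lt_one_iff]
    have : (τ / 3).im = τ.im / 3 := by simpa using div_ofReal_im τ 3
    rw [this]
    have := Real.pi_pos
    nlinarith [mul_pos this hτ]
  have h1 := (summable_nat_add_iff 1).2 (summable_pow_mul_geometric_of_norm_lt_one A
    (r := ‖ex (τ / 3)‖) (by simpa using hr))
  refine (h1.mul_left (‖ex (τ / 3)‖⁻¹)).congr fun n => ?_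
  have h0 : ‖ex (τ / 3)‖ ≠ 0 := norm_ne_zero_iff.2 (ex_ne_zero _)
  rw [show (n : ℂ) * τ / 3 = n * (τ / 3) by ring, ex_nat_mul, norm_pow, pow_succ]
  push_cast
  field_simp

lemma PG.summable {P : PowerSeries ℤ} (h : PG P) (hτ : 0 < τ.im) :
    Summable fun n : ℕ => ((coeff n P : ℤ) : ℂ) * ex (n * τ / 3) := by
  obtain ⟨C, A, hC, h⟩ := h
  refine Summable.of_norm_bounded ((summable_poly_exp hτ A).mul_left C) fun n => ?_
  rw [norm_mul, ← mul_assoc]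
  gcongr
  simpa [norm_intCast] using h n

lemma PG.mul {P R : PowerSeries ℤ} (hP : PG P) (hR : PG R) : PG (P * R) := by
  obtain ⟨C, A, hC, hP⟩ := hP
  obtain ⟨C', A', hC', hR⟩ := hR
  refine ⟨C * C', A + A' + 1, by positivity, fun n => ?_⟩
  rw [coeff_mul]
  push_cast
  refine (abs_sum_le_sum_abs _ _).trans ((sum_le_card_nsmul _ _
    (C * C' * ((n : ℝ) + 1) ^ (A + A')) fun x hx => ?_).trans (le_of_eq ?_))
  · have hx' := Finset.HasAntidiagonal.mem_antidiagonal.1 hx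
    have h1 : (x.1 : ℝ) + 1 ≤ n + 1 := by
      have : x.1 ≤ n := by omega
      have : (x.1 : ℝ) ≤ n := by exact_mod_cast this
      linarith
    have h2 : (x.2 : ℝ) + 1 ≤ n + 1 := by
      have : x.2 ≤ n := by omega
      have : (x.2 : ℝ) ≤ n := by exact_mod_cast this
      linarith
    rw [abs_mul]
    calc _ ≤ (C * ((n : ℝ) + 1) ^ A) * (C' * ((n : ℝ) + 1) ^ A') := by
          gcongr
          · exact (hP _).trans (by gcongr)
          · exact (hR _).trans (by gcongr)
      _ = _ := by rw [pow_add]; ring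
  · rw [Finset.Nat.card_antidiagonal, nsmul_eq_mul]; push_cast; ring

lemma PG.add {P R : PowerSeries ℤ} (hP : PG P) (hR : PG R) : PG (P + R) := by
  obtain ⟨C, A, hC, hP⟩ := hP
  obtain ⟨C', A', hC', hR⟩ := hR
  refine ⟨C + C', A + A', by positivity, fun n => ?_⟩
  have hn : (1 : ℝ) ≤ n + 1 := by linarith [(Nat.cast_nonneg n : (0 : ℝ) ≤ n)]
  rw [map_add]
  push_cast
  refine (abs_add_le _ _).trans ?_
  rw [add_mul]
  refine add_le_add ((hP n).trans ?_) ((hR n).trans ?_) <;> gcongr <;> first | exact hn | omega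

lemma PG_C (c : ℤ) : PG (C c) := by
  refine ⟨|(c : ℝ)|, 0, abs_nonneg _, fun n => ?_⟩
  rw [coeff_C]
  split_ifs <;> simp

lemma pe_mul {P R : PowerSeries ℤ} (hP : PG P) (hR : PG R) (hτ : 0 < τ.im) :
    pe (P * R) τ = pe P τ * pe R τ := by
  rw [pe, pe, pe, tsum_mul_tsum_eq_tsum_sum_antidiagonal_of_summable_norm (hP.summable hτ).norm
    (hR.summable hτ).norm]
  refine tsum_congr fun n => ?_
  rw [coeff_mul, Int.cast_sum, sum_mul]
  refine sum_congr rfl fun x hx => ?_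
  rw [← Finset.HasAntidiagonal.mem_antidiagonal.1 hx, mul_mul_mul_comm, ← ex_add]
  push_cast
  congr 2; ring

lemma pe_add {P R : PowerSeries ℤ} (hP : PG P) (hR : PG R) (hτ : 0 < τ.im) :
    pe (P + R) τ = pe P τ + pe R τ := by
  rw [pe, pe, pe, ← (hP.summable hτ).tsum_add (hR.summable hτ)]
  refine tsum_congr fun n => ?_
  rw [map_add]; push_cast; ring

lemma pe_C (c : ℤ) (τ : ℂ) : pe (C c) τ = c := by
  rw [pe, tsum_eq_single 0]
  · simp [ex_zero]
  · intro n hn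
    rw [coeff_C, if_neg hn]; simp

/-- The power series whose exponents lie in a class modulo three. -/
def Sup (c : ℕ) (P : PowerSeries ℤ) : Prop := ∀ n, coeff n P ≠ 0 → n % 3 = c % 3

lemma Sup.mul {c d : ℕ} {P R : PowerSeries ℤ} (hP : Sup c P) (hR : Sup d R) : Sup (c + d) (P * R) := by
  intro n hn
  rw [coeff_mul] at hn
  obtain ⟨x, hx, h⟩ := exists_ne_zero_of_sum_ne_zero hn
  have h1 := hP _ (left_ne_zero_of_mul h)
  have h2 := hR _ (right_ne_zero_of_mul h)
  have h3 := Finset.HasAntidiagonal.mem_antidiagonal.1 hx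
  omega

lemma Sup.add {c : ℕ} {P R : PowerSeries ℤ} (hP : Sup c P) (hR : Sup c R) : Sup c (P + R) := by
  intro n hn
  by_cases h : coeff n P = 0
  · exact hR n (by rw [map_add, h, zero_add] at hn; exact hn)
  · exact hP n h

lemma Sup_C (c : ℤ) : Sup 0 (C c) := by
  intro n hn
  rw [coeff_C] at hn
  split_ifs at hn with h
  · simp [h]
  · exact absurd rfl hn

lemma Sup.congr {c d : ℕ} {P : PowerSeries ℤ} (hP : Sup c P) (h : c % 3 = d % 3) : Sup d P :=
  fun n hn => (hP n hn).trans h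

/-- The points of norm `n` in a class. -/
def thS (j : ℤ) (n : ℕ) : Finset (ℤ × ℤ) :=
  ((Finset.Icc (-(n + 1) : ℤ) (n + 1)) ×ˢ (Finset.Icc (-(n + 1) : ℤ) (n + 1))).filter
    fun p => nrm p = n ∧ (3 : ℤ) ∣ p.1 - p.2 - j

lemma mem_thS (j : ℤ) (n : ℕ) (p : ℤ × ℤ) : p ∈ thS j n ↔ nrm p = n ∧ (3 : ℤ) ∣ p.1 - p.2 - j := by
  rw [thS, mem_filter, and_iff_right_iff_imp]
  rintro ⟨h, -⟩
  rw [nrm] at h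
  rw [mem_product, mem_Icc, mem_Icc, ← abs_le, ← abs_le]
  have hn : (0 : ℤ) ≤ n := Int.natCast_nonneg n
  constructor <;> refine abs_le_of_sq_le_sq ?_ (by omega)
  · nlinarith [sq_nonneg (p.1 + 2 * p.2), sq_nonneg ((n : ℤ) - 1)]
  · nlinarith [sq_nonneg (2 * p.1 + p.2), sq_nonneg ((n : ℤ) - 1)]

/-- The theta series of the cosets as power series. -/
def th (j : ℤ) : PowerSeries ℤ := mk fun n => ((thS j n).card : ℤ)

lemma PG_th (j : ℤ) : PG (th j) := by
  refine ⟨9, 2, by norm_num, fun n => ?_⟩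
  rw [th, coeff_mk]
  have h : (thS j n).card ≤ (2 * n + 3) * (2 * n + 3) := by
    refine (card_filter_le _ _).trans (le_of_eq ?_)
    rw [card_product, Int.card_Icc]
    congr 1 <;> omega
  have h' : ((thS j n).card : ℝ) ≤ (2 * n + 3) * (2 * n + 3) := by exact_mod_cast h
  have hn : (0 : ℝ) ≤ n := Nat.cast_nonneg n
  push_cast
  rw [abs_of_nonneg (by positivity)]
  nlinarith

lemma pe_th (j : ℤ) (hτ : 0 < τ.im) : pe (th j) τ = vth j τ 0 0 := by
  have hs := (summable_vth hτ 0 0 j).hasSum.tsum_fiberwise (fun p : ℤ × ℤ => (nrm p).toNat)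
  rw [vth, ← hs.tsum_eq, pe]
  refine tsum_congr fun n => ?_
  rw [tsum_subtype ((fun p : ℤ × ℤ => (nrm p).toNat) ⁻¹' {n})
    (fun p => if (3 : ℤ) ∣ p.1 - p.2 - j then tt τ 0 0 p else 0), tsum_eq_sum (s := thS j n)]
  · rw [th, coeff_mk, sum_congr rfl (g := fun _ => ex (n * τ / 3)), sum_const,
      nsmul_eq_mul]
    · push_cast; rfl
    · intro p hp
      rw [mem_thS] at hp
      rw [Set.indicator_of_mem (by simp [hp.1]), if_pos hp.2, tt, hp.1]
      simp
  · intro p hp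
    by_cases h : p ∈ (fun p : ℤ × ℤ => (nrm p).toNat) ⁻¹' {n}
    · rw [Set.indicator_of_mem h, if_neg]
      intro h3
      apply hp
      rw [mem_thS]
      refine ⟨?_, h3⟩
      have h4 : (nrm p).toNat = n := h
      have := nrm_nonneg p
      omega
    · exact Set.indicator_of_notMem h _

lemma Sup_th (j : ℤ) : Sup (j ^ 2).toNat (th j) := by
  intro n hn
  rw [th, coeff_mk] at hn
  have : (thS j n).Nonempty := by
    rw [← card_ne_zero]; exact_mod_cast hn
  obtain ⟨p, hp⟩ := this
  obtain ⟨h1, w, hw⟩ := (mem_thS j n p).1 hp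
  have h2 : (n : ℤ) = j ^ 2 + 3 * (p.1 * p.2 + 2 * w * j + 3 * w ^ 2) := by
    rw [← h1, nrm]
    have : p.1 = p.2 + j + 3 * w := by omega
    rw [this]; ring
  have := sq_nonneg j
  omega

lemma th_coeff_low : (coeff 0 (th 0) = 1 ∧ coeff 1 (th 0) = 0 ∧
    coeff 2 (th 0) = 0) ∧ (coeff 0 (th 1) = 0 ∧
    coeff 1 (th 1) = 3 ∧ coeff 2 (th 1) = 0) := by
  simp only [th, coeff_mk]
  decide

/-- The series attached to a class. -/
def gs (g : ℤ → ℤ → ℂ) (j : ℤ) (τ : ℂ) : ℂ := ∑' D : ℤ, g j D * ex (D * τ / 3)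

/-- The theta decomposition of a Jacobi cusp form of index one and weight `κ + 1`. -/
structure TD (κ : ℕ) (g : ℤ → ℤ → ℂ) : Prop where
  per : ∀ j k D, g (j + 3 * k) D = g j D
  neg : ∀ j D, D ≤ 0 → g j D = 0
  supp : ∀ j D, g j D ≠ 0 → (3 : ℤ) ∣ D + j ^ 2
  bound : ∃ (C : ℝ) (A : ℕ), 0 ≤ C ∧ ∀ j D, ‖g j D‖ ≤ C * (|(D : ℝ)| + 1) ^ A
  law : ∀ j : ℤ, j = 0 ∨ j = 1 ∨ j = 2 → ∀ τ : ℂ, 0 < τ.im → gs g j (-1 / τ) =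
    I / √3 * τ ^ κ * (gs g 0 τ + ex (j / 3) * gs g 2 τ + ex (2 * j / 3) * gs g 1 τ)

lemma TD.support_subset (h : TD κ g) (j : ℤ) (τ : ℂ) :
    support (fun D : ℤ => g j D * ex (D * τ / 3)) ⊆ Set.range ((↑) : ℕ → ℤ) := by
  intro D hD
  have h1 : ¬ D ≤ 0 := fun hc => hD (by simp [h.neg j D hc])
  exact ⟨D.toNat, by omega⟩

lemma TD.summable (h : TD κ g) (j : ℤ) (hτ : 0 < τ.im) :
    Summable fun D : ℤ => g j D * ex (D * τ / 3) := by
  rw [← Function.Injective.summable_iff (Nat.cast_injective (R := ℤ))]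
  · obtain ⟨C, A, hC, hb⟩ := h.bound
    refine Summable.of_norm_bounded ((summable_poly_exp hτ A).mul_left C) fun n => ?_
    have := hb j n
    simp only [Function.comp, norm_mul, Int.cast_natCast, Nat.abs_cast] at this ⊢
    rw [← mul_assoc]
    gcongr
  · intro D hD
    by_contra hc
    exact hD (h.support_subset j τ hc)

/-- The Jacobi form attached to a theta decomposition. -/
def phi (g : ℤ → ℤ → ℂ) (τ t σ : ℂ) : ℂ :=
  gs g 0 τ * vth 0 τ t σ + gs g 1 τ * vth 1 τ t σ + gs g 2 τ * vth 2 τ t σ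

lemma vth_congr {i j : ℤ} (h : (3 : ℤ) ∣ i - j) (τ t σ : ℂ) : vth i τ t σ = vth j τ t σ := by
  refine tsum_congr fun p => ?_
  have : (3 : ℤ) ∣ p.1 - p.2 - i ↔ (3 : ℤ) ∣ p.1 - p.2 - j := by omega
  simp only [this]

lemma ex_third_congr {m n : ℤ} (h : (3 : ℤ) ∣ m - n) : ex (m / 3) = ex (n / 3) := by
  obtain ⟨w, hw⟩ := h
  have : (m : ℂ) = n + 3 * w := by
    have : m = n + 3 * w := by omega
    rw [this]; push_cast; ring
  rw [this, show ((n : ℂ) + 3 * w) / 3 = n / 3 + w by ring, ex_add, ex_int, mul_one]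

lemma vth_split (hτ : 0 < τ.im) (t σ : ℂ) (j : ℤ) :
    ∑' p : ℤ × ℤ, ex (j * (p.1 + 2 * p.2) / 3) * tt τ t σ p =
      vth 0 τ t σ + ex (j / 3) * vth 1 τ t σ + ex (2 * j / 3) * vth 2 τ t σ := by
  have s := fun i => summable_vth hτ t σ i
  rw [vth, vth, vth, ← tsum_mul_left, ← tsum_mul_left, ← (s 0).tsum_add ((s 1).mul_left _),
    ← ((s 0).add ((s 1).mul_left _)).tsum_add ((s 2).mul_left _)]
  refine tsum_congr fun p => ?_
  have h : ∀ i : ℤ, (3 : ℤ) ∣ p.1 - p.2 - i → ex (j * (p.1 + 2 * p.2) / 3) = ex ((i * j : ℤ) / 3) := by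
    rintro i ⟨w, hw⟩
    have := ex_third_congr (m := j * (p.1 + 2 * p.2)) (n := i * j) ⟨j * (w + p.2), by
      rw [show p.1 = p.2 + i + 3 * w by omega]; ring⟩
    rw [← this]; push_cast; rfl
  have h3 : (3 : ℤ) ∣ p.1 - p.2 - 0 ∨ (3 : ℤ) ∣ p.1 - p.2 - 1 ∨ (3 : ℤ) ∣ p.1 - p.2 - 2 := by omega
  rcases h3 with h3 | h3 | h3
  · rw [if_pos h3, if_neg (by omega), if_neg (by omega), h 0 h3]; simp [ex_zero]
  · rw [if_pos h3, if_neg (by omega), if_neg (by omega), h 1 h3]; simp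
  · rw [if_pos h3, if_neg (by omega), if_neg (by omega), h 2 h3]; simp

lemma sqrt3_sq : (√3 : ℂ) * √3 = 3 := by
  rw [← ofReal_mul, Real.mul_self_sqrt (by norm_num)]; norm_num

lemma sqrt3_ne : (√3 : ℂ) ≠ 0 := by
  intro h; have := sqrt3_sq; rw [h] at this; norm_num at this

lemma TD.phi_S (h : TD κ g) (hτ : 0 < τ.im) (t σ : ℂ) :
    phi g (-1 / τ) (t / τ) (σ / τ) = τ ^ (κ + 1) * ex ((t ^ 2 + 3 * σ ^ 2) / τ) * phi g τ t σ := by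
  have hS := im_neg_inv_pos hτ
  have d : ∀ j : ℤ, _ := fun j => (vth_split hS (t / τ) (σ / τ) j).symm.trans (theta_dual hτ t σ j)
  have d0 := d 0
  have d1 := d 1
  have d2 := d 2
  rw [vth_congr (i := -0) (j := 0) (by norm_num)] at d0
  rw [vth_congr (i := -1) (j := 2) (by norm_num)] at d1
  rw [vth_congr (i := -2) (j := 1) (by norm_num)] at d2
  have l0 := h.law 0 (by norm_num) τ hτ
  have l1 := h.law 1 (by norm_num) τ hτ
  have l2 := h.law 2 (by norm_num) τ hτ
  have i3 : I / (√3 : ℂ) * (-I * √3) = 1 := by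
    have := sqrt3_ne
    field_simp
    simp
  rw [phi, phi, l0, l1, l2]
  push_cast at *
  simp only [zero_div, ex_zero, one_mul, mul_one, mul_zero] at *
  set c := I / (√3 : ℂ)
  set E := ex ((t ^ 2 + 3 * σ ^ 2) / τ)
  linear_combination (c * τ ^ κ * gs g 0 τ) * d0 + (c * τ ^ κ * gs g 2 τ) * d1 +
    (c * τ ^ κ * gs g 1 τ) * d2 + (τ ^ (κ + 1) * E * (gs g 0 τ * vth 0 τ t σ +
      gs g 1 τ * vth 1 τ t σ + gs g 2 τ * vth 2 τ t σ)) * i3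

lemma TD.congr (h : TD κ g) {i j : ℤ} (hij : (3 : ℤ) ∣ i - j) (D : ℤ) :
    g i D = g j D := by
  obtain ⟨w, hw⟩ := hij
  rw [show i = j + 3 * w by omega, h.per]

/-- The Fourier coefficients of the Jacobi form. -/
def pc (g : ℤ → ℤ → ℂ) (w : W) : ℂ := g (w.1.2 - w.2) (3 * w.1.1 - nrm (w.1.2, w.2))

lemma TD.hasSum_phi (h : TD κ g) (hτ : 0 < τ.im) (t σ : ℂ) :
    HasSum (fun w : W => pc g w * ex (linW w τ t σ)) (phi g τ t σ) := by
  have sv := fun j => summable_vth hτ t σ j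
  have sg := fun j => h.summable j hτ
  have hm : ∀ j, HasSum (fun x : ℤ × (ℤ × ℤ) => g j x.1 * ex (x.1 * τ / 3) *
      (if (3 : ℤ) ∣ x.2.1 - x.2.2 - j then tt τ t σ x.2 else 0)) (gs g j τ * vth j τ t σ) := fun j => by
    rw [gs, vth, tsum_mul_tsum_of_summable_norm (sg j).norm (sv j).norm]
    exact (summable_mul_of_summable_norm (sg j).norm (sv j).norm).hasSum
  have h3 := ((hm 0).add (hm 1)).add (hm 2)
  have h4 : HasSum (fun x : ℤ × (ℤ × ℤ) => g (x.2.1 - x.2.2) x.1 * ex (x.1 * τ / 3) * tt τ t σ x.2)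
      (phi g τ t σ) := by
    refine h3.congr_fun ?_
    rintro ⟨D, r, s⟩
    dsimp only
    have h3 : (3 : ℤ) ∣ r - s - 0 ∨ (3 : ℤ) ∣ r - s - 1 ∨ (3 : ℤ) ∣ r - s - 2 := by omega
    rcases h3 with h3 | h3 | h3
    · rw [if_pos h3, if_neg (by omega), if_neg (by omega), h.congr h3]; simp
    · rw [if_pos h3, if_neg (by omega), if_neg (by omega), h.congr h3]; simp
    · rw [if_pos h3, if_neg (by omega), if_neg (by omega), h.congr h3]; simp
  have inj : Injective fun w : W =>
      ((3 * w.1.1 - nrm (w.1.2, w.2), w.1.2, w.2) : ℤ × (ℤ × ℤ)) := by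
    rintro ⟨⟨a, b⟩, c⟩ ⟨⟨a', b'⟩, c'⟩ hh
    simp only [Prod.mk.injEq] at hh
    obtain ⟨h1, rfl, rfl⟩ := hh
    have : a = a' := by omega
    rw [this]
  rw [← inj.hasSum_iff] at h4
  · refine h4.congr_fun ?_
    rintro ⟨⟨n, r⟩, s⟩
    simp only [Function.comp, pc, linW]
    rw [mul_assoc, tt, ← ex_add]
    congr 2
    push_cast
    ring
  · rintro ⟨D, r, s⟩ hx
    by_contra hne
    apply hx
    have hg : g (r - s) D ≠ 0 := fun hc => hne (by simp [hc])
    obtain ⟨w, hw⟩ := h.supp _ _ hg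
    have e : 3 * (w + r * s) - nrm (r, s) = D := by
      rw [nrm]; linear_combination -hw
    exact ⟨((w + r * s, r), s), by simp only [e]⟩

lemma omega_sum : ex (1 / 3) + ex (2 / 3) = -1 := by
  have h : ex (1 / 3) * ex (1 / 3) = ex (2 / 3) := by rw [← ex_add]; norm_num
  have h2 : ex (1 / 3) * ex (2 / 3) = 1 := by
    rw [← ex_add]; norm_num; simpa using ex_int 1
  have h1 : ex (1 / 3) ≠ 1 := by
    intro hc
    rw [ex, exp_eq_one_iff] at hc
    obtain ⟨n, hn⟩ := hc
    have h0 := two_pi_I_ne_zero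
    have : ((3 * n : ℤ) : ℂ) = (1 : ℤ) := by
      push_cast
      apply mul_left_cancel₀ h0
      linear_combination -3 * hn
    have := Int.cast_injective this
    omega
  apply mul_left_cancel₀ (sub_ne_zero.2 h1)
  linear_combination h + h2

lemma omega_diff : ex (1 / 3) - ex (2 / 3) = I * √3 := by
  rw [ex, ex, show 2 * (π : ℂ) * I * (1 / 3) = ((2 * π / 3 : ℝ) : ℂ) * I by push_cast; ring,
    show 2 * (π : ℂ) * I * (2 / 3) = ((2 * π - 2 * π / 3 : ℝ) : ℂ) * I by
      push_cast; ring, exp_mul_I, exp_mul_I, ← ofReal_cos, ← ofReal_sin,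
      ← ofReal_cos, ← ofReal_sin, Real.cos_two_pi_sub, Real.sin_two_pi_sub,
      show 2 * π / 3 = π - π / 3 by ring, Real.sin_pi_sub, Real.sin_pi_div_three]
  push_cast
  ring

lemma vth_two (τ : ℂ) : vth 2 τ 0 0 = vth 1 τ 0 0 := by
  rw [vth, vth, ← (Equiv.neg (ℤ × ℤ)).tsum_eq]
  refine tsum_congr fun p => ?_
  have h : (3 : ℤ) ∣ (-p).1 - (-p).2 - 2 ↔ (3 : ℤ) ∣ p.1 - p.2 - 1 := by
    simp only [Prod.fst_neg, Prod.snd_neg]; omega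
  simp only [Equiv.neg_apply, h]
  congr 1
  simp [tt, nrm]

lemma th_S (hτ : 0 < τ.im) :
    pe (th 0) (-1 / τ) = -I / √3 * τ * (pe (th 0) τ + 2 * pe (th 1) τ) ∧
    pe (th 1) (-1 / τ) = -I / √3 * τ * (pe (th 0) τ - pe (th 1) τ) := by
  have hS := im_neg_inv_pos hτ
  have d : ∀ j : ℤ, _ := fun j => (vth_split hS (0 / τ) (0 / τ) j).symm.trans (theta_dual hτ 0 0 j)
  have d0 := d 0
  have d1 := d 1
  rw [vth_congr (i := -0) (j := 0) (by norm_num)] at d0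
  rw [vth_congr (i := -1) (j := 2) (by norm_num)] at d1
  rw [pe_th 0 hS, pe_th 1 hS, pe_th 0 hτ, pe_th 1 hτ]
  push_cast at *
  simp only [zero_div, ex_zero, one_mul, mul_one, mul_zero, vth_two, add_zero, ne_eq,
    OfNat.ofNat_ne_zero, not_false_eq_true, zero_pow] at *
  have i3 : -I / (√3 : ℂ) * 3 = -I * √3 := by
    rw [← sqrt3_sq]; have := sqrt3_ne; field_simp
  have hω := omega_sum
  constructor
  · linear_combination (1 / 3 : ℂ) * d0 + (2 / 3 : ℂ) * d1 - (2 / 3 : ℂ) * vth 1 (-1 / τ) 0 0 * hω -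
      τ / 3 * (vth 0 τ 0 0 + 2 * vth 1 τ 0 0) * i3
  · linear_combination (1 / 3 : ℂ) * d0 - (1 / 3 : ℂ) * d1 + (1 / 3 : ℂ) * vth 1 (-1 / τ) 0 0 * hω -
      τ / 3 * (vth 0 τ 0 0 - vth 1 τ 0 0) * i3

/-- Nine times the sixteenth power of the eta function. -/
def e2 : PowerSeries ℤ :=
  (th 1 * (th 0 * th 0 * th 0 + C (-1) * (th 1 * th 1 * th 1))) *
  (th 1 * (th 0 * th 0 * th 0 + C (-1) * (th 1 * th 1 * th 1)))

lemma PG_aux : PG (th 1 * (th 0 * th 0 * th 0 + C (-1) * (th 1 * th 1 * th 1))) :=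
  (PG_th 1).mul ((((PG_th 0).mul (PG_th 0)).mul (PG_th 0)).add
    ((PG_C _).mul (((PG_th 1).mul (PG_th 1)).mul (PG_th 1))))

lemma PG_e2 : PG e2 := PG_aux.mul PG_aux

lemma pe_e2 (hτ : 0 < τ.im) :
    pe e2 τ = (pe (th 1) τ * (pe (th 0) τ ^ 3 - pe (th 1) τ ^ 3)) ^ 2 := by
  have a0 := PG_th 0
  have a1 := PG_th 1
  rw [e2, pe_mul PG_aux PG_aux hτ, pe_mul a1 (((a0.mul a0).mul a0).add
    ((PG_C _).mul ((a1.mul a1).mul a1))) hτ, pe_add ((a0.mul a0).mul a0)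
    ((PG_C _).mul ((a1.mul a1).mul a1)) hτ, pe_mul (a0.mul a0) a0 hτ, pe_mul a0 a0 hτ,
    pe_mul (PG_C _) ((a1.mul a1).mul a1) hτ, pe_mul (a1.mul a1) a1 hτ, pe_mul a1 a1 hτ, pe_C]
  push_cast
  ring

lemma pe_e2_S (hτ : 0 < τ.im) : pe e2 (-1 / τ) = τ ^ 8 * pe e2 τ := by
  rw [pe_e2 hτ, pe_e2 (im_neg_inv_pos hτ), (th_S hτ).1, (th_S hτ).2]
  have h : (-I / (√3 : ℂ)) ^ 4 * 9 = 1 := by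
    have h1 : (-I / (√3 : ℂ)) ^ 2 * 3 = -1 := by
      rw [← sqrt3_sq]; have := sqrt3_ne; field_simp; simp
    linear_combination ((-I / (√3 : ℂ)) ^ 2 * 3 - 1) * h1
  set u := -I / (√3 : ℂ)
  set a := pe (th 0) τ
  set b := pe (th 1) τ
  have : (u * τ * (a - b) * ((u * τ * (a + 2 * b)) ^ 3 - (u * τ * (a - b)) ^ 3)) =
      τ ^ 4 * (b * (a ^ 3 - b ^ 3)) := by
    linear_combination (τ ^ 4 * (b * (a ^ 3 - b ^ 3))) * h
  rw [this]; ring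

lemma Sup_e2 : Sup 2 e2 := by
  have a0 : Sup 0 (th 0) := Sup_th 0
  have a1 : Sup 1 (th 1) := Sup_th 1
  have h : Sup 1 (th 1 * (th 0 * th 0 * th 0 + C (-1) * (th 1 * th 1 * th 1))) :=
    a1.mul (((a0.mul a0).mul a0).add (((Sup_C (-1)).mul ((a1.mul a1).mul a1)).congr (by norm_num)))
  exact h.mul h

lemma coeff_mul_low (P R : PowerSeries ℤ) : coeff 0 (P * R) =
      coeff 0 P * coeff 0 R ∧
    coeff 1 (P * R) = coeff 0 P * coeff 1 R +
      coeff 1 P * coeff 0 R ∧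
    coeff 2 (P * R) = coeff 0 P * coeff 2 R +
      coeff 1 P * coeff 1 R + coeff 2 P * coeff 0 R ∧
    coeff 3 (P * R) = coeff 0 P * coeff 3 R +
      coeff 1 P * coeff 2 R + coeff 2 P * coeff 1 R +
      coeff 3 P * coeff 0 R := by
  refine ⟨?_, ?_, ?_, ?_⟩ <;>
    simp [coeff_mul, Finset.Nat.antidiagonal_succ] <;> ring

lemma coeff_C_low (c : ℤ) : coeff 0 (C c) = c ∧
    coeff 1 (C c) = 0 ∧ coeff 2 (C c) = 0 ∧
    coeff 3 (C c) = 0 := by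
  refine ⟨?_, ?_, ?_, ?_⟩ <;> rw [coeff_C] <;> simp

lemma e2_coeff_low : coeff 0 e2 = 0 ∧ coeff 1 e2 = 0 ∧
    coeff 2 e2 = 9 ∧ coeff 3 e2 = 0 := by
  obtain ⟨⟨h0, h1, h2⟩, h3, h4, h5⟩ := th_coeff_low
  have aux : coeff 0 (th 1 * (th 0 * th 0 * th 0 + C (-1) * (th 1 * th 1 * th 1)))
      = 0 ∧ coeff 1 (th 1 * (th 0 * th 0 * th 0 + C (-1) * (th 1 * th 1 * th 1)))
      = 3 ∧ coeff 2 (th 1 * (th 0 * th 0 * th 0 + C (-1) * (th 1 * th 1 * th 1)))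
      = 0 := by
    refine ⟨?_, ?_, ?_⟩ <;>
      simp only [(coeff_mul_low _ _).1, (coeff_mul_low _ _).2.1, (coeff_mul_low _ _).2.2.1, map_add,
        (coeff_C_low _).1, (coeff_C_low _).2.1, (coeff_C_low _).2.2.1, h0, h1, h2, h3, h4, h5] <;>
      norm_num
  obtain ⟨b0, b1, b2⟩ := aux
  rw [e2]
  generalize th 1 * (th 0 * th 0 * th 0 + C (-1) * (th 1 * th 1 * th 1)) = Y at *
  obtain ⟨y0, y1, y2, y3⟩ := coeff_mul_low Y Y
  rw [y0, y1, y2, y3, b0, b1, b2]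
  norm_num

/-- The theta decomposition with given components. -/
def gd (P0 P1 : PowerSeries ℤ) (ε : ℤ) (j D : ℤ) : ℂ :=
  if D ≤ 0 then 0 else ((if (3 : ℤ) ∣ j then coeff D.toNat P0 else
    (if (3 : ℤ) ∣ j - 1 then 1 else ε) * coeff D.toNat P1 : ℤ) : ℂ) / 9

lemma gs_of_coeff {P : PowerSeries ℤ} {j : ℤ} (h0 : coeff 0 P = 0) {c : ℂ}
    (h : ∀ D : ℤ, g j D = if D ≤ 0 then 0 else c * ((coeff D.toNat P : ℤ) : ℂ)) (τ : ℂ) :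
    gs g j τ = c * pe P τ := by
  rw [gs, pe, ← tsum_mul_left, ← (Nat.cast_injective (R := ℤ)).tsum_eq]
  · refine tsum_congr fun n => ?_
    rw [h]
    rcases Nat.eq_zero_or_pos n with rfl | hn
    · simp [h0]
    · rw [if_neg (by omega)]
      simp [mul_assoc]
  · intro D hD
    have h1 : ¬ D ≤ 0 := fun hc => hD (by simp [h, hc])
    exact ⟨D.toNat, by omega⟩

lemma TD_gd {P0 P1 : PowerSeries ℤ} {ε : ℤ} (hε : ε = 1 ∨ ε = -1) (h0 : PG P0) (h1 : PG P1)
    (s0 : Sup 0 P0) (s1 : Sup 2 P1) (c0 : coeff 0 P0 = 0) (c1 : coeff 0 P1 = 0)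
    (l0 : ∀ τ : ℂ, 0 < τ.im → pe P0 (-1 / τ) = I / √3 * τ ^ κ *
      (pe P0 τ + (1 + ε) * pe P1 τ))
    (l1 : ∀ τ : ℂ, 0 < τ.im → pe P1 (-1 / τ) = I / √3 * τ ^ κ *
      (pe P0 τ + (ε * ex (1 / 3) + ex (2 / 3)) * pe P1 τ))
    (l2 : ∀ τ, (ε : ℂ) * pe P0 τ = pe P0 τ) : TD κ (gd P0 P1 ε) where
  per j k D := by
    have e1 : (3 : ℤ) ∣ j + 3 * k ↔ (3 : ℤ) ∣ j := by omega
    have e2 : (3 : ℤ) ∣ j + 3 * k - 1 ↔ (3 : ℤ) ∣ j - 1 := by omega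
    simp only [gd, e1, e2]
  neg j D hD := by rw [gd, if_pos hD]
  supp j D hne := by
    rw [gd] at hne
    split_ifs at hne with h1 h2 h3
    · exact absurd rfl hne
    · have := s0 D.toNat (fun hc => hne (by simp [hc]))
      obtain ⟨w, rfl⟩ := h2
      have : (3 : ℤ) ∣ D := by omega
      exact dvd_add this ⟨3 * w ^ 2, by ring⟩
    · have := s1 D.toNat (fun hc => hne (by simp [hc]))
      obtain ⟨w, hw⟩ := h3
      obtain ⟨v, hv⟩ : (3 : ℤ) ∣ D - 2 := by omega
      exact ⟨v + 3 * w ^ 2 + 2 * w + 1, by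
        rw [show D = 3 * v + 2 by omega, show j = 3 * w + 1 by omega]; ring⟩
    · have := s1 D.toNat (fun hc => hne (by simp [hc]))
      obtain ⟨w, hw⟩ : (3 : ℤ) ∣ j - 2 := by omega
      obtain ⟨v, hv⟩ : (3 : ℤ) ∣ D - 2 := by omega
      exact ⟨v + 3 * w ^ 2 + 4 * w + 2, by
        rw [show D = 3 * v + 2 by omega, show j = 3 * w + 2 by omega]; ring⟩
  bound := by
    obtain ⟨C, A, hC, hb⟩ := h0
    obtain ⟨C', A', hC', hb'⟩ := h1
    refine ⟨C + C', A + A', by positivity, fun j D => ?_⟩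
    rw [gd]
    have hn : (1 : ℝ) ≤ |(D : ℝ)| + 1 := by linarith [abs_nonneg (D : ℝ)]
    split_ifs with h1 h2 h3
    · rw [norm_zero]; positivity
    all_goals
      have hD : ((D.toNat : ℕ) : ℝ) = |(D : ℝ)| := by
        have : ((D.toNat : ℕ) : ℤ) = D := by omega
        rw [abs_of_nonneg (by exact_mod_cast (by omega : 0 ≤ D))]
        exact_mod_cast congrArg (Int.cast : ℤ → ℝ) this
      have h4 := hb D.toNat
      have h5 := hb' D.toNat
      rw [hD] at h4 h5
    · rw [norm_div, norm_intCast]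
      refine (div_le_self (abs_nonneg _) (by norm_num)).trans (h4.trans ?_)
      gcongr <;> first | exact hn | linarith
    · rw [norm_div, norm_intCast, one_mul]
      refine (div_le_self (abs_nonneg _) (by norm_num)).trans (h5.trans ?_)
      gcongr <;> first | exact hn | linarith
    · rw [norm_div, norm_intCast]
      have h6 : |((ε * coeff D.toNat P1 : ℤ) : ℝ)| = |((coeff D.toNat P1 : ℤ) : ℝ)| := by
        rcases hε with rfl | rfl <;> simp
      refine (div_le_self (abs_nonneg _) (by norm_num)).trans (h6.le.trans (h5.trans ?_))
      gcongr <;> first | exact hn | linarith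
  law := by
    have g0 := gs_of_coeff (g := gd P0 P1 ε) (j := 0) c0 (c := 1 / 9) fun D => by
      simp only [gd, dvd_zero, if_true]; split_ifs <;> ring
    have g1 := gs_of_coeff (g := gd P0 P1 ε) (j := 1) c1 (c := 1 / 9) fun D => by
      have : ¬ (3 : ℤ) ∣ 1 := by norm_num
      simp only [gd, this, sub_self, dvd_zero, if_true, if_false]; split_ifs <;> push_cast <;> ring
    have g2 := gs_of_coeff (g := gd P0 P1 ε) (j := 2) c1 (c := ε / 9) fun D => by
      have h1 : ¬ (3 : ℤ) ∣ 2 := by norm_num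
      have h2 : ¬ (3 : ℤ) ∣ 2 - 1 := by norm_num
      simp only [gd, h1, h2, if_false]; split_ifs <;> push_cast <;> ring
    have e4 : ex (2 * 2 / 3) = ex (1 / 3) := by
      have := ex_third_congr (m := 4) (n := 1) (by norm_num)
      norm_num at this ⊢
      exact this
    have ε2 : (ε : ℂ) * ε = 1 := by rcases hε with rfl | rfl <;> norm_num
    rintro j (rfl | rfl | rfl) τ hτ
    · simp only [g0, g1, g2, l0 τ hτ, Int.cast_zero, zero_div, mul_zero, ex_zero]; ring
    · simp only [g0, g1, g2, l1 τ hτ, Int.cast_one, mul_one]; ring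
    · simp only [g0, g1, g2, l1 τ hτ, Int.cast_ofNat, e4]
      linear_combination (1 / 9 * (I / √3 * τ ^ κ)) * l2 τ +
        (1 / 9 * (I / √3 * τ ^ κ) * ex (1 / 3) * pe P1 τ) * ε2

/-- The theta decomposition of weight nine. -/
def g9 : ℤ → ℤ → ℂ := gd (C 0) e2 (-1)

/-- The theta decomposition of weight ten. -/
def g10 : ℤ → ℤ → ℂ := gd (C (-2) * (e2 * th 1)) (e2 * th 0) 1

/-- The theta decomposition of weight twelve. -/
def g12 : ℤ → ℤ → ℂ := gd (C 6 * (e2 * (th 0 * th 0 * th 1)))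
  (e2 * (th 0 * th 0 * th 0 + C (-4) * (th 1 * th 1 * th 1))) 1

lemma c_sq : (I / (√3 : ℂ)) ^ 2 * 3 = -1 := by
  rw [← sqrt3_sq]; have := sqrt3_ne; field_simp; simp

lemma TD_g9 : TD 8 g9 := by
  refine TD_gd (Or.inr rfl) (PG_C 0) PG_e2 (Sup_C 0) Sup_e2 (by simp) e2_coeff_low.1 ?_ ?_ ?_
  · intro τ hτ; rw [pe_C, pe_C]; push_cast; ring
  · intro τ hτ
    rw [pe_e2_S hτ, pe_C]
    have h : I / (√3 : ℂ) * (I * √3) = -1 := by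
      have := sqrt3_ne; field_simp; simp
    push_cast
    linear_combination (τ ^ 8 * pe e2 τ) * h + (I / √3 * τ ^ 8 * pe e2 τ) * omega_diff
  · intro τ; rw [pe_C]; simp

lemma TD_g10 : TD 9 g10 := by
  have a0 := PG_th 0
  have a1 := PG_th 1
  have s0 : Sup 0 (th 0) := Sup_th 0
  have s1 : Sup 1 (th 1) := Sup_th 1
  have p0 : ∀ {τ : ℂ}, 0 < τ.im → pe (C (-2) * (e2 * th 1)) τ = -2 * (pe e2 τ * pe (th 1) τ) := by
    intro τ hτ
    rw [pe_mul (PG_C _) (PG_e2.mul a1) hτ, pe_mul PG_e2 a1 hτ, pe_C]; push_cast; rfl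
  have p1 : ∀ {τ : ℂ}, 0 < τ.im → pe (e2 * th 0) τ = pe e2 τ * pe (th 0) τ := fun hτ =>
    pe_mul PG_e2 a0 hτ
  obtain ⟨e0, -⟩ := e2_coeff_low
  refine TD_gd (Or.inl rfl) ((PG_C _).mul (PG_e2.mul a1)) (PG_e2.mul a0)
    (((Sup_C _).mul (Sup_e2.mul s1)).congr (by norm_num)) ((Sup_e2.mul s0).congr (by norm_num)) ?_ ?_ ?_ ?_
    (fun τ => by simp)
  · rw [(coeff_mul_low _ _).1, (coeff_mul_low _ _).1, e0]; ring
  · rw [(coeff_mul_low _ _).1, e0]; ring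
  · intro τ hτ
    rw [p0 hτ, p1 hτ, p0 (im_neg_inv_pos hτ), pe_e2_S hτ, (th_S hτ).2]
    push_cast; ring
  · intro τ hτ
    rw [p0 hτ, p1 hτ, p1 (im_neg_inv_pos hτ), pe_e2_S hτ, (th_S hτ).1]
    push_cast
    linear_combination (-I / √3 * τ ^ 9 * pe e2 τ * pe (th 0) τ) * omega_sum

lemma TD_g12 : TD 11 g12 := by
  have a0 := PG_th 0
  have a1 := PG_th 1
  have s0 : Sup 0 (th 0) := Sup_th 0
  have s1 : Sup 1 (th 1) := Sup_th 1
  have q0 := (a0.mul a0).mul a1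
  have q1 := ((a0.mul a0).mul a0).add ((PG_C (-4)).mul ((a1.mul a1).mul a1))
  have p0 : ∀ {τ : ℂ}, 0 < τ.im → pe (C 6 * (e2 * (th 0 * th 0 * th 1))) τ =
      6 * (pe e2 τ * (pe (th 0) τ ^ 2 * pe (th 1) τ)) := by
    intro τ hτ
    rw [pe_mul (PG_C _) (PG_e2.mul q0) hτ, pe_mul PG_e2 q0 hτ, pe_C, pe_mul (a0.mul a0) a1 hτ,
      pe_mul a0 a0 hτ]
    push_cast; ring
  have p1 : ∀ {τ : ℂ}, 0 < τ.im → pe (e2 * (th 0 * th 0 * th 0 + C (-4) *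
      (th 1 * th 1 * th 1))) τ = pe e2 τ * (pe (th 0) τ ^ 3 - 4 * pe (th 1) τ ^ 3) := by
    intro τ hτ
    rw [pe_mul PG_e2 q1 hτ, pe_add ((a0.mul a0).mul a0) ((PG_C (-4)).mul ((a1.mul a1).mul a1)) hτ,
      pe_mul (PG_C _) ((a1.mul a1).mul a1) hτ, pe_mul (a0.mul a0) a0 hτ, pe_mul a0 a0 hτ,
      pe_mul (a1.mul a1) a1 hτ, pe_mul a1 a1 hτ, pe_C]
    push_cast; ring
  obtain ⟨e0, -⟩ := e2_coeff_low
  have c3 : (-I / (√3 : ℂ)) ^ 3 * 3 = I / √3 := by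
    linear_combination (-I / (√3 : ℂ)) * c_sq
  refine TD_gd (Or.inl rfl) ((PG_C _).mul (PG_e2.mul q0)) (PG_e2.mul q1)
    (((Sup_C _).mul (Sup_e2.mul ((s0.mul s0).mul s1))).congr (by norm_num))
    ((Sup_e2.mul (((s0.mul s0).mul s0).add (((Sup_C _).mul ((s1.mul s1).mul s1)).congr
      (by norm_num)))).congr (by norm_num)) ?_ ?_ ?_ ?_
    (fun τ => by simp)
  · rw [(coeff_mul_low _ _).1, (coeff_mul_low _ _).1, e0]; ring
  · rw [(coeff_mul_low _ _).1, e0]; ring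
  · intro τ hτ
    rw [p0 hτ, p1 hτ, p0 (im_neg_inv_pos hτ), pe_e2_S hτ, (th_S hτ).1, (th_S hτ).2]
    push_cast
    set a := pe (th 0) τ
    set b := pe (th 1) τ
    linear_combination (2 * τ ^ 11 * pe e2 τ * (a + 2 * b) ^ 2 * (a - b)) * c3
  · intro τ hτ
    rw [p0 hτ, p1 hτ, p1 (im_neg_inv_pos hτ), pe_e2_S hτ, (th_S hτ).1, (th_S hτ).2]
    push_cast
    set a := pe (th 0) τ
    set b := pe (th 1) τ
    linear_combination (τ ^ 11 * pe e2 τ / 3 * ((a + 2 * b) ^ 3 - 4 * (a - b) ^ 3)) * c3 -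
      (I / √3 * τ ^ 11 * pe e2 τ * (a ^ 3 - 4 * b ^ 3)) * omega_sum

/-- The content of an index. -/
def ct (x : X) : ℕ :=
  Nat.gcd (Nat.gcd x.1.natAbs x.2.1.natAbs) (Nat.gcd x.2.2.1.natAbs x.2.2.2.natAbs)

lemma dvd_ct (d : ℕ) (x : X) : d ∣ ct x ↔
    (d : ℤ) ∣ x.1 ∧ (d : ℤ) ∣ x.2.1 ∧ (d : ℤ) ∣ x.2.2.1 ∧ (d : ℤ) ∣ x.2.2.2 := by
  simp only [ct, Nat.dvd_gcd_iff, Int.natCast_dvd]; tauto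

/-- Three times the determinant of an index. -/
def dt (x : X) : ℤ := 3 * x.1 * x.2.2.2 - nrm (x.2.1, x.2.2.1)

/-- The positive definite indices. -/
def Pos (x : X) : Prop := 0 < x.2.2.2 ∧ 0 < dt x

instance (x : X) : Decidable (Pos x) := by unfold Pos; infer_instance

/-- The Fourier coefficients of the lift. -/
def lift (κ : ℕ) (g : ℤ → ℤ → ℂ) (x : X) : ℂ :=
  if Pos x then ∑ d ∈ (ct x).divisors, (d : ℂ) ^ κ * g ((x.2.1 - x.2.2.1) / d) (dt x / d ^ 2) else 0

lemma Pos.fst {x : X} (h : Pos x) : 0 < x.1 := by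
  obtain ⟨h1, h2⟩ := h
  have := nrm_nonneg (x.2.1, x.2.2.1)
  unfold dt at h2
  by_contra hc
  nlinarith

lemma Pos.cone {x : X} (h : Pos x) : Cone x := by
  have h1 := h.fst
  obtain ⟨h2, h3⟩ := h
  simp only [dt, nrm] at h3
  exact ⟨h1.le, h2.le, by linarith⟩

lemma lift_congr {x y : X} (hp : Pos x ↔ Pos y) (hd : dt x = dt y)
    (hc : ∀ d : ℕ, d ∣ ct x ↔ d ∣ ct y) (hg : ∀ d : ℕ, d ∣ ct x → ∀ D,
      g ((x.2.1 - x.2.2.1) / d) D = e * g ((y.2.1 - y.2.2.1) / d) D) :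
    lift κ g x = e * lift κ g y := by
  have hct : ct x = ct y := Nat.dvd_antisymm ((hc _).1 dvd_rfl) ((hc _).2 dvd_rfl)
  unfold lift
  by_cases h : Pos x
  · rw [if_pos h, if_pos (hp.1 h), mul_sum, hct]
    refine sum_congr rfl fun d hdv => ?_
    rw [hg d (hct ▸ Nat.dvd_of_mem_divisors hdv), hd]; ring
  · rw [if_neg h, if_neg (fun h' => h (hp.2 h')), mul_zero]

lemma lift_swap (κ : ℕ) (g : ℤ → ℤ → ℂ) (n r s m : ℤ) :
    lift κ g (m, r, s, n) = lift κ g (n, r, s, m) := by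
  rw [← one_mul (lift κ g (n, r, s, m))]
  have hd : dt (m, r, s, n) = dt (n, r, s, m) := by simp only [dt]; ring
  refine lift_congr ⟨fun h => ⟨h.fst, hd ▸ h.2⟩, fun h => ⟨h.fst, hd ▸ h.2⟩⟩ hd (fun d => ?_)
    fun d _ D => by rw [one_mul]
  simp only [dvd_ct]; tauto

lemma lift_shift (κ : ℕ) (hg : ∀ j k D, g (j + 3 * k) D = g j D) (n r s m : ℤ) :
    lift κ g (n + r + m, r + 2 * m, s - m, m) = lift κ g (n, r, s, m) := by
  rw [← one_mul (lift κ g (n, r, s, m))]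
  have hd : dt (n + r + m, r + 2 * m, s - m, m) = dt (n, r, s, m) := by simp only [dt, nrm]; ring
  refine lift_congr ⟨fun h => ⟨h.1, hd ▸ h.2⟩, fun h => ⟨h.1, hd ▸ h.2⟩⟩ hd (fun d => ?_) fun d h D => ?_
  · simp only [dvd_ct]
    constructor
    · rintro ⟨h1, h2, h3, h4⟩
      have h5 : (d : ℤ) ∣ r := by simpa using dvd_sub h2 (h4.mul_left 2)
      refine ⟨?_, h5, by simpa using dvd_add h3 h4, h4⟩
      simpa using dvd_sub (dvd_sub h1 h4) h5
    · rintro ⟨h1, h2, h3, h4⟩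
      exact ⟨dvd_add (dvd_add h1 h2) h4, dvd_add h2 (h4.mul_left 2), dvd_sub h3 h4, h4⟩
  · obtain ⟨-, h2, h3, ⟨m', rfl⟩⟩ := (dvd_ct _ _).1 h
    dsimp only
    rw [one_mul, show r + 2 * (d * m') - (s - d * m') = (r - s) + d * (3 * m') by ring]
    by_cases hd0 : (d : ℤ) = 0
    · simp [hd0]
    · rw [Int.add_mul_ediv_left _ _ hd0, hg]

lemma lift_neg_class (hg : ∀ j k D, g (j + 3 * k) D = g j D)
    (he : ∀ j D, g (-j) D = e * g j D) (d : ℕ) {u v w : ℤ} (h1 : (d : ℤ) ∣ u) (h2 : (d : ℤ) ∣ w)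
    (h : v = -u + 3 * w) (D : ℤ) : g (v / d) D = e * g (u / d) D := by
  obtain ⟨u', rfl⟩ := h1
  obtain ⟨w', rfl⟩ := h2
  by_cases hd0 : (d : ℤ) = 0
  · have := he 0 D
    simp [hd0] at this ⊢
    tauto
  · rw [h, show -((d : ℤ) * u') + 3 * (d * w') = d * (-u' + 3 * w') by ring, Int.mul_ediv_cancel_left _ hd0,
      Int.mul_ediv_cancel_left _ hd0, hg, he]

lemma lift_flip (κ : ℕ) (hg : ∀ j k D, g (j + 3 * k) D = g j D)
    (he : ∀ j D, g (-j) D = e * g j D) (n r s m : ℤ) :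
    lift κ g (n, r, -r - s, m) = e * lift κ g (n, r, s, m) := by
  have hd : dt (n, r, -r - s, m) = dt (n, r, s, m) := by simp only [dt, nrm]; ring
  have hc : ∀ d : ℕ, d ∣ ct (n, r, -r - s, m) ↔ d ∣ ct (n, r, s, m) := fun d => by
    simp only [dvd_ct]
    constructor
    · rintro ⟨h1, h2, h3, h4⟩
      exact ⟨h1, h2, by simpa using (dvd_add h3 h2).neg_right, h4⟩
    · rintro ⟨h1, h2, h3, h4⟩
      exact ⟨h1, h2, dvd_sub h2.neg_right h3, h4⟩
  refine lift_congr ⟨fun h => ⟨h.1, hd ▸ h.2⟩, fun h => ⟨h.1, hd ▸ h.2⟩⟩ hd hc fun d h D => ?_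
  obtain ⟨-, h2, h3, -⟩ := (dvd_ct _ _).1 ((hc d).1 h)
  exact lift_neg_class hg he d (dvd_sub h2 h3) h2 (by dsimp only; ring) D

lemma lift_rot (κ : ℕ) (hg : ∀ j k D, g (j + 3 * k) D = g j D)
    (he : ∀ j D, g (-j) D = e * g j D) (n r s m : ℤ) :
    lift κ g (n, -s, r + s, m) = e * lift κ g (n, r, s, m) := by
  have hd : dt (n, -s, r + s, m) = dt (n, r, s, m) := by simp only [dt, nrm]; ring
  have hc : ∀ d : ℕ, d ∣ ct (n, -s, r + s, m) ↔ d ∣ ct (n, r, s, m) := fun d => by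
    simp only [dvd_ct]
    constructor
    · rintro ⟨h1, h2, h3, h4⟩
      exact ⟨h1, by simpa using dvd_add h3 h2, by simpa using h2, h4⟩
    · rintro ⟨h1, h2, h3, h4⟩
      exact ⟨h1, h3.neg_right, dvd_add h2 h3, h4⟩
  refine lift_congr ⟨fun h => ⟨h.1, hd ▸ h.2⟩, fun h => ⟨h.1, hd ▸ h.2⟩⟩ hd hc fun d h D => ?_
  obtain ⟨-, h2, h3, -⟩ := (dvd_ct _ _).1 ((hc d).1 h)
  exact lift_neg_class hg he d (dvd_sub h2 h3) h3.neg_right (by dsimp only; ring) D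

lemma CS_lift (κ : ℕ) (g : ℤ → ℤ → ℂ) : CS (lift κ g) := fun _ h => if_neg fun hp => h hp.cone

lemma exists_pow_le_exp (B : ℕ) {δ : ℝ} (hδ : 0 < δ) :
    ∃ C : ℝ, 0 ≤ C ∧ ∀ x : ℝ, 0 ≤ x → (x + 1) ^ B ≤ C * Real.exp (δ * x) := by
  refine ⟨B.factorial / δ ^ B * Real.exp δ, by positivity, fun x hx => ?_⟩
  have h := Real.pow_div_factorial_le_exp (δ * (x + 1)) (by positivity) B
  rw [mul_pow, div_le_iff₀ (by positivity)] at h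
  rw [mul_assoc, ← Real.exp_add, show δ + δ * x = δ * (x + 1) by ring, div_mul_eq_mul_div,
    le_div_iff₀ (by positivity)]
  linarith

lemma TD.grow_lift {κ κ' : ℕ} (h : TD κ' g) : Grow (lift κ g) := by
  obtain ⟨C, A, hC, hb⟩ := h.bound
  intro δ hδ
  obtain ⟨C', hC', hexp⟩ := exists_pow_le_exp (κ + 1 + 2 * A) hδ
  refine ⟨C * 3 ^ A * C', fun x => ?_⟩
  have hsz : 0 ≤ sz x := by unfold sz; positivity
  unfold lift
  split_ifs with hp
  · have hm : (0 : ℝ) < x.2.2.2 := by exact_mod_cast hp.1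
    have hn : (0 : ℝ) < x.1 := by exact_mod_cast hp.fst
    have hs : (x.1 : ℝ) + x.2.2.2 ≤ sz x := by
      unfold sz
      rw [abs_of_pos hm, abs_of_pos hn]
      have := abs_nonneg (x.2.1 : ℝ)
      have := abs_nonneg (x.2.2.1 : ℝ)
      linarith
    have hct : ((ct x : ℕ) : ℤ) ∣ x.2.2.2 := ((dvd_ct _ _).1 dvd_rfl).2.2.2
    have hcle : (ct x : ℝ) ≤ sz x + 1 := by
      have : ((ct x : ℕ) : ℤ) ≤ x.2.2.2 := Int.le_of_dvd hp.1 hct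
      have : (ct x : ℝ) ≤ x.2.2.2 := by exact_mod_cast this
      linarith
    have hD : (dt x : ℝ) + 1 ≤ 3 * (sz x + 1) ^ 2 := by
      have h0 : dt x ≤ 3 * x.1 * x.2.2.2 := by
        have := nrm_nonneg (x.2.1, x.2.2.1)
        unfold dt; linarith
      have h1 : (dt x : ℝ) ≤ 3 * x.1 * x.2.2.2 := by exact_mod_cast h0
      nlinarith
    refine (norm_sum_le _ _).trans ((sum_le_card_nsmul _ _ ((sz x + 1) ^ κ *
      (C * (3 * (sz x + 1) ^ 2) ^ A)) fun d hd => ?_).trans ?_)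
    · have hd1 := Nat.dvd_of_mem_divisors hd
      have hd0 : 0 < d := Nat.pos_of_mem_divisors hd
      have hdle : (d : ℝ) ≤ sz x + 1 := by
        have : d ≤ ct x := Nat.divisor_le hd
        have : (d : ℝ) ≤ ct x := by exact_mod_cast this
        linarith
      rw [norm_mul, norm_pow, norm_natCast]
      gcongr
      refine (hb _ _).trans ?_
      gcongr
      have h1 : (0 : ℤ) ≤ dt x / (d : ℤ) ^ 2 := Int.ediv_nonneg hp.2.le (by positivity)
      have h2 : dt x / (d : ℤ) ^ 2 ≤ dt x := Int.ediv_le_self _ hp.2.le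
      rw [abs_of_nonneg (by exact_mod_cast h1)]
      have : ((dt x / (d : ℤ) ^ 2 : ℤ) : ℝ) ≤ dt x := by exact_mod_cast h2
      linarith
    · rw [nsmul_eq_mul]
      have hcard : (((ct x).divisors.card : ℕ) : ℝ) ≤ sz x + 1 :=
        le_trans (by exact_mod_cast Nat.card_divisors_le_self _) hcle
      have he := hexp (sz x) hsz
      calc _ ≤ (sz x + 1) * ((sz x + 1) ^ κ * (C * (3 * (sz x + 1) ^ 2) ^ A)) := by gcongr
        _ = C * 3 ^ A * (sz x + 1) ^ (κ + 1 + 2 * A) := by rw [mul_pow, ← pow_mul]; ring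
        _ ≤ C * 3 ^ A * (C' * Real.exp (δ * sz x)) := by gcongr
        _ = _ := by ring
  · rw [norm_zero]; positivity

open ModularGroup FixedDetMatrices

/-- The slash action of an integral matrix of determinant `m` on a function of index one. -/
def psi (κ : ℕ) (g : ℤ → ℤ → ℂ) (m : ℤ) (A : Matrix (Fin 2) (Fin 2) ℤ) (τ t σ : ℂ) : ℂ :=
  ((A 1 0 * τ + A 1 1) ^ (κ + 1))⁻¹ * ex (-(m * A 1 0 * (t ^ 2 + 3 * σ ^ 2)) / (A 1 0 * τ + A 1 1)) *
    phi g ((A 0 0 * τ + A 0 1) / (A 1 0 * τ + A 1 1)) (m * t / (A 1 0 * τ + A 1 1))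
      (m * σ / (A 1 0 * τ + A 1 1))

lemma linear_ne {c d : ℤ} (h : c ≠ 0 ∨ d ≠ 0) (hτ : 0 < τ.im) : (c * τ + d : ℂ) ≠ 0 := by
  intro h0
  have h1 := congrArg im h0
  have h2 := congrArg re h0
  simp at h1 h2
  rcases h1 with h1 | h1
  · simp [h1] at h2; tauto
  · exact hτ.ne' h1

lemma mobius_im {a b c d m : ℤ} (h : a * d - b * c = m) :
    ((a * τ + b : ℂ) / (c * τ + d)).im = m * τ.im / normSq (c * τ + d) := by
  rw [div_im, ← sub_div, ← h]
  congr 1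
  simp
  ring

lemma mobius_facts {m : ℤ} (hm : 0 < m) {A : Matrix (Fin 2) (Fin 2) ℤ} (hA : A.det = m)
    (hτ : 0 < τ.im) : (A 1 0 * τ + A 1 1 : ℂ) ≠ 0 ∧ (A 0 0 * τ + A 0 1 : ℂ) ≠ 0 ∧
      0 < ((A 0 0 * τ + A 0 1 : ℂ) / (A 1 0 * τ + A 1 1)).im := by
  rw [det_fin_two] at hA
  have h1 : (A 1 0 * τ + A 1 1 : ℂ) ≠ 0 := by
    refine linear_ne ?_ hτ
    by_contra! hc
    simp [hc.1, hc.2] at hA; omega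
  refine ⟨h1, ?_, ?_⟩
  · refine linear_ne ?_ hτ
    by_contra! hc
    simp [hc.1, hc.2] at hA; omega
  · rw [mobius_im hA]
    have : (0 : ℝ) < m := by exact_mod_cast hm
    have := normSq_pos.2 h1
    positivity

lemma TD.phi_add_one (h : TD κ g) (hτ : 0 < τ.im) (t σ : ℂ) :
    phi g (τ + 1) t σ = phi g τ t σ := by
  have h1 := h.hasSum_phi (τ := τ + 1) (by simpa using hτ) t σ
  refine h1.unique ?_
  convert h.hasSum_phi hτ t σ using 2 with w
  rw [show linW w (τ + 1) t σ = linW w τ t σ + (w.1.1 : ℤ) by simp only [linW]; ring, ex_add, ex_int,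
    mul_one]

lemma TD.psi_T (h : TD κ g) {m : ℤ} (hm : 0 < m)
    (A : FixedDetMatrix (Fin 2) ℤ m) (hτ : 0 < τ.im) (t σ : ℂ) :
    psi κ g m (T • A).1 τ t σ = psi κ g m A.1 τ t σ := by
  obtain ⟨h1, -, h3⟩ := mobius_facts hm A.2 hτ
  have e : (T • A).1 = !![A.1 0 0 + A.1 1 0, A.1 0 1 + A.1 1 1; A.1 1 0, A.1 1 1] := by
    rw [smul_coe]; ext i j
    fin_cases i <;> fin_cases j <;> simp [T, mul_apply, Fin.sum_univ_two]
  rw [e, psi, psi]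
  simp only [of_apply, Matrix.cons_val', cons_val_zero, cons_val_one,
    cons_val_fin_one]
  rw [← h.phi_add_one h3, div_add_one h1]
  congr 2
  push_cast; ring

lemma cocycle_aux {a c m x y : ℂ} (hx : x ≠ 0) (hy : y ≠ 0) (hm : m = a * y - c * x) (t σ : ℂ) :
    -(m * c * (t ^ 2 + 3 * σ ^ 2)) / y = -(m * a * (t ^ 2 + 3 * σ ^ 2)) / x +
      ((m * t / y) ^ 2 + 3 * (m * σ / y) ^ 2) / (x / y) := by
  field_simp
  rw [hm]; ring

lemma cocycle_aux' {m c d x τ : ℂ} (hτ : τ ≠ 0) (hx : x ≠ 0) (hc : c = d * τ - x) (t σ : ℂ) :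
    -(m * c * ((t / τ) ^ 2 + 3 * (σ / τ) ^ 2)) / (x / τ) =
      m * (t ^ 2 + 3 * σ ^ 2) / τ + -(m * d * (t ^ 2 + 3 * σ ^ 2)) / x := by
  field_simp
  rw [hc]; ring

lemma TD.psi_S (h : TD κ g) {m : ℤ} (hm : 0 < m)
    (A : FixedDetMatrix (Fin 2) ℤ m) (hτ : 0 < τ.im) (t σ : ℂ) :
    psi κ g m (S • A).1 τ t σ = psi κ g m A.1 τ t σ := by
  obtain ⟨h1, h2, h3⟩ := mobius_facts hm A.2 hτ
  have hd := A.2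
  rw [det_fin_two] at hd
  have hd' : (A.1 0 0 * A.1 1 1 - A.1 0 1 * A.1 1 0 : ℂ) = m := by exact_mod_cast hd
  have e : (S • A).1 = !![-A.1 1 0, -A.1 1 1; A.1 0 0, A.1 0 1] := by
    rw [smul_coe]; ext i j
    fin_cases i <;> fin_cases j <;> simp [S, mul_apply, Fin.sum_univ_two]
  rw [e, psi, psi]
  simp only [of_apply, Matrix.cons_val', cons_val_zero, cons_val_one,
    cons_val_fin_one]
  generalize (A.1 0 0 : ℤ) = a at *
  generalize (A.1 0 1 : ℤ) = b at *
  generalize (A.1 1 0 : ℤ) = c at *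
  generalize (A.1 1 1 : ℤ) = d at *
  have hS := h.phi_S h3 (m * t / (c * τ + d)) (m * σ / (c * τ + d))
  rw [show -1 / ((a * τ + b : ℂ) / (c * τ + d)) = (((-c : ℤ) : ℂ) * τ + ((-d : ℤ) : ℂ)) / (a * τ + b) by
      push_cast; field_simp; ring,
    show m * t / (c * τ + d : ℂ) / ((a * τ + b : ℂ) / (c * τ + d)) = m * t / (a * τ + b) by field_simp,
    show m * σ / (c * τ + d : ℂ) / ((a * τ + b : ℂ) / (c * τ + d)) = m * σ / (a * τ + b) by field_simp] at hS
  rw [hS]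
  have he : ex (-(m * c * (t ^ 2 + 3 * σ ^ 2)) / (c * τ + d)) =
      ex (-(m * a * (t ^ 2 + 3 * σ ^ 2)) / (a * τ + b)) *
      ex (((m * t / (c * τ + d)) ^ 2 + 3 * (m * σ / (c * τ + d)) ^ 2) / ((a * τ + b) / (c * τ + d))) := by
    rw [← ex_add]
    congr 1
    have hm' : (m : ℂ) = a * (c * τ + d) - c * (a * τ + b) := by rw [← hd']; ring
    exact cocycle_aux h2 h1 hm' t σ
  rw [he, div_pow]
  field_simp

lemma TD.psi_smul (h : TD κ g) {m : ℤ} (hm : 0 < m)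
    (γ : SpecialLinearGroup (Fin 2) ℤ) :
    ∀ (A : FixedDetMatrix (Fin 2) ℤ m) {τ : ℂ}, 0 < τ.im → ∀ (t σ : ℂ),
    psi κ g m (γ • A).1 τ t σ = psi κ g m A.1 τ t σ := by
  have hγ : γ ∈ Subgroup.closure {S, T} := by
    rw [SpecialLinearGroup.SL2Z_generators]; trivial
  induction hγ using Subgroup.closure_induction with
  | mem x hx =>
    intro A τ hτ t σ
    rcases hx with rfl | rfl
    · exact h.psi_S hm A hτ t σ
    · exact h.psi_T hm A hτ t σ
  | one => intro A τ hτ t σ; rw [one_smul]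
  | mul x y _ _ hx hy => intro A τ hτ t σ; rw [SemigroupAction.mul_smul, hx _ hτ, hy _ hτ]
  | inv x _ hx => intro A τ hτ t σ; rw [← hx _ hτ, smul_inv_smul]

/-- Right multiplication by the inversion. -/
def mulS {m : ℤ} (A : FixedDetMatrix (Fin 2) ℤ m) : FixedDetMatrix (Fin 2) ℤ m :=
  ⟨A.1 * S.1, by rw [det_mul, A.2, S.2, mul_one]⟩

lemma mulS_smul {m : ℤ} (γ : SpecialLinearGroup (Fin 2) ℤ) (A : FixedDetMatrix (Fin 2) ℤ m) :
    mulS (γ • A) = γ • mulS A := by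
  apply FixedDetMatrices.ext'
  rw [smul_coe]
  simp only [mulS, smul_coe, Matrix.mul_assoc]

lemma mulS_injective {m : ℤ} : Injective (mulS (m := m)) := by
  intro A B h
  apply FixedDetMatrices.ext'
  have h1 : A.1 * S.1 = B.1 * S.1 := congrArg Subtype.val h
  have hu : IsUnit (S.1 : Matrix (Fin 2) (Fin 2) ℤ) := by
    rw [isUnit_iff_isUnit_det, S.2]; exact isUnit_one
  exact hu.mul_left_injective h1

lemma psi_mulS (κ : ℕ) (g : ℤ → ℤ → ℂ) {m : ℤ} (hm : 0 < m)
    (A : FixedDetMatrix (Fin 2) ℤ m) (hτ : 0 < τ.im) (t σ : ℂ) :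
    psi κ g m A.1 (-1 / τ) (t / τ) (σ / τ) =
      τ ^ (κ + 1) * ex (m * (t ^ 2 + 3 * σ ^ 2) / τ) * psi κ g m (mulS A).1 τ t σ := by
  obtain ⟨h1, h2, h3⟩ := mobius_facts hm (mulS A).2 hτ
  have hτ0 : τ ≠ 0 := fun h0 => by simp [h0] at hτ
  have e : (mulS A).1 = !![A.1 0 1, -A.1 0 0; A.1 1 1, -A.1 1 0] := by
    rw [mulS]; ext i j
    fin_cases i <;> fin_cases j <;> simp [S, mul_apply, Fin.sum_univ_two]
  rw [e] at h1 h2 h3 ⊢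
  rw [psi, psi]
  simp only [of_apply, Matrix.cons_val', cons_val_zero, cons_val_one,
    cons_val_fin_one] at h1 h2 h3 ⊢
  generalize (A.1 0 0 : ℤ) = a at *
  generalize (A.1 0 1 : ℤ) = b at *
  generalize (A.1 1 0 : ℤ) = c at *
  generalize (A.1 1 1 : ℤ) = d at *
  have hcd : (c * (-1 / τ) + d : ℂ) = (d * τ + ((-c : ℤ) : ℂ)) / τ := by push_cast; field_simp; ring
  have hab : (a * (-1 / τ) + b : ℂ) = (b * τ + ((-a : ℤ) : ℂ)) / τ := by push_cast; field_simp; ring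
  rw [hcd, hab]
  have he : ex (-(m * c * ((t / τ) ^ 2 + 3 * (σ / τ) ^ 2)) / ((d * τ + ((-c : ℤ) : ℂ)) / τ)) =
      ex (m * (t ^ 2 + 3 * σ ^ 2) / τ) *
        ex (-(m * d * (t ^ 2 + 3 * σ ^ 2)) / (d * τ + ((-c : ℤ) : ℂ))) := by
    rw [← ex_add]
    congr 1
    exact cocycle_aux' hτ0 h1 (by push_cast; ring) t σ
  rw [he, div_div_div_cancel_right₀ hτ0,
    show m * (t / τ) / ((d * τ + ((-c : ℤ) : ℂ)) / τ) = m * t / (d * τ + ((-c : ℤ) : ℂ)) by field_simp,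
    show m * (σ / τ) / ((d * τ + ((-c : ℤ) : ℂ)) / τ) = m * σ / (d * τ + ((-c : ℤ) : ℂ)) by field_simp,
    div_pow]
  field_simp

lemma exists_reduce {m : ℤ} (A : FixedDetMatrix (Fin 2) ℤ m) :
    ∃ γ : SpecialLinearGroup (Fin 2) ℤ, reduce A = γ • A := by
  induction A using reduce_rec with
  | step A h1 h2 =>
    obtain ⟨γ, hγ⟩ := h2
    rw [reduce_reduceStep h1] at hγ
    refine ⟨γ * (S * T ^ (-(A.1 0 0 / A.1 1 0))), ?_⟩
    rw [hγ, reduceStep, SemigroupAction.mul_smul, SemigroupAction.mul_smul]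
  | base A h =>
    by_cases h1 : 0 < A.1 0 0
    · exact ⟨_, reduce_of_pos h h1⟩
    · refine ⟨T ^ (-(-A.1 0 1 / -A.1 1 1)) * (S * S), ?_⟩
      rw [reduce_of_not_pos h h1, SemigroupAction.mul_smul, SemigroupAction.mul_smul]

lemma reps_unique {m : ℤ} {A B : FixedDetMatrix (Fin 2) ℤ m} (hA : A ∈ reps m) (hB : B ∈ reps m)
    {γ : SpecialLinearGroup (Fin 2) ℤ} (h : B = γ • A) : A = B := by
  obtain ⟨a1, a2, a3, a4⟩ := hA
  obtain ⟨b1, b2, b3, b4⟩ := hB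
  have hent : ∀ i j, B.1 i j = γ.1 i 0 * A.1 0 j + γ.1 i 1 * A.1 1 j := fun i j => by
    rw [h, smul_coe, mul_apply, Fin.sum_univ_two]
  have hdet := γ.2
  rw [det_fin_two] at hdet
  have h10 := hent 1 0
  rw [b1, a1, mul_zero, add_zero] at h10
  have hu : γ.1 1 0 = 0 := by
    rcases mul_eq_zero.1 h10.symm with h0 | h0
    · exact h0
    · omega
  rw [hu, mul_zero, sub_zero] at hdet
  have h00 := hent 0 0
  rw [a1, mul_zero, add_zero] at h00
  have hp : γ.1 0 0 = 1 ∧ γ.1 1 1 = 1 := by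
    rcases Int.mul_eq_one_iff_eq_one_or_neg_one.1 hdet with h0 | h0
    · exact h0
    · rw [h0.1] at h00; omega
  have h11 := hent 1 1
  rw [hu, hp.2, zero_mul, zero_add, one_mul] at h11
  have h01 := hent 0 1
  rw [hp.1, one_mul] at h01
  have hq : γ.1 0 1 = 0 := by
    rw [abs_of_nonneg a3] at a4
    rw [abs_of_nonneg b3, h11] at b4
    by_contra hq
    have h5 : |γ.1 0 1 * A.1 1 1| < |A.1 1 1| := by
      rw [show γ.1 0 1 * A.1 1 1 = B.1 0 1 - A.1 0 1 by omega]
      exact abs_sub_lt_of_nonneg_of_lt b3 b4 a3 a4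
    rw [abs_mul] at h5
    have := Int.one_le_abs hq
    nlinarith [abs_nonneg (A.1 1 1)]
  apply FixedDetMatrices.ext
  intro i j
  fin_cases i <;> fin_cases j
  · exact (by rw [h00, hp.1, one_mul] : A.1 0 0 = B.1 0 0)
  · exact (by rw [h01, hq, zero_mul, add_zero] : A.1 0 1 = B.1 0 1)
  · exact a1.trans b1.symm
  · exact h11.symm

lemma TD.sum_psi_S (h : TD κ g) {m : ℤ} (hm : 0 < m) (hτ : 0 < τ.im)
    (t σ : ℂ) : ∑ A : reps m, psi κ g m A.1.1 (-1 / τ) (t / τ) (σ / τ) =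
      τ ^ (κ + 1) * ex (m * (t ^ 2 + 3 * σ ^ 2) / τ) * ∑ A : reps m, psi κ g m A.1.1 τ t σ := by
  let f : reps m → reps m := fun A => ⟨reduce (mulS A.1), reduce_mem_reps hm.ne' _⟩
  have hf : Injective f := by
    intro A B hAB
    have h1 : reduce (mulS A.1) = reduce (mulS B.1) := congrArg Subtype.val hAB
    obtain ⟨γ, hγ⟩ := exists_reduce (mulS A.1)
    obtain ⟨δ, hδ⟩ := exists_reduce (mulS B.1)
    rw [hγ, hδ, ← mulS_smul, ← mulS_smul] at h1
    have h2 := mulS_injective h1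
    apply Subtype.ext
    refine reps_unique A.2 B.2 (γ := δ⁻¹ * γ) ?_
    rw [SemigroupAction.mul_smul, h2, inv_smul_smul]
  rw [mul_sum, ← Function.Bijective.sum_comp (Finite.injective_iff_bijective.1 hf)
    (fun A => τ ^ (κ + 1) * ex (m * (t ^ 2 + 3 * σ ^ 2) / τ) * psi κ g m A.1.1 τ t σ)]
  refine sum_congr rfl fun A _ => ?_
  rw [psi_mulS κ g hm A.1 hτ]
  congr 1
  obtain ⟨γ, hγ⟩ := exists_reduce (mulS A.1)
  change _ = psi κ g m (reduce (mulS A.1)).1 τ t σ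
  rw [hγ, h.psi_smul hm γ _ hτ]

open FixedDetMatrices

lemma ex_eq_one_iff (z : ℂ) : ex z = 1 ↔ ∃ n : ℤ, z = n := by
  rw [ex, exp_eq_one_iff]
  have : (2 * π * I : ℂ) ≠ 0 := by simp [Real.pi_ne_zero]
  constructor
  · rintro ⟨n, hn⟩
    exact ⟨n, mul_left_cancel₀ this (by rw [hn]; ring)⟩
  · rintro ⟨n, rfl⟩
    exact ⟨n, by ring⟩

lemma sum_ex_div (n : ℤ) {d : ℕ} (hd : 0 < d) :
    ∑ b ∈ range d, ex (n * b / d) = if (d : ℤ) ∣ n then (d : ℂ) else 0 := by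
  have hd0 : (d : ℂ) ≠ 0 := by exact_mod_cast hd.ne'
  have hpow : ∀ b : ℕ, ex (n * b / d) = ex (n / d) ^ b := fun b => by
    rw [← ex_nat_mul]; congr 1; ring
  have hiff : ex (n / d) = 1 ↔ (d : ℤ) ∣ n := by
    rw [ex_eq_one_iff]
    constructor
    · rintro ⟨k, hk⟩
      rw [div_eq_iff hd0] at hk
      exact ⟨k, by have : (n : ℂ) = ((d * k : ℤ) : ℂ) := by rw [hk]; push_cast; ring
                   exact_mod_cast this⟩
    · rintro ⟨k, rfl⟩
      exact ⟨k, by push_cast; field_simp⟩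
  simp_rw [hpow]
  split_ifs with h
  · rw [hiff.2 h]; simp
  · have h1 : ex (n / d) ≠ 1 := fun h' => h (hiff.1 h')
    rw [geom_sum_eq h1, ← ex_nat_mul, show (d : ℂ) * (n / d) = n by field_simp, ex_int]
    simp

lemma TD.hasSum_slice (h : TD κ g) {a d : ℕ} (ha : 0 < a) (hd : 0 < d)
    (hτ : 0 < τ.im) (t σ : ℂ) :
    HasSum (fun w : W => if (a : ℤ) ∣ w.1.1 ∧ (a : ℤ) ∣ w.1.2 ∧ (a : ℤ) ∣ w.2 then
        (a : ℂ) ^ κ * pc g ((d * (w.1.1 / a), w.1.2 / a), w.2 / a) * ex (linW w τ t σ) else 0)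
      ((a : ℂ) ^ κ * (d : ℂ)⁻¹ * ∑ b ∈ range d, phi g ((a * τ + b) / d) (a * t) (a * σ)) := by
  have ha0 : (a : ℤ) ≠ 0 := by omega
  have hd0 : (d : ℤ) ≠ 0 := by omega
  have hdc : (d : ℂ) ≠ 0 := by exact_mod_cast hd.ne'
  have him : ∀ b : ℕ, 0 < ((a * τ + b : ℂ) / d).im := fun b => by
    rw [div_natCast_im]
    simp only [add_im, mul_im, natCast_re, natCast_im, zero_mul, add_zero]
    have : (0 : ℝ) < a := by exact_mod_cast ha
    have : (0 : ℝ) < d := by exact_mod_cast hd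
    positivity
  have h1 := (hasSum_sum fun b (_ : b ∈ range d) =>
    h.hasSum_phi (him b) (a * t) (a * σ)).mul_left ((a : ℂ) ^ κ * (d : ℂ)⁻¹)
  have h2 : ∀ w : W, (a : ℂ) ^ κ * (d : ℂ)⁻¹ * ∑ b ∈ range d,
      pc g w * ex (linW w ((a * τ + b) / d) (a * t) (a * σ)) =
      if (d : ℤ) ∣ w.1.1 then (a : ℂ) ^ κ * pc g w * ex (linW w (a * τ / d) (a * t) (a * σ)) else 0 := by
    intro w
    have : ∀ b : ℕ, ex (linW w ((a * τ + b) / d) (a * t) (a * σ)) =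
        ex (linW w (a * τ / d) (a * t) (a * σ)) * ex (w.1.1 * b / d) := fun b => by
      rw [← ex_add]; congr 1; simp only [linW]; ring
    simp_rw [this]
    rw [← mul_sum, ← mul_sum, sum_ex_div _ hd]
    split_ifs
    · field_simp
    · simp
  simp_rw [h2] at h1
  let i1 : W → W := fun w => ((d * w.1.1, w.1.2), w.2)
  let i2 : W → W := fun w => ((a * w.1.1, a * w.1.2), a * w.2)
  have hi1 : Injective i1 := by
    rintro ⟨⟨n, r⟩, s⟩ ⟨⟨n', r'⟩, s'⟩ hw
    simp only [i1, Prod.mk.injEq, mul_eq_mul_left_iff, hd0, or_false] at hw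
    simp [hw]
  have hi2 : Injective i2 := by
    rintro ⟨⟨n, r⟩, s⟩ ⟨⟨n', r'⟩, s'⟩ hw
    simp only [i2, Prod.mk.injEq, mul_eq_mul_left_iff, ha0, or_false] at hw
    simp [hw]
  rw [← hi1.hasSum_iff] at h1
  · rw [← hi2.hasSum_iff]
    · refine (congrArg (fun f => HasSum f _) (funext fun w => ?_)).mp h1
      simp only [Function.comp, i1, i2, dvd_mul_right, and_self, if_true, Int.mul_ediv_cancel_left _ ha0]
      congr 2
      simp only [linW]; push_cast; field_simp
    · rintro ⟨⟨n, r⟩, s⟩ hw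
      refine if_neg ?_
      rintro ⟨⟨n', h1⟩, ⟨r', h2⟩, ⟨s', h3⟩⟩
      exact hw ⟨((n', r'), s'), by simp only [i2]; rw [← h1, ← h2, ← h3]⟩
  · rintro ⟨⟨n, r⟩, s⟩ hw
    refine if_neg ?_
    rintro ⟨n', h1⟩
    exact hw ⟨((n', r), s), by simp only [i1]; rw [← h1]⟩

lemma divisors_ct (n r s : ℤ) {m : ℕ} (hm : 0 < m) : (ct (n, r, s, (m : ℤ))).divisors =
    m.divisors.filter fun d : ℕ => (d : ℤ) ∣ n ∧ (d : ℤ) ∣ r ∧ (d : ℤ) ∣ s := by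
  have hc : ct (n, r, s, (m : ℤ)) ≠ 0 := fun h0 => by
    have := ((dvd_ct _ _).1 (dvd_refl (ct (n, r, s, (m : ℤ))))).2.2.2
    rw [h0] at this
    simp at this; omega
  ext d
  simp only [Nat.mem_divisors, mem_filter, dvd_ct, Int.natCast_dvd_natCast]
  have := hm.ne'
  tauto

lemma TD.lift_eq (h : TD κ g) (n r s : ℤ) {m : ℕ} (hm : 0 < m) :
    lift κ g (n, r, s, (m : ℤ)) = ∑ a ∈ m.divisors, if (a : ℤ) ∣ n ∧ (a : ℤ) ∣ r ∧ (a : ℤ) ∣ s then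
      (a : ℂ) ^ κ * pc g (((m / a : ℕ) * (n / a), r / a), s / a) else 0 := by
  rw [← sum_filter, ← divisors_ct n r s hm]
  have key : ∀ d ∈ (ct (n, r, s, (m : ℤ))).divisors,
      dt (n, r, s, (m : ℤ)) = d ^ 2 * (3 * ((m / d : ℕ) * (n / d)) - nrm (r / d, s / d)) ∧
        (r - s) / (d : ℤ) = r / d - s / d ∧ (0 : ℤ) < d := by
    intro d hd
    have hd0 := Nat.pos_of_mem_divisors hd
    have hd1 : (d : ℤ) ≠ 0 := by omega
    obtain ⟨⟨n', h1⟩, ⟨r', h2⟩, ⟨s', h3⟩, h4⟩ := (dvd_ct _ _).1 (Nat.dvd_of_mem_divisors hd)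
    obtain ⟨m', rfl⟩ : d ∣ m := by dsimp only at h4; exact_mod_cast h4
    dsimp only at h1 h2 h3
    subst h1 h2 h3
    rw [← mul_sub, Int.mul_ediv_cancel_left _ hd1, Int.mul_ediv_cancel_left _ hd1,
      Int.mul_ediv_cancel_left _ hd1, Int.mul_ediv_cancel_left _ hd1, Nat.mul_div_cancel_left _ hd0]
    refine ⟨?_, rfl, by omega⟩
    simp only [dt, nrm]; push_cast; ring
  unfold lift
  by_cases hp : Pos (n, r, s, (m : ℤ))
  · rw [if_pos hp]
    refine sum_congr rfl fun d hd => ?_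
    obtain ⟨h1, h2, h3⟩ := key d hd
    rw [h1, Int.mul_ediv_cancel_left _ (by positivity), pc]
    dsimp only
    rw [h2]
  · rw [if_neg hp]
    refine (sum_eq_zero fun d hd => ?_).symm
    obtain ⟨h1, h2, h3⟩ := key d hd
    have : dt (n, r, s, (m : ℤ)) ≤ 0 := by
      by_contra hc
      exact hp ⟨by dsimp only; omega, by omega⟩
    rw [pc, h.neg, mul_zero]
    dsimp only
    rw [h1] at this
    by_contra hc
    have : 0 < (d : ℤ) ^ 2 := by positivity
    nlinarith

lemma TD.hasSum_lift (h : TD κ g) {m : ℕ} (hm : 0 < m)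
    (hτ : 0 < τ.im) (t σ : ℂ) :
    HasSum (fun w : W => fj (lift κ g) m w * ex (linW w τ t σ))
      (∑ a ∈ m.divisors, (a : ℂ) ^ κ * ((m / a : ℕ) : ℂ)⁻¹ *
        ∑ b ∈ range (m / a), phi g ((a * τ + b) / (m / a : ℕ)) (a * t) (a * σ)) := by
  convert hasSum_sum fun a (ha : a ∈ m.divisors) => h.hasSum_slice (Nat.pos_of_mem_divisors ha)
    (Nat.div_pos (Nat.divisor_le ha) (Nat.pos_of_mem_divisors ha)) hτ t σ using 2 with w
  rw [fj, h.lift_eq _ _ _ hm, sum_mul]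
  refine sum_congr rfl fun a _ => ?_
  rw [ite_mul, zero_mul]

lemma reps_entries {m : ℤ} (hm : 0 < m) {A : FixedDetMatrix (Fin 2) ℤ m} (hA : A ∈ reps m) :
    ∃ a b d : ℕ, A.1 0 0 = a ∧ A.1 0 1 = b ∧ A.1 1 0 = 0 ∧ A.1 1 1 = d ∧ m = a * d ∧ b < d := by
  obtain ⟨h1, h2, h3, h4⟩ := hA
  have h5 := A.2
  rw [det_fin_two, h1, mul_zero, sub_zero] at h5
  have h6 : 0 < A.1 1 1 := by
    by_contra hc
    nlinarith
  rw [abs_of_nonneg h3, abs_of_pos h6] at h4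
  refine ⟨(A.1 0 0).toNat, (A.1 0 1).toNat, (A.1 1 1).toNat, ?_, ?_, h1, ?_, ?_, ?_⟩
  · omega
  · omega
  · omega
  · rw [Int.toNat_of_nonneg h2.le, Int.toNat_of_nonneg h6.le, h5]
  · omega

lemma sum_psi_eq (κ : ℕ) (g : ℤ → ℤ → ℂ) {m : ℕ} (hm : 0 < m) (τ t σ : ℂ) :
    ∑ a ∈ m.divisors, (a : ℂ) ^ κ * ((m / a : ℕ) : ℂ)⁻¹ *
        ∑ b ∈ range (m / a), phi g ((a * τ + b) / (m / a : ℕ)) (a * t) (a * σ) =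
      (m : ℂ) ^ κ * ∑ A : reps (m : ℤ), psi κ g m A.1.1 τ t σ := by
  have hmz : (0 : ℤ) < m := by omega
  simp_rw [mul_sum]
  rw [sum_sigma']
  symm
  refine sum_bij (fun A _ => ⟨(A.1.1 0 0).toNat, (A.1.1 0 1).toNat⟩) ?_ ?_ ?_ ?_
  · intro A _
    obtain ⟨a, b, d, ha, hb, hc, hd, hm', hbd⟩ := reps_entries hmz A.2
    have hm'' : m = a * d := by exact_mod_cast hm'
    have ha0 : 0 < a := Nat.pos_of_mul_pos_right (hm'' ▸ hm)
    simp only [mem_sigma, Nat.mem_divisors, mem_range, ha, hb, Int.toNat_natCast]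
    rw [hm'', Nat.mul_div_cancel_left _ ha0]
    exact ⟨⟨dvd_mul_right _ _, by omega⟩, hbd⟩
  · intro A _ B _ hAB
    obtain ⟨a, b, d, ha, hb, hc, hd, hm', hbd⟩ := reps_entries hmz A.2
    obtain ⟨a', b', d', ha', hb', hc', hd', hm'', hbd'⟩ := reps_entries hmz B.2
    simp only [ha, hb, ha', hb', Int.toNat_natCast, Sigma.mk.injEq, heq_eq_eq] at hAB
    obtain ⟨rfl, rfl⟩ := hAB
    have hdd : (d : ℤ) = d' := by
      rw [hm'] at hm''
      refine mul_left_cancel₀ (fun h0 => ?_) hm''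
      rw [h0, zero_mul] at hm'; omega
    apply Subtype.ext
    apply FixedDetMatrices.ext
    intro i j
    fin_cases i <;> fin_cases j
    · exact ha.trans ha'.symm
    · exact hb.trans hb'.symm
    · exact hc.trans hc'.symm
    · exact hd.trans (hdd.trans hd'.symm)
  · rintro ⟨a, b⟩ hab
    simp only [mem_sigma, Nat.mem_divisors, mem_range] at hab
    obtain ⟨⟨⟨d, hd⟩, -⟩, hb⟩ := hab
    have ha0 : 0 < a := Nat.pos_of_mul_pos_right (hd ▸ hm)
    rw [hd, Nat.mul_div_cancel_left _ ha0] at hb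
    refine ⟨⟨⟨!![(a : ℤ), b; 0, d], by rw [det_fin_two_of, hd]; push_cast; ring⟩, ?_⟩,
      mem_univ _, ?_⟩
    · refine ⟨rfl, ?_, ?_, ?_⟩
      · change (0 : ℤ) < a; omega
      · change (0 : ℤ) ≤ b; omega
      · change |(b : ℤ)| < |(d : ℤ)|
        rw [Nat.abs_cast, Nat.abs_cast]; omega
    · simp
  · intro A _
    obtain ⟨a, b, d, ha, hb, hc, hd, hm', hbd⟩ := reps_entries hmz A.2
    have hm'' : m = a * d := by exact_mod_cast hm'
    have ha0 : 0 < a := Nat.pos_of_mul_pos_right (hm'' ▸ hm)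
    have hd0 : (d : ℂ) ≠ 0 := by
      have : d ≠ 0 := by omega
      exact_mod_cast this
    simp only [psi, ha, hb, hc, hd, Int.toNat_natCast]
    rw [hm'', Nat.mul_div_cancel_left _ ha0]
    push_cast
    rw [show ex (-(a * d * 0 * (t ^ 2 + 3 * σ ^ 2)) / (0 * τ + d)) = 1 by simp [ex_zero], zero_mul, zero_add,
      show (a * d * t / d : ℂ) = a * t by field_simp, show (a * d * σ / d : ℂ) = a * σ by field_simp]
    field_simp
    ring

lemma TD.fj_lift_law (h : TD κ g) (m : ℤ) (hτ : 0 < τ.im) (t σ : ℂ) :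
    ∑' w : W, fj (lift κ g) m w * ex (linW w (-1 / τ) (t / τ) (σ / τ)) =
      τ ^ (κ + 1) * ex (m * (t ^ 2 + 3 * σ ^ 2) / τ) * ∑' w : W, fj (lift κ g) m w * ex (linW w τ t σ) := by
  by_cases hm : 0 < m
  · lift m to ℕ using hm.le
    have hm' : 0 < m := by omega
    rw [(h.hasSum_lift hm' (im_neg_inv_pos hτ) _ _).tsum_eq, (h.hasSum_lift hm' hτ t σ).tsum_eq,
      sum_psi_eq _ _ hm', sum_psi_eq _ _ hm', h.sum_psi_S hm hτ]
    ring
  · have : ∀ w, fj (lift κ g) m w = 0 := fun w => if_neg fun hp => hm hp.1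
    simp [this]

/-- Splitting off the last coordinate of an index. -/
def splitX : ℤ × W ≃ X where
  toFun p := (p.2.1.1, p.2.1.2, p.2.2, p.1)
  invFun x := (x.2.2.2, ((x.1, x.2.1), x.2.2.1))
  left_inv _ := rfl
  right_inv _ := rfl

lemma FF_eq_tsum_fj (hc : CS a) (hg : Grow a) (hz : Dom z) :
    FF a z = ∑' m : ℤ, ex (m * z.2.2.2) * ∑' w : W, fj a m w * ex (linW w z.1 z.2.1 z.2.2.1) := by
  have hs := summable_FF hc hg hz
  rw [← splitX.summable_iff] at hs
  rw [FF, ← splitX.tsum_eq]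
  refine hs.tsum_prod.trans ?_
  refine tsum_congr fun m => ?_
  rw [← tsum_mul_left]
  refine tsum_congr fun w => ?_
  rw [Function.comp, show lin (splitX (m, w)) z = m * z.2.2.2 + linW w z.1 z.2.1 z.2.2.1 by
    simp only [lin, splitX, linW, Equiv.coe_fn_mk]; ring, ex_add]
  simp only [fj, splitX, Equiv.coe_fn_mk]
  ring

lemma TD.hf_lift (h : TD κ g) (he : ∀ j D, g (-j) D = e * g j D) :
    HF (κ + 1 : ℕ) e (lift κ g) where
  cone := CS_lift κ g
  grow := h.grow_lift
  S1 z hz := by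
    rw [FF_eq_tsum_fj (CS_lift κ g) h.grow_lift (Dom_Sz hz), FF_eq_tsum_fj (CS_lift κ g) h.grow_lift hz,
      ← tsum_mul_left]
    refine tsum_congr fun m => ?_
    simp only [Sz]
    rw [h.fj_lift_law m hz.1, show (m : ℂ) * (z.2.2.2 - (z.2.1 ^ 2 + 3 * z.2.2.1 ^ 2) / z.1) =
      m * z.2.2.2 + -(m * (z.2.1 ^ 2 + 3 * z.2.2.1 ^ 2) / z.1) by ring, ex_add, ex_neg, zpow_natCast]
    have := ex_ne_zero (m * (z.2.1 ^ 2 + 3 * z.2.2.1 ^ 2) / z.1)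
    field_simp
  swap := lift_swap κ g
  flip := lift_flip κ h.per he
  rot := lift_rot κ h.per he
  shift := lift_shift κ h.per

lemma Mspan_single {w : ℤ} {i0 j0 : ℕ} (h : ∀ i j : ℕ, 4 * (i : ℤ) + 6 * j = w → i = i0 ∧ j = j0)
    {g : PowerSeries ℂ} (hg : g ∈ Mspan w) : ∃ c : ℂ, g = c • (e4 ^ i0 * e6 ^ j0) := by
  have : Mspan w ≤ Submodule.span ℂ {e4 ^ i0 * e6 ^ j0} := by
    refine Submodule.span_le.2 ?_
    rintro _ ⟨i, j, hij, rfl⟩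
    obtain ⟨rfl, rfl⟩ := h i j hij
    exact Submodule.mem_span_singleton_self _
  obtain ⟨c, hc⟩ := Submodule.mem_span_singleton.1 (this hg)
  exact ⟨c, hc.symm⟩

lemma Mspan_empty {w : ℤ} (h : ∀ i j : ℕ, 4 * (i : ℤ) + 6 * j ≠ w)
    {g : PowerSeries ℂ} (hg : g ∈ Mspan w) : g = 0 := by
  have : Mspan w ≤ ⊥ := by
    refine Submodule.span_le.2 ?_
    rintro _ ⟨i, j, hij, rfl⟩
    exact absurd hij (h i j)
  simpa using this hg

/-- The indices of norm at most one. -/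
def sev : Finset (ℤ × ℤ) := {(0, 0), (1, 0), (-1, 0), (0, 1), (0, -1), (1, -1), (-1, 1)}

lemma nrm_eq (r s : ℤ) : nrm (r, s) = r ^ 2 + r * s + s ^ 2 := rfl

lemma mem_sev {r s : ℤ} (h : nrm (r, s) ≤ 1) : (r, s) ∈ sev := by
  rw [nrm_eq] at h
  have h1 : r ≤ 1 := by nlinarith [sq_nonneg (r + 2 * s), sq_nonneg (r - 1)]
  have h2 : -1 ≤ r := by nlinarith [sq_nonneg (r + 2 * s), sq_nonneg (r + 1)]
  have h3 : s ≤ 1 := by nlinarith [sq_nonneg (2 * r + s), sq_nonneg (s - 1)]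
  have h4 : -1 ≤ s := by nlinarith [sq_nonneg (2 * r + s), sq_nonneg (s + 1)]
  interval_cases r <;> interval_cases s <;> first | decide | (exfalso; revert h; decide)

lemma nrm_mod (r s : ℤ) : ∃ k, nrm (r, s) = (r - s) ^ 2 + 3 * k := ⟨r * s, by rw [nrm_eq]; ring⟩

lemma nrm_ne_two (r s : ℤ) : nrm (r, s) ≠ 2 := by
  obtain ⟨k, hk⟩ := nrm_mod r s
  intro h
  have h1 : ((r - s) % 3 = 0 ∨ (r - s) % 3 = 1 ∨ (r - s) % 3 = 2) := by omega
  have h2 : (r - s) ^ 2 % 3 = 2 := by omega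
  rcases h1 with h1 | h1 | h1 <;> simp [pow_two, Int.mul_emod, h1] at h2

lemma nrm_zero {r s : ℤ} (h : nrm (r, s) = 0) : r = 0 ∧ s = 0 := by
  rw [nrm_eq] at h
  constructor <;> nlinarith [sq_nonneg (r + 2 * s), sq_nonneg (2 * r + s)]

lemma nrm_one {r s : ℤ} (h : nrm (r, s) = 1) : ¬ (3 : ℤ) ∣ r - s := by
  obtain ⟨k, hk⟩ := nrm_mod r s
  rintro ⟨l, hl⟩
  rw [hl, h] at hk
  have : (1 : ℤ) = 3 * (3 * l ^ 2 + k) := by linarith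
  omega

lemma lift_of_not_pos {n r s m : ℤ} (h : n ≤ 0 ∨ m ≤ 0) :
    lift κ g (n, r, s, m) = 0 := by
  refine if_neg fun hp => ?_
  have h1 := hp.fst
  have h2 := hp.1
  simp only at h1 h2
  omega

lemma lift_one (κ : ℕ) {P0 P1 : PowerSeries ℤ} {ε A : ℤ} (h0 : coeff 3 P0 = 9 * A)
    (h1 : coeff 2 P1 = 9) (r s : ℤ) : lift κ (gd P0 P1 ε) (1, r, s, 1) =
      if nrm (r, s) = 0 then (A : ℂ) else if nrm (r, s) = 1 then
        (if (r - s) % 3 = 1 then 1 else (ε : ℂ)) else 0 := by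
  have hn := nrm_nonneg (r, s)
  have hd : dt (1, r, s, 1) = 3 - nrm (r, s) := by simp [dt]
  have hc : ct (1, r, s, 1) = 1 := by simp [ct]
  rw [lift, hc]
  simp only [Pos, hd, Nat.divisors_one, sum_singleton, Nat.cast_one, one_pow, Int.ediv_one,
    one_mul]
  by_cases c0 : nrm (r, s) = 0
  · obtain ⟨rfl, rfl⟩ := nrm_zero c0
    rw [if_pos ⟨by norm_num, by omega⟩, if_pos c0, c0]
    simp [gd, h0]
  rw [if_neg c0]
  by_cases c1 : nrm (r, s) = 1
  · rw [if_pos ⟨by norm_num, by omega⟩, if_pos c1, c1]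
    have h3 := nrm_one c1
    by_cases c : (r - s) % 3 = 1
    · rw [if_pos c]
      have : (3 : ℤ) ∣ r - s - 1 := by omega
      simp [gd, h1, this, h3]
    · rw [if_neg c]
      have : ¬ (3 : ℤ) ∣ r - s - 1 := by omega
      simp [gd, h1, this, h3]
  · rw [if_neg c1, if_neg]
    have := nrm_ne_two r s
    omega

lemma gd_neg {P0 P1 : PowerSeries ℤ} {ε : ℤ} (hε : ε * ε = 1)
    (h : ε = 1 ∨ P0 = C 0) (j D : ℤ) : gd P0 P1 ε (-j) D = ε * gd P0 P1 ε j D := by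
  unfold gd
  split_ifs with a1 a2 a3 a4 a5 a6 a7 a8 a9 <;> try omega
  all_goals first
    | (simp; done)
    | (rcases h with rfl | rfl <;> simp; done)
    | (push_cast; ring; done)
    | (have : (ε : ℂ) * ε = 1 := by exact_mod_cast hε
       push_cast; linear_combination (-((coeff D.toNat P1 : ℤ) : ℂ) / 9) * this)

/-- The form of weight nine. -/
def f9 : X → ℂ := lift 8 g9
/-- The form of weight ten. -/
def f10 : X → ℂ := lift 9 g10
/-- The form of weight twelve. -/
def f12 : X → ℂ := lift 11 g12
/-- The form of weight eighteen. -/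
def f18 : X → ℂ := conv f9 f9

lemma hf9 : HF 9 (-1) f9 :=
  TD_g9.hf_lift fun j D => (gd_neg (ε := -1) (by norm_num) (Or.inr rfl) j D).trans (by simp [g9])
lemma hf10 : HF 10 1 f10 :=
  TD_g10.hf_lift fun j D => (gd_neg (ε := 1) (by norm_num) (Or.inl rfl) j D).trans (by simp [g10])
lemma hf12 : HF 12 1 f12 :=
  TD_g12.hf_lift fun j D => (gd_neg (ε := 1) (by norm_num) (Or.inl rfl) j D).trans (by simp [g12])
lemma hf18 : HF 18 1 f18 := by
  have := hf9.conv hf9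
  norm_num at this
  exact this

lemma f9_one (r s : ℤ) : f9 (1, r, s, 1) =
    if r ^ 2 + r * s + s ^ 2 = 1 then (if (r - s) % 3 = 1 then 1 else -1) else 0 := by
  rw [f9, g9, lift_one (A := 0) _ (by rw [(coeff_C_low 0).2.2.2]; rfl) e2_coeff_low.2.2.1, nrm_eq]
  split_ifs <;> first | omega | simp

lemma f10_one (r s : ℤ) : f10 (1, r, s, 1) =
    if r ^ 2 + r * s + s ^ 2 = 0 then -6 else if r ^ 2 + r * s + s ^ 2 = 1 then 1 else 0 := by
  obtain ⟨⟨h0, h1, h2⟩, h3, h4, h5⟩ := th_coeff_low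
  obtain ⟨k0, k1, k2, k3⟩ := e2_coeff_low
  rw [f10, g10, lift_one (A := -6) _ ?_ ?_, nrm_eq]
  · split_ifs <;> simp
  · simp only [(coeff_mul_low _ _).2.2.2, (coeff_mul_low _ _).1, (coeff_mul_low _ _).2.1,
      (coeff_mul_low _ _).2.2.1, (coeff_C_low _).1, (coeff_C_low _).2.1, (coeff_C_low _).2.2.1,
      (coeff_C_low _).2.2.2, h0, h1, h2, h3, h4, h5, k0, k1, k2, k3]
    norm_num
  · simp only [(coeff_mul_low _ _).2.2.1, h0, h1, h2, k0, k1, k2]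
    norm_num

lemma f12_one (r s : ℤ) : f12 (1, r, s, 1) =
    if r ^ 2 + r * s + s ^ 2 = 0 then 18 else if r ^ 2 + r * s + s ^ 2 = 1 then 1 else 0 := by
  obtain ⟨⟨h0, h1, h2⟩, h3, h4, h5⟩ := th_coeff_low
  obtain ⟨k0, k1, k2, k3⟩ := e2_coeff_low
  rw [f12, g12, lift_one (A := 18) _ ?_ ?_, nrm_eq]
  · split_ifs <;> simp
  · simp only [(coeff_mul_low _ _).2.2.2, (coeff_mul_low _ _).1, (coeff_mul_low _ _).2.1,
      (coeff_mul_low _ _).2.2.1, (coeff_C_low _).1, (coeff_C_low _).2.1, (coeff_C_low _).2.2.1,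
      (coeff_C_low _).2.2.2, h0, h1, h2, h3, h4, h5, k0, k1, k2, k3]
    norm_num
  · simp only [(coeff_mul_low _ _).2.2.1, (coeff_mul_low _ _).1, (coeff_mul_low _ _).2.1, map_add,
      (coeff_C_low _).1, (coeff_C_low _).2.1, (coeff_C_low _).2.2.1, h0, h1, h2, h3, h4, h5,
      k0, k1, k2]
    norm_num

lemma dm_one (hc : CS a) (h : ∀ r s, ¬ nrm (r, s) ≤ 1 → a (1, r, s, 1) = 0) (i j : ℕ) :
    dm a 1 1 i j =
      ∑ p ∈ sev, a (1, p.1, p.2, 1) * ((p.1 + 2 * p.2 : ℤ) : ℂ) ^ i * (p.1 : ℂ) ^ j := by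
  refine sum_subset (fun p hp => ?_) fun p _ hp => ?_
  · by_contra hn
    exact (mem_fs hc).1 hp (h _ _ fun h1 => hn (mem_sev h1))
  · rw [fs_eq_zero hc hp]; simp

section
variable {k : ℤ} {e : ℂ} {a : X → ℂ}

lemma HF.mk_mom (h : HF k e a) {i j : ℕ} (hl : Low a 1 i j) (hz : ∀ r s, a (0, r, s, 1) = 0)
    (hk : k + i + j = 12) :
    (PowerSeries.mk fun n : ℕ => mom (gam a (1 : ℕ) i) j n) = dm a 1 1 i j • dl := by
  obtain ⟨g, hg, h1⟩ := (h.jf 1 i hl.σ).mom_structure j hl.t 1 fun n hn => by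
    obtain rfl : n = 0 := by omega
    rw [mom_gam h.cone]
    exact sum_eq_zero fun p _ => by simp [hz]
  rw [show k + i + j - 12 * ((1 : ℕ) : ℤ) = 0 by push_cast; omega] at hg
  obtain ⟨c, rfl⟩ := Mspan_single (i0 := 0) (j0 := 0) (by omega) hg
  have h2 := congrArg (PowerSeries.coeff 1) h1
  rw [PowerSeries.coeff_mk, mom_gam h.cone] at h2
  simp only [pow_zero, mul_one, pow_one, mul_smul_comm, map_smul, dl_coeff_one, smul_eq_mul,
    Nat.cast_one] at h2
  rw [h1, h2]
  simp

lemma HF.mom_zero (h : HF k e a) {i j : ℕ} (hl : Low a 1 i j) (hz : ∀ r s, a (0, r, s, 1) = 0)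
    (hk : k + i + j = 10) (n : ℤ) : mom (gam a (1 : ℕ) i) j n = 0 := by
  have hj := h.jf 1 i hl.σ
  obtain ⟨g, hg, h1⟩ := hj.mom_structure j hl.t 1 fun n hn => by
    obtain rfl : n = 0 := by omega
    rw [mom_gam h.cone]
    exact sum_eq_zero fun p _ => by simp [hz]
  rw [Mspan_empty (by push_cast; omega) hg, mul_zero] at h1
  rcases lt_or_ge n 0 with hn | hn
  · exact hj.mom_neg j hn
  · lift n to ℕ using hn
    simpa using congrArg (coeff n) h1

lemma low_one (hz : ∀ n r s m, n ≤ 0 ∨ m ≤ 0 → a (n, r, s, m) = 0) : Low a 1 0 0 :=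
  ⟨fun m' hm n r s => hz _ _ _ _ (Or.inr (by push_cast at hm; omega)), by simp, by simp⟩

end

lemma lead12 : ∃ c : ℂ, c ≠ 0 ∧ LeadP (FF f12) 1 0 0 (c • dl) := by
  have hl : Low f12 1 0 0 := low_one fun _ _ _ _ => lift_of_not_pos
  have h := hf12.lead hl
  rw [hf12.mk_mom hl (fun r s => lift_of_not_pos (Or.inl le_rfl)) (by norm_num), smul_smul] at h
  refine ⟨_, ?_, h⟩
  rw [dm_one hf12.cone fun r s h => by rw [f12_one, ← nrm_eq]; split_ifs <;> first | omega | rfl]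
  refine mul_ne_zero (mul_ne_zero (tc_ne_zero _) (tc_ne_zero _)) ?_
  simp [sev, f12_one]
  norm_num

lemma lead10 : ∃ c : ℂ, c ≠ 0 ∧ LeadP (FF f10) 1 0 2 (c • dl) := by
  have hz : ∀ r s, f10 (0, r, s, 1) = 0 := fun r s => lift_of_not_pos (Or.inl le_rfl)
  have l0 : Low f10 1 0 0 := low_one fun _ _ _ _ => lift_of_not_pos
  have l1 := l0.succ_j (hf10.mom_zero l0 hz (by norm_num))
  have hl := l1.succ_j (mom_odd (hf10.gam_neg _ (by decide)) (by decide))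
  have h := hf10.lead hl
  rw [hf10.mk_mom hl hz (by norm_num), smul_smul] at h
  refine ⟨_, ?_, h⟩
  rw [dm_one hf10.cone fun r s h => by rw [f10_one, ← nrm_eq]; split_ifs <;> first | omega | rfl]
  refine mul_ne_zero (mul_ne_zero (tc_ne_zero _) (tc_ne_zero _)) ?_
  simp [sev, f10_one]
  norm_num

lemma gam9_zero (m : ℤ) : gam f9 m 0 = 0 := by
  funext ⟨n, r⟩
  have h1 : gam f9 m 0 (n, r) = -gam f9 m 0 (n, r) := by
    conv_lhs => rw [gam, ← ((Equiv.neg ℤ).trans (Equiv.subRight r)).tsum_eq]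
    rw [gam, ← tsum_neg]
    refine tsum_congr fun s => ?_
    have := hf9.flip n r s m
    simp only [Equiv.trans_apply, Equiv.neg_apply, Equiv.subRight_apply, pow_zero]
    rw [show -s - r = -r - s by ring, this]
    ring
  simpa [self_eq_neg] using h1

lemma gam9_neg (m n r : ℤ) : gam f9 m 1 (n, -r) = gam f9 m 1 (n, r) := by
  have hr : ∀ s, f9 (n, -r, -s, m) = - f9 (n, r, s, m) := fun s => by
    have h1 := hf9.rot n r s m
    have h2 := hf9.rot n (-s) (r + s) m
    have h3 := hf9.rot n (-(r + s)) (-s + (r + s)) m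
    rw [h2, h1] at h3
    rw [show f9 (n, -r, -s, m) = f9 (n, -(-s + (r + s)), -(r + s) + (-s + (r + s)), m) by
      congr 2; ring_nf, h3]
    ring
  rw [gam, gam, ← (Equiv.neg ℤ).tsum_eq]
  refine tsum_congr fun s => ?_
  simp only [Equiv.neg_apply, hr]
  push_cast
  ring

lemma lead18 : ∃ c : ℂ, c ≠ 0 ∧ LeadP (FF f18) 2 2 4 (c • dl ^ 2) := by
  have hz : ∀ r s, f9 (0, r, s, 1) = 0 := fun r s => lift_of_not_pos (Or.inl le_rfl)
  have l00 : Low f9 1 0 0 := low_one fun _ _ _ _ => lift_of_not_pos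
  have l0 : Low f9 1 1 0 := l00.succ_i (gam9_zero _)
  have l1 := l0.succ_j (hf9.mom_zero l0 hz (by norm_num))
  have hl := l1.succ_j (mom_odd (gam9_neg _) (by decide))
  have h := hf9.lead hl
  rw [hf9.mk_mom hl hz (by norm_num), smul_smul] at h
  set c := tc 1 * tc (0 + 1 + 1) * dm f9 1 1 1 (0 + 1 + 1) with hc
  have hc0 : c ≠ 0 := by
    rw [hc, dm_one hf9.cone fun r s h => by rw [f9_one, ← nrm_eq, if_neg (by omega)]]
    refine mul_ne_zero (mul_ne_zero (tc_ne_zero _) (tc_ne_zero _)) ?_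
    simp [sev, f9_one]
    norm_num
  refine ⟨c * c, mul_ne_zero hc0 hc0, ?_⟩
  have h2 := (h.mul h).congr (G := FF f18) fun z hz => (FF_conv (hf9.summ hz) (hf9.summ hz)).symm
  rw [smul_mul_smul_comm, ← sq dl] at h2
  exact h2

lemma HF.mk_mom_zero (h : HF k 1 a) :
    ∃ g ∈ Mspan k, LeadP (FF a) 0 0 0 g ∧ ∀ n : ℕ, coeff n g = a (n, 0, 0, 0) := by
  have hl : Low a 0 0 0 := ⟨fun m' hm n r s => h.cone _ fun hc => by
    have := hc.2.1; simp only at this; push_cast at hm; omega, by simp, by simp⟩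
  have h1 := h.lead hl
  obtain ⟨g, hg, h2⟩ := (h.jf 0 0 hl.σ).mom_structure 0 hl.t 0 (by simp)
  rw [h2] at h1
  simp only [Nat.cast_zero, add_zero, mul_zero, sub_zero] at hg
  refine ⟨g, hg, by simpa [tc] using h1, fun n => ?_⟩
  have h3 := congrArg (coeff n) h2
  rw [pow_zero, one_mul, coeff_mk, mom_gam h.cone] at h3
  rw [← h3, dm]
  rw [sum_subset (s₂ := {(0, 0)})]
  · simp
  · intro p hp
    have h4 := h.cone.cone ((mem_fs h.cone).1 hp)
    have h5 := h4.2.2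
    simp only [Nat.cast_zero, mul_zero] at h5
    have := nrm_zero (le_antisymm h5 (nrm_nonneg (p.1, p.2)))
    rw [mem_singleton, Prod.ext_iff]
    exact this
  · intro p _ hp
    rw [fs_eq_zero h.cone hp]; simp

lemma HF.eis4 (h : HF 4 1 a) (h0 : a 0 = 1) :
    LeadP (FF a) 0 0 0 e4 ∧ a (1, 0, 0, 0) = 240 := by
  obtain ⟨g, hg, hl, hc⟩ := h.mk_mom_zero
  obtain ⟨c, rfl⟩ := Mspan_single (i0 := 1) (j0 := 0) (by omega) hg
  simp only [pow_one, pow_zero, mul_one, map_smul, smul_eq_mul] at hl hc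
  have hc0 := hc 0
  rw [e4_coeff_zero, mul_one, Nat.cast_zero, show ((0, 0, 0, 0) : X) = 0 from rfl, h0] at hc0
  subst hc0
  have h1 := hc 1
  rw [e4_coeff_one] at h1
  exact ⟨by simpa using hl, by rw [Nat.cast_one] at h1; rw [← h1, one_mul]⟩

lemma HF.eis6 (h : HF 6 1 a) (h0 : a 0 = 1) :
    LeadP (FF a) 0 0 0 e6 ∧ a (1, 0, 0, 0) = -504 := by
  obtain ⟨g, hg, hl, hc⟩ := h.mk_mom_zero
  obtain ⟨c, rfl⟩ := Mspan_single (i0 := 0) (j0 := 1) (by omega) hg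
  simp only [pow_one, pow_zero, one_mul, map_smul, smul_eq_mul] at hl hc
  have hc0 := hc 0
  rw [e6_coeff_zero, mul_one, Nat.cast_zero, show ((0, 0, 0, 0) : X) = 0 from rfl, h0] at hc0
  subst hc0
  have h1 := hc 1
  rw [e6_coeff_one] at h1
  exact ⟨by simpa using hl, by rw [Nat.cast_one] at h1; rw [← h1, one_mul]⟩

/-- The five generators. -/
def fam (a4 a6 : X → ℂ) : Fin 5 → X → ℂ := ![a4, a6, f10, f12, f18]

lemma gens {a4 a6 : X → ℂ} (h4 : HF 4 1 a4) (h6 : HF 6 1 a6) (n4 : a4 0 = 1) (n6 : a6 0 = 1) :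
    Gens (fam a4 a6) :=
  ⟨h4, h6, hf10, hf12, hf18, (h4.eis4 n4).1, (h6.eis6 n6).1, lead10, lead12, lead18⟩

lemma leadCoeffs {a4 a6 : X → ℂ} (h4 : HF 4 1 a4) (h6 : HF 6 1 a6) (n4 : a4 0 = 1)
    (n6 : a6 0 = 1) : LeadCoeffs (fam a4 a6) f9 where
  csr i := by
    fin_cases i
    exacts [h4.cone, h6.cone, hf10.cone, hf12.cone, hf18.cone]
  csr9 := hf9.cone
  a0 := n4
  b0 := (h4.eis4 n4).2
  a1 := n6
  b1 := (h6.eis6 n6).2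
  z2 _ _ _ _ := lift_of_not_pos
  z3 _ _ _ _ := lift_of_not_pos
  z9 _ _ _ _ := lift_of_not_pos
  l2 := f10_one
  l3 := f12_one
  l9 := f9_one
  sq := conv_eq_convR hf9.cone hf9.cone

/-- The ring `ℤ[1/3]`, as a subring of the complex numbers. -/
def Z3 : Subring ℂ := (Subring.closure {((1 / 3 : ℂ))})

lemma inv_three_mem : (1 / 3 : ℂ) ∈ Z3 := Subring.subset_closure rfl

lemma gd_mem (P0 P1 : PowerSeries ℤ) (ε j D : ℤ) : gd P0 P1 ε j D ∈ Z3 := by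
  unfold gd
  split_ifs
  · exact zero_mem _
  all_goals
    rw [show (9 : ℂ) = 3 * 3 by norm_num, div_mul_eq_div_div, div_eq_mul_one_div,
      div_eq_mul_one_div (_ : ℂ) 3]
    exact mul_mem (mul_mem (intCast_mem _ _) inv_three_mem) inv_three_mem

lemma lift_mem (κ : ℕ) (h : ∀ j D, g j D ∈ Z3) (x : X) : lift κ g x ∈ Z3 := by
  unfold lift
  split_ifs
  · exact sum_mem fun d _ => mul_mem (pow_mem (natCast_mem _ _) _) (h _ _)
  · exact zero_mem _

lemma f9_mem (x : X) : f9 x ∈ Z3 := lift_mem _ (gd_mem _ _ _) x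
lemma f10_mem (x : X) : f10 x ∈ Z3 := lift_mem _ (gd_mem _ _ _) x
lemma f12_mem (x : X) : f12 x ∈ Z3 := lift_mem _ (gd_mem _ _ _) x
lemma f18_mem (x : X) : f18 x ∈ Z3 := by
  rw [f18, conv_eq_convR hf9.cone hf9.cone]
  exact sum_mem fun q _ => mul_mem (f9_mem _) (f9_mem _)

/-- The square root of `-3` in the upper half plane. -/
def rt : ℂ := √3 * I

lemma rt_sq : rt * rt = -3 := by
  have := sqrt3_sq
  rw [rt]
  linear_combination (I * I) * this + 3 * I_mul_I

lemma rt_conj : star rt = -rt := by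
  simp [rt]

lemma sqrtD_eq : sqrtD (-3) = rt := by
  simp [sqrtD, rt]

/-- The generator of the ring of integers. -/
def om : ℂ := (-3 + rt) / 2

lemma om_sq : om * om = -3 * om - 3 := by
  rw [om]; linear_combination (1 / 4) * rt_sq

lemma om_conj : star om = -3 - om := by
  have := rt_conj
  rw [om, star_div₀, star_add, this]
  simp
  ring

/-- The ring of integers, as a subring of the complex numbers. -/
def OO : Subring ℂ where
  carrier := ringInt (-3)
  zero_mem' := ⟨0, 0, by simp⟩
  one_mem' := ⟨1, 0, by simp⟩
  add_mem' := by
    rintro _ _ ⟨a, b, rfl⟩ ⟨c, d, rfl⟩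
    exact ⟨a + c, b + d, by push_cast; ring⟩
  neg_mem' := by
    rintro _ ⟨a, b, rfl⟩
    exact ⟨-a, -b, by push_cast; ring⟩
  mul_mem' := by
    rintro _ _ ⟨a, b, rfl⟩ ⟨c, d, rfl⟩
    refine ⟨a * c - 3 * b * d, a * d + b * c - 3 * b * d, ?_⟩
    have := om_sq
    rw [om, ← sqrtD_eq] at this
    push_cast at this ⊢
    linear_combination (b * d : ℂ) * this

lemma mem_OO {z : ℂ} : z ∈ OO ↔ ∃ a b : ℤ, z = a + b * om := by
  rw [om, ← sqrtD_eq]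
  exact ⟨fun ⟨a, b, h⟩ => ⟨a, b, by rw [h]; push_cast; rfl⟩,
    fun ⟨a, b, h⟩ => ⟨a, b, by rw [h]; push_cast; rfl⟩⟩

lemma star_mem_OO {z : ℂ} (h : z ∈ OO) : star z ∈ OO := by
  obtain ⟨a, b, rfl⟩ := mem_OO.1 h
  refine mem_OO.2 ⟨a - 3 * b, -b, ?_⟩
  rw [star_add, star_mul', om_conj]
  simp
  ring

lemma normSq_OO (a b : ℝ) : normSq (a + b * om) = a ^ 2 - 3 * a * b + 3 * b ^ 2 := by
  have h : ((normSq (a + b * om) : ℝ) : ℂ) = ((a ^ 2 - 3 * a * b + 3 * b ^ 2 : ℝ) : ℂ) := by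
    rw [← mul_conj]
    have := om_conj
    rw [← starRingEnd_apply] at this
    simp only [map_add, map_mul, conj_ofReal, this]
    push_cast
    linear_combination (-b ^ 2 : ℂ) * om_sq
  exact_mod_cast h

lemma exists_normSq {z : ℂ} (h : z ∈ OO) : ∃ n : ℕ, normSq z = n := by
  obtain ⟨a, b, rfl⟩ := mem_OO.1 h
  have h1 := normSq_OO a b
  have h2 : 0 ≤ a ^ 2 - 3 * a * b + 3 * b ^ 2 := by nlinarith [sq_nonneg (2 * a - 3 * b)]
  push_cast at h1
  refine ⟨(a ^ 2 - 3 * a * b + 3 * b ^ 2).toNat, ?_⟩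
  rw [h1, ← Int.cast_natCast, Int.toNat_of_nonneg h2]
  push_cast; ring

lemma exists_coord (z : ℂ) : ∃ x y : ℝ, z = x + y * om := by
  have h3 : √3 ≠ 0 := by positivity
  refine ⟨z.re + 3 * (z.im / √3), 2 * z.im / √3, ?_⟩
  apply Complex.ext
  · simp [om, rt]; ring
  · simp [om, rt]; field_simp

lemma exists_quot {a b : ℂ} (hb : b ≠ 0) :
    ∃ q ∈ OO, normSq (a + q * b) < normSq b := by
  obtain ⟨x, y, h⟩ := exists_coord (a / b)
  set u := x - y - round (x - y) with hu
  set v := y - round y with hv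
  have hb' := normSq_pos.2 hb
  have hx := abs_le.1 (abs_sub_round (x - y))
  have hy := abs_le.1 (abs_sub_round y)
  rw [← hu] at hx
  rw [← hv] at hy
  refine ⟨-(round (x - y) + round y + round y * om), neg_mem (mem_OO.2
    ⟨round (x - y) + round y, round y, by push_cast; rfl⟩), ?_⟩
  have h1 : a + -(round (x - y) + round y + round y * om) * b =
      (((u + v : ℝ) : ℂ) + (v : ℂ) * om) * b := by
    rw [div_eq_iff hb] at h
    rw [h, hu, hv]; push_cast; ring
  rw [h1, normSq_mul, normSq_OO]
  have h2 : (u + v) ^ 2 - 3 * (u + v) * v + 3 * v ^ 2 < 1 := by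
    nlinarith [mul_nonneg (sub_nonneg.2 hx.1) (sub_nonneg.2 hy.1), mul_nonneg (sub_nonneg.2 hx.2) (sub_nonneg.2 hy.2),
      mul_nonneg (sub_nonneg.2 hx.1) (sub_nonneg.2 hx.2), mul_nonneg (sub_nonneg.2 hy.1) (sub_nonneg.2 hy.2)]
  nlinarith

lemma exists_quot_real {a b : ℂ} (hb : b ≠ 0) (h : star b * a = star a * b) :
    ∃ s : ℤ, normSq (a + s * b) < normSq b := by
  have h1 : (starRingEnd ℂ) (a / b) = a / b := by
    have hb' : star b ≠ 0 := star_ne_zero.2 hb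
    rw [map_div₀, starRingEnd_apply, starRingEnd_apply, div_eq_div_iff hb' hb, ← h, mul_comm]
  obtain ⟨x, hx⟩ := conj_eq_iff_real.1 h1
  rw [div_eq_iff hb] at hx
  refine ⟨-round x, ?_⟩
  rw [show a + ((-round x : ℤ) : ℂ) * b = ((x - round x : ℝ) : ℂ) * b by
    rw [hx]; push_cast; ring, normSq_mul, normSq_ofReal]
  have hb' := normSq_pos.2 hb
  have hx := abs_le.1 (abs_sub_round x)
  have h2 : (x - round x) * (x - round x) < 1 := by nlinarith
  nlinarith


/-- Complex matrices of size four, in blocks. -/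
abbrev M4 := Matrix (Fin 2 ⊕ Fin 2) (Fin 2 ⊕ Fin 2) ℂ

/-- The Hermitian modular group. -/
abbrev UU : Set M4 := HermitianModularGroup (-3)

lemma UU.mul {M N : M4} (hM : M ∈ UU) (hN : N ∈ UU) : M * N ∈ UU := by
  refine ⟨fun i j => ?_, ?_⟩
  · rw [mul_apply]
    exact sum_mem (S := OO) fun l _ => mul_mem (s := OO) (hM.1 _ _) (hN.1 _ _)
  · rw [conjTranspose_mul, show Nᴴ * Mᴴ * J2 * (M * N) = Nᴴ * (Mᴴ * J2 * M) * N by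
      simp only [Matrix.mul_assoc], hM.2, hN.2]

/-- Translations. -/
def tMat (B : M2) : M4 := fromBlocks 1 B 0 1
/-- Unipotent base changes. -/
def lMat (x : ℂ) : M4 := fromBlocks !![1, 0; -star x, 1] 0 0 !![1, x; 0, 1]
/-- The exchange of coordinates. -/
def wMat : M4 := fromBlocks !![0, 1; 1, 0] 0 0 !![0, 1; 1, 0]
/-- Diagonal base changes. -/
def dMat (u v : ℂ) : M4 := fromBlocks !![u, 0; 0, 1] 0 0 !![v, 0; 0, 1]
/-- The embedded inversion. -/
def sMat : M4 := fromBlocks !![0, 0; 0, 1] !![-1, 0; 0, 0] !![1, 0; 0, 0] !![0, 0; 0, 1]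

/-- A set of matrices, stable under division, which contains the generators. -/
structure GenSet (G : Set M4) : Prop where
  sub : G ⊆ UU
  cancel : ∀ N ∈ G, ∀ M ∈ UU, N * M ∈ G → M ∈ G
  t : ∀ B : M2, B.IsHermitian → (∀ i j, B i j ∈ OO) → tMat B ∈ G
  l : ∀ x ∈ OO, lMat x ∈ G
  w : wMat ∈ G
  d : ∀ u ∈ OO, ∀ v ∈ OO, star u * v = 1 → dMat u v ∈ G
  s : sMat ∈ G

lemma UU.rel {M : M4} (hM : M ∈ UU) (i j : Fin 2 ⊕ Fin 2) :
    star (M (.inr 0) i) * M (.inl 0) j + star (M (.inr 1) i) * M (.inl 1) j -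
      star (M (.inl 0) i) * M (.inr 0) j - star (M (.inl 1) i) * M (.inr 1) j = J2 i j := by
  rw [← hM.2]
  simp [mul_apply, Fintype.sum_sum_type, J2]
  ring

lemma tMat_mul (B : M2) (M : M4) (j : Fin 2 ⊕ Fin 2) :
    (tMat B * M) (.inl 0) j = M (.inl 0) j + B 0 0 * M (.inr 0) j + B 0 1 * M (.inr 1) j ∧
    (tMat B * M) (.inl 1) j = M (.inl 1) j + B 1 0 * M (.inr 0) j + B 1 1 * M (.inr 1) j ∧
    (tMat B * M) (.inr 0) j = M (.inr 0) j ∧ (tMat B * M) (.inr 1) j = M (.inr 1) j := by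
  simp [tMat, mul_apply, Fintype.sum_sum_type, one_apply, add_assoc]

lemma lMat_mul (x : ℂ) (M : M4) (j : Fin 2 ⊕ Fin 2) :
    (lMat x * M) (.inl 0) j = M (.inl 0) j ∧
    (lMat x * M) (.inl 1) j = -star x * M (.inl 0) j + M (.inl 1) j ∧
    (lMat x * M) (.inr 0) j = M (.inr 0) j + x * M (.inr 1) j ∧
    (lMat x * M) (.inr 1) j = M (.inr 1) j := by
  simp [lMat, mul_apply, Fintype.sum_sum_type]

lemma wMat_mul (M : M4) (j : Fin 2 ⊕ Fin 2) :
    (wMat * M) (.inl 0) j = M (.inl 1) j ∧ (wMat * M) (.inl 1) j = M (.inl 0) j ∧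
    (wMat * M) (.inr 0) j = M (.inr 1) j ∧ (wMat * M) (.inr 1) j = M (.inr 0) j := by
  simp [wMat, mul_apply, Fintype.sum_sum_type]

lemma dMat_mul (u v : ℂ) (M : M4) (j : Fin 2 ⊕ Fin 2) :
    (dMat u v * M) (.inl 0) j = u * M (.inl 0) j ∧ (dMat u v * M) (.inl 1) j = M (.inl 1) j ∧
    (dMat u v * M) (.inr 0) j = v * M (.inr 0) j ∧ (dMat u v * M) (.inr 1) j = M (.inr 1) j := by
  simp [dMat, mul_apply, Fintype.sum_sum_type]

lemma sMat_mul (M : M4) (j : Fin 2 ⊕ Fin 2) :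
    (sMat * M) (.inl 0) j = -M (.inr 0) j ∧ (sMat * M) (.inl 1) j = M (.inl 1) j ∧
    (sMat * M) (.inr 0) j = M (.inl 0) j ∧ (sMat * M) (.inr 1) j = M (.inr 1) j := by
  simp [sMat, mul_apply, Fintype.sum_sum_type]

/-- Induction on the norm of an integral matrix entry. -/
lemma norm_induction {P : M4 → Prop} (f : M4 → ℂ) (hf : ∀ M ∈ UU, f M ∈ OO)
    (h : ∀ M ∈ UU, (∀ N ∈ UU, normSq (f N) < normSq (f M) → P N) → P M) : ∀ M ∈ UU, P M := by
  have key : ∀ n : ℕ, ∀ M ∈ UU, normSq (f M) = n → P M := by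
    intro n
    induction n using Nat.strong_induction_on with
    | _ n ih =>
      intro M hM hn
      refine h M hM fun N hN hlt => ?_
      obtain ⟨m, hm⟩ := exists_normSq (hf N hN)
      exact ih m (by rw [hn, hm] at hlt; exact_mod_cast hlt) N hN hm
  intro M hM
  obtain ⟨n, hn⟩ := exists_normSq (hf M hM)
  exact key n M hM hn

namespace GenSet
variable {G : Set M4}

lemma step (g : GenSet G) {N M : M4} (hN : N ∈ G) (hM : M ∈ UU) (h : N * M ∈ UU → N * M ∈ G) :
    M ∈ G :=
  g.cancel N hN M hM (h (UU.mul (g.sub hN) hM))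

lemma final (g : GenSet G) {M : M4} (hM : M ∈ UU)
    (h0 : M (.inl 0) (.inl 0) = 1) (h1 : M (.inl 1) (.inl 0) = 0)
    (h2 : M (.inr 0) (.inl 0) = 0) (h3 : M (.inr 1) (.inl 0) = 0)
    (k0 : M (.inl 0) (.inl 1) = 0) (k1 : M (.inl 1) (.inl 1) = 1)
    (k2 : M (.inr 0) (.inl 1) = 0) (k3 : M (.inr 1) (.inl 1) = 0) : M ∈ G := by
  have r00 := UU.rel hM (.inl 0) (.inr 0)
  have r01 := UU.rel hM (.inl 0) (.inr 1)
  have r10 := UU.rel hM (.inl 1) (.inr 0)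
  have r11 := UU.rel hM (.inl 1) (.inr 1)
  have s00 := UU.rel hM (.inr 0) (.inr 0)
  have s01 := UU.rel hM (.inr 0) (.inr 1)
  have s10 := UU.rel hM (.inr 1) (.inr 0)
  have s11 := UU.rel hM (.inr 1) (.inr 1)
  simp [h0, h1, h2, h3, k0, k1, k2, k3, J2] at r00 r01 r10 r11
  simp [r00, r01, r10, r11, J2] at s00 s01 s10 s11
  have hB := g.t M.toBlocks₁₂ (by
    ext i j
    fin_cases i <;> fin_cases j <;> simp [toBlocks₁₂] <;>
      first | linear_combination s00 | linear_combination s01 | linear_combination s10 |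
        linear_combination s11 | linear_combination -s00 | linear_combination -s01 | linear_combination -s10 |
        linear_combination -s11) (fun i j => hM.1 _ _)
  convert hB
  rw [tMat, ← fromBlocks_toBlocks M]
  congr 1
  · ext i j; fin_cases i <;> fin_cases j <;> simp [toBlocks₁₁, *]
  · ext i j; fin_cases i <;> fin_cases j <;> simp [toBlocks₂₁, *]
  · ext i j; fin_cases i <;> fin_cases j <;> simp [toBlocks₂₂, *]

lemma of_w4 (g : GenSet G) {M : M4} (hM : M ∈ UU)
    (h0 : M (.inl 0) (.inl 0) = 1) (h1 : M (.inl 1) (.inl 0) = 0)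
    (h2 : M (.inr 0) (.inl 0) = 0) (h3 : M (.inr 1) (.inl 0) = 0)
    (k1 : M (.inl 1) (.inl 1) = 1)
    (k2 : M (.inr 0) (.inl 1) = 0) (k3 : M (.inr 1) (.inl 1) = 0) : M ∈ G := by
  set x := star (M (.inl 0) (.inl 1)) with hx
  have hxO : x ∈ OO := star_mem_OO (hM.1 _ _)
  refine g.step g.w hM fun u1 => g.step (g.l x hxO) u1 fun u2 => g.step g.w u2 fun u3 =>
    g.final u3 ?_ ?_ ?_ ?_ ?_ ?_ ?_ ?_ <;>
  simp [wMat_mul, lMat_mul, h0, h1, h2, h3, k1, k2, k3, hx]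

lemma of_col0_w4 (g : GenSet G) {M : M4} (hM : M ∈ UU)
    (h0 : M (.inl 0) (.inl 0) = 1) (h1 : M (.inl 1) (.inl 0) = 0)
    (h2 : M (.inr 0) (.inl 0) = 0) (h3 : M (.inr 1) (.inl 0) = 0)
    (k3 : M (.inr 1) (.inl 1) = 0) : M ∈ G := by
  have r1 := UU.rel hM (.inl 0) (.inl 1)
  have r2 := UU.rel hM (.inl 0) (.inr 1)
  have r3 := UU.rel hM (.inl 1) (.inr 1)
  simp [h0, h1, h2, h3, J2] at r1 r2
  simp [r1, r2, k3, J2] at r3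
  have hu : star (M (.inr 1) (.inr 1)) ∈ OO := star_mem_OO (hM.1 _ _)
  have hv : M (.inl 1) (.inl 1) ∈ OO := hM.1 _ _
  have e1 : star (M (.inr 1) (.inr 1)) * M (.inl 1) (.inl 1) = 1 := by
    have := congrArg star r3
    simpa [mul_comm] using this
  have e2 : star (star (M (.inr 1) (.inr 1))) * star (M (.inl 1) (.inl 1)) = 1 := by
    rw [star_star, mul_comm]; exact r3
  refine g.step g.w hM fun u1 => g.step (g.d _ hu _ (star_mem_OO hv) e2) u1 fun u2 =>
    g.step g.w u2 fun u3 => g.of_w4 u3 ?_ ?_ ?_ ?_ ?_ ?_ ?_ <;>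
  first
  | (simp only [wMat_mul, dMat_mul]; exact e1)
  | simp [wMat_mul, dMat_mul, h0, h1, h2, h3, r1, k3]

lemma of_col0 (g : GenSet G) : ∀ M ∈ UU,
    (M (.inl 0) (.inl 0) = 1 ∧ M (.inl 1) (.inl 0) = 0 ∧ M (.inr 0) (.inl 0) = 0 ∧
      M (.inr 1) (.inl 0) = 0) → M ∈ G := by
  refine norm_induction (fun M => M (.inr 1) (.inl 1)) (fun M hM => hM.1 _ _) ?_
  rintro M hM ih ⟨h0, h1, h2, h3⟩
  by_cases hz : M (.inr 1) (.inl 1) = 0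
  · exact g.of_col0_w4 hM h0 h1 h2 h3 hz
  have r1 := UU.rel hM (.inl 0) (.inl 1)
  have r3 := UU.rel hM (.inl 1) (.inl 1)
  simp [h0, h1, h2, h3, J2] at r1
  simp [r1, J2] at r3
  obtain ⟨s, hs⟩ := exists_quot_real hz (sub_eq_zero.1 r3)
  have hT : tMat !![0, 0; 0, (s : ℂ)] ∈ G := g.t _ (by
    ext i j; fin_cases i <;> fin_cases j <;> simp) fun i j => by
      fin_cases i <;> fin_cases j <;> simp
  refine g.step hT hM fun u0 => g.step g.w u0 fun u1 => g.step g.s u1 fun u2 =>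
    g.step g.w u2 fun u3 => ih _ u3 ?_ ⟨?_, ?_, ?_, ?_⟩
  · simpa [wMat_mul, sMat_mul, tMat_mul, r1] using hs
  all_goals simp [wMat_mul, sMat_mul, tMat_mul, h0, h1, h2, h3]

lemma of_v1 (g : GenSet G) {M : M4} (hM : M ∈ UU) (h1 : M (.inl 1) (.inl 0) = 0)
    (h2 : M (.inr 0) (.inl 0) = 0) (h3 : M (.inr 1) (.inl 0) = 0) : M ∈ G := by
  have r3 := UU.rel hM (.inl 0) (.inr 0)
  simp [h1, h2, h3, J2] at r3
  have hu : star (M (.inr 0) (.inr 0)) ∈ OO := star_mem_OO (hM.1 _ _)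
  have hv : M (.inl 0) (.inl 0) ∈ OO := hM.1 _ _
  have e1 : star (M (.inr 0) (.inr 0)) * M (.inl 0) (.inl 0) = 1 := by
    have := congrArg star r3
    simpa [mul_comm] using this
  have e2 : star (star (M (.inr 0) (.inr 0))) * star (M (.inl 0) (.inl 0)) = 1 := by
    rw [star_star, mul_comm]; exact r3
  refine g.step (g.d _ hu _ (star_mem_OO hv) e2) hM fun u2 => g.of_col0 _ u2 ⟨?_, ?_, ?_, ?_⟩
  · simp only [dMat_mul]; exact e1
  all_goals simp [dMat_mul, h1, h2, h3]

lemma of_bot (g : GenSet G) : ∀ M ∈ UU,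
    (M (.inr 0) (.inl 0) = 0 ∧ M (.inr 1) (.inl 0) = 0) → M ∈ G := by
  refine norm_induction (fun M => M (.inl 0) (.inl 0)) (fun M hM => hM.1 _ _) ?_
  rintro M hM ih ⟨h2, h3⟩
  by_cases hz : M (.inl 0) (.inl 0) = 0
  · refine g.step g.w hM fun u1 => g.of_v1 u1 ?_ ?_ ?_ <;> simp [wMat_mul, hz, h2, h3]
  obtain ⟨q, hq, hlt⟩ := exists_quot (a := M (.inl 1) (.inl 0)) hz
  refine g.step (g.l (-star q) (neg_mem (star_mem_OO hq))) hM fun u0 => g.step g.w u0 fun u1 =>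
    ih _ u1 ?_ ⟨?_, ?_⟩
  · rw [add_comm] at hlt
    simpa [wMat_mul, lMat_mul] using hlt
  all_goals simp [wMat_mul, lMat_mul, h2, h3]

lemma of_v4 (g : GenSet G) : ∀ M ∈ UU, M (.inr 1) (.inl 0) = 0 → M ∈ G := by
  refine norm_induction (fun M => M (.inr 0) (.inl 0)) (fun M hM => hM.1 _ _) ?_
  rintro M hM ih h3
  by_cases hz : M (.inr 0) (.inl 0) = 0
  · exact g.of_bot M hM ⟨hz, h3⟩
  have r3 := UU.rel hM (.inl 0) (.inl 0)
  simp [h3, J2] at r3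
  obtain ⟨s, hs⟩ := exists_quot_real hz (sub_eq_zero.1 r3)
  have hT : tMat !![(s : ℂ), 0; 0, 0] ∈ G := g.t _ (by
    ext i j; fin_cases i <;> fin_cases j <;> simp) fun i j => by
      fin_cases i <;> fin_cases j <;> simp
  refine g.step hT hM fun u0 => g.step g.s u0 fun u3 => ih _ u3 ?_ ?_
  · simpa [sMat_mul, tMat_mul] using hs
  · simp [sMat_mul, tMat_mul, h3]

theorem mem (g : GenSet G) : ∀ M ∈ UU, M ∈ G := by
  refine norm_induction (fun M => M (.inr 1) (.inl 0)) (fun M hM => hM.1 _ _) ?_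
  rintro M hM ih
  by_cases hz : M (.inr 1) (.inl 0) = 0
  · exact g.of_v4 M hM hz
  obtain ⟨q, hq, hlt⟩ := exists_quot (a := M (.inr 0) (.inl 0)) hz
  refine g.step (g.l q hq) hM fun u0 => g.step g.w u0 fun u1 => ih _ u1 ?_
  simpa [wMat_mul, lMat_mul] using hlt

end GenSet

section
variable {𝕜 : Type*} [RCLike 𝕜]

lemma form_two (a d : ℝ) (β : 𝕜) (x : Fin 2 → 𝕜) :
    star x ⬝ᵥ (!![(a : 𝕜), β; star β, (d : 𝕜)] *ᵥ x) =
      ((a * ‖x 0‖ ^ 2 + d * ‖x 1‖ ^ 2 + 2 * RCLike.re (star (x 0) * β * x 1) : ℝ) : 𝕜) := by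
  have h0 := RCLike.mul_conj (x 0)
  have h1 := RCLike.mul_conj (x 1)
  have h2 := RCLike.add_conj (star (x 0) * β * x 1)
  simp only [starRingEnd_apply, star_mul', star_star] at h0 h1 h2
  simp only [dotProduct, mulVec, Fin.sum_univ_two, Pi.star_apply, of_apply,
    Matrix.cons_val', cons_val_zero, cons_val_one, cons_val_fin_one]
  push_cast
  linear_combination (a : 𝕜) * h0 + (d : 𝕜) * h1 + h2

lemma herm_two (a d : ℝ) (β : 𝕜) : (!![(a : 𝕜), β; star β, (d : 𝕜)]).IsHermitian := by
  ext i j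
  fin_cases i <;> fin_cases j <;> simp

lemma posSemidef_two {a d : ℝ} {β : 𝕜} :
    (!![(a : 𝕜), β; star β, (d : 𝕜)]).PosSemidef ↔ 0 ≤ a ∧ 0 ≤ d ∧ ‖β‖ ^ 2 ≤ a * d := by
  have hdet : (!![(a : 𝕜), β; star β, (d : 𝕜)]).det = ((a * d - ‖β‖ ^ 2 : ℝ) : 𝕜) := by
    rw [det_fin_two_of, ← starRingEnd_apply, RCLike.mul_conj]; push_cast; ring
  constructor
  · intro h
    have h0 := h.diag_nonneg (i := 0)
    have h1 := h.diag_nonneg (i := 1)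
    have h2 := h.det_nonneg
    rw [hdet] at h2
    simp only [of_apply, Matrix.cons_val', cons_val_zero, cons_val_one,
      cons_val_fin_one] at h0 h1
    exact ⟨RCLike.ofReal_nonneg.1 h0, RCLike.ofReal_nonneg.1 h1, by
      have := RCLike.ofReal_nonneg.1 h2; linarith⟩
  · rintro ⟨ha, hd, hb⟩
    refine .of_dotProduct_mulVec_nonneg (herm_two a d β) fun x => ?_
    rw [form_two, RCLike.ofReal_nonneg]
    have h1 : |RCLike.re (star (x 0) * β * x 1)| ≤ ‖x 0‖ * ‖β‖ * ‖x 1‖ := by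
      refine (RCLike.abs_re_le_norm _).trans ?_
      rw [norm_mul, norm_mul, norm_star]
    have h2 : 2 * (‖x 0‖ * ‖β‖ * ‖x 1‖) ≤ a * ‖x 0‖ ^ 2 + d * ‖x 1‖ ^ 2 := by
      refine le_of_sq_le_sq ?_ (by positivity)
      have h3 : 0 ≤ (‖x 0‖ * ‖x 1‖) ^ 2 * (a * d - ‖β‖ ^ 2) := mul_nonneg (sq_nonneg _) (by linarith)
      nlinarith [sq_nonneg (a * ‖x 0‖ ^ 2 - d * ‖x 1‖ ^ 2)]
    have := (abs_le.1 h1).1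
    linarith

lemma posDef_two {a d : ℝ} {β : 𝕜} :
    (!![(a : 𝕜), β; star β, (d : 𝕜)]).PosDef ↔ 0 < a ∧ ‖β‖ ^ 2 < a * d := by
  have hdet : (!![(a : 𝕜), β; star β, (d : 𝕜)]).det = ((a * d - ‖β‖ ^ 2 : ℝ) : 𝕜) := by
    rw [det_fin_two_of, ← starRingEnd_apply, RCLike.mul_conj]; push_cast; ring
  constructor
  · intro h
    have h0 := h.diag_pos (i := 0)
    have h2 := h.det_pos
    rw [hdet] at h2
    simp only [of_apply, Matrix.cons_val', cons_val_zero,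
      cons_val_fin_one] at h0
    exact ⟨RCLike.ofReal_pos.1 h0, by have := RCLike.ofReal_pos.1 h2; linarith⟩
  · rintro ⟨ha, hb⟩
    have hd : 0 ≤ d := by
      by_contra hd
      have : a * d ≤ 0 := mul_nonpos_of_nonneg_of_nonpos ha.le (by linarith)
      nlinarith [sq_nonneg ‖β‖]
    rw [(posSemidef_two.2 ⟨ha.le, hd, hb.le⟩).posDef_iff_isUnit, isUnit_iff_isUnit_det,
      isUnit_iff_ne_zero, hdet]
    exact_mod_cast (sub_pos.2 hb).ne'

end

/-- The automorphy factor. -/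
def jac (M : M4) (Z : M2) : ℂ := (M.toBlocks₂₁ * Z + M.toBlocks₂₂).det

section
variable {M N : M4} {Z : M2}

lemma mem_HU : Z ∈ HermitianUpperHalfSpace ↔ ((2 * I)⁻¹ • (Z - Zᴴ)).PosDef := by
  have : (Z - Zᴴ).map (fun w => w / (2 * I)) = (2 * I)⁻¹ • (Z - Zᴴ) := by
    ext i j; simp only [map_apply, Matrix.smul_apply, smul_eq_mul]; rw [div_eq_inv_mul]
  rw [HermitianUpperHalfSpace, Set.mem_setOf_eq, this]

lemma block_rel (hM : Mᴴ * J2 * M = J2) :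
    (M.toBlocks₂₁ * Z + M.toBlocks₂₂)ᴴ * (M.toBlocks₁₁ * Z + M.toBlocks₁₂) -
      (M.toBlocks₁₁ * Z + M.toBlocks₁₂)ᴴ * (M.toBlocks₂₁ * Z + M.toBlocks₂₂) = Z - Zᴴ := by
  rw [← fromBlocks_toBlocks M, J2, fromBlocks_conjTranspose, fromBlocks_multiply,
    fromBlocks_multiply, fromBlocks_inj] at hM
  obtain ⟨h1, h2, h3, h4⟩ := hM
  simp only [Matrix.mul_zero, Matrix.mul_one, zero_add, Matrix.mul_neg, add_zero] at h1 h2 h3 h4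
  set A := M.toBlocks₁₁
  set B := M.toBlocks₁₂
  set C := M.toBlocks₂₁
  set D := M.toBlocks₂₂
  simp only [conjTranspose_add, conjTranspose_mul]
  have e : (Zᴴ * Cᴴ + Dᴴ) * (A * Z + B) - (Zᴴ * Aᴴ + Bᴴ) * (C * Z + D) =
      Zᴴ * (Cᴴ * A + -Aᴴ * C) * Z + Zᴴ * (Cᴴ * B + -Aᴴ * D) + (Dᴴ * A + -Bᴴ * C) * Z +
        (Dᴴ * B + -Bᴴ * D) := by noncomm_ring
  rw [e, h1, h2, h3, h4]
  noncomm_ring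

lemma jac_ne_zero (hM : Mᴴ * J2 * M = J2) (hZ : Z ∈ HermitianUpperHalfSpace) : jac M Z ≠ 0 := by
  intro h
  obtain ⟨v, hv, h0⟩ := exists_mulVec_eq_zero_iff.2 h
  have h1 := (mem_HU.1 hZ).dotProduct_mulVec_pos hv
  rw [← block_rel hM, smul_mulVec, sub_mulVec, ← mulVec_mulVec, ← mulVec_mulVec, h0, mulVec_zero,
    sub_zero, dotProduct_smul, dotProduct_mulVec, ← star_mulVec, h0] at h1
  simp at h1

lemma matAct_mem (hM : Mᴴ * J2 * M = J2) (hZ : Z ∈ HermitianUpperHalfSpace) :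
    matAct M Z ∈ HermitianUpperHalfSpace := by
  have h0 := jac_ne_zero hM hZ
  have hr := block_rel (Z := Z) hM
  rw [mem_HU, matAct]
  rw [jac] at h0
  set P := M.toBlocks₁₁ * Z + M.toBlocks₁₂
  set R := M.toBlocks₂₁ * Z + M.toBlocks₂₂
  have hu : IsUnit R.det := isUnit_iff_ne_zero.2 h0
  have e : (2 * I)⁻¹ • (P * R⁻¹ - (P * R⁻¹)ᴴ) = (R⁻¹)ᴴ * ((2 * I)⁻¹ • (Z - Zᴴ)) * R⁻¹ := by
    rw [Matrix.mul_smul, Matrix.smul_mul, ← hr, Matrix.mul_sub, Matrix.sub_mul, conjTranspose_mul]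
    congr 2
    · rw [← Matrix.mul_assoc, ← conjTranspose_mul, mul_nonsing_inv _ hu, conjTranspose_one,
        Matrix.one_mul]
    · rw [Matrix.mul_assoc, Matrix.mul_assoc, mul_nonsing_inv _ hu, Matrix.mul_one]
  rw [e]
  refine (mem_HU.1 hZ).conjTranspose_mul_mul_same ?_
  rw [mulVec_injective_iff_isUnit, isUnit_nonsing_inv_iff, isUnit_iff_isUnit_det]
  exact hu

lemma jac_block (hN : Nᴴ * J2 * N = J2) (hZ : Z ∈ HermitianUpperHalfSpace) :
    ((M * N).toBlocks₁₁ * Z + (M * N).toBlocks₁₂ = (M.toBlocks₁₁ * matAct N Z + M.toBlocks₁₂) *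
      (N.toBlocks₂₁ * Z + N.toBlocks₂₂)) ∧
    ((M * N).toBlocks₂₁ * Z + (M * N).toBlocks₂₂ = (M.toBlocks₂₁ * matAct N Z + M.toBlocks₂₂) *
      (N.toBlocks₂₁ * Z + N.toBlocks₂₂)) := by
  have hu := isUnit_iff_ne_zero.2 (jac_ne_zero hN hZ)
  rw [jac] at hu
  have h1 : matAct N Z * (N.toBlocks₂₁ * Z + N.toBlocks₂₂) =
      N.toBlocks₁₁ * Z + N.toBlocks₁₂ := by
    rw [matAct, Matrix.mul_assoc, nonsing_inv_mul _ hu, Matrix.mul_one]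
  have hb : M * N = fromBlocks M.toBlocks₁₁ M.toBlocks₁₂ M.toBlocks₂₁ M.toBlocks₂₂ *
      fromBlocks N.toBlocks₁₁ N.toBlocks₁₂ N.toBlocks₂₁ N.toBlocks₂₂ := by
    rw [fromBlocks_toBlocks, fromBlocks_toBlocks]
  rw [fromBlocks_multiply] at hb
  rw [hb, toBlocks_fromBlocks₁₁, toBlocks_fromBlocks₁₂, toBlocks_fromBlocks₂₁,
    toBlocks_fromBlocks₂₂, Matrix.add_mul (_ * matAct N Z), Matrix.add_mul (_ * matAct N Z),
    Matrix.mul_assoc _ (matAct N Z), Matrix.mul_assoc _ (matAct N Z), h1]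
  constructor <;> noncomm_ring

lemma jac_mul (hN : Nᴴ * J2 * N = J2) (hZ : Z ∈ HermitianUpperHalfSpace) :
    jac (M * N) Z = jac M (matAct N Z) * jac N Z := by
  rw [jac, (jac_block hN hZ).2, det_mul]; rfl

lemma matAct_mul (hN : Nᴴ * J2 * N = J2) (hZ : Z ∈ HermitianUpperHalfSpace) :
    matAct (M * N) Z = matAct M (matAct N Z) := by
  have hu := isUnit_iff_ne_zero.2 (jac_ne_zero hN hZ)
  rw [jac] at hu
  rw [matAct, (jac_block hN hZ).1, (jac_block hN hZ).2, Matrix.mul_inv_rev, Matrix.mul_assoc,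
    mul_nonsing_inv_cancel_left _ _ hu]
  rfl

lemma det_ne_zero_of_rel (hM : Mᴴ * J2 * M = J2) : M.det ≠ 0 := by
  intro h
  have h1 := congrArg det hM
  rw [det_mul, h, mul_zero] at h1
  have h2 : J2 * J2 = -1 := by
    rw [J2, fromBlocks_multiply, ← fromBlocks_one, fromBlocks_neg]; simp
  have h3 := congrArg det h2
  rw [det_mul, ← h1, zero_mul, det_neg, det_one, mul_one] at h3
  exact pow_ne_zero _ (neg_ne_zero.2 one_ne_zero) h3.symm

end

/-- The coordinates of a matrix. -/
def qM (Z : M2) : Q :=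
  (Z 0 0, (Z 0 1 + Z 1 0) / 2, -(Z 0 1 - Z 1 0) * rt / 6, Z 1 1)

/-- The matrix with given coordinates. -/
def zM (z : Q) : M2 :=
  !![z.1, z.2.1 + rt * z.2.2.1; z.2.1 - rt * z.2.2.1, z.2.2.2]

lemma qM_zM (z : Q) : qM (zM z) = z := by
  have := rt_sq
  obtain ⟨a, b, c, d⟩ := z
  simp only [qM, zM, of_apply, cons_val', cons_val_zero, cons_val_one, cons_val_fin_one,
    Prod.mk.injEq, true_and, and_true]
  constructor
  · ring
  · linear_combination (-c / 3) * this

lemma zM_qM (Z : M2) : zM (qM Z) = Z := by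
  have := rt_sq
  ext i j
  fin_cases i <;> fin_cases j <;> simp [zM, qM] <;> grind

/-- The off-diagonal entry attached to an index. -/
def bb (x : X) : ℂ := x.2.1 / 2 + (x.2.1 + 2 * x.2.2.1) * rt / 6

/-- The Hermitian matrix attached to an index. -/
def hM (x : X) : M2 := !![(x.1 : ℂ), bb x; star (bb x), (x.2.2.2 : ℂ)]

lemma star_bb (x : X) : star (bb x) = x.2.1 / 2 - (x.2.1 + 2 * x.2.2.1) * rt / 6 := by
  rw [bb, star_add, star_div₀, star_div₀, star_mul', rt_conj]
  simp
  ring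

lemma trace_hM (x : X) (Z : M2) : (hM x * Z).trace = lin x (qM Z) := by
  rw [hM, star_bb, bb]
  simp only [trace, mul_apply, Fin.sum_univ_two, Matrix.diag_apply, lin, qM, of_apply,
    cons_val', cons_val_zero, cons_val_one, cons_val_fin_one]
  ring

lemma norm_bb (x : X) :
    ‖bb x‖ ^ 2 = ((x.2.1 : ℝ) ^ 2 + x.2.1 * x.2.2.1 + (x.2.2.1 : ℝ) ^ 2) / 3 := by
  have h : ((‖bb x‖ ^ 2 : ℝ) : ℂ) =
      ((((x.2.1 : ℝ) ^ 2 + x.2.1 * x.2.2.1 + (x.2.2.1 : ℝ) ^ 2) / 3 : ℝ) : ℂ) := by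
    rw [ofReal_pow, ← mul_conj', starRingEnd_apply, star_bb, bb]
    push_cast
    linear_combination (-(x.2.1 + 2 * x.2.2.1) ^ 2 / 36 : ℂ) * rt_sq
  exact_mod_cast h

lemma hM_inj {x y : X} (h : hM x = hM y) : x = y := by
  obtain ⟨n, r, s, m⟩ := x
  obtain ⟨n', r', s', m'⟩ := y
  have h0 := congrFun (congrFun h 0) 0
  have h1 := congrFun (congrFun h 0) 1
  have h2 := congrFun (congrFun h 1) 0
  have h3 := congrFun (congrFun h 1) 1
  simp only [hM, of_apply, cons_val', cons_val_zero, cons_val_one, cons_val_fin_one,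
    star_bb] at h0 h1 h2 h3
  simp only [bb] at h1
  have e1 : (r : ℂ) = r' := by linear_combination h1 + h2
  have e2 : (s : ℂ) = s' := by
    have h4 : ((r + 2 * s) * rt / 6 : ℂ) = (r' + 2 * s') * rt / 6 := by
      linear_combination (h1 - h2) / 2
    linear_combination -rt * h4 + ((r + 2 * s - r' - 2 * s') / 6 : ℂ) * rt_sq - e1 / 2
  norm_cast at h0 h3 e1 e2
  simp [h0, h3, e1, e2]

lemma hM_mem {x : X} : hM x ∈ HermLattice (-3) ↔ Cone x := by
  have h1 : (hM x).PosSemidef ↔ Cone x := by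
    have h := posSemidef_two (𝕜 := ℂ) (a := x.1) (d := x.2.2.2) (β := bb x)
    rw [norm_bb] at h
    rw [hM, ← ofReal_intCast, ← ofReal_intCast]
    refine h.trans ?_
    rw [Cone, ← Int.cast_nonneg_iff (R := ℝ), ← Int.cast_nonneg_iff (R := ℝ) (n := x.2.2.2),
      ← Int.cast_le (R := ℝ), div_le_iff₀ (by norm_num)]
    push_cast
    rw [show (x.1 * x.2.2.2 * 3 : ℝ) = 3 * x.1 * x.2.2.2 by ring]
  rw [← h1]
  refine ⟨fun h => h.2, fun h => ⟨⟨h.1, ?_, ?_⟩, h⟩⟩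
  · intro i
    fin_cases i
    · exact ⟨x.1, rfl⟩
    · exact ⟨x.2.2.2, rfl⟩
  · have hb : ∀ z : ℂ, z ∈ OO → z ∈ ringInt (-3) := fun z h => h
    have hrt : rt ∈ OO := mem_OO.2 ⟨3, 2, by rw [om]; push_cast; ring⟩
    intro i j
    rw [sqrtD_eq]
    apply hb
    fin_cases i <;> fin_cases j
    · exact OO.mul_mem hrt (intCast_mem OO _)
    · refine mem_OO.2 ⟨x.2.1 - x.2.2.1, x.2.1, ?_⟩
      simp only [hM, bb, om, Fin.zero_eta, Fin.mk_one, of_apply, cons_val', cons_val_zero,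
        cons_val_one, cons_val_fin_one]
      push_cast
      linear_combination ((x.2.1 + 2 * x.2.2.1) / 6 : ℂ) * rt_sq
    · refine mem_OO.2 ⟨2 * x.2.1 + x.2.2.1, x.2.1, ?_⟩
      simp only [hM, star_bb, om, Fin.zero_eta, Fin.mk_one, of_apply, cons_val',
        cons_val_zero, cons_val_one, cons_val_fin_one]
      push_cast
      linear_combination (-(x.2.1 + 2 * x.2.2.1) / 6 : ℂ) * rt_sq
    · exact OO.mul_mem hrt (intCast_mem OO _)

lemma exists_hM {H : M2} (h : H ∈ HermLattice (-3)) :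
    ∃ x, Cone x ∧ hM x = H := by
  obtain ⟨n, hn⟩ := h.1.2.1 0
  obtain ⟨m, hm⟩ := h.1.2.1 1
  obtain ⟨c, d, hcd⟩ := mem_OO.1 (h.1.2.2 0 1)
  rw [sqrtD_eq, om] at hcd
  have hx : hM (n, d, d - c, m) = H := by
    have hb : bb (n, d, d - c, m) = H 0 1 := by
      rw [bb]
      push_cast
      linear_combination (rt / 3) * hcd + (d / 6 - H 0 1 / 3) * rt_sq
    have h10 : H 1 0 = star (H 0 1) := (h.1.1.apply 1 0).symm
    ext i j
    fin_cases i <;> fin_cases j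
    · exact hn.symm
    · exact hb
    · change star (bb _) = H 1 0
      rw [hb, h10]
    · exact hm.symm
  exact ⟨_, hM_mem.1 (hx ▸ h), hx⟩

lemma mem_HUHS : Z ∈ HermitianUpperHalfSpace ↔ Dom (qM Z) := by
  obtain ⟨z, rfl⟩ : ∃ z, zM z = Z := ⟨_, zM_qM Z⟩
  obtain ⟨a, t, s, d⟩ := z
  rw [qM_zM, mem_HU]
  have him : ∀ w : ℂ, (w.im : ℂ) = (2 * I)⁻¹ * (w - star w) := by
    intro w
    have := im_eq_sub_conj w
    rw [this, starRingEnd_apply]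
    ring
  have e : (2 * I)⁻¹ • (zM (a, t, s, d) - (zM (a, t, s, d))ᴴ) =
      !![(a.im : ℂ), t.im + rt * s.im; star (t.im + rt * s.im : ℂ), (d.im : ℂ)] := by
    have hs : star (t.im + rt * s.im : ℂ) = t.im - rt * s.im := by
      rw [star_add, star_mul', rt_conj]; simp; ring
    rw [hs]
    ext i j
    fin_cases i <;> fin_cases j <;>
      simp only [zM, him, conjTranspose_apply, star_add, star_sub, star_mul', rt_conj,
        Matrix.smul_apply, Matrix.sub_apply, smul_eq_mul, Fin.zero_eta, Fin.mk_one,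
        of_apply, cons_val', cons_val_zero, cons_val_one, cons_val_fin_one] <;> ring
  rw [e]
  refine (posDef_two (𝕜 := ℂ)).trans ?_
  have hn : ‖(t.im + rt * s.im : ℂ)‖ ^ 2 = t.im ^ 2 + 3 * s.im ^ 2 := by
    rw [← normSq_eq_norm_sq, normSq_apply]
    have : √3 * √3 = 3 := Real.mul_self_sqrt (by norm_num)
    simp [rt]
    linear_combination s.im ^ 2 * this
  rw [hn, Dom]

lemma hasSum_hM (ha : CS a) {c : M2 → ℂ}
    (h : ∀ x, Cone x → c (hM x) = a x) (Z : M2) (s : ℂ) :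
    HasSum (fun H : HermLattice (-3) => c H * exp (2 * π * I *
      ((H : M2) * Z).trace)) s ↔
    HasSum (fun x => a x * ex (lin x (qM Z))) s := by
  let e : {x // Cone x} ≃ HermLattice (-3) := Equiv.ofBijective (fun x => ⟨hM x, hM_mem.2 x.2⟩)
    ⟨fun x y hxy => Subtype.ext (hM_inj (congrArg Subtype.val hxy)), fun H => by
      obtain ⟨x, hx, hH⟩ := exists_hM H.2
      exact ⟨⟨x, hx⟩, Subtype.ext hH⟩⟩
  rw [← e.hasSum_iff, ← hasSum_subtype_iff_of_support_subset (s := {x | Cone x})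
    (f := fun x => a x * ex (lin x (qM Z)))]
  · refine iff_of_eq (congrArg (fun f => HasSum f s) (funext fun x => ?_))
    change c (hM x) * exp (2 * π * I * (hM x * Z).trace) = _
    rw [trace_hM, h x x.2]
    rfl
  · intro x hx
    by_contra hc
    exact hx (by simp [ha x hc])

lemma UU.fromBlocks_mem {A B C D : M2} (hA : ∀ i j, A i j ∈ OO)
    (hB : ∀ i j, B i j ∈ OO) (hC : ∀ i j, C i j ∈ OO) (hD : ∀ i j, D i j ∈ OO)
    (h : (fromBlocks A B C D)ᴴ * J2 * fromBlocks A B C D = J2) : fromBlocks A B C D ∈ UU := by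
  refine ⟨?_, h⟩
  rintro (i | i) (j | j)
  exacts [hA i j, hB i j, hC i j, hD i j]

lemma UU.diag_mem {A D : M2} (hA : ∀ i j, A i j ∈ OO)
    (hD : ∀ i j, D i j ∈ OO) (h : Aᴴ * D = 1) : fromBlocks A 0 0 D ∈ UU := by
  have h' : Dᴴ * A = 1 := by rw [← conjTranspose_conjTranspose A, ← conjTranspose_mul, h,
    conjTranspose_one]
  refine UU.fromBlocks_mem hA (fun _ _ => OO.zero_mem) (fun _ _ => OO.zero_mem) hD ?_
  rw [fromBlocks_conjTranspose, J2, fromBlocks_multiply, fromBlocks_multiply]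
  simp [h, h']

lemma matAct_diag {A D Z : M2} (h : Aᴴ * D = 1) :
    matAct (fromBlocks A 0 0 D) Z = A * Z * Aᴴ := by
  rw [matAct, toBlocks_fromBlocks₁₁, toBlocks_fromBlocks₁₂, toBlocks_fromBlocks₂₁,
    toBlocks_fromBlocks₂₂, Matrix.zero_mul, zero_add, add_zero, inv_eq_left_inv h]

lemma jac_diag {A D Z : M2} : jac (fromBlocks A 0 0 D) Z = D.det := by
  rw [jac, toBlocks_fromBlocks₂₁, toBlocks_fromBlocks₂₂, Matrix.zero_mul, zero_add]

lemma lMat_rel (x : ℂ) : (!![1, 0; -star x, 1] : M2)ᴴ * !![1, x; 0, 1] = 1 := by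
  ext i j
  fin_cases i <;> fin_cases j <;> simp [mul_apply, Fin.sum_univ_two]

lemma lMat_mem {x : ℂ} (hx : x ∈ OO) : lMat x ∈ UU := by
  refine UU.diag_mem (fun i j => ?_) (fun i j => ?_) (lMat_rel x) <;>
    fin_cases i <;> fin_cases j <;>
    first | exact OO.one_mem | exact OO.zero_mem | exact hx | exact OO.neg_mem (star_mem_OO hx)

lemma wMat_rel : (!![0, 1; 1, 0] : M2)ᴴ * !![0, 1; 1, 0] = 1 := by
  ext i j
  fin_cases i <;> fin_cases j <;> simp [mul_apply, Fin.sum_univ_two]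

lemma wMat_mem : wMat ∈ UU := by
  refine UU.diag_mem (fun i j => ?_) (fun i j => ?_) wMat_rel <;>
    fin_cases i <;> fin_cases j <;> first | exact OO.one_mem | exact OO.zero_mem

lemma dMat_rel {u v : ℂ} (h : star u * v = 1) :
    (!![u, 0; 0, 1] : M2)ᴴ * !![v, 0; 0, 1] = 1 := by
  rw [← starRingEnd_apply] at h
  ext i j
  fin_cases i <;> fin_cases j <;> simp [mul_apply, Fin.sum_univ_two, h]

lemma dMat_mem {u v : ℂ} (hu : u ∈ OO) (hv : v ∈ OO) (h : star u * v = 1) : dMat u v ∈ UU := by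
  refine UU.diag_mem (fun i j => ?_) (fun i j => ?_) (dMat_rel h) <;>
    fin_cases i <;> fin_cases j <;>
    first | exact OO.one_mem | exact OO.zero_mem | exact hu | exact hv

lemma tMat_mem {B : M2} (hB : B.IsHermitian) (h : ∀ i j, B i j ∈ OO) :
    tMat B ∈ UU := by
  have h1 : ∀ i j : Fin 2, (1 : M2) i j ∈ OO := fun i j => by
    rw [one_apply]; split_ifs; exacts [OO.one_mem, OO.zero_mem]
  refine UU.fromBlocks_mem h1 h (fun _ _ => OO.zero_mem) h1 ?_
  rw [fromBlocks_conjTranspose, J2, fromBlocks_multiply, fromBlocks_multiply]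
  simp [hB.eq]

lemma sMat_mem : sMat ∈ UU := by
  refine UU.fromBlocks_mem (fun i j => ?_) (fun i j => ?_) (fun i j => ?_) (fun i j => ?_) ?_
  iterate 4
    fin_cases i <;> fin_cases j <;>
      first | exact OO.one_mem | exact OO.zero_mem | exact OO.neg_mem OO.one_mem
  rw [fromBlocks_conjTranspose, J2, fromBlocks_multiply, fromBlocks_multiply]
  congr 1 <;> ext i j <;> fin_cases i <;> fin_cases j <;>
    simp [mul_apply, Fin.sum_univ_two]

/-- The unipotent action in matrix entries. -/
def lM (x : ℂ) (Z : M2) : M2 :=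
  !![Z 0 0, Z 0 1 - x * Z 0 0; Z 1 0 - star x * Z 0 0,
    Z 1 1 - star x * Z 0 1 - x * Z 1 0 + x * star x * Z 0 0]

/-- The diagonal action in matrix entries. -/
def dM (u : ℂ) (Z : M2) : M2 :=
  !![Z 0 0, u * Z 0 1; star u * Z 1 0, Z 1 1]

lemma matAct_lMat (x : ℂ) (Z : M2) : matAct (lMat x) Z = lM x Z := by
  rw [lMat, matAct_diag (lMat_rel x)]
  ext i j
  fin_cases i <;> fin_cases j <;>
    simp [mul_apply, Fin.sum_univ_two, vecMul, dotProduct, lM] <;> ring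

lemma matAct_wMat (Z : M2) :
    matAct wMat Z = !![Z 1 1, Z 1 0; Z 0 1, Z 0 0] := by
  rw [wMat, matAct_diag wMat_rel]
  ext i j
  fin_cases i <;> fin_cases j <;> simp [mul_apply, Fin.sum_univ_two, vecMul, dotProduct]

lemma matAct_dMat {u v : ℂ} (h : star u * v = 1) (hu : u * star u = 1)
    (Z : M2) : matAct (dMat u v) Z = dM u Z := by
  rw [← starRingEnd_apply] at hu
  rw [dMat, matAct_diag (dMat_rel h)]
  ext i j
  fin_cases i <;> fin_cases j <;> simp [mul_apply, Fin.sum_univ_two, vecMul, dotProduct, dM]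
  · linear_combination Z 0 0 * hu
  · ring

lemma matAct_tMat (B Z : M2) : matAct (tMat B) Z = Z + B := by
  simp [matAct, tMat]

lemma jac_sMat (Z : M2) : jac sMat Z = Z 0 0 := by
  simp [jac, sMat, det_fin_two, vecHead, vecTail, Fin.sum_univ_two, vecMul, dotProduct]

lemma matAct_sMat (h : Z 0 0 ≠ 0) :
    matAct sMat Z = zM (Sz (qM Z)) := by
  have e1 : (!![1, 0; 0, 0] * Z + !![0, 0; 0, 1] : M2) =
      !![Z 0 0, Z 0 1; 0, 1] := by
    ext i j; fin_cases i <;> fin_cases j <;> simp [Fin.sum_univ_two, vecMul, dotProduct]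
  have e2 : (!![0, 0; 0, 1] * Z + !![-1, 0; 0, 0] : M2) =
      !![-1, 0; Z 1 0, Z 1 1] := by
    ext i j; fin_cases i <;> fin_cases j <;> simp [Fin.sum_univ_two, vecMul, dotProduct]
  have e3 : (!![Z 0 0, Z 0 1; 0, 1])⁻¹ = !![1 / Z 0 0, -Z 0 1 / Z 0 0; 0, 1] := by
    apply inv_eq_left_inv
    ext i j; fin_cases i <;> fin_cases j <;> simp [mul_apply, Fin.sum_univ_two, h]
    ring
  have := rt_sq
  rw [matAct, sMat, toBlocks_fromBlocks₁₁, toBlocks_fromBlocks₁₂, toBlocks_fromBlocks₂₁,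
    toBlocks_fromBlocks₂₂, e1, e2, e3]
  ext i j; fin_cases i <;> fin_cases j <;>
    simp [mul_apply, Fin.sum_univ_two, zM, Sz, qM] <;> field_simp <;> grind

lemma det_sMat : sMat.det = 1 := by
  have h : sMat = fromBlocks (1 : M2) !![-1, 0; 0, 0] 0 1 *
      fromBlocks 1 0 !![1, 0; 0, 0] 1 * fromBlocks 1 !![-1, 0; 0, 0] 0 1 := by
    rw [sMat, fromBlocks_multiply, fromBlocks_multiply]
    congr 1 <;> ext i j <;> fin_cases i <;> fin_cases j <;>
      simp [mul_apply, Fin.sum_univ_two]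
  rw [h, det_mul, det_mul, det_fromBlocks_zero₂₁, det_fromBlocks_zero₁₂]
  simp

lemma FF_of_equiv (g : X ≃ X) (ha : ∀ x, a (g x) = a x) {z z' : Q}
    (h : ∀ x, lin x z' = lin (g x) z) : FF a z' = FF a z := by
  rw [FF, FF, ← g.tsum_eq fun x => a x * ex (lin x z)]
  exact tsum_congr fun x => by rw [ha, h]

/-- A primitive sixth root of unity. -/
def zt : ℂ := (1 + rt) / 2

lemma zt_conj : star zt = (1 - rt) / 2 := by
  rw [zt, star_div₀, star_add, rt_conj]; simp; ring

lemma unit_cases {u v : ℂ} (hu : u ∈ OO) (hv : v ∈ OO) (h : star u * v = 1) :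
    u = v ∧ u * star u = 1 ∧ u ^ 6 = 1 ∧ ∃ n : ℕ, u = star zt ^ n := by
  have hz := zt_conj
  have hs := rt_sq
  have hn : normSq u = 1 := by
    obtain ⟨n, hn⟩ := exists_normSq hu
    obtain ⟨m, hm⟩ := exists_normSq hv
    have h1 := congrArg normSq h
    rw [normSq_mul, ← starRingEnd_apply, normSq_conj, hn, hm, map_one] at h1
    have : n * m = 1 := by exact_mod_cast h1
    rw [hn, Nat.eq_one_of_mul_eq_one_right this, Nat.cast_one]
  have huu : u * star u = 1 := by
    rw [← starRingEnd_apply, mul_conj, hn, ofReal_one]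
  refine ⟨by linear_combination (-u) * h + v * huu, huu, ?_⟩
  obtain ⟨a, b, rfl⟩ := mem_OO.1 hu
  have h2 := normSq_OO a b
  simp only [ofReal_intCast] at h2
  rw [h2] at hn
  have h3 : a ^ 2 - 3 * a * b + 3 * b ^ 2 = 1 := by exact_mod_cast hn
  have hb1 : b ≤ 1 := by nlinarith [sq_nonneg (2 * a - 3 * b)]
  have hb2 : -1 ≤ b := by nlinarith [sq_nonneg (2 * a - 3 * b)]
  have key : ∃ n : ℕ, (a + b * om : ℂ) = star zt ^ n := by
    rw [hz, om]
    have h4 : a = 1 ∧ b = 0 ∨ a = -1 ∧ b = 0 ∨ a = 1 ∧ b = 1 ∨ a = 2 ∧ b = 1 ∨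
        a = -1 ∧ b = -1 ∨ a = -2 ∧ b = -1 := by
      interval_cases b
      · have : (a + 1) * (a + 2) = 0 := by linarith
        rcases mul_eq_zero.1 this with h | h <;> omega
      · have : (a + 1) * (a - 1) = 0 := by linarith
        rcases mul_eq_zero.1 this with h | h <;> omega
      · have : (a - 1) * (a - 2) = 0 := by linarith
        rcases mul_eq_zero.1 this with h | h <;> omega
    rcases h4 with ⟨rfl, rfl⟩ | ⟨rfl, rfl⟩ | ⟨rfl, rfl⟩ | ⟨rfl, rfl⟩ | ⟨rfl, rfl⟩ | ⟨rfl, rfl⟩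
    · exact ⟨0, by simp⟩
    · exact ⟨3, by push_cast; grind⟩
    · exact ⟨4, by push_cast; grind⟩
    · exact ⟨5, by push_cast; grind⟩
    · exact ⟨1, by push_cast; grind⟩
    · exact ⟨2, by push_cast; grind⟩
  refine ⟨?_, key⟩
  obtain ⟨n, hn⟩ := key
  have h6 : star zt ^ 6 = 1 := by rw [hz]; grind
  rw [hn, ← pow_mul, mul_comm, pow_mul, h6, one_pow]

lemma lin_gshift (Z : M2) (x : X) :
    lin x (qM (lM (-1) Z)) = lin (gshift x) (qM Z) := by
  simp [lin, qM, lM, gshift]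
  ring

lemma lin_grot (Z : M2) (x : X) :
    lin x (qM (dM (star zt) Z)) = lin (grot x) (qM Z) := by
  have hs := rt_sq
  have hz' : star ((1 - rt) / 2) = (1 + rt) / 2 := by rw [← zt_conj, star_star, zt]
  simp only [lin, qM, dM, of_apply, cons_val', cons_val_zero, zt_conj, hz',
    cons_val_one, cons_val_fin_one, grot]
  simp
  grind

lemma HF.lM_inv (h : HF k 1 a) {x : ℂ} (hx : x ∈ OO) (Z : M2) :
    FF a (qM (lM x Z)) = FF a (qM Z) := by
  have hs := rt_sq
  have hz := zt_conj
  have hadd : ∀ x y Z, lM x (lM y Z) = lM (x + y) Z := by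
    intro x y Z
    ext i j
    fin_cases i <;> fin_cases j <;> simp [lM] <;> ring
  let S : AddSubgroup ℂ :=
    { carrier := {x | ∀ Z, FF a (qM (lM x Z)) = FF a (qM Z)}
      zero_mem' := fun Z => by
        congr 2
        ext i j
        fin_cases i <;> fin_cases j <;> simp [lM]
      add_mem' := fun {x y} hx hy Z => by rw [← hadd, hx, hy]
      neg_mem' := fun {x} hx Z => by
        rw [← hx, hadd, add_neg_cancel]
        congr 2
        ext i j
        fin_cases i <;> fin_cases j <;> simp [lM] }
  have h1 : (-1 : ℂ) ∈ S := fun Z => by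
    exact FF_of_equiv gshift.toEquiv (fun x => h.shift _ _ _ _) (lin_gshift Z)
  have h2 : -zt ∈ S := fun Z => by
    refine FF_of_equiv ((grot.symm.trans gshift).trans grot).toEquiv (fun x => ?_) fun x => ?_
    · obtain ⟨y, rfl⟩ := grot.surjective x
      have hr : ∀ y, a (grot y) = a y := fun y => by
        have := h.rot y.1 y.2.1 y.2.2.1 y.2.2.2
        rw [one_mul] at this
        exact this
      change a (grot (gshift (grot.symm (grot y)))) = a (grot y)
      rw [grot.symm_apply_apply, hr, hr]
      exact h.shift _ _ _ _
    · have e : (((grot.symm.trans gshift).trans grot).toEquiv x) =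
          (x.1 + (x.2.1 + x.2.2.1) + x.2.2.2, x.2.1 + x.2.2.2, x.2.2.1 + x.2.2.2, x.2.2.2) := by
        simp [grot, gshift]
        constructor <;> ring
      rw [e]
      simp only [lin, qM, lM, star_neg, hz, of_apply, cons_val', cons_val_zero,
        cons_val_one, cons_val_fin_one]
      rw [zt]
      push_cast
      grind
  obtain ⟨c, d, rfl⟩ := mem_OO.1 hx
  have h3 : ((-c + 2 * d : ℤ) • (-1 : ℂ) + (-d : ℤ) • (-zt)) ∈ S :=
    S.add_mem (S.zsmul_mem h1 _) (S.zsmul_mem h2 _)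
  have e : (c + d * om : ℂ) = (-c + 2 * d : ℤ) • (-1 : ℂ) + (-d : ℤ) • (-zt) := by
    simp only [zsmul_eq_mul, om, zt]; push_cast; ring
  rw [e]
  exact h3 Z

lemma HF.dM_inv (h : HF k 1 a) (n : ℕ) (Z : M2) :
    FF a (qM (dM (star zt ^ n) Z)) = FF a (qM Z) := by
  have h1 : ∀ Z, FF a (qM (dM (star zt) Z)) = FF a (qM Z) := fun Z => by
    exact FF_of_equiv grot.toEquiv (fun x => (h.rot _ _ _ _).trans (one_mul _)) (lin_grot Z)
  induction n generalizing Z with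
  | zero =>
    congr 2
    ext i j
    fin_cases i <;> fin_cases j <;> simp [dM]
  | succ n ih =>
    rw [show dM (star zt ^ (n + 1)) Z = dM (star zt) (dM (star zt ^ n) Z) from ?_, h1, ih]
    ext i j
    fin_cases i <;> fin_cases j <;> simp [dM, pow_succ] <;> ring

lemma qM_periodic {B : M2} (hB : B.IsHermitian) (h : ∀ i j, B i j ∈ OO)
    (x : X) (Z : M2) : ex (lin x (qM (Z + B))) = ex (lin x (qM Z)) := by
  have hd : ∀ i, ∃ n : ℤ, B i i = n := fun i => by
    obtain ⟨c, d, hc⟩ := mem_OO.1 (h i i)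
    have h1 : star (B i i) = B i i := hB.apply i i
    have hi : ∀ n : ℤ, star (n : ℂ) = n := fun n => by simp
    rw [hc, star_add, star_mul', om_conj, om, hi, hi] at h1
    have h2 : (d : ℂ) * rt = 0 := by linear_combination -h1
    rcases mul_eq_zero.1 h2 with h3 | h3
    · exact ⟨c, by rw [hc, h3]; ring⟩
    · have := rt_sq; rw [h3] at this; norm_num at this
  obtain ⟨n, hn⟩ := hd 0
  obtain ⟨m, hm⟩ := hd 1
  obtain ⟨c, d, hc⟩ := mem_OO.1 (h 0 1)
  have h10 : B 1 0 = c + d * (-3 - om) := by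
    rw [← hB.apply 1 0, hc, star_add, star_mul', om_conj]; simp
  have e : lin x (qM (Z + B)) = lin x (qM Z) +
      ((x.1 * n + x.2.1 * c - x.2.1 * d + x.2.2.1 * d + x.2.2.2 * m : ℤ) : ℂ) := by
    simp only [lin, qM, Matrix.add_apply, hn, hm, hc, h10, om]
    push_cast
    linear_combination (-(x.2.1 + 2 * x.2.2.1) * d / 6 : ℂ) * rt_sq
  rw [e, ex_add, ex_int, mul_one]

lemma unit_factor (hk : Even k) {u : ℂ} (h : u ^ 6 = 1) : (u * u) ^ k * u ^ k = 1 := by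
  obtain ⟨l, rfl⟩ := hk
  rw [← mul_zpow, ← two_mul, _root_.zpow_mul, show ((u * u * u) ^ (2 : ℤ)) = u ^ 6 by
    rw [show (2 : ℤ) = (2 : ℕ) by rfl, zpow_natCast]; ring, h, _root_.one_zpow]

lemma HF.genSet (h : HF k 1 a) (hk : Even k) :
    GenSet {M | M ∈ UU ∧ ∀ Z ∈ HermitianUpperHalfSpace,
      FF a (qM (matAct M Z)) = M.det ^ k * jac M Z ^ k * FF a (qM Z)} where
  sub M hM := hM.1
  cancel N hN M hM hNM := by
    refine ⟨hM, fun Z hZ => ?_⟩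
    have h1 := hNM.2 Z hZ
    have hM2 := matAct_mem hM.2 hZ
    rw [matAct_mul hM.2 hZ, hN.2 _ hM2, jac_mul hM.2 hZ, det_mul, mul_zpow, mul_zpow] at h1
    have hd := zpow_ne_zero k (det_ne_zero_of_rel hN.1.2)
    have hj := zpow_ne_zero k (jac_ne_zero hN.1.2 hM2)
    refine mul_left_cancel₀ (mul_ne_zero hd hj) ?_
    rw [h1]
    ring
  t B hB hBO := by
    refine ⟨tMat_mem hB hBO, fun Z _ => ?_⟩
    rw [matAct_tMat, FF, FF]
    simp_rw [qM_periodic hB hBO]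
    simp [tMat, jac]
  l x hx := by
    refine ⟨lMat_mem hx, fun Z _ => ?_⟩
    rw [matAct_lMat, h.lM_inv hx, lMat, jac_diag, det_fromBlocks_zero₂₁]
    simp
  w := by
    refine ⟨wMat_mem, fun Z _ => ?_⟩
    rw [matAct_wMat, wMat, jac_diag, det_fromBlocks_zero₂₁]
    simp only [det_fin_two_of]
    norm_num [hk.neg_one_zpow]
    refine FF_of_equiv (gflip.trans gswap).toEquiv (fun x => ?_) fun x => ?_
    · have h1 := h.flip x.1 x.2.1 x.2.2.1 x.2.2.2
      rw [one_mul] at h1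
      rw [← h1]
      exact h.swap _ _ _ _
    · simp [lin, qM, gflip, gswap]
      ring
  d u hu v hv huv := by
    obtain ⟨rfl, h1, h2, n, hn⟩ := unit_cases hu hv huv
    refine ⟨dMat_mem hu hv huv, fun Z _ => ?_⟩
    rw [matAct_dMat huv h1]
    rw [dMat, jac_diag, det_fromBlocks_zero₂₁]
    simp only [det_fin_two_of, mul_one, mul_zero, sub_zero]
    rw [unit_factor hk h2, one_mul, hn, h.dM_inv]
  s := by
    refine ⟨sMat_mem, fun Z hZ => ?_⟩
    have hD := mem_HUHS.1 hZ
    have h0 : Z 0 0 ≠ 0 := fun h0 => by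
      have := hD.1
      simp [qM, h0] at this
    rw [matAct_sMat h0, qM_zM, h.S1 _ hD, jac_sMat, det_sMat, _root_.one_zpow, one_mul]
    rfl

/-- The pairing with an index, as a continuous linear form. -/
def linL (x : X) : Q →L[ℂ] ℂ :=
  LinearMap.mkContinuous
    { toFun := lin x
      map_add' := fun z w => by simp only [lin, Prod.fst_add, Prod.snd_add]; ring
      map_smul' := fun c z => by
        simp only [lin, Prod.smul_fst, Prod.smul_snd, smul_eq_mul, RingHom.id_apply]; ring }
    (3 * sz x) fun z => by
      have h1 : ‖z.1‖ ≤ ‖z‖ := norm_fst_le z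
      have h2 : ‖z.2‖ ≤ ‖z‖ := norm_snd_le z
      have h3 : ‖z.2.1‖ ≤ ‖z‖ := (norm_fst_le z.2).trans h2
      have h4 : ‖z.2.2‖ ≤ ‖z‖ := (norm_snd_le z.2).trans h2
      have h5 : ‖z.2.2.1‖ ≤ ‖z‖ := (norm_fst_le z.2.2).trans h4
      have h6 : ‖z.2.2.2‖ ≤ ‖z‖ := (norm_snd_le z.2.2).trans h4
      change ‖x.1 * z.1 + x.2.1 * z.2.1 + (x.2.1 + 2 * x.2.2.1) * z.2.2.1 + x.2.2.2 * z.2.2.2‖ ≤ _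
      have hn : ∀ (n : ℤ) (w : ℂ), ‖w‖ ≤ ‖z‖ → ‖(n : ℂ) * w‖ ≤ |(n : ℝ)| * ‖z‖ := fun n w hw => by
        rw [norm_mul, norm_intCast]; gcongr
      have e : (x.1 * z.1 + x.2.1 * z.2.1 + (x.2.1 + 2 * x.2.2.1) * z.2.2.1 +
          x.2.2.2 * z.2.2.2 : ℂ) = x.1 * z.1 + x.2.1 * z.2.1 + (x.2.1 * z.2.2.1 +
          (x.2.2.1 * z.2.2.1 + x.2.2.1 * z.2.2.1)) + x.2.2.2 * z.2.2.2 := by ring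
      rw [e]
      refine (norm_add_le_of_le (norm_add_le_of_le (norm_add_le_of_le (hn _ _ h1) (hn _ _ h3))
        (norm_add_le_of_le (hn _ _ h5) (norm_add_le_of_le (hn _ _ h5) (hn _ _ h5))))
        (hn _ _ h6)).trans ?_
      rw [sz]
      have := norm_nonneg z
      nlinarith [mul_nonneg (abs_nonneg (x.1 : ℝ)) this, mul_nonneg (abs_nonneg (x.2.1 : ℝ)) this,
        mul_nonneg (abs_nonneg (x.2.2.1 : ℝ)) this, mul_nonneg (abs_nonneg (x.2.2.2 : ℝ)) this]

lemma sz_nonneg (x : X) : 0 ≤ sz x := by unfold sz; positivity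

lemma norm_linL (x : X) : ‖linL x‖ ≤ 3 * sz x :=
  LinearMap.mkContinuous_norm_le _ (by have := sz_nonneg x; positivity) _

lemma hasFDerivAt_term (c : ℂ) (x : X) (z : Q) :
    HasFDerivAt (fun z => c * ex (lin x z))
      ((2 * π * I * (c * ex (lin x z))) • linL x) z := by
  have h1 : HasFDerivAt (fun z => lin x z) (linL x) z := (linL x).hasFDerivAt
  have h2 : HasFDerivAt (fun z => ex (lin x z))
      (exp (2 * π * I * lin x z) • (2 * π * I) • linL x) z :=
    (h1.const_mul (2 * π * I)).cexp
  refine (h2.const_mul c).congr_fderiv ?_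
  rw [smul_smul, smul_smul, ex]
  congr 1
  ring

lemma HF.differentiableAt (h : HF k 1 a) {z₀ : Q} (h₀ : Dom z₀) : DifferentiableAt ℂ (FF a) z₀ := by
  have hρ := h₀.rate_pos
  obtain ⟨C, hC⟩ := exists_term_bound h.cone h.grow (half_pos hρ)
  have hev : ∀ᶠ z in 𝓝 z₀, Dom z ∧ rate z₀ / 2 ≤ rate z := by
    have h1 : ContinuousAt rate z₀ := by
      have hne : 3 * (z₀.1.im + z₀.2.2.2.im) ≠ 0 := by
        have := h₀.1; have := h₀.im2_pos; positivity
      unfold rate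
      refine ContinuousAt.div (Continuous.continuousAt ?_) (Continuous.continuousAt ?_) hne <;>
        fun_prop
    have h2 : IsOpen {z : Q | Dom z} := by
      refine IsOpen.and (isOpen_lt (by fun_prop) (by fun_prop)) (isOpen_lt ?_ ?_) <;> fun_prop
    filter_upwards [h2.mem_nhds h₀, h1.eventually (lt_mem_nhds (half_lt_self hρ))] with z hz hr
    exact ⟨hz, hr.le⟩
  obtain ⟨ε, hε, hball⟩ := Metric.eventually_nhds_iff_ball.1 hev
  have hC0 : 0 ≤ C := by
    have := (norm_nonneg _).trans (hC z₀ h₀ (half_le_self hρ.le) 0)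
    exact nonneg_of_mul_nonneg_left this (Real.exp_pos _)
  set ρ := rate z₀
  have hu : Summable fun x : X => (2 * π * (C * (12 / ρ))) * Real.exp (-(ρ / 4) * sz x) :=
    (summable_exp_sz (by positivity)).mul_left _
  refine (hasFDerivAt_tsum_of_isPreconnected hu Metric.isOpen_ball
    (convex_ball z₀ ε).isPreconnected (fun x z _ => hasFDerivAt_term (a x) x z)
    (fun x z hz => ?_) (Metric.mem_ball_self hε) (summable_FF h.cone h.grow h₀)
    (Metric.mem_ball_self hε)).differentiableAt
  obtain ⟨hD, hr⟩ := hball z hz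
  rw [norm_smul, norm_mul, norm_mul, norm_mul, norm_I, mul_one, Complex.norm_two, norm_real,
    Real.norm_of_nonneg Real.pi_pos.le]
  have h1 := hC z hD hr x
  have h2 : 3 * sz x ≤ 12 / ρ * Real.exp (ρ / 4 * sz x) := by
    have := Real.add_one_le_exp (ρ / 4 * sz x)
    rw [div_mul_eq_mul_div, le_div_iff₀ hρ]
    nlinarith
  have h3 := (norm_linL x).trans h2
  calc _ ≤ 2 * π * (C * Real.exp (-(ρ / 2) * sz x)) *
        (12 / ρ * Real.exp (ρ / 4 * sz x)) := by gcongr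
    _ = 2 * π * (C * (12 / ρ)) * (Real.exp (-(ρ / 2) * sz x) * Real.exp (ρ / 4 * sz x)) := by
        ring
    _ = _ := by rw [← Real.exp_add]; congr 2; ring

open Classical in
/-- The Hermitian modular form attached to a family of Fourier coefficients. -/
def HF.form (h : HF k 1 a) (hk : Even k) : HermitianModularForm (-3) k where
  toFun Z := FF a (qM Z)
  coeff H := if hH : ∃ x, hM x = H then a hH.choose else 0
  holo Z hZ := by
    have h1 : DifferentiableAt ℂ (fun Z : Fin 2 → Fin 2 → ℂ => qM (of Z)) Z := by
      simp only [qM, of_apply]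
      fun_prop
    exact ((h.differentiableAt (mem_HUHS.1 hZ)).comp Z h1).differentiableWithinAt
  transform M hM Z hZ := by
    rw [nuChar, if_neg (by norm_num)]
    exact ((h.genSet hk).mem M hM).2 Z hZ
  coeff_supported H hH := by
    split_ifs at hH with hx
    · rw [← hx.choose_spec]
      exact hM_mem.2 (by_contra fun hc => hH (h.cone _ hc))
    · exact absurd rfl hH
  expansion Z hZ := by
    refine (hasSum_hM h.cone (c := fun H => if hH : ∃ x, hM x = H then a hH.choose else 0)
      (fun x _ => ?_) Z _).2 (summable_FF h.cone h.grow (mem_HUHS.1 hZ)).hasSum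
    have hx : ∃ y, hM y = hM x := ⟨x, rfl⟩
    simp only [dif_pos hx]
    rw [hM_inj hx.choose_spec]

lemma HF.form_toFun (h : HF k 1 a) (hk : Even k) (Z : M2) :
    (h.form hk).toFun Z = FF a (qM Z) := rfl

lemma HF.form_coeff (h : HF k 1 a) (hk : Even k) (x : X) : (h.form hk).coeff (hM x) = a x := by
  have hx : ∃ y, hM y = hM x := ⟨x, rfl⟩
  simp only [HF.form, dif_pos hx]
  rw [hM_inj hx.choose_spec]

lemma HF.form_coeff_cases (h : HF k 1 a) (hk : Even k) (H : M2) :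
    (h.form hk).coeff H = 0 ∨ ∃ x, hM x = H ∧ (h.form hk).coeff H = a x := by
  by_cases hx : ∃ x, hM x = H
  · obtain ⟨x, rfl⟩ := hx
    exact .inr ⟨x, rfl, h.form_coeff hk x⟩
  · exact .inl (by simp only [HF.form, dif_neg hx])

lemma HF.form_symm (h : HF k 1 a) (hk : Even k) : IsSymmetricHMF (h.form hk) := by
  intro Z _
  simp only [HF.form_toFun]
  refine FF_of_equiv gflip.toEquiv (fun x => (h.flip _ _ _ _).trans (one_mul _)) fun x => ?_
  simp [lin, qM, gflip]
  ring

/-- The Fourier coefficients of a Hermitian modular form, as a family over the indices. -/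
def ca (f : HermitianModularForm (-3) k) (x : X) : ℂ := f.coeff (hM x)

lemma ca_cone (f : HermitianModularForm (-3) k) : CS (ca f) := fun x hx =>
  by_contra fun h => hx (hM_mem.1 (f.coeff_supported _ h))

lemma ca_hasSum (f : HermitianModularForm (-3) k)
    (hZ : Z ∈ HermitianUpperHalfSpace) :
    HasSum (fun x => ca f x * ex (lin x (qM Z))) (f.toFun Z) :=
  (hasSum_hM (ca_cone f) (fun _ _ => rfl) Z _).1 (f.expansion Z hZ)

lemma FF_ca (f : HermitianModularForm (-3) k)
    (hZ : Z ∈ HermitianUpperHalfSpace) : FF (ca f) (qM Z) = f.toFun Z := (ca_hasSum f hZ).tsum_eq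

lemma ca_summable (f : HermitianModularForm (-3) k) (hz : Dom z) :
    Summable fun x => ca f x * ex (lin x z) := by
  have := ca_hasSum f (mem_HUHS.2 ((qM_zM z).symm ▸ hz))
  rw [qM_zM] at this
  exact this.summable

lemma ca_equiv (f : HermitianModularForm (-3) k) (g : X ≃ X)
    (q : M2 → M2)
    (hlin : ∀ Z x, lin x (qM (q Z)) = lin (g x) (qM Z))
    (hq : ∀ Z ∈ HermitianUpperHalfSpace, q Z ∈ HermitianUpperHalfSpace ∧ f.toFun (q Z) = f.toFun Z)
    (x : X) : ca f (g x) = ca f x := by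
  have key : ∀ Z ∈ HermitianUpperHalfSpace,
      HasSum (fun x => ca f (g.symm x) * ex (lin x (qM Z))) (f.toFun Z) := fun Z hZ => by
    have h1 := ca_hasSum f (hq Z hZ).1
    rw [(hq Z hZ).2, ← g.symm.hasSum_iff] at h1
    refine (congrArg (fun f => HasSum f _) (funext fun w => ?_)).mp h1
    simp only [Function.comp, hlin, Equiv.apply_symm_apply]
  have e := FF_injective (a := fun x => ca f (g.symm x)) (b := ca f) (fun z hz => ?_)
    (fun z hz => ca_summable f hz) fun z hz => ?_
  · have := congrFun e (g x)
    simpa using this.symm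
  · have := (key _ (mem_HUHS.2 ((qM_zM z).symm ▸ hz))).summable
    rwa [qM_zM] at this
  · have hZ := mem_HUHS.2 ((qM_zM z).symm ▸ hz)
    have h1 := (key _ hZ).tsum_eq
    have h2 := FF_ca f hZ
    rw [qM_zM] at h1 h2
    rw [h2, ← h1, FF]

lemma ca_hf (f : HermitianModularForm (-3) k) (hk : Even k) (hf : IsSymmetricHMF f) :
    HF k 1 (ca f) := by
  have law : ∀ M ∈ UU, ∀ Z ∈ HermitianUpperHalfSpace,
      f.toFun (matAct M Z) = M.det ^ k * jac M Z ^ k * f.toFun Z := fun M hM Z hZ => by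
    have := f.transform M hM Z hZ
    rwa [nuChar, if_neg (by norm_num)] at this
  have hT : ∀ Z ∈ HermitianUpperHalfSpace, Zᵀ ∈ HermitianUpperHalfSpace := fun Z hZ => by
    rw [mem_HUHS] at hZ ⊢
    have e : qM Zᵀ = ((qM Z).1, (qM Z).2.1, -(qM Z).2.2.1, (qM Z).2.2.2) := by
      simp only [qM, transpose_apply, Prod.mk.injEq, true_and, and_true]
      constructor <;> ring
    rw [e]
    simpa [Dom] using hZ
  have hflip : ∀ x, ca f (gflip x) = ca f x :=
    ca_equiv f gflip.toEquiv transpose (fun Z x => by simp [lin, qM, gflip]; ring)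
      fun Z hZ => ⟨hT Z hZ, hf Z hZ⟩
  have hz1 : star (star zt) * star zt = 1 := by
    rw [star_star, zt_conj, zt]; linear_combination (-1 / 4 : ℂ) * rt_sq
  have hz2 : star zt ∈ OO := mem_OO.2 ⟨-1, -1, by rw [zt_conj, om]; push_cast; ring⟩
  have hone : (-1 : ℂ) ∈ OO := OO.neg_mem OO.one_mem
  refine ⟨ca_cone f, grow_of_summable fun v hv => ca_summable f (Dom_diag hv), fun z hz => ?_,
    fun n r s m => ?_, fun n r s m => ?_, fun n r s m => ?_, fun n r s m => ?_⟩
  · obtain ⟨Z, rfl⟩ : ∃ Z, qM Z = z := ⟨_, qM_zM z⟩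
    have hZ := mem_HUHS.2 hz
    have h0 : Z 0 0 ≠ 0 := fun h0 => by
      have := hz.1
      simp [qM, h0] at this
    have h1 := law _ sMat_mem Z hZ
    have h2 := FF_ca f (matAct_mem sMat_mem.2 hZ)
    rw [matAct_sMat h0] at h1 h2
    rw [qM_zM] at h2
    rw [h2, h1, FF_ca f hZ, jac_sMat, det_sMat, _root_.one_zpow, one_mul]
    rfl
  · refine ca_equiv f gswap.toEquiv (fun Z => (matAct wMat Z)ᵀ) (fun Z x => ?_)
      (fun Z hZ => ?_) (n, r, s, m)
    · rw [matAct_wMat]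
      simp [lin, qM, gswap]
      ring
    · have hw := matAct_mem wMat_mem.2 hZ
      refine ⟨hT _ hw, ?_⟩
      rw [hf _ hw, law _ wMat_mem Z hZ, wMat, jac_diag, det_fromBlocks_zero₂₁]
      simp only [det_fin_two_of]
      norm_num [hk.neg_one_zpow]
  · rw [one_mul]
    exact hflip (n, r, s, m)
  · rw [one_mul]
    obtain ⟨-, h1, h6, -⟩ := unit_cases hz2 hz2 hz1
    refine ca_equiv f grot.toEquiv (dM (star zt)) lin_grot (fun Z hZ => ?_) (n, r, s, m)
    have hd := dMat_mem hz2 hz2 hz1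
    rw [← matAct_dMat hz1 h1]
    refine ⟨matAct_mem hd.2 hZ, ?_⟩
    rw [law _ hd Z hZ, dMat, jac_diag, det_fromBlocks_zero₂₁]
    simp only [det_fin_two_of, mul_one, mul_zero, sub_zero]
    rw [unit_factor hk h6, one_mul]
  · refine ca_equiv f gshift.toEquiv (lM (-1)) lin_gshift (fun Z hZ => ?_) (n, r, s, m)
    have hl := lMat_mem hone
    rw [← matAct_lMat]
    refine ⟨matAct_mem hl.2 hZ, ?_⟩
    rw [law _ hl Z hZ, lMat, jac_diag, det_fromBlocks_zero₂₁]
    simp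

section

lemma FF_sum_mon (G : Gens A) (D : Finset (Fin 5 →₀ ℕ)) (c : (Fin 5 →₀ ℕ) → ℂ) (hz : Dom z) :
    HasSum (fun x => (∑ d ∈ D, c d * mon A d x) * ex (lin x z)) (∑ d ∈ D, c d * FF (mon A d) z) := by
  have := hasSum_sum fun d (_ : d ∈ D) => ((G.hf d).summ hz).hasSum.mul_left (c d)
  refine (congrArg (fun f => HasSum f _) (funext fun x => ?_)).mp this
  rw [sum_mul]
  exact sum_congr rfl fun d _ => (mul_assoc _ _ _).symm

lemma FF_translate (a : X → ℂ) (z : Q) (l : ℕ) : FF a (z.1 + l, z.2) = FF a z := by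
  refine tsum_congr fun x => ?_
  have e : lin x (z.1 + l, z.2) = lin x z + ((x.1 * l : ℤ) : ℂ) := by simp [lin]; ring
  rw [e, ex_add, ex_int, mul_one]

/-- A vanishing polynomial in the generators has vanishing homogeneous parts. -/
lemma graded_part (G : Gens A) (P : MvPolynomial (Fin 5) ℂ)
    (h : ∀ z, Dom z → MvPolynomial.eval (fun i => FF (A i) z) P = 0) (k : ℕ) (hz : Dom z) :
    ∑ d ∈ P.support.filter (fun d => wt d = k), P.coeff d * FF (mon A d) z = 0 := by
  have hev : ∀ z, Dom z → ∑ d ∈ P.support, P.coeff d * FF (mon A d) z = 0 := fun z hz => by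
    have := h z hz
    rw [MvPolynomial.eval_eq'] at this
    rw [← this]
    exact sum_congr rfl fun d _ => by rw [G.FF_mon d hz, Fin.prod_univ_five]
  have hwt : ∀ d, ((wt d).toNat : ℤ) = wt d := fun d => Int.toNat_of_nonneg (by unfold wt; positivity)
  set q : Polynomial ℂ := ∑ d ∈ P.support,
    Polynomial.C (P.coeff d * FF (mon A d) z) * Polynomial.X ^ (wt d).toNat with hq
  have hroot : ∀ l : ℕ, q.IsRoot (z.1 + l) := fun l => by
    have hz' : Dom (z.1 + l, z.2) := by simpa [Dom] using hz
    have h1 := hev _ (Dom_Sz hz')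
    rw [Polynomial.IsRoot, hq, Polynomial.eval_finset_sum, ← h1]
    refine sum_congr rfl fun d _ => ?_
    rw [(G.hf d).S1 _ hz', FF_translate, Polynomial.eval_mul, Polynomial.eval_C, Polynomial.eval_pow,
      Polynomial.eval_X, ← zpow_natCast, hwt]
    ring
  have hq0 : q = 0 := Polynomial.eq_zero_of_infinite_isRoot _ <|
    (Set.infinite_range_of_injective (f := fun l : ℕ => z.1 + (l : ℂ)) fun l l' hl => by
      simpa using hl).mono (by rintro _ ⟨l, rfl⟩; exact hroot l)
  have h2 := congrArg (fun q => Polynomial.coeff q k) hq0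
  simp only [hq, Polynomial.finset_sum_coeff, Polynomial.coeff_C_mul, Polynomial.coeff_X_pow,
    Polynomial.coeff_zero, mul_ite, mul_one, mul_zero] at h2
  rw [sum_filter, ← h2]
  refine sum_congr rfl fun d _ => ?_
  have := hwt d
  congr 1
  exact propext ⟨fun h => by omega, fun h => by omega⟩

theorem alg_indep (G : Gens A) {g9 : X → ℂ} (L : LeadCoeffs A g9) (P : MvPolynomial (Fin 5) ℂ)
    (h : ∀ z, Dom z → MvPolynomial.eval (fun i => FF (A i) z) P = 0) : P = 0 := by
  ext d0
  by_contra hd0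
  have hk0 : ((wt d0).toNat : ℤ) = wt d0 := Int.toNat_of_nonneg (by unfold wt; positivity)
  set D := P.support.filter (fun d => wt d = (wt d0).toNat) with hD
  have hmon : ∀ d, mon A d = monR A d := mon_eq_monR L.csr
  refine hd0 (indep (by norm_num) L (wt d0).toNat D (fun d hd => (mem_filter.1 hd).2)
    (fun d => P.coeff d) (fun x => ?_) d0 ?_)
  · have := FF_injective (a := fun x => ∑ d ∈ D, P.coeff d * mon A d x) (b := fun _ => 0)
      (fun z hz => (FF_sum_mon G D _ hz).summable) (fun z hz => by simpa using summable_zero)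
      fun z hz => by
        rw [FF, (FF_sum_mon G D _ hz).tsum_eq, graded_part G P h _ hz]
        simp [FF]
    simpa only [hmon] using congrFun this x
  · simp [hD, hk0, MvPolynomial.mem_support_iff] at hd0 ⊢
    exact hd0

end

section
variable {p : ℕ}

lemma IsPIntegral.exists_rat {z : ℂ} (h : IsPIntegral p z) : ∃ q : ℚ, (q : ℂ) = z := by
  obtain ⟨a, b, hb, e⟩ := h
  have hb0 : (b : ℂ) ≠ 0 := by
    rintro h0
    rw [Int.cast_eq_zero] at h0
    exact hb (h0 ▸ dvd_zero _)
  exact ⟨a / b, by push_cast; field_simp; linear_combination -e⟩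

/-- The ring of `p`-integral rational numbers inside the complex numbers. -/
def pInt (hp : p.Prime) : Subring ℂ where
  carrier := {z | IsPIntegral p z}
  mul_mem' := by
    rintro x y ⟨a, b, hb, e⟩ ⟨a', b', hb', e'⟩
    refine ⟨a * a', b * b', fun h => ((Nat.prime_iff_prime_int.1 hp).dvd_or_dvd h).elim hb hb', ?_⟩
    push_cast
    linear_combination (b' * y) * e + a * e'
  one_mem' := ⟨1, 1, (Nat.prime_iff_prime_int.1 hp).not_dvd_one, by simp⟩
  add_mem' := by
    rintro x y ⟨a, b, hb, e⟩ ⟨a', b', hb', e'⟩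
    refine ⟨b' * a + b * a', b * b',
      fun h => ((Nat.prime_iff_prime_int.1 hp).dvd_or_dvd h).elim hb hb', ?_⟩
    push_cast
    linear_combination b' * e + b * e'
  zero_mem' := ⟨0, 1, (Nat.prime_iff_prime_int.1 hp).not_dvd_one, by simp⟩
  neg_mem' := by
    rintro x ⟨a, b, hb, e⟩
    exact ⟨-a, b, hb, by push_cast; linear_combination -e⟩

lemma Z3_le (hp : p.Prime) (hp5 : 5 ≤ p) : Z3 ≤ pInt hp := by
  rw [Z3, Subring.closure_le, Set.singleton_subset_iff]
  refine ⟨1, 3, fun h => ?_, by norm_num⟩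
  have := Int.le_of_dvd (by norm_num) h
  omega

lemma pInt_div (hp : p.Prime) {z : ℂ} (hz : z ∈ pInt hp) {N : ℕ} (hN : ¬ p ∣ N) : z / N ∈ pInt hp := by
  obtain ⟨a, b, hb, e⟩ := hz
  have hN0 : (N : ℂ) ≠ 0 := by
    rintro h0
    rw [Nat.cast_eq_zero] at h0
    exact hN (h0 ▸ dvd_zero _)
  refine ⟨a, b * N, fun h => ((Nat.prime_iff_prime_int.1 hp).dvd_or_dvd h).elim hb
    fun h => hN (Int.natCast_dvd_natCast.1 h), ?_⟩
  push_cast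
  field_simp
  linear_combination e

lemma natCast_not_unit (hp : p.Prime) : ¬ IsUnit ((p : ℕ) : pInt hp) := by
  rintro hu
  obtain ⟨⟨w, a, b, hb, e⟩, hw⟩ := hu.exists_right_inv
  have hw' : (p : ℂ) * w = 1 := congrArg Subtype.val hw
  refine hb ⟨a, ?_⟩
  have : (b : ℂ) = p * a := by rw [← e]; linear_combination -b * hw'
  exact_mod_cast this

/-- Elements of a proper ideal containing `p` are divisible by `p`. -/
lemma div_mem_of_mem (hp : p.Prime) {M : Ideal (pInt hp)} (hM : M ≠ ⊤) {z : pInt hp}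
    (hz : z ∈ M) : (z : ℂ) / p ∈ pInt hp := by
  obtain ⟨z, a, b, hb, e⟩ := z
  have hp0 : (p : ℂ) ≠ 0 := by exact_mod_cast hp.ne_zero
  by_cases ha : (p : ℤ) ∣ a
  · obtain ⟨a', rfl⟩ := ha
    refine ⟨a', b, hb, ?_⟩
    push_cast at e
    field_simp
    linear_combination e
  · have ha0 : (a : ℂ) ≠ 0 := by
      rintro h0
      rw [Int.cast_eq_zero] at h0
      exact ha (h0 ▸ dvd_zero _)
    refine absurd (M.eq_top_iff_one.2 ?_) hM
    have := M.mul_mem_left (⟨b / a, b, a, ha, by field_simp⟩ : pInt hp) hz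
    convert this using 1
    ext1
    simp only [Subring.coe_one, Subring.coe_mul]
    field_simp
    linear_combination -e

/-- A combination of monomials all of whose coefficients are divisible by `p` is trivial modulo
`p`. -/
lemma reduce (hp : p.Prime) (hp5 : 5 ≤ p) {g9 : X → ℂ} (L : LeadCoeffs A g9)
    (hA : ∀ i x, A i x ∈ pInt hp) (h9 : ∀ x, g9 x ∈ pInt hp) (k : ℤ) (D : Finset (Fin 5 →₀ ℕ))
    (hk : ∀ d ∈ D, wt d = k) (c : (Fin 5 →₀ ℕ) → ℂ) (hc : ∀ d, c d ∈ pInt hp)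
    (h : ∀ x, (∑ d ∈ D, c d * monR A d x) / p ∈ pInt hp) : ∀ d ∈ D, c d / p ∈ pInt hp := by
  have hp0 : (p : ℂ) ≠ 0 := by exact_mod_cast hp.ne_zero
  obtain ⟨M, hM, hpM⟩ := Ideal.exists_le_maximal (Ideal.span {((p : ℕ) : pInt hp)})
    (by rw [Ne, Ideal.span_singleton_eq_top]; exact natCast_not_unit hp)
  have hpM : ((p : ℕ) : pInt hp) ∈ M := hpM (Ideal.mem_span_singleton_self _)
  letI := Ideal.Quotient.field M
  set K := AlgebraicClosure (pInt hp ⧸ M)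
  set φ : pInt hp →+* K := (algebraMap (pInt hp ⧸ M) K).comp (Ideal.Quotient.mk M) with hφ
  have φ0 : ∀ z, φ z = 0 ↔ z ∈ M := fun z => by
    rw [hφ, RingHom.comp_apply, _root_.map_eq_zero, Ideal.Quotient.eq_zero_iff_mem]
  set AR : Fin 5 → X → pInt hp := fun i x => ⟨A i x, hA i x⟩
  set gR : X → pInt hp := fun x => ⟨g9 x, h9 x⟩
  have hmon : ∀ d x, ((monR AR d x : pInt hp) : ℂ) = monR A d x := fun d x =>
    congrFun (map_monR (pInt hp).subtype AR d) x
  have h6 : (6 : K) ≠ 0 := fun h0 => by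
    have h1 : (6 : pInt hp) ∈ M := (φ0 _).1 (by rw [map_ofNat]; exact h0)
    obtain ⟨a, b, hb, e⟩ := div_mem_of_mem hp hM.ne_top h1
    have h2 : ((b * 6 : ℤ) : ℂ) = ((p * a : ℤ) : ℂ) := by
      push_cast
      rw [← e]
      field_simp
      rfl
    have h3 : (p : ℤ) ∣ b * 6 := ⟨a, by exact_mod_cast h2⟩
    rcases (Nat.prime_iff_prime_int.1 hp).dvd_or_dvd h3 with h3 | h3
    · exact hb h3
    · have : p ∣ 2 * 3 := by exact_mod_cast h3
      rcases hp.dvd_mul.1 this with h | h <;> have := Nat.le_of_dvd (by norm_num) h <;> omega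
  have L' : LeadCoeffs (fun i x => φ (AR i x)) fun x => φ (gR x) := by
    have push : ∀ {z w : pInt hp} {v : K}, φ w = v → (z : ℂ) = w → φ z = v := fun hv e => by
      rw [Subtype.ext e, hv]
    refine ⟨fun i x hx => push (map_zero φ) (L.csr i x hx), fun x hx => push (map_zero φ) (L.csr9 x hx),
      push (map_one φ) L.a0, push (w := 240) (map_ofNat φ 240) L.b0, push (map_one φ) L.a1,
      push (w := -504) ((map_neg φ _).trans (congrArg _ (map_ofNat φ 504))) L.b1, fun n r s m h => push (map_zero φ) (L.z2 n r s m h),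
      fun n r s m h => push (map_zero φ) (L.z3 n r s m h),
      fun n r s m h => push (map_zero φ) (L.z9 n r s m h), fun r s => ?_, fun r s => ?_, fun r s => ?_, ?_⟩
    · have := L.l2 r s
      split_ifs at this ⊢
      exacts [push (w := -6) ((map_neg φ _).trans (congrArg _ (map_ofNat φ 6))) this, push (map_one φ) this, push (map_zero φ) this]
    · have := L.l3 r s
      split_ifs at this ⊢
      exacts [push (w := 18) (map_ofNat φ 18) this, push (map_one φ) this, push (map_zero φ) this]
    · have := L.l9 r s
      split_ifs at this ⊢
      exacts [push (map_one φ) this, push (w := -1) (by simp) this, push (map_zero φ) this]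
    · rw [← map_convR φ]
      funext x
      refine congrArg φ (Subtype.ext ?_)
      exact (congrFun L.sq x).trans (congrFun (map_convR (pInt hp).subtype gR gR) x).symm
  have key := indep h6 L' k D hk (fun d => φ ⟨c d, hc d⟩) fun x => by
    simp only [← map_monR φ, ← map_mul, ← map_sum]
    rw [φ0]
    have e : (∑ d ∈ D, (⟨c d, hc d⟩ : pInt hp) * monR AR d x) = ((p : ℕ) : pInt hp) * ⟨_, h x⟩ := by
      ext1
      push_cast [hmon]
      field_simp
    rw [e]
    exact M.mul_mem_right _ hpM
  exact fun d hd => div_mem_of_mem hp hM.ne_top ((φ0 _).1 (key d hd))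

lemma integral_of_combination (hp : p.Prime) (hp5 : 5 ≤ p) {g9 : X → ℂ}
    (L : LeadCoeffs A g9) (hA : ∀ i x, A i x ∈ pInt hp) (h9 : ∀ x, g9 x ∈ pInt hp) (k : ℤ)
    (D : Finset (Fin 5 →₀ ℕ)) (hk : ∀ d ∈ D, wt d = k) (c : (Fin 5 →₀ ℕ) → ℂ)
    (h : ∀ x, (∑ d ∈ D, c d * monR A d x) ∈ pInt hp) (N : ℕ) (hN : N ≠ 0)
    (hc : ∀ d, N * c d ∈ pInt hp) (hD : ∀ d, d ∉ D → c d = 0) : ∀ d, c d ∈ pInt hp := by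
  have hp0 : (p : ℂ) ≠ 0 := by exact_mod_cast hp.ne_zero
  induction N using Nat.strong_induction_on with
  | _ N ih =>
  by_cases hpN : p ∣ N
  · obtain ⟨N', rfl⟩ := hpN
    have hN' : N' ≠ 0 := by rintro rfl; exact hN rfl
    refine ih N' ?_ hN' fun d => ?_
    · have := hp.two_le
      nlinarith [Nat.pos_of_ne_zero hN']
    · by_cases hd : d ∈ D
      · have := reduce hp hp5 L hA h9 k D hk (fun d => ((p * N' : ℕ) : ℂ) * c d) hc (fun x => ?_) d hd
        · convert this using 1
          push_cast
          field_simp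
        · have := (pInt hp).mul_mem (natCast_mem (pInt hp) N') (h x)
          convert this using 1
          rw [mul_sum, sum_div]
          refine sum_congr rfl fun d _ => ?_
          push_cast
          field_simp
      · rw [hD d hd, mul_zero]
        exact zero_mem _
  · intro d
    have := pInt_div hp (hc d) hpN
    rwa [mul_div_cancel_left₀] at this
    exact_mod_cast hN

lemma exists_rational (D : Finset (Fin 5 →₀ ℕ)) (c : (Fin 5 →₀ ℕ) → ℂ) (f : X → ℂ)
    (hA : ∀ d x, ∃ q : ℚ, (q : ℂ) = monR A d x) (hf : ∀ x, ∃ q : ℚ, (q : ℂ) = f x)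
    (h : ∀ x, ∑ d ∈ D, c d * monR A d x = f x) :
    ∃ c' : (Fin 5 →₀ ℕ) → ℚ, (∀ d, d ∉ D → c' d = 0) ∧ ∀ x, ∑ d ∈ D, (c' d : ℂ) * monR A d x = f x := by
  classical
  obtain ⟨ρ, hρ⟩ := (Algebra.linearMap ℚ ℂ).exists_leftInverse_of_injective
    (LinearMap.ker_eq_bot.2 (algebraMap ℚ ℂ).injective)
  have hρ : ∀ q : ℚ, ρ q = q := fun q => LinearMap.congr_fun hρ q
  refine ⟨fun d => if d ∈ D then ρ (c d) else 0, fun d hd => if_neg hd, fun x => ?_⟩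
  obtain ⟨q, hq⟩ := hf x
  have h1 := congrArg ρ (h x)
  rw [← hq, hρ, map_sum] at h1
  rw [← hq, ← h1]
  push_cast
  refine sum_congr rfl fun d hd => ?_
  obtain ⟨q', hq'⟩ := hA d x
  rw [if_pos hd, ← hq', mul_comm (c d), show (q' : ℂ) * c d = q' • c d from (Algebra.smul_def q' (c d)).symm, map_smul]
  push_cast [smul_eq_mul]
  ring

theorem generation (hp : p.Prime) (hp5 : 5 ≤ p) {g9 : X → ℂ} (G : Gens A)
    (L : LeadCoeffs A g9) (hA : ∀ i x, A i x ∈ pInt hp) (h9 : ∀ x, g9 x ∈ pInt hp)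
    {f : X → ℂ} (hf : HF k 1 f) (hfi : ∀ x, f x ∈ pInt hp) :
    ∃! P : MvPolynomial (Fin 5) ℚ, (∀ m, IsPIntegral p ((P.coeff m : ℚ) : ℂ)) ∧
      ∀ z, Dom z → FF f z = MvPolynomial.aeval (fun i => FF (A i) z) P := by
  have hmon : ∀ d, mon A d = monR A d := mon_eq_monR L.csr
  have hev : ∀ (z : Q) (P : MvPolynomial (Fin 5) ℚ), MvPolynomial.aeval (fun i => FF (A i) z) P =
      MvPolynomial.eval (fun i => FF (A i) z) (MvPolynomial.map (algebraMap ℚ ℂ) P) := fun z P => by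
    rw [MvPolynomial.eval_map, MvPolynomial.aeval_def]
  have hAm : ∀ d x, monR A d x ∈ pInt hp := fun d x => by
    have := congrFun (map_monR (pInt hp).subtype (fun i x => ⟨A i x, hA i x⟩) d) x
    exact (this : _ = monR A d x) ▸ Subtype.property _
  obtain ⟨l, hl, e⟩ := (Finsupp.mem_span_image_iff_linearCombination ℂ).1 (G.mem_span hf)
  have hk : ∀ d ∈ l.support, wt d = k := fun d hd => (Finsupp.mem_supported ℂ l).1 hl hd
  obtain ⟨c, hc0, hc⟩ := exists_rational (A := A) l.support l f (fun d x => IsPIntegral.exists_rat (hAm d x))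
    (fun x => IsPIntegral.exists_rat (hfi x)) fun x => by
      rw [← e, Finsupp.linearCombination_apply, Finsupp.sum, Finset.sum_apply]
      exact sum_congr rfl fun d _ => by rw [hmon]; rfl
  have hcI : ∀ d, (c d : ℂ) ∈ pInt hp := integral_of_combination hp hp5 L hA h9 k l.support hk
    (fun d => c d) (fun x => hc x ▸ hfi x) (∏ d ∈ l.support, (c d).den)
    (prod_ne_zero_iff.2 fun d _ => (c d).den_ne_zero) (fun d => ?_) (fun d hd => by simp [hc0 d hd])
  · set P : MvPolynomial (Fin 5) ℚ := ∑ d ∈ l.support, MvPolynomial.monomial d (c d) with hP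
    have hcoe : ∀ m, P.coeff m = c m := fun m => by
      simp only [hP, MvPolynomial.coeff_sum, MvPolynomial.coeff_monomial, sum_ite_eq']
      split_ifs with h
      · rfl
      · exact (hc0 m h).symm
    have hPf : ∀ z, Dom z → FF f z = MvPolynomial.aeval (fun i => FF (A i) z) P := fun z hz => by
      have h1 := (FF_sum_mon G l.support (fun d => (c d : ℂ)) hz).tsum_eq
      simp only [hmon, hc] at h1
      rw [FF, h1, hP, map_sum]
      refine sum_congr rfl fun d _ => ?_
      rw [← hmon, G.FF_mon d hz, MvPolynomial.aeval_monomial, Finsupp.prod_fintype _ _ (by simp),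
        Fin.prod_univ_five]
      rfl
    refine ⟨P, ⟨fun m => hcoe m ▸ hcI m, hPf⟩, fun P' hP' => ?_⟩
    have hz := alg_indep G L (MvPolynomial.map (algebraMap ℚ ℂ) (P' - P)) fun z hz => by
      rw [← hev, map_sub, ← hP'.2 z hz, ← hPf z hz, sub_self]
    rw [← sub_eq_zero]
    exact MvPolynomial.map_injective _ (algebraMap ℚ ℂ).injective (by rw [hz, map_zero])
  · by_cases hd : d ∈ l.support
    · obtain ⟨N, hN⟩ := dvd_prod_of_mem (fun d => (c d).den) hd
      rw [hN]
      have : ((((c d).den * N : ℕ)) : ℂ) * c d = ((N * (c d).num : ℤ) : ℂ) := by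
        have h1 : ((c d).den : ℂ) * c d = (c d).num := by exact_mod_cast Rat.den_mul_eq_num (c d)
        push_cast
        linear_combination N * h1
      rw [this]
      exact intCast_mem _ _
    · rw [hc0 d hd, Rat.cast_zero, mul_zero]
      exact zero_mem _

end

lemma coeff_dl_pow_mul (m : ℕ) (g : PowerSeries ℂ) :
    coeff m (dl ^ m * g) = coeff 0 g := by
  obtain ⟨u, hu⟩ := X_dvd_iff.2
    ((coeff_zero_eq_constantCoeff_apply dl).symm.trans dl_coeff_zero)
  have h1 : constantCoeff u = 1 := by
    have := dl_coeff_one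
    rwa [hu, coeff_succ_X_mul 0, coeff_zero_eq_constantCoeff_apply] at this
  rw [hu, mul_pow, mul_assoc]
  have := coeff_X_pow_mul (u ^ m * g) m 0
  rw [zero_add] at this
  rw [this]
  simp [h1]

lemma Mspan_small {w : ℤ} (hw : w ≤ 6) {g : PowerSeries ℂ} (hg : g ∈ Mspan w)
    (h0 : coeff 0 g = 0) : g = 0 := by
  by_cases h : ∃ i j : ℕ, 4 * (i : ℤ) + 6 * j = w
  · obtain ⟨i, j, hij⟩ := h
    obtain ⟨c, rfl⟩ := Mspan_single (i0 := i) (j0 := j) (fun i' j' h => by omega) hg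
    have h4 := e4_coeff_zero
    have h6 := e6_coeff_zero
    rw [coeff_zero_eq_constantCoeff_apply] at h0 h4 h6
    have hc : c = 0 := by simpa [h4, h6] using h0
    rw [hc, zero_smul]
  · push Not at h
    exact Mspan_empty h hg

lemma JF.sub_smul {κ : ℤ} {m : ℕ} {γ γ' : ℤ × ℤ → ℂ} (h : JF κ m γ) (h' : JF κ m γ') (c : ℂ) :
    JF κ m (fun x => γ x - c * γ' x) := by
  have hs : ∀ τ t : ℂ, 0 < τ.im → HasSum (fun x : ℤ × ℤ => (γ x - c * γ' x) * ex (x.1 * τ + x.2 * t))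
      ((∑' x : ℤ × ℤ, γ x * ex (x.1 * τ + x.2 * t)) -
        c * ∑' x : ℤ × ℤ, γ' x * ex (x.1 * τ + x.2 * t)) := fun τ t hτ =>
    (congrArg (fun f => HasSum f _) (funext fun x => by ring)).mp
      ((h.summ τ t hτ).hasSum.sub ((h'.summ τ t hτ).hasSum.mul_left c))
  refine ⟨fun n r hne => ?_, fun τ t hτ => (hs τ t hτ).summable, fun τ t hτ => ?_, fun n r => ?_⟩
  · by_cases h0 : γ (n, r) = 0
    · exact h'.cone n r fun h1 => hne (by rw [h0, h1]; ring)
    · exact h.cone n r h0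
  · rw [(hs τ t hτ).tsum_eq, (hs _ _ (im_neg_inv_pos hτ)).tsum_eq, h.law τ t hτ, h'.law τ t hτ]
    ring
  · rw [h.shift, h'.shift]

/-- Families of Jacobi forms with the symmetries of a degree two expansion. -/
structure SJ (k : ℤ) (γ : ℤ → ℤ × ℤ → ℂ) : Prop where
  jf : ∀ m : ℕ, JF k m (γ m)
  neg : ∀ m < 0, γ m = 0
  swap : ∀ m n r, γ m (n, r) = γ n (m, r)
  even : ∀ m n r, γ m (n, -r) = γ m (n, r)

namespace SJ
variable {γ γ' : ℤ → ℤ × ℤ → ℂ}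

lemma sub_smul (h : SJ k γ) (h' : SJ k γ') (c : ℂ) : SJ k fun m x => γ m x - c * γ' m x :=
  ⟨fun m => (h.jf m).sub_smul (h'.jf m) c, fun m hm => by simp [h.neg m hm, h'.neg m hm]; rfl,
    fun m n r => by rw [h.swap, h'.swap], fun m n r => by rw [h.even, h'.even]⟩

lemma mom_zero (h : SJ k γ) {m : ℕ} (ih : ∀ m' : ℕ, m' < m → γ m' = 0) {j : ℕ}
    (hj : ∀ j' < j, ∀ n, mom (γ m) j' n = 0)
    (hw : k + j - 12 * m ≤ 6) (h0 : mom (γ m) j m = 0 ∨ k + j - 12 * m < 0 ∨ k + j - 12 * m = 2) (n : ℤ) :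
    mom (γ m) j n = 0 := by
  obtain ⟨g, hg, e⟩ := (h.jf m).mom_structure j hj m fun n hn => by
    rw [mom, ← tsum_zero (β := ℤ)]
    exact tsum_congr fun r => by rw [h.swap, ih n hn]; simp
  have hg0 : g = 0 := by
    rcases h0 with h0 | h0
    · refine Mspan_small hw hg ?_
      rw [← coeff_dl_pow_mul m, ← e, coeff_mk, h0]
    · exact Mspan_empty (by omega) hg
  rw [hg0, mul_zero] at e
  rcases lt_or_ge n 0 with hn | hn
  · exact (h.jf m).mom_neg j hn
  · lift n to ℕ using hn
    simpa using congrArg (coeff n) e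

lemma eq_zero (h : SJ k γ) (h0 : ∀ m j : ℕ, j ≤ 2 * m → Even j → γ m = 0 ∨
      k + j - 12 * m ≤ 6 ∧ (mom (γ m) j m = 0 ∨ k + j - 12 * m < 0 ∨ k + j - 12 * m = 2)) (m : ℤ) :
    γ m = 0 := by
  rcases lt_or_ge m 0 with hm | hm
  · exact h.neg m hm
  lift m to ℕ using hm
  induction m using Nat.strong_induction_on with
  | _ m ih =>
  by_cases hz : γ m = 0
  · exact hz
  refine (h.jf m).eq_zero_of_mom fun j => ?_
  induction j using Nat.strong_induction_on with
  | _ j ihj =>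
  intro hj n
  rcases Nat.even_or_odd j with he | ho
  · rcases h0 m j hj he with h1 | ⟨h1, h2⟩
    · exact absurd h1 hz
    · exact h.mom_zero ih (fun j' hj' => ihj j' hj' (by omega)) h1 h2 n
  · exact mom_odd (h.even m) ho n

lemma mom_one (h : SJ k γ) (hc : γ 0 = 0) {j : ℕ} (hj : Even j) :
    mom (γ 1) j 1 = γ 1 (1, 0) * 0 ^ j + 2 * γ 1 (1, 1) := by
  have h2 : γ 1 (1, 2) = 0 := by
    have := (h.jf 1).shift 0 0
    have h3 := h.swap 1 0 0
    rw [hc] at h3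
    simpa [h3] using this
  have hm : ∀ r, γ 1 (1, -r) = γ 1 (1, r) := h.even 1 1
  rw [mom, tsum_eq_sum (s := {0, 1, -1})]
  · simp [hm, hj.neg_one_pow]
    ring
  · intro r hr
    by_cases h0 : γ 1 (1, r) = 0
    · rw [h0, zero_mul]
    · have h4 := ((h.jf 1).cone 1 r (by exact_mod_cast h0)).2
      push_cast at h4
      have h5 : r ≤ 2 := by nlinarith
      have h6 : -2 ≤ r := by nlinarith
      simp only [mem_insert, mem_singleton, not_or] at hr
      have h7 : r = 2 ∨ r = -2 := by omega
      rcases h7 with rfl | rfl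
      · rw [h2, zero_mul]
      · rw [hm, h2, zero_mul]

lemma eq_zero_eis (h : SJ k γ) (hk : k = 4 ∨ k = 6) (h0 : γ 0 (0, 0) = 0) (m : ℤ) : γ m = 0 := by
  refine h.eq_zero (fun m j hj _ => Or.inr ⟨by omega, ?_⟩) m
  rcases Nat.eq_zero_or_pos m with rfl | hm
  · left
    obtain rfl : j = 0 := by omega
    refine (tsum_congr fun r : ℤ => ?_).trans tsum_zero
    by_cases hr : γ ((0 : ℕ) : ℤ) ((0 : ℕ), r) = 0
    · rw [hr, zero_mul]
    · have := ((h.jf 0).cone 0 r hr).2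
      obtain rfl : r = 0 := by nlinarith
      exact absurd h0 hr
  · omega

lemma eq_zero_ten (h : SJ 10 γ) (hc : γ 0 = 0) (h0 : γ 1 (1, 1) = 0) (m : ℤ) : γ m = 0 := by
  refine h.eq_zero (fun m j hj hje => ?_) m
  obtain rfl | rfl | hm : m = 0 ∨ m = 1 ∨ 2 ≤ m := by omega
  · exact Or.inl hc
  · refine Or.inr ⟨by omega, ?_⟩
    rcases Nat.eq_zero_or_pos j with rfl | hj0
    · omega
    · left
      rw [Nat.cast_one, h.mom_one hc hje, h0, zero_pow hj0.ne']
      ring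
  · omega

lemma eq_zero_twelve (h : SJ 12 γ) (hc : γ 0 = 0) (h0 : γ 1 (1, 1) = 0) (h' : SJ 12 γ')
    (hc' : γ' 0 = 0) (h1' : γ' 1 (1, 0) = 20) (h2' : γ' 1 (1, 1) = 2) (m : ℤ) : γ m = 0 := by
  have hd : γ 1 (1, 0) = 0 := by
    have hs := h.sub_smul h' (γ 1 (1, 0) / 24)
    have hcs : (fun x => γ 0 x - γ 1 (1, 0) / 24 * γ' 0 x) = 0 := by rw [hc, hc']; funext; simp
    have ih : ∀ m' : ℕ, m' < 1 → (fun x => γ m' x - γ 1 (1, 0) / 24 * γ' m' x) = 0 := fun m' hm' => by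
      obtain rfl : m' = 0 := by omega
      exact hcs
    have m0 := hs.mom_zero (m := 1) ih (j := 0) (by simp) (by norm_num) (Or.inl (by
      rw [Nat.cast_one, hs.mom_one hcs Even.zero, h0, h1', h2']; ring))
    have m2 := hs.mom_zero (m := 1) ih (j := 2) (fun j' hj' n => by
      obtain rfl | rfl : j' = 0 ∨ j' = 1 := by omega
      · exact m0 n
      · exact mom_odd (hs.even _) odd_one n) (by norm_num) (Or.inr (Or.inr (by norm_num))) 1
    rw [Nat.cast_one, hs.mom_one hcs even_two, h0, h1', h2'] at m2
    linear_combination (-6 : ℂ) * m2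
  refine h.eq_zero (fun m j hj hje => ?_) m
  obtain rfl | rfl | hm : m = 0 ∨ m = 1 ∨ 2 ≤ m := by omega
  · exact Or.inl hc
  · refine Or.inr ⟨by omega, Or.inl ?_⟩
    rw [Nat.cast_one, h.mom_one hc hje, h0, hd]
    ring
  · omega

end SJ

lemma HF.sj (h : HF k 1 a) : SJ k fun m => gam a m 0 where
  jf m := by simpa using h.jf m 0 (by simp)
  neg m hm := by
    funext x
    simp only [gam, pow_zero, mul_one, Pi.zero_apply]
    rw [← tsum_zero (β := ℤ)]
    exact tsum_congr fun s => h.cone _ fun hc => absurd hc.2.1 (not_le.2 hm)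
  swap m n r := tsum_congr fun s => by simp only [pow_zero, mul_one]; exact h.swap ..
  even m n r := by
    simp only [gam, pow_zero, mul_one]
    rw [← (Equiv.neg ℤ).tsum_eq]
    refine tsum_congr fun s => ?_
    have h1 := h.rot n r s m
    have h2 := h.rot n (-s) (r + s) m
    have h3 := h.rot n (-(r + s)) (-s + (r + s)) m
    simp only [one_mul] at h1 h2 h3
    rw [← h1, ← h2, ← h3]
    simp

/-- A symmetric matrix from its entries. -/
def sM (τ t τ2 : ℂ) : M2 := !![τ, t; t, τ2]

lemma qM_sM (τ t τ2 : ℂ) : qM (sM τ t τ2) = (τ, t, 0, τ2) := by simp [qM, sM]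

lemma sM_mem {τ t τ2 : ℂ} : sM τ t τ2 ∈ SiegelUpperHalfSpace 2 ↔ Dom (τ, t, 0, τ2) := by
  rw [← qM_sM, ← mem_HUHS]
  refine ⟨fun h => h.2, fun h => ⟨?_, h⟩⟩
  ext i j
  fin_cases i <;> fin_cases j <;> simp [sM]

lemma exists_sM (hZ : Z ∈ SiegelUpperHalfSpace 2) :
    Z = sM (Z 0 0) (Z 0 1) (Z 1 1) := by
  have := hZ.1.apply 0 1
  ext i j
  fin_cases i <;> fin_cases j <;> simp [sM, this]

/-- The exponents of degree two expansions. -/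
def linS (w : W) (τ t τ2 : ℂ) : ℂ := w.1.1 * τ + w.1.2 * t + w.2 * τ2

/-- Half-integral matrices. -/
def tM (w : W) : Matrix (Fin 2) (Fin 2) ℚ := !![(w.1.1 : ℚ), w.1.2 / 2; w.1.2 / 2, w.2]

lemma tM_map (w : W) : (tM w).map (fun q => (q : ℝ)) =
    !![((w.1.1 : ℝ) : ℝ), (w.1.2 / 2 : ℝ); star (w.1.2 / 2 : ℝ), ((w.2 : ℝ) : ℝ)] := by
  ext i j
  fin_cases i <;> fin_cases j <;> simp [tM]

lemma tM_cone {w : W} (h : tM w ∈ SiegelLattice 2 1) :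
    0 ≤ w.1.1 ∧ 0 ≤ w.2 ∧ w.1.2 ^ 2 ≤ 4 * w.1.1 * w.2 := by
  have := h.2.2.2
  rw [tM_map] at this
  obtain ⟨h1, h2, h3⟩ := (posSemidef_two (𝕜 := ℝ) (a := (w.1.1 : ℝ)) (d := (w.2 : ℝ)) (β := (w.1.2 / 2 : ℝ))).1 this
  rw [Real.norm_eq_abs, sq_abs] at h3
  refine ⟨by exact_mod_cast h1, by exact_mod_cast h2, ?_⟩
  have : (w.1.2 : ℝ) ^ 2 ≤ 4 * w.1.1 * w.2 := by nlinarith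
  exact_mod_cast this

lemma tM_inj : Injective tM := fun w w' h => by
  have h0 := congrFun (congrFun h 0) 0
  have h1 := congrFun (congrFun h 0) 1
  have h2 := congrFun (congrFun h 1) 1
  simp only [tM, of_apply, cons_val', cons_val_zero, cons_val_one, cons_val_fin_one, Int.cast_inj] at h0 h1 h2
  have h1 : (w.1.2 : ℚ) = w'.1.2 := by linarith
  exact Prod.ext (Prod.ext h0 (by exact_mod_cast h1)) h2

lemma exists_tM {T : Matrix (Fin 2) (Fin 2) ℚ} (h : T ∈ SiegelLattice 2 1) : ∃ w, tM w = T := by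
  obtain ⟨n, hn⟩ := h.2.1 0
  obtain ⟨m, hm⟩ := h.2.1 1
  obtain ⟨r, hr⟩ := h.2.2.1 0 1
  have hs := h.1.apply 0 1
  simp only [Nat.cast_one, one_mul, mul_one] at hn hm hr
  refine ⟨((n, r), m), ?_⟩
  ext i j
  fin_cases i <;> fin_cases j <;> simp [tM, ← hn, ← hm, ← hr, hs]

section
variable {k : ℤ} (G : SiegelModularForm 2 k (SiegelModularGroup 2) 1)

/-- The Fourier coefficients of a Siegel modular form, as a family over the indices. -/
def cs (w : W) : ℂ := G.coeff (tM w)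

lemma cs_cone {w : W} (h : cs G w ≠ 0) : 0 ≤ w.1.1 ∧ 0 ≤ w.2 ∧ w.1.2 ^ 2 ≤ 4 * w.1.1 * w.2 :=
  tM_cone (G.coeff_supported _ h)

lemma cs_hasSum {τ t τ2 : ℂ} (hz : Dom (τ, t, 0, τ2)) :
    HasSum (fun w => cs G w * ex (linS w τ t τ2)) (G.toFun (sM τ t τ2)) := by
  let e : {w | tM w ∈ SiegelLattice 2 1} ≃ SiegelLattice 2 1 :=
    Equiv.ofBijective (fun w => ⟨tM w, w.2⟩) ⟨fun x y hxy => Subtype.ext (tM_inj (congrArg Subtype.val hxy)),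
      fun T => by
        obtain ⟨w, hw⟩ := exists_tM T.2
        exact ⟨⟨w, by rw [Set.mem_setOf_eq, hw]; exact T.2⟩, Subtype.ext hw⟩⟩
  have h := G.expansion _ (sM_mem.2 hz)
  rw [← e.hasSum_iff] at h
  rw [← hasSum_subtype_iff_of_support_subset (s := {w | tM w ∈ SiegelLattice 2 1})]
  · refine (congrArg (fun f => HasSum f _) (funext fun w => ?_)).mp h
    change G.coeff (tM w) * exp (2 * π * I *
      ((tM w).map (fun q => (q : ℂ)) * sM τ t τ2).trace) = cs G w * exp _
    congr 3
    simp [trace, tM, sM, linS, mul_apply, Fin.sum_univ_two]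
    ring
  · exact fun w hw => G.coeff_supported _ fun h0 => hw (by simp [cs, h0])

lemma cs_transform {A B C D : Matrix (Fin 2) (Fin 2) ℤ} (hM : fromBlocks A B C D ∈ SiegelModularGroup 2)
    {Z Z' : M2} (hZ : Z ∈ SiegelUpperHalfSpace 2) {δ : ℂ} (hδ : δ ≠ 0)
    (hd : (C.map (fun a => (a : ℂ)) * Z + D.map (fun a => (a : ℂ))).det = δ)
    (e : Z' * (C.map (fun a => (a : ℂ)) * Z + D.map (fun a => (a : ℂ))) =
      A.map (fun a => (a : ℂ)) * Z + B.map (fun a => (a : ℂ))) :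
    G.toFun Z' = δ ^ k * G.toFun Z := by
  have h := G.transform _ hM Z hZ
  simp only [matActS, fromBlocks_map, toBlocks_fromBlocks₁₁, toBlocks_fromBlocks₁₂, toBlocks_fromBlocks₂₁,
    toBlocks_fromBlocks₂₂] at h
  rwa [hd, ← e, mul_assoc, mul_nonsing_inv _ (by rw [hd]; exact isUnit_iff_ne_zero.2 hδ), mul_one] at h

lemma cs_S1 {τ t τ2 : ℂ} (hz : Dom (τ, t, 0, τ2)) :
    G.toFun (sM (-1 / τ) (t / τ) (τ2 - t ^ 2 / τ)) = τ ^ k * G.toFun (sM τ t τ2) := by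
  have hτ : τ ≠ 0 := by rintro rfl; simpa using hz.1
  refine cs_transform G (A := !![0, 0; 0, 1]) (B := !![-1, 0; 0, 0]) (C := !![1, 0; 0, 0])
    (D := !![0, 0; 0, 1]) (by unfold SiegelModularGroup Jn; decide) (sM_mem.2 hz) hτ ?_ ?_
  · simp [sM, det_fin_two, mul_apply, Fin.sum_univ_two]
  · ext i j
    fin_cases i <;> fin_cases j <;> simp [sM, mul_apply, Fin.sum_univ_two] <;> field_simp
    all_goals ring

/-- The degree two Fourier coefficients are determined by the function. -/
lemma cs_unique {b : W → ℂ} (hs : Summable fun w => b w * ex (linS w I 0 I))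
    (h : ∀ u v w : ℝ, ∑' x, b x * ex (linS x (I + u) v (I + w)) = 0) : b = 0 := by
  have inj : Injective fun w : W => ((w.1.1, w.1.2, 0, w.2) : X) := by
    rintro ⟨⟨a, b⟩, c⟩ ⟨⟨a', b'⟩, c'⟩ h
    simp only [Prod.mk.injEq] at h
    obtain ⟨rfl, rfl, -, rfl⟩ := h
    rfl
  set a : X → ℂ := fun x => if x.2.2.1 = 0 then
    b ((x.1, x.2.1), x.2.2.2) * ex (linS ((x.1, x.2.1), x.2.2.2) I 0 I) else 0 with ha
  have hsup : ∀ x, x ∉ Set.range (fun w : W => ((w.1.1, w.1.2, 0, w.2) : X)) → a x = 0 := fun x hx =>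
    if_neg fun h0 => hx ⟨((x.1, x.2.1), x.2.2.2), by simp [← h0]⟩
  have key := coeff_eq_zero_of_sum (a := a) ((inj.summable_iff hsup).1 (by simpa [ha, Function.comp_def] using hs))
    fun u1 u2 u3 u4 => by
      rw [← inj.tsum_eq (fun x hx => by_contra fun hc => hx (by simp [hsup x hc])), ← h u1 (u2 + u3) u4]
      refine tsum_congr fun x => ?_
      simp only [ha, if_true]
      rw [mul_assoc, ← ex_add]
      congr 2
      simp [lin, linS]
      ring
  funext w
  have := key (w.1.1, w.1.2, 0, w.2)
  simpa [ha, ex_ne_zero] using this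

lemma cs_equiv (g : W ≃ W) (q : ℂ × ℂ × ℂ → ℂ × ℂ × ℂ)
    (hlin : ∀ z w, linS w (q z).1 (q z).2.1 (q z).2.2 = linS (g w) z.1 z.2.1 z.2.2)
    (hq : ∀ z : ℂ × ℂ × ℂ, Dom (z.1, z.2.1, 0, z.2.2) → Dom ((q z).1, (q z).2.1, 0, (q z).2.2) ∧
      G.toFun (sM (q z).1 (q z).2.1 (q z).2.2) = G.toFun (sM z.1 z.2.1 z.2.2)) (w : W) :
    cs G (g w) = cs G w := by
  have key : ∀ z : ℂ × ℂ × ℂ, Dom (z.1, z.2.1, 0, z.2.2) →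
      HasSum (fun w => (cs G w - cs G (g.symm w)) * ex (linS w z.1 z.2.1 z.2.2)) 0 := fun z hz => by
    have h1 := cs_hasSum G (hq z hz).1
    rw [(hq z hz).2, ← g.symm.hasSum_iff] at h1
    have h2 := (cs_hasSum G hz).sub h1
    rw [sub_self] at h2
    refine (congrArg (fun f => HasSum f _) (funext fun w => ?_)).mp h2
    simp only [Function.comp, hlin, Equiv.apply_symm_apply, sub_mul]
  have e := cs_unique (b := fun w => cs G w - cs G (g.symm w))
    (key (I, 0, I) (by simp [Dom])).summable fun u v w => (key (I + u, v, I + w) (by simp [Dom])).tsum_eq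
  have := congrFun e (g w)
  simpa [sub_eq_zero] using this

lemma cs_swap (hk : Even k) (n r m : ℤ) : cs G ((m, r), n) = cs G ((n, r), m) := by
  refine cs_equiv G ⟨fun w => ((w.2, w.1.2), w.1.1), fun w => ((w.2, w.1.2), w.1.1), fun _ => rfl, fun _ => rfl⟩
    (fun z => (z.2.2, z.2.1, z.1)) (fun z w => by simp [linS]; ring) (fun z hz => ?_) ((n, r), m)
  have h := cs_transform G (A := !![0, 1; 1, 0]) (B := 0) (C := 0) (D := !![0, 1; 1, 0])
    (Z' := sM z.2.2 z.2.1 z.1) (δ := -1) (by unfold SiegelModularGroup Jn; decide) (sM_mem.2 hz) (by simp)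
    (by simp [det_fin_two])
    (by ext i j; fin_cases i <;> fin_cases j <;> simp [sM, mul_apply, Fin.sum_univ_two])
  rw [hk.neg_one_zpow, one_mul] at h
  have h1 := hz.1
  have h2 := hz.2
  simp only at h1 h2
  exact ⟨⟨by simp only; nlinarith, by simp only; linarith⟩, h⟩

lemma cs_flip (hk : Even k) (n r m : ℤ) : cs G ((n, -r), m) = cs G ((n, r), m) := by
  refine cs_equiv G ⟨fun w => ((w.1.1, -w.1.2), w.2), fun w => ((w.1.1, -w.1.2), w.2), fun _ => by simp,
    fun _ => by simp⟩ (fun z => (z.1, -z.2.1, z.2.2)) (fun z w => by simp [linS]) (fun z hz => ?_) ((n, r), m)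
  have h := cs_transform G (A := !![1, 0; 0, -1]) (B := 0) (C := 0) (D := !![1, 0; 0, -1])
    (Z' := sM z.1 (-z.2.1) z.2.2) (δ := -1) (by unfold SiegelModularGroup Jn; decide) (sM_mem.2 hz) (by simp)
    (by simp [det_fin_two])
    (by ext i j; fin_cases i <;> fin_cases j <;> simp [sM, mul_apply, Fin.sum_univ_two])
  rw [hk.neg_one_zpow, one_mul] at h
  exact ⟨by simpa [Dom] using hz, h⟩

lemma cs_shift (n r m : ℤ) : cs G ((n + r + m, r + 2 * m), m) = cs G ((n, r), m) := by
  refine cs_equiv G ⟨fun w => ((w.1.1 + w.1.2 + w.2, w.1.2 + 2 * w.2), w.2),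
      fun w => ((w.1.1 - w.1.2 + w.2, w.1.2 - 2 * w.2), w.2),
      fun _ => by ext <;> simp; ring, fun _ => by ext <;> simp; ring⟩
    (fun z => (z.1, z.1 + z.2.1, z.1 + 2 * z.2.1 + z.2.2)) (fun z w => by simp [linS]; ring)
    (fun z hz => ?_) ((n, r), m)
  have h := cs_transform G (A := !![1, 0; 1, 1]) (B := 0) (C := 0) (D := !![1, -1; 0, 1])
    (Z' := sM z.1 (z.1 + z.2.1) (z.1 + 2 * z.2.1 + z.2.2)) (δ := 1)
    (by unfold SiegelModularGroup Jn; decide) (sM_mem.2 hz) one_ne_zero (by simp [det_fin_two])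
    (by ext i j; fin_cases i <;> fin_cases j <;> simp [sM, mul_apply, Fin.sum_univ_two]; ring)
  rw [_root_.one_zpow, one_mul] at h
  have h1 := hz.1
  have h2 := hz.2
  simp only at h1 h2
  refine ⟨⟨h1, ?_⟩, h⟩
  simp at h2 ⊢
  nlinarith

lemma cs_summ (m : ℤ) (hτ : 0 < τ.im) (t : ℂ) :
    Summable fun x : ℤ × ℤ => cs G (x, m) * ex (x.1 * τ + x.2 * t) := by
  obtain ⟨τ2, h⟩ := exists_Dom hτ t 0
  refine (((cs_hasSum G h).summable.comp_injective (Prod.mk_left_injective m)).mul_right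
    (ex (-(m * τ2)))).congr fun x => ?_
  simp only [Function.comp, linS, ex_add _ ((m : ℂ) * τ2), ex_neg]
  field_simp [ex_ne_zero]

lemma cs_law (m : ℤ) (hτ : 0 < τ.im) (t : ℂ) :
    ∑' x : ℤ × ℤ, cs G (x, m) * ex (x.1 * (-1 / τ) + x.2 * (t / τ)) =
      τ ^ k * ex (m * t ^ 2 / τ) * ∑' x : ℤ × ℤ, cs G (x, m) * ex (x.1 * τ + x.2 * t) := by
  obtain ⟨τ2, hz⟩ := exists_Dom hτ t 0
  have hS : ∀ {τ2}, Dom (τ, t, 0, τ2) → HasSum (fun w => cs G w * ex (linS w (-1 / τ) (t / τ) (τ2 - t ^ 2 / τ)) -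
      τ ^ k * (cs G w * ex (linS w τ t τ2))) 0 := fun {τ2} hz => by
    have h2 := cs_hasSum G (τ := -1 / τ) (t := t / τ) (τ2 := τ2 - t ^ 2 / τ) (by simpa [Sz] using Dom_Sz hz)
    rw [cs_S1 G hz] at h2
    simpa using h2.sub ((cs_hasSum G hz).mul_left (τ ^ k))
  have key := fourier_unique (hS hz).summable (fun w => w.2) (fun u => by
    have hz' := hz.add_real 0 0 0 u
    simp only [ofReal_zero, add_zero] at hz'
    rw [← (hS hz').tsum_eq]
    refine tsum_congr fun w => ?_
    have e1 : linS w τ t (τ2 + u) = linS w τ t τ2 + w.2 * u := by simp [linS]; ring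
    have e2 : linS w (-1 / τ) (t / τ) (τ2 + u - t ^ 2 / τ) =
        linS w (-1 / τ) (t / τ) (τ2 - t ^ 2 / τ) + w.2 * u := by simp [linS]; ring
    rw [e1, e2, ex_add, ex_add]
    ring) m
  rw [← (Prod.mk_left_injective m).tsum_eq (fun w hw => ⟨w.1, by
    have : w.2 = m := by by_contra hc; simp [hc] at hw
    simp [← this]⟩)] at key
  simp only [if_true, linS, ex_add _ ((m : ℂ) * _)] at key
  have h5 := (((cs_summ G m (im_neg_inv_pos hτ) (t / τ)).hasSum.mul_right (ex (m * (τ2 - t ^ 2 / τ)))).sub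
    (((cs_summ G m hτ t).hasSum.mul_right (ex (m * τ2))).mul_left (τ ^ k))).tsum_eq
  simp only [mul_assoc] at h5 key
  have e3 : ex (m * τ2) = ex (m * t ^ 2 / τ) * ex (m * (τ2 - t ^ 2 / τ)) := by
    rw [← ex_add]; congr 1; ring
  rw [key, e3] at h5
  apply mul_right_cancel₀ (ex_ne_zero (m * (τ2 - t ^ 2 / τ)))
  linear_combination -h5

lemma cs_sj (hk : Even k) : SJ k fun m x => cs G (x, m) where
  jf m :=
    { cone := fun n r h => ⟨(cs_cone G h).1, (cs_cone G h).2.2⟩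
      summ := fun τ t hτ => cs_summ G m hτ t
      law := fun τ t hτ => by exact_mod_cast cs_law G m hτ t
      shift := fun n r => cs_shift G n r m }
  neg m hm := funext fun x => by_contra fun h => (cs_cone G h).2.1.not_gt hm
  swap m n r := (cs_swap G hk m r n)
  even m n r := cs_flip G hk n r m

lemma FF_siegel (h : HF k e a) {τ t τ2 : ℂ} (hz : Dom (τ, t, 0, τ2)) :
    FF a (τ, t, 0, τ2) = ∑' w : W, gam a w.2 0 w.1 * ex (linS w τ t τ2) := by
  let g : W × ℤ ≃ X := ⟨fun w => (w.1.1.1, w.1.1.2, w.2, w.1.2),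
    fun x => (((x.1, x.2.1), x.2.2.2), x.2.2.1), fun _ => rfl, fun _ => rfl⟩
  have hs := (g.summable_iff).2 (h.summ hz)
  refine ((g.tsum_eq _).symm.trans hs.tsum_prod).trans (tsum_congr fun w => ?_)
  rw [gam, ← tsum_mul_right]
  refine tsum_congr fun s => ?_
  simp [g, lin, linS]

lemma siegel_eq (h : HF k e a) {c : ℂ}
    (h0 : ∀ m : ℤ, (fun x => gam a m 0 x - c * cs G (x, m)) = 0)
    (hZ : Z ∈ SiegelUpperHalfSpace 2) : FF a (qM Z) = c * G.toFun Z := by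
  obtain ⟨τ, t, τ2, rfl⟩ : ∃ τ t τ2, Z = sM τ t τ2 := ⟨_, _, _, exists_sM hZ⟩
  rw [qM_sM, FF_siegel h (sM_mem.1 hZ), ← (cs_hasSum G (sM_mem.1 hZ)).tsum_eq, ← tsum_mul_left]
  refine tsum_congr fun w => ?_
  rw [sub_eq_zero.1 (congrFun (h0 w.2) w.1), mul_assoc]

end

lemma gam_zero_zero (hc : CS a) (h0 : a 0 = 1) : gam a 0 0 (0, 0) = 1 := by
  rw [gam, tsum_eq_single 0 fun s hs => ?_]
  · rw [pow_zero, mul_one]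
    exact h0
  · rw [hc, zero_mul]
    rintro ⟨-, -, h⟩
    simp only at h
    have : s ^ 2 = 0 := by nlinarith [sq_nonneg s]
    exact hs (by simpa using this)

lemma gam_one {r : ℤ} (hr : r = 0 ∨ r = 1)
    (h : ∀ s : ℤ, 1 < r ^ 2 + r * s + s ^ 2 → a (1, r, s, 1) = 0) :
    gam a 1 0 (1, r) = a (1, r, -1, 1) + a (1, r, 0, 1) + a (1, r, 1, 1) := by
  rw [gam, tsum_eq_sum (s := {-1, 0, 1}) fun s hs => ?_]
  · simp [add_assoc]
  · simp only [mem_insert, mem_singleton, not_or] at hs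
    rw [h s, zero_mul]
    have : s ≤ -2 ∨ 2 ≤ s := by omega
    rcases hr with rfl | rfl <;> rcases this with h | h <;> nlinarith

lemma gam_lift_zero : gam (lift κ g) 0 0 = 0 := funext fun x => by
  simp [gam, lift_of_not_pos]

lemma gam_f10 : gam f10 1 0 (1, 1) = 2 := by
  rw [gam_one (Or.inr rfl) fun s h => by rw [f10_one, if_neg (by omega), if_neg (by omega)]]
  norm_num [f10_one]

lemma gam_f12 : gam f12 1 0 (1, 1) = 2 ∧ gam f12 1 0 (1, 0) = 20 := by
  constructor
  · rw [gam_one (Or.inr rfl) fun s h => by rw [f12_one, if_neg (by omega), if_neg (by omega)]]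
    norm_num [f12_one]
  · rw [gam_one (Or.inl rfl) fun s h => by rw [f12_one, if_neg (by omega), if_neg (by omega)]]
    norm_num [f12_one]

lemma tM_zero : tM ((0, 0), 0) = 0 := by
  ext i j; fin_cases i <;> fin_cases j <;> simp [tM]

section
variable {k : ℤ} (G : SiegelModularForm 2 k (SiegelModularGroup 2) 1)

/-- Restriction of the Eisenstein series to the Siegel half-space. -/
lemma eis_restrict (hk : k = 4 ∨ k = 6) (hG : G.coeff 0 = 1) {E : HermitianModularForm (-3) k}
    (hs : IsSymmetricHMF E) (hE : ca E 0 = 1)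
    (hZ : Z ∈ SiegelUpperHalfSpace 2) : E.toFun Z = G.toFun Z := by
  have hk2 : Even k := by rcases hk with rfl | rfl <;> decide
  have h := ca_hf E hk2 hs
  rw [← FF_ca E hZ.2, ← one_mul (G.toFun Z)]
  exact siegel_eq G h (fun m => (h.sj.sub_smul (cs_sj G hk2) 1).eq_zero_eis hk
    (by rw [gam_zero_zero h.cone hE, cs, tM_zero, hG]; norm_num) m) hZ

lemma cs_one (hG : G.coeff !![1, 1/2; 1/2, 1] = 1) : cs G ((1, 1), 1) = 1 := by
  rw [← hG, cs, tM]; simp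

lemma cs_cusp (hc : ∀ T, ¬ (T.map (fun q : ℚ => (q : ℝ))).PosDef → G.coeff T = 0) (x : ℤ × ℤ) :
    cs G (x, 0) = 0 := by
  refine hc _ fun h => ?_
  have := h.diag_pos (i := 1)
  simp [tM] at this

end

lemma f10_restrict (G : SiegelModularForm 2 10 (SiegelModularGroup 2) 1)
    (hc : ∀ T, ¬ (T.map (fun q : ℚ => (q : ℝ))).PosDef → G.coeff T = 0)
    (hG : G.coeff !![1, 1/2; 1/2, 1] = 1)
    (hZ : Z ∈ SiegelUpperHalfSpace 2) : FF f10 (qM Z) = 2 * G.toFun Z :=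
  siegel_eq G hf10 (fun m => (hf10.sj.sub_smul (cs_sj G (by decide)) 2).eq_zero_ten
    (funext fun x => by rw [cs_cusp G hc, f10, gam_lift_zero]; simp)
    (by rw [gam_f10, cs_one G hG]; norm_num) m) hZ

lemma f12_restrict (G : SiegelModularForm 2 12 (SiegelModularGroup 2) 1)
    (hc : ∀ T, ¬ (T.map (fun q : ℚ => (q : ℝ))).PosDef → G.coeff T = 0)
    (hG : G.coeff !![1, 1/2; 1/2, 1] = 1)
    (hZ : Z ∈ SiegelUpperHalfSpace 2) : FF f12 (qM Z) = 2 * G.toFun Z :=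
  siegel_eq G hf12 (fun m => (hf12.sj.sub_smul (cs_sj G (by decide)) 2).eq_zero_twelve
    (funext fun x => by rw [cs_cusp G hc, f12, gam_lift_zero]; simp)
    (by rw [gam_f12.1, cs_one G hG]; norm_num) hf12.sj gam_lift_zero gam_f12.2 gam_f12.1 m) hZ

lemma f18_restrict (hZ : Z ∈ SiegelUpperHalfSpace 2) :
    FF f18 (qM Z) = 0 := by
  obtain ⟨τ, t, τ2, rfl⟩ : ∃ τ t τ2, Z = sM τ t τ2 := ⟨_, _, _, exists_sM hZ⟩
  have hz := sM_mem.1 hZ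
  rw [qM_sM, f18, FF_conv (hf9.summ hz) (hf9.summ hz), FF_siegel hf9 hz]
  simp [gam9_zero]

lemma Pos.posDef {x : X} (h : Pos x) : (hM x).PosDef := by
  have h1 := h.fst
  have h2 := h.2
  have := (posDef_two (𝕜 := ℂ) (a := x.1) (d := x.2.2.2) (β := bb x)).2
    ⟨by exact_mod_cast h1, by
      rw [norm_bb, div_lt_iff₀ three_pos]
      rw [dt, nrm] at h2
      have : (x.2.1 : ℝ) ^ 2 + x.2.1 * x.2.2.1 + (x.2.2.1 : ℝ) ^ 2 < 3 * x.1 * x.2.2.2 := by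
        exact_mod_cast sub_pos.1 h2
      linarith⟩
  simpa [hM] using this

lemma lift_pos {x : X} (h : lift κ g x ≠ 0) : Pos x :=
  by_contra fun hc => h (if_neg hc)

lemma hM_add (x y : X) : hM (x + y) = hM x + hM y := by
  ext i j
  fin_cases i <;> fin_cases j <;> simp [hM, bb] <;> ring

lemma f18_posDef {x : X} (h : f18 x ≠ 0) : (hM x).PosDef := by
  obtain ⟨y, hy⟩ : ∃ y, f9 y * f9 (x - y) ≠ 0 := by
    by_contra! hc
    exact h (by simp [f18, conv, hc])
  have := (lift_pos (left_ne_zero_of_mul hy)).posDef.add (lift_pos (right_ne_zero_of_mul hy)).posDef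
  rwa [← hM_add, add_sub_cancel] at this

lemma HF.form_cusp (h : HF k 1 a) (hk : Even k)
    (ha : ∀ {x}, a x ≠ 0 → (hM x).PosDef) : IsCuspHMF (h.form hk) := fun H hH => by
  obtain h0 | ⟨x, rfl, h0⟩ := h.form_coeff_cases hk H
  · exact h0
  · exact h0.trans (by_contra fun hc => hH (ha hc))

lemma HF.form_int (h : HF k 1 a) (hk : Even k) {p : ℕ} (hp : p.Prime)
    (ha : ∀ x, a x ∈ pInt hp) (H : M2) : IsPIntegral p ((h.form hk).coeff H) := by
  obtain h0 | ⟨x, rfl, h0⟩ := h.form_coeff_cases hk H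
  · exact h0 ▸ (pInt hp).zero_mem
  · exact h0 ▸ ha x

lemma f18_term {n R S m : ℤ} {y : X} (h4 : n + m ≤ 4) (h : f9 y * f9 ((n, R, S, m) - y) ≠ 0) :
    n = 2 ∧ m = 2 ∧ ∃ r s, y = (1, r, s, 1) ∧ r ^ 2 + r * s + s ^ 2 = 1 ∧
      (R - r) ^ 2 + (R - r) * (S - s) + (S - s) ^ 2 = 1 := by
  have h1 := lift_pos (left_ne_zero_of_mul h)
  have h2 := lift_pos (right_ne_zero_of_mul h)
  obtain ⟨a, r, s, d⟩ := y
  have := h1.fst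
  have := h2.fst
  have := h1.1
  have := h2.1
  simp only [Prod.mk_sub_mk] at *
  obtain rfl : a = 1 := by omega
  obtain rfl : d = 1 := by omega
  obtain rfl : n = 2 := by omega
  obtain rfl : m = 2 := by omega
  refine ⟨rfl, rfl, r, s, rfl, ?_, ?_⟩
  · by_contra hc
    exact left_ne_zero_of_mul h (by rw [f9_one, if_neg hc])
  · by_contra hc
    exact right_ne_zero_of_mul h (by norm_num only; rw [f9_one, if_neg hc])

lemma f18_double {r s : ℤ} (h : r ^ 2 + r * s + s ^ 2 = 1) : f18 (2, 2 * r, 2 * s, 2) = 1 := by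
  rw [f18, conv, tsum_eq_single (1, r, s, 1) fun y hy => ?_]
  · rw [show ((2, 2 * r, 2 * s, 2) : X) - (1, r, s, 1) = (1, r, s, 1) by
      simp only [Prod.mk_sub_mk, Prod.mk.injEq]; omega, f9_one, if_pos h]
    split_ifs <;> norm_num
  · by_contra hc
    obtain ⟨-, -, r', s', rfl, h1, h2⟩ := f18_term (by norm_num) hc
    have e : (r' - r) ^ 2 + (r' - r) * (s' - s) + (s' - s) ^ 2 = 0 := by linarith
    have e1 : (r' - r) ^ 2 = 0 := by nlinarith [sq_nonneg ((r' - r) + 2 * (s' - s)), sq_nonneg (r' - r)]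
    have e2 : (s' - s) ^ 2 = 0 := by nlinarith [sq_nonneg (2 * (r' - r) + (s' - s)), sq_nonneg (s' - s)]
    rw [sq_eq_zero_iff, sub_eq_zero] at e1 e2
    exact hy (by rw [e1, e2])

lemma f18_low {n R S m : ℤ} (h4 : n + m ≤ 4) (h : f18 (n, R, S, m) ≠ 0) :
    n = 2 ∧ m = 2 ∧ (-2 < R ∨ R = -2 ∧ -2 ≤ R + 2 * S) := by
  obtain ⟨y, hy⟩ : ∃ y, f9 y * f9 ((n, R, S, m) - y) ≠ 0 := by
    by_contra! hc
    exact h (by simp [f18, conv, hc])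
  obtain ⟨rfl, rfl, r, s, rfl, h1, h2⟩ := f18_term h4 hy
  have m1 := mem_sev (r := r) (s := s) (by rw [nrm_eq, h1])
  have m2 := mem_sev (r := R - r) (s := S - s) (by rw [nrm_eq, h2])
  simp only [sev, mem_insert, mem_singleton, Prod.mk.injEq] at m1 m2
  have b1 : -1 ≤ r ∧ (r = -1 → 0 ≤ s) := by clear m2; omega
  have b2 : -1 ≤ R - r ∧ (R - r = -1 → 0 ≤ S - s) := by clear m1; omega
  clear m1 m2
  omega

lemma isOrdP_f18 {p : ℕ} (hp : p.Prime) : IsOrdP p (hf18.form (by decide)) (hM (2, -2, 0, 2)) := by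
  have hp0 : (p : ℂ) ≠ 0 := by exact_mod_cast hp.ne_zero
  have h1 : f18 (2, -2, 0, 2) = 1 := by
    have := f18_double (r := -1) (s := 0) (by norm_num)
    norm_num only at this
    exact this
  refine ⟨hM_mem.2 ⟨by decide, by decide, by decide⟩, ?_, fun H hH hlt => ?_⟩
  · rw [HF.form_coeff, h1]
    rintro ⟨a, b, hb, e⟩
    refine hb ⟨a, ?_⟩
    field_simp at e
    have e : (b : ℂ) = p * a := by linear_combination e
    exact_mod_cast e
  · obtain ⟨⟨n, r, s, m⟩, -, rfl⟩ := exists_hM hH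
    rw [HF.form_coeff]
    suffices f18 (n, r, s, m) = 0 by
      rw [this]
      exact ⟨0, 1, (Nat.prime_iff_prime_int.1 hp).not_dvd_one, by simp⟩
    by_contra hc
    have re : ∀ x : X, (bb x).re = x.2.1 / 2 := fun x => by simp [bb, rt]
    have im : ∀ x : X, (bb x).im = (x.2.1 + 2 * x.2.2.1) * √3 / 6 := fun x => by simp [bb, rt]
    have h3 : 0 < √3 := by positivity
    simp only [lexLt, trace_fin_two, hM, of_apply, cons_val', cons_val_zero, cons_val_one,
      cons_val_fin_one, re, im] at hlt
    have hle : n + m ≤ 4 := by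
      rcases hlt with h | ⟨h, -⟩ <;> norm_cast at h <;> push_cast at h <;> omega
    obtain ⟨rfl, rfl, hr | ⟨rfl, hs⟩⟩ := f18_low hle hc
    all_goals
      rcases hlt with h | ⟨-, h | ⟨-, h | ⟨h, h'⟩⟩⟩ <;> norm_num at h
    · have : r < -2 := by exact_mod_cast (by linarith : (r : ℝ) < -2)
      omega
    · have : r = -2 := by exact_mod_cast (by linarith : (r : ℝ) = -2)
      omega
    · have hs : (-2 : ℝ) ≤ -2 + 2 * s := by exact_mod_cast hs
      push_cast at h'
      nlinarith [mul_le_mul_of_nonneg_right hs h3.le]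

lemma hM_eq : hM (2, 0, 2, 2) = !![2, 2 * I / (√3 : ℂ);
    -(2 * I / (√3 : ℂ)), 2] := by
  have h3 : (√3 : ℂ) ≠ 0 := by simp
  have h := sqrt3_sq
  have e : bb (2, 0, 2, 2) = 2 * I / (√3 : ℂ) := by
    simp only [bb, rt]
    field_simp
    push_cast
    linear_combination 8 * I * h
  rw [hM, e]
  ext i j
  fin_cases i <;> fin_cases j <;> simp [neg_div]

end KN

/-- **Kikuta–Nagaoka structure theorem over ℚ(√-3)** (Theorem 4.5). Let
`p ≥ 5` be prime, `K = ℚ(√-3)` (`d_K = -3`), let `G₄, G₆, X₁₀, X₁₂` be the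
standard normalized generators of the even-weight Siegel modular forms of
degree 2, and let `E₄, E₆` be the (normalized) Hermitian Eisenstein series of
weights 4, 6. Then there exist Hermitian cusp forms `F₁₀, F₁₂, χ₁₈` of weights
10, 12, 18 such that:
(1) `E₄, E₆, F₁₀, F₁₂, χ₁₈` are algebraically independent and generate the
graded ring `⊕_{k even} M_k^{(s)}(U₂(O_K), ν_k)_{ℤ_(p)}` over `ℤ_(p)` — every
symmetric even-weight form with `p`-integral coefficients is a unique
`p`-integral polynomial in them;
(2) `E₄|_{S₂} = G₄`, `E₆|_{S₂} = G₆`, `F₁₀|_{S₂} = 2X₁₀`, `F₁₂|_{S₂} = 2X₁₂`,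
`χ₁₈|_{S₂} = 0`;
(3) `a_{χ₁₈}([[2, 2i/√3], [-2i/√3, 2]]) = 1`, and the diagonal of
`ord_p(χ₁₈)` is `(2, 2)`. -/
theorem kikuta_nagaoka_generators_sqrt_neg_three
    (p : ℕ) (hp : Nat.Prime p) (hp5 : 5 ≤ p)
    (G4 : SiegelModularForm 2 4 (SiegelModularGroup 2) 1)
    (G6 : SiegelModularForm 2 6 (SiegelModularGroup 2) 1)
    (X10 : SiegelModularForm 2 10 (SiegelModularGroup 2) 1)
    (X12 : SiegelModularForm 2 12 (SiegelModularGroup 2) 1)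
    (hG4norm : G4.coeff 0 = 1) (hG6norm : G6.coeff 0 = 1)
    (hX10cusp : ∀ T, ¬ (T.map (fun q => (q : ℝ))).PosDef → X10.coeff T = 0)
    (hX12cusp : ∀ T, ¬ (T.map (fun q => (q : ℝ))).PosDef → X12.coeff T = 0)
    (hX10norm : X10.coeff !![1, 1/2; 1/2, 1] = 1)
    (hX12norm : X12.coeff !![1, 1/2; 1/2, 1] = 1)
    (E4 : HermitianModularForm (-3) 4) (E6 : HermitianModularForm (-3) 6)
    (hE4sym : IsSymmetricHMF E4) (hE6sym : IsSymmetricHMF E6)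
    (hE4int : ∀ H, IsPIntegral p (E4.coeff H)) (hE6int : ∀ H, IsPIntegral p (E6.coeff H))
    (hE4norm : E4.coeff 0 = 1) (hE6norm : E6.coeff 0 = 1) :
    ∃ (F10 : HermitianModularForm (-3) 10) (F12 : HermitianModularForm (-3) 12)
      (χ18 : HermitianModularForm (-3) 18),
      IsSymmetricHMF F10 ∧ IsSymmetricHMF F12 ∧ IsSymmetricHMF χ18 ∧
      IsCuspHMF F10 ∧ IsCuspHMF F12 ∧ IsCuspHMF χ18 ∧
      (∀ H, IsPIntegral p (F10.coeff H)) ∧ (∀ H, IsPIntegral p (F12.coeff H)) ∧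
      (∀ H, IsPIntegral p (χ18.coeff H)) ∧
      -- (1) algebraic independence …
      (∀ P : MvPolynomial (Fin 5) ℂ,
        (∀ Z ∈ HermitianUpperHalfSpace,
          MvPolynomial.eval
            (![E4.toFun Z, E6.toFun Z, F10.toFun Z, F12.toFun Z, χ18.toFun Z]) P = 0) →
        P = 0) ∧
      -- … and generation over ℤ_(p), with a unique polynomial for each form
      (∀ k : ℤ, Even k → ∀ f : HermitianModularForm (-3) k, IsSymmetricHMF f →
        (∀ H, IsPIntegral p (f.coeff H)) →
        ∃! P : MvPolynomial (Fin 5) ℚ,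
          (∀ m, IsPIntegral p ((P.coeff m : ℚ) : ℂ)) ∧
          ∀ Z ∈ HermitianUpperHalfSpace,
            f.toFun Z =
              MvPolynomial.aeval
                (![E4.toFun Z, E6.toFun Z, F10.toFun Z, F12.toFun Z, χ18.toFun Z]) P) ∧
      -- (2) restrictions to the Siegel upper half-space
      (∀ Z ∈ SiegelUpperHalfSpace 2,
        E4.toFun Z = G4.toFun Z ∧ E6.toFun Z = G6.toFun Z ∧
        F10.toFun Z = 2 * X10.toFun Z ∧ F12.toFun Z = 2 * X12.toFun Z ∧
        χ18.toFun Z = 0) ∧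
      -- (3) normalization of χ₁₈ and the diagonal of its order
      χ18.coeff !![2, 2 * Complex.I / (Real.sqrt 3 : ℂ);
        -(2 * Complex.I / (Real.sqrt 3 : ℂ)), 2] = 1 ∧
      (∃ H0, IsOrdP p χ18 H0 ∧ H0 0 0 = 2 ∧ H0 1 1 = 2) := by
  have h4 := KN.ca_hf E4 (by decide) hE4sym
  have h6 := KN.ca_hf E6 (by decide) hE6sym
  have h0 : KN.hM 0 = 0 := by ext i j; fin_cases i <;> fin_cases j <;> simp [KN.hM, KN.bb]
  have n4 : KN.ca E4 0 = 1 := by rw [KN.ca, h0, hE4norm]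
  have n6 : KN.ca E6 0 = 1 := by rw [KN.ca, h0, hE6norm]
  have G := KN.gens h4 h6 n4 n6
  have L := KN.leadCoeffs h4 h6 n4 n6
  have i9 := fun x => KN.Z3_le hp hp5 (KN.f9_mem x)
  have i10 := fun x => KN.Z3_le hp hp5 (KN.f10_mem x)
  have i12 := fun x => KN.Z3_le hp hp5 (KN.f12_mem x)
  have i18 := fun x => KN.Z3_le hp hp5 (KN.f18_mem x)
  have hA : ∀ i x, KN.fam (KN.ca E4) (KN.ca E6) i x ∈ KN.pInt hp := fun i x => by
    fin_cases i
    exacts [hE4int _, hE6int _, i10 x, i12 x, i18 x]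
  have hfam : ∀ Z ∈ HermitianUpperHalfSpace,
      (fun i => KN.FF (KN.fam (KN.ca E4) (KN.ca E6) i) (KN.qM Z)) =
        ![E4.toFun Z, E6.toFun Z, KN.FF KN.f10 (KN.qM Z), KN.FF KN.f12 (KN.qM Z),
          KN.FF KN.f18 (KN.qM Z)] := fun Z hZ => by
    funext i
    fin_cases i
    exacts [KN.FF_ca E4 hZ, KN.FF_ca E6 hZ, rfl, rfl, rfl]
  have hdom : ∀ {C : KN.Q → Prop},
      (∀ z, KN.Dom z → C z) ↔ ∀ Z ∈ HermitianUpperHalfSpace, C (KN.qM Z) :=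
    fun {C} => ⟨fun h Z hZ => h _ (KN.mem_HUHS.1 hZ), fun h z hz => by
      have := h (KN.zM z) (KN.mem_HUHS.2 ((KN.qM_zM z).symm ▸ hz))
      rwa [KN.qM_zM] at this⟩
  refine ⟨KN.hf10.form (by decide), KN.hf12.form (by decide), KN.hf18.form (by decide),
    KN.hf10.form_symm _, KN.hf12.form_symm _, KN.hf18.form_symm _,
    KN.hf10.form_cusp _ fun h => (KN.lift_pos h).posDef,
    KN.hf12.form_cusp _ fun h => (KN.lift_pos h).posDef, KN.hf18.form_cusp _ KN.f18_posDef,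
    KN.hf10.form_int _ hp i10, KN.hf12.form_int _ hp i12, KN.hf18.form_int _ hp i18,
    fun P hP => ?_, fun k hk f hf hfi => ?_, fun Z hZ => ⟨?_, ?_, ?_, ?_, ?_⟩, ?_,
    KN.hM (2, -2, 0, 2), KN.isOrdP_f18 hp, ?_, ?_⟩
  · refine KN.alg_indep G L P (hdom.2 fun Z hZ => ?_)
    rw [hfam Z hZ]
    exact hP Z hZ
  · have key := KN.generation hp hp5 G L hA i9 (KN.ca_hf f hk hf) fun x => hfi _
    refine (existsUnique_congr fun P => and_congr_right fun _ => ?_).1 key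
    rw [hdom]
    refine forall₂_congr fun Z hZ => ?_
    rw [hfam Z hZ, KN.FF_ca f hZ]
    rfl
  · exact KN.eis_restrict G4 (Or.inl rfl) hG4norm hE4sym n4 hZ
  · exact KN.eis_restrict G6 (Or.inr rfl) hG6norm hE6sym n6 hZ
  · exact KN.f10_restrict X10 hX10cusp hX10norm hZ
  · exact KN.f12_restrict X12 hX12cusp hX12norm hZ
  · exact KN.f18_restrict hZ
  · rw [← KN.hM_eq, KN.HF.form_coeff]
    have := KN.f18_double (r := 0) (s := 1) (by norm_num)
    norm_num only at this
    exact this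
  · simp [KN.hM]
  · simp [KN.hM]

end
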